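/- F₂ ≤ 0.17066, and in particular F₂ ≤ c for some constant c strictly less than (√2 − 1)². -/

import Mathlib

open Filter

/-- F₂ = liminf_{n→∞} max(p_{n+1} − p_n, p_{n+2} − p_{n+1}) / log p_n,
where p_n is the n-th prime. -/
noncomputable def F2 : ℝ :=
  Filter.liminf (fun n : ℕ =>
    max ((Nat.nth Nat.Prime (n + 1) : ℝ) - (Nat.nth Nat.Prime n : ℝ))
        ((Nat.nth Nat.Prime (n + 2) : ℝ) - (Nat.nth Nat.Prime (n + 1) : ℝ)) /
      Real.log (Nat.nth Nat.Prime n)) Filter.atTop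

namespace PrimeGaps

open Finset

/-- Summation by parts against a sequence with bounded partial sums. -/
theorem norm_sum_mul_le_of_partial_sums {a : ℕ → ℂ} {B : ℝ}
    (h : ∀ n, ‖∑ i ∈ range n, a i‖ ≤ B) (g : ℕ → ℂ) (n : ℕ) :
    ‖∑ i ∈ range n, a i * g i‖ ≤ B * (‖g n‖ + ∑ i ∈ range n, ‖g (i + 1) - g i‖) := by
  have key : ∀ n, ∑ i ∈ range n, a i * g i =
      (∑ i ∈ range n, a i) * g n
        - ∑ i ∈ range n, (∑ j ∈ range (i + 1), a j) * (g (i + 1) - g i) := by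
    intro n
    induction n with
    | zero => simp
    | succ n ih => rw [sum_range_succ, ih, sum_range_succ a n, sum_range_succ _ n, sum_range_succ a n]; ring
  have hB : 0 ≤ B := (norm_nonneg _).trans (h 0)
  rw [key, mul_add, mul_sum]
  refine (norm_sub_le _ _).trans (add_le_add ?_ ((norm_sum_le _ _).trans (sum_le_sum ?_)))
  · rw [norm_mul]; gcongr; exact h n
  · intro i _
    rw [norm_mul]; gcongr; exact h _

/-- Partial sums of a periodic mean-zero sequence. -/
theorem norm_sum_range_le_of_periodic {a : ℕ → ℂ} {q : ℕ} {b : ℝ} (hq : 0 < q)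
    (hper : Function.Periodic a q) (hsum : ∑ i ∈ range q, a i = 0)
    (hb : ∀ n, ‖a n‖ ≤ b) (n : ℕ) : ‖∑ i ∈ range n, a i‖ ≤ q * b := by
  have hblock : ∀ k r, ∑ i ∈ range (k * q + r), a i = ∑ i ∈ range r, a i := by
    intro k r
    induction k with
    | zero => simp
    | succ k ih =>
      rw [show (k + 1) * q + r = q + (k * q + r) by ring, sum_range_add, hsum, zero_add]
      rw [← ih]
      exact sum_congr rfl fun i _ => by rw [add_comm q i]; exact hper i
  rw [← Nat.div_add_mod' n q, hblock]
  refine (norm_sum_le _ _).trans ((sum_le_sum fun i _ => hb i).trans ?_)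
  rw [sum_const, card_range, nsmul_eq_mul]
  have hb0 : 0 ≤ b := (norm_nonneg _).trans (hb 0)
  gcongr
  exact (Nat.mod_lt n hq).le

end PrimeGaps

namespace PrimeGaps

open Finset

/-- Smooth real functions supported in `[-4, 4]`. -/
structure IsBlock (ψ : ℝ → ℝ) : Prop where
  smooth : ContDiff ℝ (⊤ : ℕ∞) ψ
  support : ∀ u, 4 < |u| → ψ u = 0

theorem IsBlock.id_mul {ψ : ℝ → ℝ} (h : IsBlock ψ) : IsBlock fun u => u * ψ u :=
  ⟨contDiff_id.mul h.smooth, fun u hu => by simp [h.support u hu]⟩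

theorem IsBlock.pow_mul {ψ : ℝ → ℝ} (h : IsBlock ψ) (j : ℕ) : IsBlock fun u => u ^ j * ψ u :=
  ⟨(contDiff_id.pow j).mul h.smooth, fun u hu => by simp [h.support u hu]⟩

theorem IsBlock.hasCompactSupport {ψ : ℝ → ℝ} (h : IsBlock ψ) : HasCompactSupport ψ := by
  refine HasCompactSupport.intro (isCompact_Icc (a := (-4 : ℝ)) (b := 4)) fun u hu => ?_
  refine h.support u ?_
  rw [Set.mem_Icc, ← abs_le] at hu
  exact not_le.mp hu

theorem IsBlock.bounds {ψ : ℝ → ℝ} (h : IsBlock ψ) :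
    ∃ C : ℝ, 0 < C ∧ (∀ u, |ψ u| ≤ C) ∧ ∀ u, |deriv ψ u| ≤ C := by
  obtain ⟨C₁, h₁⟩ := h.hasCompactSupport.exists_bound_of_continuous h.smooth.continuous
  obtain ⟨C₂, h₂⟩ := h.hasCompactSupport.deriv.exists_bound_of_continuous
    (h.smooth.continuous_deriv (by simp))
  refine ⟨max 1 (max C₁ C₂), by positivity, fun u => ?_, fun u => ?_⟩
  · exact (h₁ u).trans ((le_max_left _ _).trans (le_max_right _ _))
  · exact (h₂ u).trans ((le_max_right _ _).trans (le_max_right _ _))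

theorem IsBlock.deriv_eq_zero {ψ : ℝ → ℝ} (h : IsBlock ψ) {u : ℝ} (hu : 4 < |u|) :
    deriv ψ u = 0 := by
  have : ψ =ᶠ[nhds u] fun _ => 0 := by
    filter_upwards [(isOpen_lt continuous_const continuous_abs).mem_nhds hu] with v hv
    exact h.support v hv
  rw [this.deriv_eq]; simp

/-- Fourier representation of a block. -/
theorem IsBlock.fourier {ψ : ℝ → ℝ} (h : IsBlock ψ) :
    ∃ g : ℝ → ℂ, Continuous g ∧
      (∀ K : ℕ, MeasureTheory.Integrable fun t => (1 + |t|) ^ K * ‖g t‖) ∧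
      ∀ u : ℝ, (ψ u : ℂ) = ∫ t : ℝ, g t * Complex.exp (2 * Real.pi * t * u * Complex.I) := by
  have hc : HasCompactSupport (fun u => (ψ u : ℂ)) :=
    h.hasCompactSupport.comp_left (g := ((↑) : ℝ → ℂ)) (by simp)
  let f : SchwartzMap ℝ ℂ := hc.toSchwartzMap
    (Complex.ofRealCLM.contDiff.comp h.smooth)
  let g : SchwartzMap ℝ ℂ := FourierTransform.fourier f
  refine ⟨g, g.continuous, fun K => ?_, fun u => ?_⟩
  · have hI : MeasureTheory.Integrable fun t : ℝ => (2:ℝ) ^ K * (‖g t‖ + ‖t‖ ^ K * ‖g t‖) := by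
      refine (((g.integrable).norm).add (g.integrable_pow_mul MeasureTheory.volume K)).const_mul _
    refine hI.mono' ?_ (Filter.Eventually.of_forall fun t => ?_)
    · exact (((continuous_const.add continuous_abs).pow K).mul
        g.continuous.norm).aestronglyMeasurable
    · rw [Real.norm_of_nonneg (by positivity)]
      have : (1 + |t|) ^ K ≤ 2 ^ K * (1 + |t| ^ K) := by
        rcases le_total 1 |t| with h1 | h1
        · calc (1 + |t|) ^ K ≤ (2 * |t|) ^ K := by gcongr; linarith
            _ = 2 ^ K * |t| ^ K := mul_pow _ _ _
            _ ≤ _ := by gcongr; linarith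
        · calc (1 + |t|) ^ K ≤ 2 ^ K := by gcongr; linarith
            _ ≤ _ := by
              have : 0 ≤ |t| ^ K := by positivity
              nlinarith [pow_pos (two_pos (α := ℝ)) K]
      calc _ ≤ (2 ^ K * (1 + |t| ^ K)) * ‖g t‖ := by gcongr
        _ = _ := by rw [Real.norm_eq_abs]; ring
  · have h1 : FourierTransformInv.fourierInv g = f := by simp [g]
    have h2 : (FourierTransformInv.fourierInv g) u = (ψ u : ℂ) := by rw [h1]; rfl
    rw [← h2, SchwartzMap.fourierInv_coe, Real.fourierInv_eq']
    congr 1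
    ext t
    rw [smul_eq_mul, mul_comm]
    congr 2
    simp
    ring

/-- The weight `y ^ (-(1 + 1 / log N)) * ψ (log (y / N))`. -/
noncomputable def wt (ψ : ℝ → ℝ) (N y : ℝ) : ℝ :=
  Real.exp (-(1 + 1 / Real.log N) * Real.log y) * ψ (Real.log y - Real.log N)

theorem IsBlock.wt_eq_zero_of_lt {ψ : ℝ → ℝ} (h : IsBlock ψ) {N y : ℝ} (hN : 5 ≤ Real.log N)
    (hy0 : 0 ≤ y) (hy : y < N * Real.exp (-4)) : wt ψ N y = 0 := by
  have hN0 : 0 < N := by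
    by_contra hc
    have : N * Real.exp (-4) ≤ 0 := mul_nonpos_of_nonpos_of_nonneg (not_lt.mp hc) (Real.exp_nonneg _)
    linarith
  rw [wt, h.support, mul_zero]
  rcases hy0.eq_or_lt with rfl | hy0
  · rw [Real.log_zero, zero_sub, abs_neg, abs_of_nonneg] <;> linarith
  · have := Real.log_lt_log hy0 hy
    rw [Real.log_mul hN0.ne' (Real.exp_ne_zero _), Real.log_exp] at this
    rw [abs_of_neg] <;> linarith

theorem IsBlock.wt_eq_zero_of_gt {ψ : ℝ → ℝ} (h : IsBlock ψ) {N y : ℝ} (hN : 0 < N)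
    (hy : N * Real.exp 4 < y) : wt ψ N y = 0 := by
  rw [wt, h.support, mul_zero]
  have := Real.log_lt_log (by positivity) hy
  rw [Real.log_mul hN.ne' (Real.exp_ne_zero _), Real.log_exp] at this
  rw [abs_of_pos] <;> linarith

theorem exp_weight_le {N y : ℝ} (hN0 : 0 < N) (hN : 5 ≤ Real.log N)
    (hy : N * Real.exp (-4) ≤ y) :
    Real.exp (-(1 + 1 / Real.log N) * Real.log y) ≤ Real.exp 4 / N := by
  have h1 := Real.log_le_log (by positivity) hy
  rw [Real.log_mul hN0.ne' (Real.exp_ne_zero _), Real.log_exp] at h1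
  have : 0 ≤ 1 / Real.log N * Real.log y := by
    have : 0 ≤ Real.log y := by linarith
    positivity
  calc _ ≤ Real.exp (4 - Real.log N) := Real.exp_le_exp.mpr (by linarith)
    _ = _ := by rw [Real.exp_sub, Real.exp_log hN0]

theorem IsBlock.wt_bounds {ψ : ℝ → ℝ} (h : IsBlock ψ) :
    ∃ C : ℝ, 0 < C ∧ ∀ N : ℝ, 0 < N → 5 ≤ Real.log N →
      (∀ y, 0 ≤ y → |wt ψ N y| ≤ C / N) ∧
      ∀ y z, 0 ≤ y → 0 ≤ z → |wt ψ N y - wt ψ N z| ≤ C / N ^ 2 * |y - z| := by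
  obtain ⟨C, hC, hb, hb'⟩ := h.bounds
  refine ⟨3 * C * Real.exp 8, by positivity, fun N hN0 hN => ⟨fun y hy => ?_, ?_⟩⟩
  · rcases lt_or_ge y (N * Real.exp (-4)) with hy' | hy'
    · rw [h.wt_eq_zero_of_lt hN hy hy', abs_zero]; positivity
    have hy0 : 0 < y := lt_of_lt_of_le (by positivity) hy'
    rw [wt, abs_mul, abs_of_pos (Real.exp_pos _)]
    calc _ ≤ Real.exp 4 / N * C := by
          gcongr
          · exact exp_weight_le hN0 hN hy'
          · exact hb _
      _ ≤ Real.exp 8 / N * (3 * C) := by gcongr <;> linarith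
      _ = _ := by ring
  · have hpos : ∀ y z : ℝ, 0 < y → 0 < z →
        |wt ψ N y - wt ψ N z| ≤ 3 * C * Real.exp 8 / N ^ 2 * |y - z| := by
      intro y z hy hz
      set σ := 1 + 1 / Real.log N with hσ
      have hσ1 : 0 ≤ σ ∧ σ ≤ 2 := by
        have h1 : 1 / Real.log N ≤ 1 := by
          rw [div_le_one (by linarith)]; linarith
        have h2 : 0 ≤ 1 / Real.log N := by
          apply div_nonneg <;> linarith
        constructor <;> linarith
      have hd : ∀ x ∈ Set.Ioi (0 : ℝ), HasDerivWithinAt (wt ψ N)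
          (Real.exp (-σ * Real.log x) * (-σ * x⁻¹) * ψ (Real.log x - Real.log N) +
            Real.exp (-σ * Real.log x) * (deriv ψ (Real.log x - Real.log N) * x⁻¹))
          (Set.Ioi 0) x := by
        intro x hx
        have hx : 0 < x := hx
        have hl := Real.hasDerivAt_log hx.ne'
        have h1 : HasDerivAt (fun x => Real.exp (-σ * Real.log x))
          (Real.exp (-σ * Real.log x) * (-σ * x⁻¹)) x := (hl.const_mul (-σ)).exp
        have h2 : HasDerivAt (fun x => ψ (Real.log x - Real.log N))
          (deriv ψ (Real.log x - Real.log N) * x⁻¹) x := by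
          have h3 : HasDerivAt ψ (deriv ψ (Real.log x - Real.log N)) (Real.log x - Real.log N) :=
            (h.smooth.differentiable (by simp) _).hasDerivAt
          exact h3.comp x (hl.sub_const _)
        exact (h1.mul h2).hasDerivWithinAt
      have hbd : ∀ x ∈ Set.Ioi (0 : ℝ),
          ‖Real.exp (-σ * Real.log x) * (-σ * x⁻¹) * ψ (Real.log x - Real.log N) +
            Real.exp (-σ * Real.log x) * (deriv ψ (Real.log x - Real.log N) * x⁻¹)‖ ≤
            3 * C * Real.exp 8 / N ^ 2 := by
        intro x hx
        have hx : 0 < x := hx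
        rcases lt_or_ge x (N * Real.exp (-4)) with hx' | hx'
        · have hl : 4 < |Real.log x - Real.log N| := by
            have := Real.log_lt_log hx hx'
            rw [Real.log_mul hN0.ne' (Real.exp_ne_zero _), Real.log_exp] at this
            rw [abs_of_neg] <;> linarith
          rw [h.support _ hl, h.deriv_eq_zero hl]
          simp; positivity
        · have hE := exp_weight_le hN0 hN hx'
          rw [← hσ] at hE
          have hxi : x⁻¹ ≤ Real.exp 4 / N := by
            rw [inv_le_comm₀ hx (by positivity), inv_div, div_eq_mul_inv, ← Real.exp_neg]
            exact hx'
          rw [Real.norm_eq_abs]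
          calc _ ≤ Real.exp (-σ * Real.log x) * (σ * x⁻¹) * |ψ (Real.log x - Real.log N)| +
                Real.exp (-σ * Real.log x) * (|deriv ψ (Real.log x - Real.log N)| * x⁻¹) := by
                refine (abs_add_le _ _).trans (le_of_eq ?_)
                rw [abs_mul, abs_mul, abs_mul, abs_mul, abs_mul, abs_neg, abs_of_pos (Real.exp_pos _),
                  abs_of_nonneg hσ1.1, abs_of_pos (inv_pos.mpr hx)]
            _ ≤ Real.exp 4 / N * (2 * (Real.exp 4 / N)) * C +
                Real.exp 4 / N * (C * (Real.exp 4 / N)) := by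
                have h2 := hσ1.2
                have h1 := hσ1.1
                have h3 := hb (Real.log x - Real.log N)
                have h4 := hb' (Real.log x - Real.log N)
                gcongr
            _ = _ := by
                rw [show (8:ℝ) = 4 + 4 by norm_num, Real.exp_add]; field_simp; ring
      have := (convex_Ioi (0:ℝ)).norm_image_sub_le_of_norm_hasDerivWithin_le hd hbd hz hy
      simpa [Real.norm_eq_abs] using this
    have hzero : ∀ y : ℝ, 0 < y → |wt ψ N y| ≤ 3 * C * Real.exp 8 / N ^ 2 * y := by
      intro y hy
      rcases lt_or_ge y (N * Real.exp (-4)) with hy' | hy'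
      · rw [h.wt_eq_zero_of_lt hN hy.le hy', abs_zero]; positivity
      have h5 : N * Real.exp (-5) < N * Real.exp (-4) := by gcongr; norm_num
      have := hpos y (N * Real.exp (-5)) hy (by positivity)
      rw [h.wt_eq_zero_of_lt hN (by positivity) h5, sub_zero] at this
      refine this.trans ?_
      gcongr
      rw [abs_of_nonneg (by linarith)]
      linarith [mul_pos hN0 (Real.exp_pos (-5))]
    have hw0 : wt ψ N 0 = 0 := h.wt_eq_zero_of_lt hN le_rfl (by positivity)
    intro y z hy hz
    rcases hy.eq_or_lt with rfl | hy
    · rcases hz.eq_or_lt with rfl | hz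
      · simp
      · rw [hw0, zero_sub, abs_neg, zero_sub, abs_neg, abs_of_pos hz]; exact hzero z hz
    · rcases hz.eq_or_lt with rfl | hz
      · rw [hw0, sub_zero, sub_zero, abs_of_pos hy]; exact hzero y hy
      · exact hpos y z hy hz

/-- Twisted sums of a weight along a progression `m * l`. -/
theorem IsBlock.norm_sum_mul_wt_le {ψ : ℝ → ℝ} (h : IsBlock ψ) :
    ∃ C : ℝ, 0 < C ∧ ∀ N : ℝ, 0 < N → 5 ≤ Real.log N → ∀ (a : ℕ → ℂ) (B : ℝ),
      (∀ n, ‖∑ i ∈ range n, a i‖ ≤ B) → ∀ m M : ℕ, 0 < m → N * Real.exp 4 < m * M →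
      ‖∑ l ∈ range M, a l * (wt ψ N (m * l) : ℂ)‖ ≤ C * B / N := by
  obtain ⟨C, hC, hw⟩ := h.wt_bounds
  refine ⟨2 * Real.exp 4 * C, by positivity, fun N hN0 hN a B hB m M hm hM => ?_⟩
  obtain ⟨hw1, hw2⟩ := hw N hN0 hN
  have hB0 : 0 ≤ B := (norm_nonneg _).trans (hB 0)
  refine (norm_sum_mul_le_of_partial_sums hB (fun l => (wt ψ N (m * l) : ℂ)) M).trans ?_
  rw [h.wt_eq_zero_of_gt hN0 hM, Complex.ofReal_zero, norm_zero, zero_add]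
  have hm' : (0:ℝ) < m := by exact_mod_cast hm
  suffices hs : ∑ i ∈ range M, ‖(wt ψ N (m * ((i + 1 : ℕ) : ℝ)) : ℂ) - (wt ψ N (m * i) : ℂ)‖ ≤
      2 * Real.exp 4 * C / N by
    calc _ ≤ B * (2 * Real.exp 4 * C / N) := by gcongr
      _ = _ := by ring
  rcases lt_or_ge (N * Real.exp 4) m with hbig | hsmall
  · rw [sum_eq_zero]
    · positivity
    intro i _
    have h1 : wt ψ N (m * ((i + 1 : ℕ) : ℝ)) = 0 := by
      refine h.wt_eq_zero_of_gt hN0 (hbig.trans_le ?_)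
      push_cast; nlinarith [(Nat.cast_nonneg i : (0:ℝ) ≤ i)]
    have h2 : wt ψ N (m * i) = 0 := by
      rcases Nat.eq_zero_or_pos i with rfl | hi
      · simp only [Nat.cast_zero, mul_zero]
        exact h.wt_eq_zero_of_lt hN le_rfl (by positivity)
      · refine h.wt_eq_zero_of_gt hN0 (hbig.trans_le ?_)
        have : (1:ℝ) ≤ i := by exact_mod_cast hi
        nlinarith
    rw [h1, h2]; simp
  · set t := ⌊N * Real.exp 4 / m⌋₊ with ht
    have hle : ∀ i ∈ range M, ‖(wt ψ N (m * ((i + 1 : ℕ) : ℝ)) : ℂ) - (wt ψ N (m * i) : ℂ)‖ ≤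
        if i ∈ range (t + 1) then C / N ^ 2 * m else 0 := by
      intro i _
      rw [← Complex.ofReal_sub, Complex.norm_real, Real.norm_eq_abs]
      split_ifs with hi
      · refine (hw2 _ _ (by positivity) (by positivity)).trans (le_of_eq ?_)
        congr 1
        push_cast
        rw [show (m:ℝ) * (i + 1) - m * i = m by ring, abs_of_pos hm']
      · rw [mem_range, not_lt] at hi
        have h0 : N * Real.exp 4 < m * i := by
          have := Nat.lt_of_floor_lt (Nat.lt_of_succ_le hi)
          rw [div_lt_iff₀ hm'] at this
          linarith
        rw [h.wt_eq_zero_of_gt hN0 h0, h.wt_eq_zero_of_gt hN0 (h0.trans_le (by push_cast; nlinarith))]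
        simp
    refine (sum_le_sum hle).trans ?_
    rw [← sum_filter]
    calc _ ≤ ∑ i ∈ range (t + 1), C / N ^ 2 * m := by
          refine sum_le_sum_of_subset_of_nonneg ?_ fun _ _ _ => by positivity
          intro i hi; exact (mem_filter.mp hi).2
      _ = (t + 1) * (C / N ^ 2 * m) := by rw [sum_const, card_range, nsmul_eq_mul]; push_cast; ring
      _ ≤ (N * Real.exp 4 / m + N * Real.exp 4 / m) * (C / N ^ 2 * m) := by
          gcongr
          · exact Nat.floor_le (by positivity)
          · rwa [one_le_div hm']
      _ = _ := by field_simp; ring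

/-- Fourier representation of the weight at positive arguments. -/
theorem wt_eq_integral {ψ : ℝ → ℝ} {g : ℝ → ℂ}
    (hg : ∀ u : ℝ, (ψ u : ℂ) = ∫ t : ℝ, g t * Complex.exp (2 * Real.pi * t * u * Complex.I))
    (N y : ℝ) :
    (wt ψ N y : ℂ) = ∫ t : ℝ, g t * Complex.exp (-(2 * Real.pi * t * Real.log N * Complex.I)) *
      Complex.exp (-(1 + 1 / Real.log N - 2 * Real.pi * t * Complex.I) * Real.log y) := by
  rw [wt, Complex.ofReal_mul, hg, ← MeasureTheory.integral_const_mul]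
  congr 1
  ext t
  rw [Complex.ofReal_exp, mul_left_comm, mul_assoc (g t), ← Complex.exp_add, ← Complex.exp_add]
  congr 2
  push_cast
  ring

end PrimeGaps

namespace PrimeGaps

open Finset ArithmeticFunction

/-- Dirichlet convolutions summed against a function vanishing beyond `M`. -/
theorem sum_conv_mul (f g : ArithmeticFunction ℝ) (h : ℕ → ℂ) (M : ℕ)
    (hh : ∀ n, M ≤ n → h n = 0) :
    ∑ n ∈ range M, ((f * g) n : ℂ) * h n =
      ∑ m ∈ range M, ∑ l ∈ range M, (f m : ℂ) * (g l : ℂ) * h (m * l) := by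
  rw [← sum_product']
  have h1 : ∀ x ∈ range M ×ˢ range M, x.1 * x.2 ∉ range M →
      (f x.1 : ℂ) * (g x.2 : ℂ) * h (x.1 * x.2) = 0 := by
    intro x _ hx2
    rw [hh _ (by simpa using hx2), mul_zero]
  rw [← sum_filter_of_ne (p := fun x : ℕ × ℕ => x.1 * x.2 ∈ range M)
    (fun x hx hne => by by_contra hc; exact hne (h1 x hx hc))]
  rw [← sum_fiberwise_of_maps_to (t := range M) (g := fun x : ℕ × ℕ => x.1 * x.2)
    (fun x hx => (mem_filter.mp hx).2)]
  refine sum_congr rfl fun n hn => ?_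
  rcases Nat.eq_zero_or_pos n with rfl | hn0
  · rw [ArithmeticFunction.map_zero, Complex.ofReal_zero, zero_mul]
    refine (sum_eq_zero fun x hx => ?_).symm
    have h0 : x.1 * x.2 = 0 := (mem_filter.mp hx).2
    rcases Nat.mul_eq_zero.mp h0 with h | h <;> simp [h]
  rw [ArithmeticFunction.mul_apply, Complex.ofReal_sum, sum_mul]
  refine sum_congr_of_eq_on_inter ?_ ?_ ?_
  · intro x hx hx'
    exfalso
    apply hx'
    obtain ⟨hx1, -⟩ := Nat.mem_divisorsAntidiagonal.mp hx
    have hn' := mem_range.mp hn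
    have hp : 0 < x.1 * x.2 := by omega
    have ha := Nat.pos_of_mul_pos_right hp
    have hb := Nat.pos_of_mul_pos_left hp
    simp only [mem_filter, mem_product, mem_range]
    refine ⟨⟨⟨?_, ?_⟩, by omega⟩, hx1⟩ <;> nlinarith
  · intro x hx hx'
    exfalso
    apply hx'
    exact Nat.mem_divisorsAntidiagonal.mpr ⟨(mem_filter.mp hx).2, by omega⟩
  · intro x hx _
    rw [(Nat.mem_divisorsAntidiagonal.mp hx).1]
    push_cast
    ring

/-- Truncation of an arithmetic function to arguments at most `V`. -/
noncomputable def trunc (V : ℕ) (f : ArithmeticFunction ℝ) : ArithmeticFunction ℝ :=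
  ⟨fun n => if n ≤ V then f n else 0, by simp⟩

theorem trunc_apply (V : ℕ) (f : ArithmeticFunction ℝ) (n : ℕ) :
    trunc V f n = if n ≤ V then f n else 0 := rfl

/-- Vaughan-type decomposition of the von Mangoldt function. -/
theorem vonMangoldt_eq_vaughan (V : ℕ) :
    vonMangoldt = trunc V vonMangoldt +
      (vonMangoldt - trunc V vonMangoldt) *
        ((zeta : ArithmeticFunction ℝ) * ((moebius : ArithmeticFunction ℝ) - trunc V moebius)) +
      trunc V moebius * log - (trunc V vonMangoldt * trunc V moebius) * zeta := by
  have h1 : (zeta : ArithmeticFunction ℝ) * (moebius : ArithmeticFunction ℝ) = 1 :=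
    ArithmeticFunction.coe_zeta_mul_coe_moebius
  have h2 : vonMangoldt * (zeta : ArithmeticFunction ℝ) = log := vonMangoldt_mul_zeta
  rw [← h2, mul_sub, h1]
  ring

end PrimeGaps

namespace PrimeGaps

open Finset ComplexConjugate

/-- A finite family of bounded completely multiplicative functions whose partial sums and
correlations are small. -/
structure IsFamily {ι : Type*} (s : Finset ι) (χ : ι → ℕ → ℂ) (Q : ℕ) : Prop where
  mul_apply : ∀ i ∈ s, ∀ m n, χ i (m * n) = χ i m * χ i n
  le_one : ∀ i ∈ s, ∀ n, ‖χ i n‖ ≤ 1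
  sum_le : ∀ i ∈ s, ∀ n, ‖∑ m ∈ range n, χ i m‖ ≤ Q
  corr_le : ∀ i ∈ s, ∀ j ∈ s, i ≠ j → ∀ n, ‖∑ m ∈ range n, χ i m * conj (χ j m)‖ ≤ (Q : ℝ) ^ 2
  card_le : #s ≤ Q ^ 2

theorem norm_sum_div_le {a : ℕ → ℂ} {B : ℝ} (h : ∀ n, ‖∑ i ∈ range n, a i‖ ≤ B) (V M : ℕ) :
    ‖∑ m ∈ Ico (V + 1) M, a m / m‖ ≤ 2 * B / (V + 1) := by
  have hB : 0 ≤ B := (norm_nonneg _).trans (h 0)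
  have h' : ∀ n, ‖∑ i ∈ range n, (if V < i then a i else 0)‖ ≤ 2 * B := by
    intro n
    rw [← sum_filter]
    rcases le_total (V + 1) n with hn | hn
    · have : (range n).filter (V < ·) = Ico (V + 1) n := by ext; simp; omega
      rw [this, sum_Ico_eq_sub _ hn]
      refine (norm_sub_le _ _).trans ?_
      linarith [h n, h (V + 1)]
    · rw [filter_false_of_mem (by intro i hi; rw [mem_range] at hi; omega)]
      simpa using hB
  let g : ℕ → ℝ := fun i => 1 / (max i (V + 1) : ℕ)
  have hg : Antitone g := by
    intro i j hij
    simp only [g]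
    gcongr
  have hsum : ∑ m ∈ Ico (V + 1) M, a m / m =
      ∑ i ∈ range M, (if V < i then a i else 0) * (g i : ℂ) := by
    simp_rw [ite_mul, zero_mul]
    rw [← sum_filter]
    have : (range M).filter (V < ·) = Ico (V + 1) M := by ext; simp; omega
    rw [this]
    refine sum_congr rfl fun i hi => ?_
    have hi' := (mem_Ico.mp hi).1
    simp only [g, max_eq_left hi']
    push_cast
    rw [mul_one_div]
  rw [hsum]
  refine (norm_sum_mul_le_of_partial_sums h' (fun i => (g i : ℂ)) M).trans ?_
  have h1 : ∀ i ∈ range M, ‖(g (i + 1) : ℂ) - (g i : ℂ)‖ = g i - g (i + 1) := by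
    intro i _
    rw [← Complex.ofReal_sub, Complex.norm_real, Real.norm_eq_abs, abs_sub_comm,
      abs_of_nonneg (sub_nonneg.mpr (hg (Nat.le_succ i)))]
  have h2 : 0 ≤ g M := by positivity
  rw [sum_congr rfl h1, sum_range_sub', Complex.norm_real, Real.norm_eq_abs, abs_of_nonneg h2]
  simp only [g]
  simp
  rw [div_eq_mul_inv]

/-- A large sieve inequality for families with small correlations. -/
theorem IsFamily.large_sieve {ι : Type*} {s : Finset ι} {χ : ι → ℕ → ℂ} {Q : ℕ}
    (h : IsFamily s χ Q) (V M : ℕ) (hV : Q ^ 4 ≤ V) (α : ℕ → ℂ) :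
    ∑ i ∈ s, ‖∑ m ∈ Ico (V + 1) M, α m / m * χ i m‖ ^ 2 ≤
      (∑ m ∈ Ico (V + 1) M, ‖α m‖ ^ 2 / m) * (∑ m ∈ Ico (V + 1) M, 1 / (m : ℝ) + 2) := by
  classical
  set c : ι → ℂ := fun i => ∑ m ∈ Ico (V + 1) M, α m / m * χ i m with hc
  set S := ∑ i ∈ s, ‖c i‖ ^ 2 with hS
  set E := ∑ m ∈ Ico (V + 1) M, ‖α m‖ ^ 2 / m
  set G := ∑ m ∈ Ico (V + 1) M, 1 / (m : ℝ)
  have hE : 0 ≤ E := sum_nonneg fun _ _ => by positivity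
  have hG : 0 ≤ G := sum_nonneg fun _ _ => by positivity
  have hS0 : 0 ≤ S := sum_nonneg fun _ _ => by positivity
  set b : ℕ → ℂ := fun m => ∑ i ∈ s, conj (c i) * χ i m with hb
  have e1 : (S : ℂ) = ∑ m ∈ Ico (V + 1) M, α m / m * b m := by
    have : ∀ i ∈ s, ((‖c i‖ ^ 2 : ℝ) : ℂ) = ∑ m ∈ Ico (V + 1) M, α m / m * (conj (c i) * χ i m) := by
      intro i _
      rw [Complex.ofReal_pow, ← Complex.conj_mul', hc]
      simp only
      rw [mul_sum]
      refine sum_congr rfl fun m _ => by ring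
    rw [hS, Complex.ofReal_sum, sum_congr rfl this, sum_comm]
    refine sum_congr rfl fun m _ => by rw [hb, mul_sum]
  have e2 : ∑ m ∈ Ico (V + 1) M, ‖b m‖ ^ 2 / m ≤ S * (G + 2) := by
    have e3 : ((∑ m ∈ Ico (V + 1) M, ‖b m‖ ^ 2 / m : ℝ) : ℂ) =
        ∑ i ∈ s, ∑ j ∈ s, conj (c i) * c j * ∑ m ∈ Ico (V + 1) M, χ i m * conj (χ j m) / m := by
      simp_rw [mul_sum]
      rw [Complex.ofReal_sum]
      have : ∀ m ∈ Ico (V + 1) M, ((‖b m‖ ^ 2 / m : ℝ) : ℂ) =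
          ∑ i ∈ s, ∑ j ∈ s, conj (c i) * c j * (χ i m * conj (χ j m) / m) := by
        intro m _
        rw [Complex.ofReal_div, Complex.ofReal_pow, ← Complex.mul_conj', hb]
        simp only
        rw [map_sum, sum_mul_sum, sum_div]
        refine sum_congr rfl fun i _ => ?_
        rw [sum_div]
        refine sum_congr rfl fun j _ => ?_
        simp only [map_mul, Complex.conj_conj, Complex.ofReal_natCast]
        ring
      rw [sum_congr rfl this, sum_comm]
      refine sum_congr rfl fun i _ => ?_
      rw [sum_comm]
    have e4 : ∀ i ∈ s, ∀ j ∈ s,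
        ‖conj (c i) * c j * ∑ m ∈ Ico (V + 1) M, χ i m * conj (χ j m) / m‖ ≤
        (if i = j then ‖c i‖ ^ 2 * G else 0) + ‖c i‖ * ‖c j‖ * (2 * Q ^ 2 / (V + 1)) := by
      intro i hi j hj
      rw [norm_mul, norm_mul, RCLike.norm_conj]
      split_ifs with hij
      · subst hij
        have : ‖∑ m ∈ Ico (V + 1) M, χ i m * conj (χ i m) / m‖ ≤ G := by
          refine norm_sum_le_of_le _ fun m _ => ?_
          rw [norm_div, norm_mul, RCLike.norm_conj, Complex.norm_natCast]
          gcongr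
          nlinarith [h.le_one i hi m, norm_nonneg (χ i m)]
        calc _ ≤ ‖c i‖ * ‖c i‖ * G := by gcongr
          _ = ‖c i‖ ^ 2 * G := by ring
          _ ≤ _ := le_add_of_nonneg_right (by positivity)
      · rw [zero_add]
        gcongr
        exact norm_sum_div_le (h.corr_le i hi j hj hij) V M
    have e5 : ∑ m ∈ Ico (V + 1) M, ‖b m‖ ^ 2 / m ≤ ∑ i ∈ s, ∑ j ∈ s,
        ((if i = j then ‖c i‖ ^ 2 * G else 0) + ‖c i‖ * ‖c j‖ * (2 * Q ^ 2 / (V + 1))) := by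
      have : 0 ≤ ∑ m ∈ Ico (V + 1) M, ‖b m‖ ^ 2 / m := sum_nonneg fun _ _ => by positivity
      rw [← abs_of_nonneg this, ← Real.norm_eq_abs, ← Complex.norm_real, e3]
      refine norm_sum_le_of_le _ fun i hi => norm_sum_le_of_le _ fun j hj => e4 i hi j hj
    refine e5.trans ?_
    simp_rw [sum_add_distrib]
    have e6 : ∑ i ∈ s, ∑ j ∈ s, (if i = j then ‖c i‖ ^ 2 * G else 0) = S * G := by
      rw [hS, sum_mul]
      refine sum_congr rfl fun i hi => ?_
      rw [sum_ite_eq, if_pos hi]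
    have e7 : ∑ i ∈ s, ∑ j ∈ s, ‖c i‖ * ‖c j‖ * (2 * (Q:ℝ) ^ 2 / (V + 1)) =
        (∑ i ∈ s, ‖c i‖) ^ 2 * (2 * (Q:ℝ) ^ 2 / (V + 1)) := by
      rw [sq (∑ i ∈ s, ‖c i‖), sum_mul_sum, sum_mul]
      refine sum_congr rfl fun i _ => by rw [sum_mul]
    have e8 : (∑ i ∈ s, ‖c i‖) ^ 2 ≤ (Q:ℝ) ^ 2 * S := by
      refine (sq_sum_le_card_mul_sum_sq).trans ?_
      gcongr
      exact_mod_cast h.card_le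
    rw [e6, e7]
    have e9 : (∑ i ∈ s, ‖c i‖) ^ 2 * (2 * (Q:ℝ) ^ 2 / (V + 1)) ≤ S * 2 := by
      have hV' : (Q:ℝ) ^ 4 ≤ V := by exact_mod_cast hV
      calc _ ≤ (Q:ℝ) ^ 2 * S * (2 * (Q:ℝ) ^ 2 / (V + 1)) := by gcongr
        _ = S * 2 * (Q ^ 4 / (V + 1)) := by ring
        _ ≤ S * 2 * 1 := by
          gcongr
          rw [div_le_one (by positivity)]
          linarith
        _ = _ := mul_one _
    linarith
  have e10 : S ≤ ∑ m ∈ Ico (V + 1) M, (‖α m‖ / √m) * (‖b m‖ / √m) := by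
    rw [← abs_of_nonneg hS0, ← Real.norm_eq_abs, ← Complex.norm_real, e1]
    refine norm_sum_le_of_le _ fun m _ => le_of_eq ?_
    rw [norm_mul, norm_div, Complex.norm_natCast, div_mul_div_comm, Real.mul_self_sqrt (by positivity)]
    ring
  have e11 := sum_mul_sq_le_sq_mul_sq (Ico (V + 1) M) (fun m => ‖α m‖ / √(m:ℝ)) (fun m => ‖b m‖ / √(m:ℝ))
  have e12 : S ^ 2 ≤ E * (S * (G + 2)) := by
    calc S ^ 2 ≤ (∑ m ∈ Ico (V + 1) M, (‖α m‖ / √(m:ℝ)) * (‖b m‖ / √(m:ℝ))) ^ 2 := by gcongr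
      _ ≤ _ := e11
      _ = E * ∑ m ∈ Ico (V + 1) M, ‖b m‖ ^ 2 / m := by
        congr 1 <;>
        · refine sum_congr rfl fun m _ => ?_
          rw [div_pow, Real.sq_sqrt (by positivity)]
      _ ≤ _ := by gcongr
  rcases hS0.eq_or_lt with h0 | h0
  · rw [← h0]; positivity
  · nlinarith

end PrimeGaps

namespace PrimeGaps

open Finset

/-- First natural number beyond the support of the weights at scale `N`. -/
noncomputable def cutoff (N : ℝ) : ℕ := ⌊N * Real.exp 4⌋₊ + 1

theorem lt_cutoff (N : ℝ) : N * Real.exp 4 < cutoff N := by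
  unfold cutoff; push_cast; exact Nat.lt_floor_add_one _

theorem IsBlock.wt_eq_zero_of_cutoff_le {ψ : ℝ → ℝ} (h : IsBlock ψ) {N : ℝ} (hN : 0 < N) {n : ℕ}
    (hn : cutoff N ≤ n) : wt ψ N n = 0 :=
  h.wt_eq_zero_of_gt hN ((lt_cutoff N).trans_le (by exact_mod_cast hn))

theorem log_cutoff_le {N : ℝ} (hN0 : 0 < N) (hN : 7 ≤ Real.log N) :
    Real.log (cutoff N) ≤ 2 * Real.log N - 1 := by
  have h1 : (1:ℝ) ≤ N * Real.exp 4 := by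
    have : Real.exp 0 ≤ N := by rw [Real.exp_zero]; exact (Real.log_pos_iff hN0.le).mp (by linarith) |>.le
    rw [Real.exp_zero] at this
    nlinarith [Real.one_le_exp (show (0:ℝ) ≤ 4 by norm_num)]
  have h2 : (cutoff N : ℝ) ≤ N * Real.exp 5 := by
    unfold cutoff
    push_cast
    have h3 := Nat.floor_le (show 0 ≤ N * Real.exp 4 by positivity)
    have h4 : Real.exp 5 = Real.exp 4 * Real.exp 1 := by rw [← Real.exp_add]; norm_num
    have h5 := Real.add_one_le_exp 1
    rw [h4]
    nlinarith
  calc _ ≤ Real.log (N * Real.exp 5) := by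
        apply Real.log_le_log _ h2
        exact_mod_cast Nat.succ_pos _
    _ = Real.log N + 5 := by rw [Real.log_mul hN0.ne' (Real.exp_ne_zero _), Real.log_exp]
    _ ≤ _ := by linarith

theorem sum_inv_le_log {M : ℕ} (hM : 1 ≤ M) :
    ∑ m ∈ range M, 1 / (m : ℝ) ≤ 1 + Real.log M := by
  have h1 := harmonic_le_one_add_log M
  rw [harmonic, Rat.cast_sum] at h1
  refine le_trans ?_ h1
  obtain ⟨K, rfl⟩ : ∃ K, M = K + 1 := ⟨M - 1, by omega⟩
  rw [sum_range_succ', sum_range_succ]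
  simp
  positivity

theorem sum_inv_cutoff_le {N : ℝ} (hN0 : 0 < N) (hN : 7 ≤ Real.log N) :
    ∑ m ∈ range (cutoff N), 1 / (m : ℝ) ≤ 2 * Real.log N := by
  have := sum_inv_le_log (show 1 ≤ cutoff N from Nat.succ_pos _)
  linarith [log_cutoff_le hN0 hN]

theorem sum_conv_div_le {f g : ArithmeticFunction ℝ} (hf : ∀ n, 0 ≤ f n) (hg : ∀ n, 0 ≤ g n)
    (M : ℕ) : ∑ n ∈ range M, (f * g) n / n ≤
      (∑ n ∈ range M, f n / n) * ∑ n ∈ range M, g n / n := by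
  have h := sum_conv_mul f g (fun n => ((if n < M then (1:ℝ) / n else 0 : ℝ) : ℂ)) M
    (fun n hn => by rw [if_neg (by omega)]; simp)
  have h' : ∑ n ∈ range M, (f * g) n * (if n < M then (1:ℝ) / n else 0) =
      ∑ m ∈ range M, ∑ l ∈ range M, f m * g l * (if m * l < M then (1:ℝ) / (m * l : ℕ) else 0) := by
    exact_mod_cast h
  have h'' : ∑ n ∈ range M, (f * g) n / n =
      ∑ n ∈ range M, (f * g) n * (if n < M then (1:ℝ) / n else 0) := by
    refine sum_congr rfl fun n hn => ?_
    rw [if_pos (mem_range.mp hn)]; ring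
  rw [h'', h', sum_mul_sum]
  refine sum_le_sum fun m _ => sum_le_sum fun l _ => ?_
  have : (f m / m) * (g l / l) = f m * g l * (1 / (m * l : ℕ)) := by
    push_cast; rw [div_mul_div_comm]; ring
  rw [this]
  refine mul_le_mul_of_nonneg_left ?_ (mul_nonneg (hf m) (hg l))
  split_ifs
  · exact le_rfl
  · positivity

theorem card_divisors_mul_le (m n : ℕ) :
    #(m * n).divisors ≤ #m.divisors * #n.divisors := by
  rw [Nat.divisors_mul]; exact card_mul_le

theorem sum_divisors_sq_div_le (M : ℕ) :
    ∑ n ∈ range M, (#n.divisors : ℝ) ^ 2 / n ≤ (∑ n ∈ range M, 1 / (n : ℝ)) ^ 4 := by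
  let ζ : ArithmeticFunction ℝ := ArithmeticFunction.zeta
  have hζ : ∀ n, 0 ≤ ζ n := fun n => by
    simp only [ζ, ArithmeticFunction.natCoe_apply]; positivity
  have hζ1 : ∀ n, ζ n / n ≤ 1 / n := fun n => by
    simp only [ζ, ArithmeticFunction.natCoe_apply, ArithmeticFunction.zeta_apply]
    split_ifs <;> simp
  have hτ : ∀ n, (ζ * ζ) n = #n.divisors := by
    intro n
    have : ζ * ζ = ((ArithmeticFunction.zeta * ArithmeticFunction.zeta : ArithmeticFunction ℕ) :
        ArithmeticFunction ℝ) := by simp [ζ]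
    rw [this, ArithmeticFunction.natCoe_apply, ArithmeticFunction.zeta_mul_apply]
    norm_cast
    rw [card_eq_sum_ones]
    refine sum_congr rfl fun d hd => ?_
    rw [ArithmeticFunction.zeta_apply_ne (Nat.pos_of_mem_divisors hd).ne']
  have h0 : 0 ≤ ∑ n ∈ range M, ζ n / n := sum_nonneg fun n _ => div_nonneg (hζ n) (by positivity)
  have hτ0 : ∀ n, 0 ≤ (ζ * ζ) n := fun n => by rw [hτ]; positivity
  have h1 := sum_conv_div_le hζ hζ M
  have h2 := sum_conv_div_le hτ0 hτ0 M
  have h3 : ∑ n ∈ range M, ζ n / n ≤ ∑ n ∈ range M, 1 / (n : ℝ) := sum_le_sum fun n _ => hζ1 n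
  have h4 : 0 ≤ ∑ n ∈ range M, (ζ * ζ) n / n :=
    sum_nonneg fun n _ => div_nonneg (hτ0 n) (by positivity)
  calc ∑ n ∈ range M, (#n.divisors : ℝ) ^ 2 / n ≤ ∑ n ∈ range M, ((ζ * ζ) * (ζ * ζ)) n / n := by
        refine sum_le_sum fun n _ => ?_
        gcongr
        rw [ArithmeticFunction.mul_apply]
        calc (#n.divisors : ℝ) ^ 2 = ∑ x ∈ n.divisorsAntidiagonal, (#n.divisors : ℝ) := by
              rw [sum_const, nsmul_eq_mul, sq, ← Nat.map_div_right_divisors, card_map]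
          _ ≤ _ := by
              refine sum_le_sum fun x hx => ?_
              rw [hτ, hτ, ← (Nat.mem_divisorsAntidiagonal.mp hx).1]
              exact_mod_cast card_divisors_mul_le _ _
    _ ≤ (∑ n ∈ range M, (ζ * ζ) n / n) * ∑ n ∈ range M, (ζ * ζ) n / n := h2
    _ ≤ ((∑ n ∈ range M, ζ n / n) * ∑ n ∈ range M, ζ n / n) *
          ((∑ n ∈ range M, ζ n / n) * ∑ n ∈ range M, ζ n / n) := by gcongr
    _ ≤ ((∑ n ∈ range M, 1 / (n : ℝ)) * ∑ n ∈ range M, 1 / (n : ℝ)) *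
          ((∑ n ∈ range M, 1 / (n : ℝ)) * ∑ n ∈ range M, 1 / (n : ℝ)) := by
        gcongr
    _ = _ := by ring

end PrimeGaps

namespace PrimeGaps

open Finset ArithmeticFunction

/-- Type I sums. -/
theorem norm_typeI_le {χ : ℕ → ℂ} (hmul : ∀ m n, χ (m * n) = χ m * χ n) (hle : ∀ n, ‖χ n‖ ≤ 1)
    {w : ℕ → ℂ} {M : ℕ} (hw : ∀ n, M ≤ n → w n = 0) {b k : ArithmeticFunction ℝ} {U : ℕ} {β D : ℝ}
    (hb : ∀ m, m ≤ U → |b m| ≤ β) (hU : ∀ m, U < m → b m = 0)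
    (hD : ∀ m, 0 < m → m ≤ U → ‖∑ l ∈ range M, (k l : ℂ) * χ l * w (m * l)‖ ≤ D) (hD0 : 0 ≤ D) :
    ‖∑ n ∈ range M, ((b * k) n : ℂ) * (χ n * w n)‖ ≤ U * (β * D) := by
  have hβ : 0 ≤ β := (abs_nonneg _).trans (hb 0 (Nat.zero_le _))
  rw [sum_conv_mul b k (fun n => χ n * w n) M (fun n hn => by simp [hw n hn])]
  have h1 : ∀ m ∈ range M, ‖∑ l ∈ range M, (b m : ℂ) * (k l : ℂ) * (χ (m * l) * w (m * l))‖ ≤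
      if m ∈ Ico 1 (U + 1) then β * D else 0 := by
    intro m _
    have : ∑ l ∈ range M, (b m : ℂ) * (k l : ℂ) * (χ (m * l) * w (m * l)) =
        (b m : ℂ) * χ m * ∑ l ∈ range M, (k l : ℂ) * χ l * w (m * l) := by
      rw [mul_sum]
      refine sum_congr rfl fun l _ => ?_
      rw [hmul]; ring
    rw [this]
    split_ifs with hm
    · rw [mem_Ico] at hm
      rw [norm_mul, norm_mul, Complex.norm_real, Real.norm_eq_abs]
      calc _ ≤ β * 1 * D := by
            gcongr
            · exact hb m (by omega)
            · exact hle m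
            · exact hD m (by omega) (by omega)
        _ = _ := by ring
    · rcases Nat.eq_zero_or_pos m with rfl | hm0
      · simp
      · rw [hU m (by rw [mem_Ico] at hm; omega)]; simp
  refine (norm_sum_le_of_le _ h1).trans ?_
  rw [← sum_filter]
  calc _ ≤ ∑ i ∈ Ico 1 (U + 1), β * D := by
        refine sum_le_sum_of_subset_of_nonneg ?_ fun _ _ _ => by positivity
        intro i hi; exact (mem_filter.mp hi).2
    _ = _ := by rw [sum_const, Nat.card_Ico, nsmul_eq_mul]; push_cast; simp

/-- Smooth sums over a progression with logarithmic weights. -/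
theorem IsBlock.norm_sum_log_mul_wt_le {ψ : ℝ → ℝ} (h : IsBlock ψ) :
    ∃ C : ℝ, 0 < C ∧ ∀ N : ℝ, 0 < N → 5 ≤ Real.log N → ∀ (a : ℕ → ℂ) (B : ℝ),
      (∀ n, ‖∑ i ∈ range n, a i‖ ≤ B) → ∀ m M : ℕ, 0 < m → m ≤ N → N * Real.exp 4 < m * M →
      ‖∑ l ∈ range M, (Real.log l : ℂ) * a l * (wt ψ N (m * l) : ℂ)‖ ≤ C * B / N * Real.log N := by
  obtain ⟨C₁, hC₁, h₁⟩ := h.norm_sum_mul_wt_le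
  obtain ⟨C₂, hC₂, h₂⟩ := h.id_mul.norm_sum_mul_wt_le
  refine ⟨C₁ + C₂, by positivity, fun N hN0 hN a B hB m M hm hmN hM => ?_⟩
  have hB0 : 0 ≤ B := (norm_nonneg _).trans (hB 0)
  have hm' : (0:ℝ) < m := by exact_mod_cast hm
  have e : ∑ l ∈ range M, (Real.log l : ℂ) * a l * (wt ψ N (m * l) : ℂ) =
      ∑ l ∈ range M, a l * (wt (fun u => u * ψ u) N (m * l) : ℂ) +
      ((Real.log N - Real.log m : ℝ) : ℂ) * ∑ l ∈ range M, a l * (wt ψ N (m * l) : ℂ) := by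
    rw [mul_sum, ← sum_add_distrib]
    refine sum_congr rfl fun l _ => ?_
    rcases Nat.eq_zero_or_pos l with rfl | hl
    · have h0 : wt ψ N (m * (0:ℕ)) = 0 := h.wt_eq_zero_of_lt hN (by simp) (by simp; positivity)
      have h0' : wt (fun u => u * ψ u) N (m * (0:ℕ)) = 0 :=
        h.id_mul.wt_eq_zero_of_lt hN (by simp) (by simp; positivity)
      rw [h0, h0']; simp
    · have hl' : (0:ℝ) < l := by exact_mod_cast hl
      have : wt (fun u => u * ψ u) N (m * l) =
          (Real.log m + Real.log l - Real.log N) * wt ψ N (m * l) := by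
        unfold wt
        rw [Real.log_mul hm'.ne' hl'.ne']; ring
      rw [this]
      push_cast
      ring
  rw [e]
  refine (norm_add_le _ _).trans ?_
  rw [norm_mul, Complex.norm_real, Real.norm_eq_abs]
  have hlm : 0 ≤ Real.log m := Real.log_natCast_nonneg m
  have hlm' : Real.log m ≤ Real.log N := Real.log_le_log hm' hmN
  have hl : |Real.log N - Real.log m| ≤ Real.log N := by rw [abs_of_nonneg] <;> linarith
  calc _ ≤ C₂ * B / N + Real.log N * (C₁ * B / N) := by
        gcongr
        · exact h₂ N hN0 hN a B hB m M hm hM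
        · exact h₁ N hN0 hN a B hB m M hm hM
    _ ≤ C₂ * B / N * Real.log N + Real.log N * (C₁ * B / N) := by
        gcongr
        refine le_mul_of_one_le_right (by positivity) (by linarith)
    _ = _ := by ring

/-- Type II sums, on average over a family. -/
theorem IsBlock.typeII_le {ψ : ℝ → ℝ} (h : IsBlock ψ) :
    ∃ C : ℝ, 0 < C ∧ ∀ (ι : Type) (s : Finset ι) (χ : ι → ℕ → ℂ) (Q : ℕ), IsFamily s χ Q →
      ∀ N : ℝ, 0 < N → 7 ≤ Real.log N → ∀ V : ℕ, Q ^ 4 ≤ V → ∀ f g : ArithmeticFunction ℝ,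
      (∀ n, n ≤ V → f n = 0) → (∀ n, n ≤ V → g n = 0) → ∀ Ef Eg : ℝ, 0 ≤ Ef → 0 ≤ Eg →
      ∑ n ∈ range (cutoff N), |f n| ^ 2 / n ≤ Ef ^ 2 →
      ∑ n ∈ range (cutoff N), |g n| ^ 2 / n ≤ Eg ^ 2 →
      ∑ i ∈ s, ‖∑ n ∈ range (cutoff N), ((f * g) n : ℂ) * (χ i n * wt ψ N n)‖ ≤
        C * Real.log N * Ef * Eg := by
  obtain ⟨g₀, hg₀c, hg₀i, hg₀⟩ := h.fourier
  have hI0 : MeasureTheory.Integrable fun t => ‖g₀ t‖ := by simpa using hg₀i 0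
  refine ⟨3 * (∫ t, ‖g₀ t‖) + 1, ?_, ?_⟩
  · have : 0 ≤ ∫ t, ‖g₀ t‖ := MeasureTheory.integral_nonneg fun _ => norm_nonneg _
    linarith
  intro ι s χ Q hF N hN0 hN V hV f g hf hg Ef Eg hEf0 hEg0 hEf hEg
  set M := cutoff N with hM
  set L := Real.log N with hL
  -- Dirichlet polynomial associated to `f` at `t`
  let tw : ℝ → ℕ → ℂ := fun t n => Complex.exp (-(1 + 1 / L - 2 * Real.pi * t * Complex.I) * Real.log n)
  let P : (ArithmeticFunction ℝ) → ι → ℝ → ℂ := fun f i t =>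
    ∑ m ∈ range M, (f m : ℂ) * χ i m * tw t m
  have htw : ∀ t, ∀ n : ℕ, 1 ≤ n → ‖tw t n * n‖ ≤ 1 := by
    intro t n hn
    have hn' : (0:ℝ) < n := by exact_mod_cast hn
    simp only [tw]
    rw [norm_mul, Complex.norm_natCast, Complex.norm_exp]
    have : (-(1 + 1 / (L:ℂ) - 2 * Real.pi * t * Complex.I) * Real.log n).re =
        -(1 + 1 / L) * Real.log n := by
      have h1 : (-(1 + 1 / (L:ℂ) - 2 * Real.pi * t * Complex.I) * Real.log n) =
        ((-(1 + 1 / L) * Real.log n : ℝ) : ℂ) + ((2 * Real.pi * t * Real.log n : ℝ) : ℂ) * Complex.I := by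
        push_cast; ring
      rw [h1, Complex.add_re, Complex.ofReal_re, Complex.re_ofReal_mul, Complex.I_re, mul_zero,
        add_zero]
    rw [this]
    calc Real.exp (-(1 + 1 / L) * Real.log n) * n ≤ Real.exp (-Real.log n) * n := by
          gcongr
          have : 0 ≤ 1 / L * Real.log n := by
            have := Real.log_natCast_nonneg n
            positivity
          linarith
      _ = 1 := by rw [Real.exp_neg, Real.exp_log hn', inv_mul_cancel₀ hn'.ne']
  have hLS : ∀ f : ArithmeticFunction ℝ, (∀ n, n ≤ V → f n = 0) → ∀ E : ℝ, 
      ∑ n ∈ range M, |f n| ^ 2 / n ≤ E ^ 2 → ∀ t, ∑ i ∈ s, ‖P f i t‖ ^ 2 ≤ E ^ 2 * (3 * L) := by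
    intro f hf E hE t
    have h1 : ∀ i, P f i t = ∑ m ∈ Ico (V + 1) M, ((f m : ℂ) * (tw t m * m)) / m * χ i m := by
      intro i
      simp only [P]
      symm
      have hsub : Ico (V + 1) M ⊆ range M := by intro x; simp
      rw [← sum_subset hsub]
      · refine sum_congr rfl fun m hm => ?_
        have : (m : ℂ) ≠ 0 := by
          have := (mem_Ico.mp hm).1
          exact_mod_cast (by omega : m ≠ 0)
        field_simp
      · intro m hm hm'
        rw [hf m (by rw [mem_range] at hm; rw [mem_Ico] at hm'; omega)]; simp
    simp_rw [h1]
    refine (hF.large_sieve V M hV _).trans ?_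
    have h2 : ∑ m ∈ Ico (V + 1) M, ‖(f m : ℂ) * (tw t m * m)‖ ^ 2 / m ≤ E ^ 2 := by
      refine le_trans ?_ hE
      calc _ ≤ ∑ m ∈ Ico (V + 1) M, |f m| ^ 2 / m := by
            refine sum_le_sum fun m hm => ?_
            rw [norm_mul, Complex.norm_real, Real.norm_eq_abs]
            gcongr
            exact mul_le_of_le_one_right (abs_nonneg _) (htw t m (by have := (mem_Ico.mp hm).1; omega))
        _ ≤ _ := sum_le_sum_of_subset_of_nonneg (by intro x; simp) fun _ _ _ => by positivity
    have h3 : ∑ m ∈ Ico (V + 1) M, 1 / (m : ℝ) ≤ 2 * L :=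
      (sum_le_sum_of_subset_of_nonneg (fun x hx => mem_range.mpr (mem_Ico.mp hx).2)
        fun _ _ _ => by positivity).trans
        (sum_inv_cutoff_le hN0 hN)
    have h4 : 0 ≤ ∑ m ∈ Ico (V + 1) M, 1 / (m : ℝ) := sum_nonneg fun _ _ => by positivity
    gcongr
    linarith
  have hprod : ∀ t, ∑ i ∈ s, ‖P f i t‖ * ‖P g i t‖ ≤ 3 * L * Ef * Eg := by
    intro t
    have h1 := sum_mul_sq_le_sq_mul_sq s (fun i => ‖P f i t‖) (fun i => ‖P g i t‖)
    have h2 : (∑ i ∈ s, ‖P f i t‖ * ‖P g i t‖) ^ 2 ≤ (3 * L * Ef * Eg) ^ 2 := by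
      calc _ ≤ _ := h1
        _ ≤ (Ef ^ 2 * (3 * L)) * (Eg ^ 2 * (3 * L)) := by
          gcongr
          · exact hLS f hf Ef hEf t
          · exact hLS g hg Eg hEg t
        _ = _ := by ring
    have hL0 : 0 ≤ L := by linarith
    exact abs_le_of_sq_le_sq' h2 (by positivity) |>.2
  have hPc : ∀ f i, Continuous (P f i) := by
    intro f i
    simp only [P, tw]
    fun_prop
  have hPb : ∀ f : ArithmeticFunction ℝ, ∀ i ∈ s, ∀ t, ‖P f i t‖ ≤ ∑ m ∈ range M, |f m| := by
    intro f i hi t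
    refine norm_sum_le_of_le _ fun m _ => ?_
    rcases Nat.eq_zero_or_pos m with rfl | hm
    · simp
    rw [norm_mul, norm_mul, Complex.norm_real, Real.norm_eq_abs, mul_assoc]
    refine mul_le_of_le_one_right (abs_nonneg _) ?_
    have h1 := htw t m hm
    rw [norm_mul, Complex.norm_natCast] at h1
    have h2 : (1:ℝ) ≤ m := by exact_mod_cast hm
    nlinarith [hF.le_one i hi m, norm_nonneg (χ i m), norm_nonneg (tw t m)]
  have hrep : ∀ i ∈ s, ∑ n ∈ range M, ((f * g) n : ℂ) * (χ i n * wt ψ N n) =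
      ∫ t : ℝ, g₀ t * Complex.exp (-(2 * Real.pi * t * L * Complex.I)) * (P f i t * P g i t) := by
    intro i hi
    rw [sum_conv_mul f g (fun n => χ i n * wt ψ N n) M
      (fun n hn => by simp only [h.wt_eq_zero_of_cutoff_le hN0 hn]; simp)]
    have hterm : ∀ m ∈ range M, ∀ l ∈ range M,
        (f m : ℂ) * (g l : ℂ) * (χ i (m * l) * wt ψ N ((m * l : ℕ) : ℝ)) =
        ∫ t : ℝ, g₀ t * Complex.exp (-(2 * Real.pi * t * L * Complex.I)) *
          ((f m : ℂ) * χ i m * tw t m * ((g l : ℂ) * χ i l * tw t l)) := by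
      intro m _ l _
      rcases Nat.eq_zero_or_pos m with rfl | hm
      · simp
      rcases Nat.eq_zero_or_pos l with rfl | hl
      · simp
      have hm' : (0:ℝ) < m := by exact_mod_cast hm
      have hl' : (0:ℝ) < l := by exact_mod_cast hl
      rw [wt_eq_integral hg₀, hF.mul_apply i hi, ← MeasureTheory.integral_const_mul,
        ← MeasureTheory.integral_const_mul]
      congr 1
      ext t
      have : Complex.exp (-(1 + 1 / (L:ℂ) - 2 * Real.pi * t * Complex.I) *
          (Real.log ((m * l : ℕ) : ℝ) : ℂ)) = tw t m * tw t l := by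
        simp only [tw]
        rw [← Complex.exp_add]
        congr 1
        push_cast [Real.log_mul hm'.ne' hl'.ne']
        ring
      rw [this]
      ring
    rw [sum_congr rfl fun m hm => sum_congr rfl fun l hl => hterm m hm l hl]
    have hint : ∀ m l : ℕ, MeasureTheory.Integrable fun t : ℝ =>
        g₀ t * Complex.exp (-(2 * Real.pi * t * L * Complex.I)) *
          ((f m : ℂ) * χ i m * tw t m * ((g l : ℂ) * χ i l * tw t l)) := by
      intro m l
      have hm1 : ∀ n : ℕ, ∀ t, ‖tw t n‖ ≤ 1 := by
        intro n t
        rcases Nat.eq_zero_or_pos n with rfl | hn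
        · simp [tw]
        · have h1 := htw t n hn
          rw [norm_mul, Complex.norm_natCast] at h1
          have h2 : (1:ℝ) ≤ n := by exact_mod_cast hn
          nlinarith [norm_nonneg (tw t n)]
      refine MeasureTheory.Integrable.mono' (hI0.mul_const (‖(f m : ℂ)‖ * ‖(g l : ℂ)‖)) ?_ ?_
      · apply Continuous.aestronglyMeasurable
        simp only [tw]
        fun_prop
      · refine Filter.Eventually.of_forall fun t => ?_
        have he : ‖Complex.exp (-(2 * Real.pi * t * L * Complex.I))‖ = 1 := by
          rw [show -(2 * Real.pi * t * L * Complex.I) = ((-(2 * Real.pi * t * L) : ℝ) : ℂ) * Complex.I by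
            push_cast; ring]
          exact Complex.norm_exp_ofReal_mul_I _
        simp only [norm_mul, he, mul_one]
        have a1 := hF.le_one i hi m
        have a2 := hF.le_one i hi l
        calc _ ≤ ‖g₀ t‖ * (‖(f m : ℂ)‖ * 1 * 1 * (‖(g l : ℂ)‖ * 1 * 1)) := by
              gcongr
              · exact hm1 m t
              · exact hm1 l t
          _ = _ := by ring
    rw [sum_congr rfl fun m _ => (MeasureTheory.integral_finsetSum _ fun l _ => hint m l).symm,
      ← MeasureTheory.integral_finsetSum _ fun m _ =>
        MeasureTheory.integrable_finsetSum _ fun l _ => hint m l]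
    congr 1
    ext t
    simp only [P]
    rw [sum_mul_sum, mul_sum]
    refine sum_congr rfl fun m _ => by rw [mul_sum]
  have hbd : ∀ i ∈ s, ‖∑ n ∈ range M, ((f * g) n : ℂ) * (χ i n * wt ψ N n)‖ ≤
      ∫ t, ‖g₀ t‖ * (‖P f i t‖ * ‖P g i t‖) := by
    intro i hi
    rw [hrep i hi]
    refine (MeasureTheory.norm_integral_le_integral_norm _).trans (le_of_eq ?_)
    congr 1
    ext t
    have he : ‖Complex.exp (-(2 * Real.pi * t * L * Complex.I))‖ = 1 := by
      rw [show -(2 * Real.pi * t * L * Complex.I) = ((-(2 * Real.pi * t * L) : ℝ) : ℂ) * Complex.I by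
        push_cast; ring]
      exact Complex.norm_exp_ofReal_mul_I _
    simp only [norm_mul, he, mul_one]
  have hint2 : ∀ i ∈ s, MeasureTheory.Integrable fun t => ‖g₀ t‖ * (‖P f i t‖ * ‖P g i t‖) := by
    intro i hi
    refine MeasureTheory.Integrable.mono' (hI0.mul_const
      ((∑ m ∈ range M, |f m|) * (∑ m ∈ range M, |g m|))) ?_ ?_
    · apply Continuous.aestronglyMeasurable
      have := hPc f i
      have := hPc g i
      fun_prop
    · refine Filter.Eventually.of_forall fun t => ?_
      rw [Real.norm_of_nonneg (by positivity)]
      gcongr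
      · exact hPb f i hi t
      · exact hPb g i hi t
  refine (sum_le_sum hbd).trans ?_
  rw [← MeasureTheory.integral_finsetSum _ hint2]
  have hfin : ∫ t, ∑ i ∈ s, ‖g₀ t‖ * (‖P f i t‖ * ‖P g i t‖) ≤ ∫ t, ‖g₀ t‖ * (3 * L * Ef * Eg) := by
    refine MeasureTheory.integral_mono (MeasureTheory.integrable_finsetSum _ hint2)
      (hI0.mul_const _) fun t => ?_
    simp only
    rw [← mul_sum]
    exact mul_le_mul_of_nonneg_left (hprod t) (norm_nonneg _)
  refine hfin.trans ?_
  rw [MeasureTheory.integral_mul_const]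
  have : 0 ≤ L * Ef * Eg := by
    have hL0 : 0 ≤ L := by linarith
    positivity
  nlinarith

end PrimeGaps

namespace PrimeGaps

open Finset ArithmeticFunction

theorem abs_trunc_moebius_le (V n : ℕ) : |trunc V (moebius : ArithmeticFunction ℝ) n| ≤ 1 := by
  rw [trunc_apply]
  split_ifs
  · rw [intCoe_apply, ← Int.cast_abs]
    exact_mod_cast abs_moebius_le_one
  · simp

theorem abs_conv_trunc_le (V n : ℕ) :
    |(trunc V vonMangoldt * trunc V (moebius : ArithmeticFunction ℝ)) n| ≤ Real.log n := by
  rw [ArithmeticFunction.mul_apply]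
  calc _ ≤ ∑ x ∈ n.divisorsAntidiagonal, vonMangoldt x.1 := by
        refine (abs_sum_le_sum_abs _ _).trans (sum_le_sum fun x _ => ?_)
        rw [abs_mul]
        refine (mul_le_of_le_one_right (abs_nonneg _) (abs_trunc_moebius_le V _)).trans ?_
        rw [trunc_apply]
        split_ifs
        · rw [abs_of_nonneg vonMangoldt_nonneg]
        · simp
    _ = ∑ d ∈ n.divisors, vonMangoldt d := by
        rw [← Nat.map_div_right_divisors, sum_map]
        rfl
    _ = _ := vonMangoldt_sum

theorem conv_trunc_eq_zero {V n : ℕ} (hn : V ^ 2 < n) :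
    (trunc V vonMangoldt * trunc V (moebius : ArithmeticFunction ℝ)) n = 0 := by
  rw [ArithmeticFunction.mul_apply]
  refine sum_eq_zero fun x hx => ?_
  have h := (Nat.mem_divisorsAntidiagonal.mp hx).1
  rw [trunc_apply, trunc_apply]
  by_cases h1 : x.1 ≤ V
  · by_cases h2 : x.2 ≤ V
    · exfalso; have := Nat.mul_le_mul h1 h2; nlinarith
    · rw [if_neg h2, mul_zero]
  · rw [if_neg h1, zero_mul]

theorem arith_sub_apply (f g : ArithmeticFunction ℝ) (n : ℕ) : (f - g) n = f n - g n := by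
  have := ArithmeticFunction.add_apply (f := f - g) (g := g) (n := n)
  rw [sub_add_cancel] at this
  linarith

theorem zeta_mul_sub_trunc_apply (V n : ℕ) :
    ((zeta : ArithmeticFunction ℝ) * ((moebius : ArithmeticFunction ℝ) - trunc V moebius)) n =
      ∑ d ∈ n.divisors, if d ≤ V then 0 else (moebius d : ℝ) := by
  rw [coe_zeta_mul_apply]
  refine sum_congr rfl fun d _ => ?_
  rw [arith_sub_apply, trunc_apply, intCoe_apply]
  split_ifs <;> simp

theorem IsBlock.sum_norm_vonMangoldt_le {ψ : ℝ → ℝ} (h : IsBlock ψ) :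
    ∃ C : ℝ, 0 < C ∧ ∀ (ι : Type) (s : Finset ι) (χ : ι → ℕ → ℂ) (Q : ℕ), IsFamily s χ Q →
      ∀ N : ℝ, 0 < N → 7 ≤ Real.log N → (Q : ℝ) ^ 12 ≤ N →
      ∑ i ∈ s, ‖∑ n ∈ range (cutoff N), (vonMangoldt n : ℂ) * (χ i n * wt ψ N n)‖ ≤
        C * Real.log N ^ 5 := by
  obtain ⟨C₁, hC₁, h₁⟩ := h.norm_sum_log_mul_wt_le
  obtain ⟨C₂, hC₂, h₂⟩ := h.norm_sum_mul_wt_le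
  obtain ⟨C₃, hC₃, h₃⟩ := h.typeII_le
  refine ⟨16 * C₃ + C₁ + C₂, by positivity, ?_⟩
  intro ι s χ Q hF N hN0 hN hQ
  set L := Real.log N with hL
  set M := cutoff N with hM
  set V := Q ^ 4 with hV
  have hN1 : 1 ≤ N := ((Real.log_pos_iff hN0.le).mp (by linarith)).le
  have hVN : ∀ n : ℕ, n ≤ V ^ 2 → (n : ℝ) ≤ N := by
    intro n hn
    have hn' : (n : ℝ) ≤ (Q:ℝ) ^ 8 := by
      have : n ≤ Q ^ 8 := by rw [hV, ← _root_.pow_mul] at hn; exact hn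
      exact_mod_cast this
    rcases Nat.eq_zero_or_pos Q with rfl | hQ0
    · simp at hn'; subst hn'; simpa using hN0.le
    · have hQ1 : (1:ℝ) ≤ Q := by exact_mod_cast hQ0
      exact hn'.trans ((pow_le_pow_right₀ hQ1 (by norm_num)).trans hQ)
  have hVlt : ∀ n : ℕ, n ≤ V → wt ψ N n = 0 := by
    intro n hn
    refine h.wt_eq_zero_of_lt (by linarith) (by positivity) ?_
    have h3 : (n : ℝ) ^ 3 ≤ N := by
      have : (n:ℝ) ≤ (Q:ℝ) ^ 4 := by exact_mod_cast hn
      calc (n:ℝ) ^ 3 ≤ ((Q:ℝ) ^ 4) ^ 3 := by gcongr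
        _ = (Q:ℝ) ^ 12 := by ring
        _ ≤ N := hQ
    rcases Nat.eq_zero_or_pos n with rfl | hn0
    · simp; positivity
    have hn' : (0:ℝ) < n := by exact_mod_cast hn0
    rw [← Real.log_lt_log_iff hn' (by positivity), Real.log_mul hN0.ne' (Real.exp_ne_zero _),
      Real.log_exp]
    have := Real.log_le_log (by positivity) h3
    rw [Real.log_pow] at this
    push_cast at this
    linarith
  set f : ArithmeticFunction ℝ := vonMangoldt - trunc V vonMangoldt with hf
  set g : ArithmeticFunction ℝ :=
    (zeta : ArithmeticFunction ℝ) * ((moebius : ArithmeticFunction ℝ) - trunc V moebius) with hg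
  set b : ArithmeticFunction ℝ := trunc V vonMangoldt * trunc V moebius with hb
  have hfa : ∀ n, f n = if n ≤ V then 0 else vonMangoldt n := by
    intro n
    rw [hf, arith_sub_apply, trunc_apply]
    split_ifs <;> simp
  have hdec : ∀ n, vonMangoldt n = trunc V vonMangoldt n + (f * g) n +
      (trunc V moebius * log) n - (b * zeta) n := by
    intro n
    conv_lhs => rw [vonMangoldt_eq_vaughan V]
    rw [arith_sub_apply, ArithmeticFunction.add_apply, ArithmeticFunction.add_apply]
  -- split
  have hsplit : ∀ i ∈ s, ‖∑ n ∈ range M, (vonMangoldt n : ℂ) * (χ i n * wt ψ N n)‖ ≤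
      ‖∑ n ∈ range M, ((f * g) n : ℂ) * (χ i n * wt ψ N n)‖ +
      ‖∑ n ∈ range M, ((trunc V moebius * log) n : ℂ) * (χ i n * wt ψ N n)‖ +
      ‖∑ n ∈ range M, ((b * zeta) n : ℂ) * (χ i n * wt ψ N n)‖ := by
    intro i _
    refine le_trans (le_of_eq ?_) ((norm_sub_le _ _).trans (add_le_add_left (norm_add_le _ _) _))
    congr 1
    rw [← sum_add_distrib, ← sum_sub_distrib]
    refine sum_congr rfl fun n _ => ?_
    rcases le_or_gt n V with hn | hn
    · rw [hVlt n hn]; simp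
    · rw [hdec n, trunc_apply, if_neg (by omega)]; push_cast; ring
  have hL1 : 1 ≤ L := by linarith
  have hMp : 1 ≤ M := Nat.succ_pos _
  have hlogM : ∀ n ∈ range M, Real.log n ≤ 2 * L := by
    intro n hn
    rcases Nat.eq_zero_or_pos n with rfl | hn0
    · simp; linarith
    have h1 : Real.log n ≤ Real.log M :=
      Real.log_le_log (by exact_mod_cast hn0) (by exact_mod_cast (mem_range.mp hn).le)
    linarith [log_cutoff_le hN0 hN]
  have hinv := sum_inv_cutoff_le hN0 hN
  have hinv0 : 0 ≤ ∑ m ∈ range M, 1 / (m : ℝ) := sum_nonneg fun _ _ => by positivity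
  have hEf : ∑ n ∈ range M, |f n| ^ 2 / n ≤ ((2 * L) ^ 2) ^ 2 := by
    calc _ ≤ ∑ n ∈ range M, (2 * L) ^ 2 * (1 / (n:ℝ)) := by
          refine sum_le_sum fun n hn => ?_
          rw [mul_one_div]
          gcongr
          rw [hfa]
          split_ifs
          · simp; linarith
          · rw [abs_of_nonneg vonMangoldt_nonneg]
            exact vonMangoldt_le_log.trans (hlogM n hn)
      _ ≤ (2 * L) ^ 2 * (2 * L) := by rw [← mul_sum]; gcongr
      _ ≤ (2 * L) ^ 2 * (2 * L) ^ 2 := by gcongr; nlinarith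
      _ = _ := by ring
  have hEg : ∑ n ∈ range M, |g n| ^ 2 / n ≤ ((2 * L) ^ 2) ^ 2 := by
    calc _ ≤ ∑ n ∈ range M, (#n.divisors : ℝ) ^ 2 / n := by
          refine sum_le_sum fun n hn => ?_
          gcongr
          rw [hg, zeta_mul_sub_trunc_apply]
          refine (abs_sum_le_sum_abs _ _).trans ?_
          rw [card_eq_sum_ones]
          push_cast
          refine sum_le_sum fun d _ => ?_
          split_ifs
          · simp
          · rw [← Int.cast_abs]; exact_mod_cast abs_moebius_le_one
      _ ≤ (∑ n ∈ range M, 1 / (n : ℝ)) ^ 4 := sum_divisors_sq_div_le M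
      _ ≤ (2 * L) ^ 4 := by gcongr
      _ = _ := by ring
  have hII := h₃ ι s χ Q hF N hN0 hN V le_rfl f g (fun n hn => by rw [hfa, if_pos hn])
    (fun n hn => by
      rw [hg, zeta_mul_sub_trunc_apply]
      refine sum_eq_zero fun d hd => if_pos ((Nat.divisor_le hd).trans hn))
    _ _ (by positivity) (by positivity) hEf hEg
  have hMN : ∀ m : ℕ, 0 < m → N * Real.exp 4 < m * M := by
    intro m hm
    have h1 := lt_cutoff N
    have h2 : (1:ℝ) ≤ m := by exact_mod_cast hm
    have h3 : (0:ℝ) ≤ M := by positivity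
    nlinarith
  have hVV : V ≤ V ^ 2 := by nlinarith [Nat.zero_le V, Nat.le_self_pow (two_ne_zero) V]
  have hI1 : ∀ i ∈ s, ‖∑ n ∈ range M, ((trunc V moebius * log) n : ℂ) * (χ i n * wt ψ N n)‖ ≤
      V * (1 * (C₁ * Q / N * L)) := by
    intro i hi
    refine norm_typeI_le (hF.mul_apply i hi) (hF.le_one i hi)
      (w := fun n => (wt ψ N n : ℂ)) (fun n hn => by simp [h.wt_eq_zero_of_cutoff_le hN0 hn])
      (fun m _ => abs_trunc_moebius_le V m) (fun m hm => by rw [trunc_apply, if_neg (by omega)]) ?_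
      (by positivity)
    intro m hm hmV
    have := h₁ N hN0 (by linarith) (χ i) Q (hF.sum_le i hi) m M hm (hVN m (hmV.trans hVV)) (hMN m hm)
    simpa [log_apply] using this
  have hI2 : ∀ i ∈ s, ‖∑ n ∈ range M, ((b * zeta) n : ℂ) * (χ i n * wt ψ N n)‖ ≤
      (V ^ 2 : ℕ) * (L * (C₂ * Q / N)) := by
    intro i hi
    refine norm_typeI_le (hF.mul_apply i hi) (hF.le_one i hi)
      (w := fun n => (wt ψ N n : ℂ)) (fun n hn => by simp [h.wt_eq_zero_of_cutoff_le hN0 hn])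
      (fun m hm => (abs_conv_trunc_le V m).trans ?_) (fun m hm => conv_trunc_eq_zero hm) ?_
      (by positivity)
    · rcases Nat.eq_zero_or_pos m with rfl | hm0
      · simp; linarith
      · exact Real.log_le_log (by exact_mod_cast hm0) (hVN m hm)
    intro m hm hmV
    have := h₂ N hN0 (by linarith) (χ i) Q (hF.sum_le i hi) m M hm (hMN m hm)
    refine le_trans (le_of_eq ?_) this
    congr 1
    refine sum_congr rfl fun l _ => ?_
    rcases Nat.eq_zero_or_pos l with rfl | hl
    · have h0 : wt ψ N (m * (0:ℕ)) = 0 :=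
        h.wt_eq_zero_of_lt (by linarith) (by simp) (by simp; positivity)
      simp only [Nat.cast_mul]
      rw [h0]; simp
    · rw [natCoe_apply, zeta_apply_ne hl.ne']; simp
  have hcard : (#s : ℝ) ≤ (Q:ℝ) ^ 2 := by exact_mod_cast hF.card_le
  calc _ ≤ ∑ i ∈ s, (‖∑ n ∈ range M, ((f * g) n : ℂ) * (χ i n * wt ψ N n)‖ +
        V * (1 * (C₁ * Q / N * L)) + (V ^ 2 : ℕ) * (L * (C₂ * Q / N))) := by
        refine sum_le_sum fun i hi => (hsplit i hi).trans ?_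
        gcongr
        · exact hI1 i hi
        · exact hI2 i hi
    _ = ∑ i ∈ s, ‖∑ n ∈ range M, ((f * g) n : ℂ) * (χ i n * wt ψ N n)‖ +
        #s * (V * (1 * (C₁ * Q / N * L))) + #s * ((V ^ 2 : ℕ) * (L * (C₂ * Q / N))) := by
        rw [sum_add_distrib, sum_add_distrib, sum_const, sum_const, nsmul_eq_mul, nsmul_eq_mul]
    _ ≤ C₃ * L * (2 * L) ^ 2 * (2 * L) ^ 2 + Q ^ 2 * (V * (1 * (C₁ * Q / N * L))) +
        Q ^ 2 * ((V ^ 2 : ℕ) * (L * (C₂ * Q / N))) := by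
        gcongr
    _ = 16 * C₃ * L ^ 5 + C₁ * L * (Q ^ 7 / N) + C₂ * L * (Q ^ 11 / N) := by
        rw [hV]; push_cast; ring
    _ ≤ 16 * C₃ * L ^ 5 + C₁ * L * 1 + C₂ * L * 1 := by
        have hQk : ∀ k, k ≤ 12 → 0 < k → (Q:ℝ) ^ k / N ≤ 1 := by
          intro k hk hk0
          rw [div_le_one hN0]
          rcases Nat.eq_zero_or_pos Q with rfl | hQ0
          · simp [hk0.ne']; exact hN0.le
          · have hQ1 : (1:ℝ) ≤ Q := by exact_mod_cast hQ0
            exact (pow_le_pow_right₀ hQ1 hk).trans hQ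
        gcongr
        · exact hQk 7 (by norm_num) (by norm_num)
        · exact hQk 11 (by norm_num) (by norm_num)
    _ ≤ _ := by
        have : L ≤ L ^ 5 := le_self_pow₀ hL1 (by norm_num)
        have e1 : C₁ * L ≤ C₁ * L ^ 5 := by gcongr
        have e2 : C₂ * L ≤ C₂ * L ^ 5 := by gcongr
        linarith

end PrimeGaps

namespace PrimeGaps

open Finset

theorem one_add_log_pow_le (j : ℕ) {z : ℝ} (hz : 1 ≤ z) :
    (1 + Real.log z) ^ j ≤ (2 ^ j * j.factorial * Real.exp (1 / 2)) * √z := by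
  have hl := Real.log_nonneg hz
  have h := Real.pow_div_factorial_le_exp ((1 + Real.log z) / 2) (by positivity) j
  have h2 : Real.exp ((1 + Real.log z) / 2) = Real.exp (1 / 2) * √z := by
    rw [Real.sqrt_eq_rpow, Real.rpow_def_of_pos (by linarith), ← Real.exp_add]; congr 1; ring
  rw [h2, div_le_iff₀ (by positivity), div_pow, div_le_iff₀ (by positivity)] at h
  linarith

/-- The function `y ↦ (log y)^j y^{-s}`. -/
noncomputable def logPowCpow (s : ℂ) (j : ℕ) (y : ℝ) : ℂ :=
  (Real.log y : ℂ) ^ j * Complex.exp (-s * Real.log y)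

theorem norm_exp_neg_mul_log_le {s : ℂ} (hs : 1 < s.re) {y : ℝ} (hy : 1 ≤ y) :
    ‖Complex.exp (-s * Real.log y)‖ ≤ 1 / y := by
  rw [Complex.norm_exp, Complex.mul_re, Complex.ofReal_re, Complex.ofReal_im, mul_zero, sub_zero,
    Complex.neg_re, one_div, ← Real.exp_log (show 0 < y by linarith), ← Real.exp_neg, Real.log_exp]
  have := Real.log_nonneg hy
  exact Real.exp_le_exp.mpr (by nlinarith)

theorem hasDerivAt_logPowCpow (s : ℂ) (j : ℕ) {y : ℝ} (hy : 0 < y) :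
    HasDerivAt (logPowCpow s j)
      ((j * (Real.log y : ℂ) ^ (j - 1) - s * (Real.log y : ℂ) ^ j) *
        Complex.exp (-s * Real.log y) / y) y := by
  have h1 : HasDerivAt (fun y : ℝ => (Real.log y : ℂ)) ((y⁻¹ : ℝ) : ℂ) y :=
    (Real.hasDerivAt_log hy.ne').ofReal_comp
  have h2 := (h1.pow j).mul ((h1.const_mul (-s)).cexp)
  refine (h2.congr_deriv ?_)
  simp only [Pi.pow_apply]
  push_cast
  field_simp
  ring

theorem one_add_log_pow_le_mul_sqrt (j : ℕ) {Q y : ℝ} (hQ : 1 ≤ Q) (hy : Q ≤ y) :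
    (1 + Real.log y) ^ j ≤
      (2 ^ j * j.factorial * Real.exp (1 / 2)) * (1 + Real.log Q) ^ j * √(y / Q) := by
  have hz : 1 ≤ y / Q := by rw [le_div_iff₀ (by linarith)]; linarith
  have h1 := one_add_log_pow_le j hz
  have hlq := Real.log_nonneg hQ
  have hlz := Real.log_nonneg hz
  have : 1 + Real.log y ≤ (1 + Real.log Q) * (1 + Real.log (y / Q)) := by
    rw [Real.log_div (by linarith) (by linarith)] at hlz ⊢
    nlinarith
  calc (1 + Real.log y) ^ j ≤ ((1 + Real.log Q) * (1 + Real.log (y / Q))) ^ j := by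
        have : 0 ≤ Real.log y := Real.log_nonneg (hQ.trans hy)
        gcongr
    _ = (1 + Real.log Q) ^ j * (1 + Real.log (y / Q)) ^ j := mul_pow _ _ _
    _ ≤ (1 + Real.log Q) ^ j * ((2 ^ j * j.factorial * Real.exp (1 / 2)) * √(y / Q)) := by gcongr
    _ = _ := by ring

theorem sum_inv_mul_sqrt_le (Q M : ℕ) (hQ : 0 < Q) :
    ∑ i ∈ range M, 1 / (((Q + i : ℕ) : ℝ) * √((Q + i : ℕ) : ℝ)) ≤ 6 / √Q := by
  have key : ∀ M : ℕ, ∑ i ∈ range M, 1 / (((Q + i : ℕ) : ℝ) * √((Q + i : ℕ) : ℝ)) ≤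
      6 / √Q - 6 / √((Q + M : ℕ) : ℝ) := by
    intro M
    induction M with
    | zero => simp
    | succ M ih =>
      rw [sum_range_succ]
      have hx1 : (1:ℝ) ≤ ((Q + M : ℕ) : ℝ) := by exact_mod_cast (by omega : 1 ≤ Q + M)
      have e : ((Q + (M + 1) : ℕ) : ℝ) = ((Q + M : ℕ) : ℝ) + 1 := by push_cast; ring
      rw [e]
      generalize ((Q + M : ℕ) : ℝ) = x at *
      have ha : 0 < √x := Real.sqrt_pos.mpr (by linarith)
      have hb : 0 < √(x + 1) := Real.sqrt_pos.mpr (by linarith)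
      have ha2 : √x ^ 2 = x := Real.sq_sqrt (by linarith)
      have hb2 : √(x + 1) ^ 2 = x + 1 := Real.sq_sqrt (by linarith)
      have hba : √(x + 1) ≤ 1.5 * √x := by
        rw [Real.sqrt_le_left (by positivity)]; nlinarith
      have hd : (√(x + 1) - √x) * (√(x + 1) + √x) = 1 := by nlinarith
      have : 1 / (x * √x) ≤ 6 / √x - 6 / √(x + 1) := by
        rw [div_sub_div _ _ ha.ne' hb.ne', div_le_div_iff₀ (by positivity) (by positivity)]
        have h1 : √(x + 1) - √x ≥ 1 / (2.5 * √x) := by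
          rw [ge_iff_le, div_le_iff₀ (by positivity)]
          have : 0 ≤ √(x + 1) - √x := sub_nonneg.mpr (Real.sqrt_le_sqrt (by linarith))
          nlinarith
        have h2 : (√(x + 1) - √x) * √x ≥ 1 / 2.5 := by
          rw [ge_iff_le, div_le_iff₀ (by positivity)] at h1
          linarith
        nlinarith [mul_nonneg (sub_nonneg.mpr h2) (by linarith : (0:ℝ) ≤ x),
          mul_le_mul_of_nonneg_left hba ha.le]
      linarith
  refine (key M).trans ?_
  have : 0 ≤ 6 / √((Q + M : ℕ) : ℝ) := by positivity
  linarith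

theorem norm_logPowCpow_sub_le {s : ℂ} (hs : 1 < s.re) (j : ℕ) {Q x : ℝ} (hQ : 1 ≤ Q)
    (hx : Q ≤ x) :
    ‖logPowCpow s j (x + 1) - logPowCpow s j x‖ ≤
      (2 ^ j * j.factorial * Real.exp (1 / 2)) * (1 + Real.log Q) ^ j * (j + ‖s‖) / √Q *
        (1 / (x * √x)) := by
  have hx0 : 0 < x := by linarith
  have hmain := Convex.norm_image_sub_le_of_norm_hasDerivWithin_le (𝕜 := ℝ)
    (f := logPowCpow s j) (s := Set.Icc x (x + 1)) (x := x) (y := x + 1)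
    (C := (2 ^ j * j.factorial * Real.exp (1 / 2)) * (1 + Real.log Q) ^ j * (j + ‖s‖) / √Q *
        (1 / (x * √x)))
    (fun y hy => (hasDerivAt_logPowCpow s j (by linarith [hy.1])).hasDerivWithinAt) ?_
    (convex_Icc _ _) (by simp) (by simp)
  · simpa using hmain
  intro y hy
  have hyx : x ≤ y := hy.1
  have hy1 : 1 ≤ y := by linarith
  have hly := Real.log_nonneg hy1
  have hpow := one_add_log_pow_le_mul_sqrt j hQ (hx.trans hyx)
  rw [norm_div, norm_mul, Complex.norm_real, Real.norm_of_nonneg (by linarith : (0:ℝ) ≤ y)]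
  have h1 : ‖(j * (Real.log y : ℂ) ^ (j - 1) - s * (Real.log y : ℂ) ^ j)‖ ≤
      (j + ‖s‖) * (1 + Real.log y) ^ j := by
    refine (norm_sub_le _ _).trans ?_
    rw [norm_mul, norm_mul, norm_pow, norm_pow, Complex.norm_real, Real.norm_of_nonneg hly,
      Complex.norm_natCast, add_mul]
    gcongr
    · calc Real.log y ^ (j - 1) ≤ (1 + Real.log y) ^ (j - 1) := by gcongr; linarith
        _ ≤ (1 + Real.log y) ^ j := pow_le_pow_right₀ (by linarith) (by omega)
    · linarith
  have h2 := norm_exp_neg_mul_log_le hs hy1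
  have hlQ := Real.log_nonneg hQ
  calc _ ≤ (j + ‖s‖) * ((2 ^ j * j.factorial * Real.exp (1 / 2)) * (1 + Real.log Q) ^ j * √(y / Q))
        * (1 / y) / y := by
        gcongr
        exact h1.trans (by gcongr)
    _ = (2 ^ j * j.factorial * Real.exp (1 / 2)) * (1 + Real.log Q) ^ j * (j + ‖s‖) / √Q *
        (1 / (y * √y)) := by
        rw [Real.sqrt_div (by linarith)]
        have hs1 : 0 < √y := Real.sqrt_pos.mpr (by linarith)
        have hs2 : 0 < √Q := Real.sqrt_pos.mpr (by linarith)
        field_simp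
        rw [Real.sq_sqrt (by linarith)]
    _ ≤ _ := by gcongr

theorem norm_sum_logPowCpow_le (j : ℕ) : ∃ C : ℝ, 0 < C ∧ ∀ (a : ℕ → ℂ) (Q : ℕ), 1 ≤ Q →
    (a 0 = 0) → (∀ n, ‖a n‖ ≤ 1) → (∀ n, ‖∑ i ∈ range n, a i‖ ≤ Q) → ∀ s : ℂ, 1 < s.re → ∀ M : ℕ,
      ‖∑ n ∈ range M, a n * logPowCpow s j n‖ ≤ C * (1 + Real.log Q) ^ (j + 1) * ‖s‖ := by
  set c : ℝ := 2 ^ j * j.factorial * Real.exp (1 / 2) with hc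
  have hc0 : 0 < c := by positivity
  refine ⟨1 + 2 * (c + c * (j + 1) * 6), by positivity, fun a Q hQ ha0 ha1 hsum s hs M => ?_⟩
  have hQ' : (1:ℝ) ≤ Q := by exact_mod_cast hQ
  have hlQ := Real.log_nonneg hQ'
  have hs1 : 1 ≤ ‖s‖ := by
    have := Complex.abs_re_le_norm s; rw [abs_of_pos (by linarith)] at this; linarith
  have hhead : ∀ M ≤ Q, ‖∑ n ∈ range M, a n * logPowCpow s j n‖ ≤ (1 + Real.log Q) ^ (j + 1) := by
    intro M hM
    calc ‖∑ n ∈ range M, a n * logPowCpow s j n‖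
        ≤ ∑ n ∈ range M, (1 + Real.log Q) ^ j * (1 / (n : ℝ)) := by
          refine norm_sum_le_of_le _ fun n hn => ?_
          rcases Nat.eq_zero_or_pos n with rfl | hn0
          · simp [ha0]
          have hn1 : (1:ℝ) ≤ n := by exact_mod_cast hn0
          have hnQ : (n:ℝ) ≤ Q := by
            exact_mod_cast ((mem_range.mp hn).le.trans hM)
          have := norm_exp_neg_mul_log_le hs hn1
          rw [logPowCpow, norm_mul, norm_mul, norm_pow, Complex.norm_real,
            Real.norm_of_nonneg (Real.log_nonneg hn1)]
          have hln := Real.log_nonneg hn1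
          calc ‖a n‖ * (Real.log n ^ j * ‖Complex.exp (-s * Real.log n)‖)
              ≤ 1 * ((1 + Real.log Q) ^ j * (1 / (n:ℝ))) := by
                gcongr
                · exact ha1 n
                · linarith [Real.log_le_log (by linarith) hnQ]
            _ = _ := one_mul _
      _ ≤ ∑ n ∈ range Q, (1 + Real.log Q) ^ j * (1 / (n : ℝ)) :=
          sum_le_sum_of_subset_of_nonneg (range_subset_range.mpr hM) fun n _ _ => by positivity
      _ ≤ (1 + Real.log Q) ^ j * (1 + Real.log Q) := by
          rw [← mul_sum]; gcongr; exact sum_inv_le_log hQ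
      _ = _ := (pow_succ _ _).symm
  have hp : 0 ≤ (1 + Real.log Q) ^ (j + 1) := by positivity
  rcases le_total M Q with hM | hM
  · refine (hhead M hM).trans ?_
    have : 1 ≤ (1 + 2 * (c + c * (j + 1) * 6)) * ‖s‖ := by
      nlinarith [show 0 ≤ 2 * (c + c * (j + 1) * 6) by positivity]
    nlinarith
  obtain ⟨K, rfl⟩ := Nat.exists_eq_add_of_le hM
  rw [sum_range_add]
  have htail : ‖∑ i ∈ range K, a (Q + i) * logPowCpow s j ((Q + i : ℕ) : ℝ)‖ ≤
      2 * Q * (‖logPowCpow s j ((Q + K : ℕ) : ℝ)‖ +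
        ∑ i ∈ range K, ‖logPowCpow s j ((Q + (i + 1) : ℕ) : ℝ) -
          logPowCpow s j ((Q + i : ℕ) : ℝ)‖) := by
    refine norm_sum_mul_le_of_partial_sums (a := fun i => a (Q + i)) (B := 2 * Q) (fun n => ?_)
      (fun i => logPowCpow s j ((Q + i : ℕ) : ℝ)) K
    have e : ∑ i ∈ range n, a (Q + i) = ∑ i ∈ range (Q + n), a i - ∑ i ∈ range Q, a i := by
      rw [sum_range_add]; ring
    rw [e]
    refine (norm_sub_le _ _).trans ?_
    linarith [hsum (Q + n), hsum Q]
  have h1 : ‖logPowCpow s j ((Q + K : ℕ) : ℝ)‖ ≤ c * (1 + Real.log Q) ^ j / Q := by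
    have hy : (Q:ℝ) ≤ ((Q + K : ℕ) : ℝ) := by push_cast; linarith [(Nat.cast_nonneg K : (0:ℝ) ≤ K)]
    generalize ((Q + K : ℕ) : ℝ) = y at *
    have hy1 : 1 ≤ y := by linarith
    have hly := Real.log_nonneg hy1
    have hpow := one_add_log_pow_le_mul_sqrt j hQ' hy
    rw [logPowCpow, norm_mul, norm_pow, Complex.norm_real, Real.norm_of_nonneg hly]
    have hs1 : 0 < √y := Real.sqrt_pos.mpr (by linarith)
    have hs2 : 0 < √(Q:ℝ) := Real.sqrt_pos.mpr (by linarith)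
    calc _ ≤ (c * (1 + Real.log Q) ^ j * √(y / Q)) * (1 / y) := by
          gcongr
          · refine le_trans ?_ hpow
            gcongr
            linarith
          · exact norm_exp_neg_mul_log_le hs hy1
      _ = c * (1 + Real.log Q) ^ j / (√(Q:ℝ) * √y) := by
          rw [Real.sqrt_div (by linarith)]
          have := Real.sq_sqrt (show 0 ≤ y by linarith)
          field_simp
          rw [this]
      _ ≤ c * (1 + Real.log Q) ^ j / (√(Q:ℝ) * √(Q:ℝ)) := by gcongr
      _ = _ := by rw [Real.mul_self_sqrt (by linarith)]
  have h2 : ∑ i ∈ range K, ‖logPowCpow s j ((Q + (i + 1) : ℕ) : ℝ) -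
          logPowCpow s j ((Q + i : ℕ) : ℝ)‖ ≤ c * (1 + Real.log Q) ^ j * (j + ‖s‖) * 6 / Q := by
    calc _ ≤ ∑ i ∈ range K, c * (1 + Real.log Q) ^ j * (j + ‖s‖) / √(Q:ℝ) *
          (1 / (((Q + i : ℕ) : ℝ) * √((Q + i : ℕ) : ℝ))) := by
          refine sum_le_sum fun i _ => ?_
          have hx : (Q:ℝ) ≤ ((Q + i : ℕ) : ℝ) := by
            push_cast; linarith [(Nat.cast_nonneg i : (0:ℝ) ≤ i)]
          have := norm_logPowCpow_sub_le hs j hQ' hx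
          have e : ((Q + (i + 1) : ℕ) : ℝ) = ((Q + i : ℕ) : ℝ) + 1 := by push_cast; ring
          rwa [e]
      _ ≤ c * (1 + Real.log Q) ^ j * (j + ‖s‖) / √(Q:ℝ) * (6 / √(Q:ℝ)) := by
          rw [← mul_sum]; gcongr; exact sum_inv_mul_sqrt_le Q K hQ
      _ = _ := by
          rw [div_mul_div_comm, Real.mul_self_sqrt (by linarith)]
  have h3 : 2 * Q * (c * (1 + Real.log Q) ^ j / Q + c * (1 + Real.log Q) ^ j * (j + ‖s‖) * 6 / Q)
      = 2 * (1 + Real.log Q) ^ j * (c + c * (j + ‖s‖) * 6) := by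
    field_simp
  have h4 : (1 + Real.log Q) ^ j ≤ (1 + Real.log Q) ^ (j + 1) :=
    pow_le_pow_right₀ (by linarith) (by omega)
  calc _ ≤ (1 + Real.log Q) ^ (j + 1) + 2 * (1 + Real.log Q) ^ j * (c + c * (j + ‖s‖) * 6) := by
        refine (norm_add_le _ _).trans (add_le_add (hhead Q le_rfl) (htail.trans ?_))
        rw [← h3]; gcongr
    _ ≤ (1 + Real.log Q) ^ (j + 1) * ‖s‖
        + 2 * (1 + Real.log Q) ^ (j + 1) * (c * ‖s‖ + c * (j * ‖s‖ + ‖s‖) * 6) := by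
        gcongr
        · nlinarith
        · nlinarith
        · nlinarith [(Nat.cast_nonneg j : (0:ℝ) ≤ j)]
    _ = _ := by ring

end PrimeGaps

namespace PrimeGaps

open Finset

theorem sum_range_eq_sum_zmod (q : ℕ) [NeZero q] (f : ZMod q → ℂ) :
    ∑ i ∈ range q, f i = ∑ a : ZMod q, f a := by
  refine sum_nbij' (fun i => (i : ZMod q)) (fun a => a.val) (fun _ _ => mem_univ _)
    (fun a _ => mem_range.mpr a.val_lt) (fun i hi => ?_) (fun a _ => ?_) (fun _ _ => rfl)
  · exact ZMod.val_cast_of_lt (mem_range.mp hi)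
  · exact ZMod.natCast_zmod_val a

theorem norm_sum_dirichletCharacter_le {q : ℕ} [NeZero q] {ψ : DirichletCharacter ℂ q}
    (hψ : ψ ≠ 1) (n : ℕ) : ‖∑ i ∈ range n, ψ i‖ ≤ q := by
  have h := norm_sum_range_le_of_periodic (a := fun i : ℕ => ψ i) (q := q) (b := 1)
    (Nat.pos_of_ne_zero (NeZero.ne q)) (fun i => by simp) ?_ (fun i => ψ.norm_le_one i) n
  · simpa using h
  rw [sum_range_eq_sum_zmod q (fun a => ψ a)]
  exact MulChar.sum_eq_zero_of_ne_one hψ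

theorem logMul_iterate_apply (a : ℕ → ℂ) (j n : ℕ) :
    LSeries.logMul^[j] a n = (Real.log n : ℂ) ^ j * a n := by
  induction j with
  | zero => simp
  | succ j ih =>
    rw [Function.iterate_succ_apply', LSeries.logMul, ih, Complex.natCast_log]
    ring

theorem norm_LSeries_logMul_le (j : ℕ) : ∃ C : ℝ, 0 < C ∧ ∀ (a : ℕ → ℂ) (Q : ℕ), 1 ≤ Q →
    (a 0 = 0) → (∀ n, ‖a n‖ ≤ 1) → (∀ n, ‖∑ i ∈ range n, a i‖ ≤ Q) → ∀ s : ℂ, 1 < s.re →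
      ‖iteratedDeriv j (LSeries a) s‖ ≤ C * (1 + Real.log Q) ^ (j + 1) * ‖s‖ := by
  obtain ⟨C, hC, h⟩ := norm_sum_logPowCpow_le j
  refine ⟨C, hC, fun a Q hQ ha0 ha1 hsum s hs => ?_⟩
  have habs : LSeries.abscissaOfAbsConv a < s.re :=
    lt_of_le_of_lt (LSeries.abscissaOfAbsConv_le_of_le_const ⟨1, fun n _ => ha1 n⟩)
      (by exact_mod_cast hs)
  rw [LSeries_iteratedDeriv j habs, norm_mul, norm_pow, norm_neg, norm_one, one_pow, one_mul]
  have hsm : LSeriesSummable (LSeries.logMul^[j] a) s :=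
    LSeriesSummable_of_abscissaOfAbsConv_lt_re (by rwa [LSeries.absicssaOfAbsConv_logPowMul])
  have ht := (hsm.LSeriesHasSum.tendsto_sum_nat).norm
  refine le_of_tendsto ht (Eventually.of_forall fun M => ?_)
  have e : ∑ n ∈ range M, LSeries.term (LSeries.logMul^[j] a) s n =
      ∑ n ∈ range M, a n * logPowCpow s j n := by
    refine sum_congr rfl fun n _ => ?_
    rcases eq_or_ne n 0 with rfl | hn
    · simp [ha0]
    · rw [LSeries.term_of_ne_zero hn, logMul_iterate_apply, logPowCpow,
        Complex.cpow_def_of_ne_zero (by exact_mod_cast hn), ← Complex.natCast_log,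
        div_eq_mul_inv, ← Complex.exp_neg]
      ring_nf
  rw [e]
  exact h a Q hQ ha0 ha1 hsum s hs M

theorem norm_iteratedDeriv_LSeries_dirichletCharacter_le (j : ℕ) : ∃ C : ℝ, 0 < C ∧
    ∀ (q : ℕ) [NeZero q] (ψ : DirichletCharacter ℂ q), ψ ≠ 1 → ∀ s : ℂ, 1 < s.re →
      ‖iteratedDeriv j (LSeries fun n => ψ n) s‖ ≤ C * (1 + Real.log q) ^ (j + 1) * ‖s‖ := by
  obtain ⟨C, hC, h⟩ := norm_LSeries_logMul_le j
  refine ⟨C, hC, fun q _ ψ hψ s hs => h _ q (Nat.pos_of_ne_zero (NeZero.ne q)) ?_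
    (fun n => ψ.norm_le_one n) (norm_sum_dirichletCharacter_le hψ) s hs⟩
  have hq : q ≠ 1 := by
    rintro rfl
    exact hψ (DirichletCharacter.level_one ψ)
  have : Nontrivial (ZMod q) := by
    have h2 : 1 < q := by have := NeZero.ne q; omega
    have : Fact (1 < q) := ⟨h2⟩
    infer_instance
  simpa using ψ.map_nonunit not_isUnit_zero

theorem norm_iteratedDeriv_le_of_deriv_eq_mul (A : ℕ) : ∃ C : ℝ, 0 < C ∧
    ∀ (F G : ℂ → ℂ) (U : Set ℂ) (s : ℂ), IsOpen U → s ∈ U → AnalyticOnNhd ℂ F U →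
      AnalyticOnNhd ℂ G U → (∀ z ∈ U, deriv F z = -(G z * F z)) → ∀ δ K : ℝ, 0 < δ → δ ≤ 1 →
      1 ≤ K → δ ≤ ‖F s‖ → (∀ j ≤ A + 1, ‖iteratedDeriv j F s‖ ≤ K) →
      ∀ n ≤ A, ‖iteratedDeriv n G s‖ ≤ C * (K / δ) ^ (n + 1) := by
  induction A with
  | zero =>
    refine ⟨1, one_pos, fun F G U s hU hs hF hG hd δ K hδ hδ1 hK hFs hb n hn => ?_⟩
    obtain rfl : n = 0 := by omega
    have := hb 1 le_rfl
    rw [iteratedDeriv_one, hd s hs, norm_neg, norm_mul] at this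
    rw [iteratedDeriv_zero, zero_add, pow_one, one_mul, le_div_iff₀ hδ]
    exact (mul_le_mul_of_nonneg_left hFs (norm_nonneg _)).trans this
  | succ A ih =>
    obtain ⟨C, hC, h⟩ := ih
    refine ⟨C + (1 + ∑ k ∈ range (A + 1), ((A + 1).choose k) * C), by positivity,
      fun F G U s hU hs hF hG hd δ K hδ hδ1 hK hFs hb n hn => ?_⟩
    have hKδ : 1 ≤ K / δ := by rw [le_div_iff₀ hδ]; linarith
    have hI := h F G U s hU hs hF hG hd δ K hδ hδ1 hK hFs (fun j hj => hb j (by omega))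
    rcases Nat.lt_or_ge n (A + 1) with hn' | hn'
    · refine (hI n (by omega)).trans ?_
      gcongr
      have : 0 ≤ ∑ k ∈ range (A + 1), (((A + 1).choose k : ℕ) : ℝ) * C := by positivity
      linarith
    obtain rfl : n = A + 1 := by omega
    have hev : deriv F =ᶠ[nhds s] -(G * F) := by
      filter_upwards [hU.mem_nhds hs] with z hz
      rw [hd z hz]; rfl
    have hL := hb (A + 2) le_rfl
    rw [iteratedDeriv_succ', hev.iteratedDeriv_eq, iteratedDeriv_neg, norm_neg,
      iteratedDeriv_mul ((hG s hs).contDiffAt) ((hF s hs).contDiffAt), sum_range_succ,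
      Nat.choose_self, Nat.cast_one, one_mul, Nat.sub_self, iteratedDeriv_zero] at hL
    have h1 : ‖iteratedDeriv (A + 1) G s * F s‖ ≤
        K + ‖∑ k ∈ range (A + 1), ((A + 1).choose k : ℂ) * iteratedDeriv k G s *
          iteratedDeriv (A + 1 - k) F s‖ := by
      have := norm_add_le (∑ k ∈ range (A + 1), ((A + 1).choose k : ℂ) * iteratedDeriv k G s *
          iteratedDeriv (A + 1 - k) F s + iteratedDeriv (A + 1) G s * F s)
          (-(∑ k ∈ range (A + 1), ((A + 1).choose k : ℂ) * iteratedDeriv k G s *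
          iteratedDeriv (A + 1 - k) F s))
      rw [norm_neg, add_neg_cancel_comm] at this
      linarith
    have h2 : ‖∑ k ∈ range (A + 1), ((A + 1).choose k : ℂ) * iteratedDeriv k G s *
          iteratedDeriv (A + 1 - k) F s‖ ≤
        ∑ k ∈ range (A + 1), ((A + 1).choose k) * C * ((K / δ) ^ (A + 1) * K) := by
      refine norm_sum_le_of_le _ fun k hk => ?_
      have hk' := mem_range.mp hk
      rw [norm_mul, norm_mul, Complex.norm_natCast]
      calc _ ≤ ((A + 1).choose k : ℝ) * (C * (K / δ) ^ (k + 1)) * K := by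
            gcongr
            · exact hI k (by omega)
            · exact hb _ (by omega)
        _ ≤ ((A + 1).choose k : ℝ) * (C * (K / δ) ^ (A + 1)) * K := by
            have := pow_le_pow_right₀ hKδ (show k + 1 ≤ A + 1 by omega)
            gcongr
        _ = _ := by ring
    rw [← sum_mul] at h2
    set S := ∑ k ∈ range (A + 1), (((A + 1).choose k : ℕ) : ℝ) * C with hS
    have hS0 : 0 ≤ S := by positivity
    have h3 : ‖iteratedDeriv (A + 1) G s‖ * δ ≤ (1 + S) * ((K / δ) ^ (A + 1) * K) := by
      rw [norm_mul] at h1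
      have h4 : 1 ≤ (K / δ) ^ (A + 1) := one_le_pow₀ hKδ
      have h5 : K ≤ (K / δ) ^ (A + 1) * K := by nlinarith
      have h6 := mul_le_mul_of_nonneg_left hFs (norm_nonneg (iteratedDeriv (A + 1) G s))
      nlinarith
    rw [← le_div_iff₀ hδ] at h3
    refine h3.trans ?_
    rw [pow_succ (K / δ) (A + 1), mul_div_assoc, mul_div_assoc]
    exact mul_le_mul_of_nonneg_right (by linarith) (by positivity)

end PrimeGaps

namespace PrimeGaps

open Finset ArithmeticFunction

/-- The coefficients of `log ζ(σ)`. -/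
noncomputable def logZetaTerm (σ : ℝ) (n : ℕ) : ℝ :=
  vonMangoldt n / Real.log n * (n : ℝ) ^ (-σ)

theorem logZetaTerm_nonneg (σ : ℝ) (n : ℕ) : 0 ≤ logZetaTerm σ n :=
  mul_nonneg (div_nonneg vonMangoldt_nonneg (Real.log_natCast_nonneg n)) (by positivity)

theorem summable_logZetaTerm {σ : ℝ} (hσ : 1 < σ) : Summable (logZetaTerm σ) := by
  refine Summable.of_nonneg_of_le (logZetaTerm_nonneg σ) (fun n => ?_)
    (Real.summable_nat_rpow.mpr (show -σ < -1 by linarith))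
  refine mul_le_of_le_one_left (by positivity) (div_le_one_of_le₀ vonMangoldt_le_log
    (Real.log_natCast_nonneg n))

/-- The unimodular function `n ↦ n^{-it}`. -/
noncomputable def twist (t : ℝ) (n : ℕ) : ℂ := Complex.exp (-(t * Real.log n) * Complex.I)

theorem norm_twist (t : ℝ) (n : ℕ) : ‖twist t n‖ = 1 := by
  rw [twist, ← Complex.norm_exp_ofReal_mul_I (-(t * Real.log n))]; push_cast; rfl

theorem twist_sub (t u : ℝ) (n : ℕ) :
    twist (t - u) n = twist t n * (starRingEnd ℂ) (twist u n) := by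
  rw [twist, twist, twist, ← Complex.exp_conj, ← Complex.exp_add]
  congr 1
  simp only [map_mul, map_neg, Complex.conj_ofReal, Complex.conj_I]
  push_cast; ring

theorem norm_LSeries_eq_exp {q : ℕ} (χ : DirichletCharacter ℂ q) {σ : ℝ} (hσ : 1 < σ) (t : ℝ) :
    Summable (fun n : ℕ => logZetaTerm σ n * (χ n * twist t n).re) ∧
    ‖LSeries (fun n => χ n) (σ + t * Complex.I)‖ =
      Real.exp (∑' n : ℕ, logZetaTerm σ n * (χ n * twist t n).re) := by
  have hs : 1 < (σ + t * Complex.I : ℂ).re := by simpa using hσ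
  have hsum : LSeriesSummable (fun n : ℕ => χ n * vonMangoldt n / Real.log n)
      (σ + t * Complex.I) := by
    refine LSeriesSummable_of_bounded_of_one_lt_re (m := 1) (fun n _ => ?_) hs
    rw [norm_div, norm_mul, Complex.norm_real, Complex.norm_real,
      Real.norm_of_nonneg vonMangoldt_nonneg, Real.norm_of_nonneg (Real.log_natCast_nonneg n)]
    refine div_le_one_of_le₀ ?_ (Real.log_natCast_nonneg n)
    calc _ ≤ 1 * Real.log n :=
          mul_le_mul (χ.norm_le_one _) vonMangoldt_le_log vonMangoldt_nonneg zero_le_one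
      _ = _ := one_mul _
  have hterm : ∀ n : ℕ, (LSeries.term (fun n : ℕ => χ n * vonMangoldt n / Real.log n)
      (σ + t * Complex.I) n).re = logZetaTerm σ n * (χ n * twist t n).re := by
    intro n
    rcases eq_or_ne n 0 with rfl | hn
    · simp [logZetaTerm]
    have hn0 : (0:ℝ) < n := by exact_mod_cast Nat.pos_of_ne_zero hn
    have : LSeries.term (fun n : ℕ => χ n * vonMangoldt n / Real.log n)
        (σ + t * Complex.I) n = (logZetaTerm σ n : ℂ) * (χ n * twist t n) := by
      rw [LSeries.term_of_ne_zero hn, logZetaTerm, twist,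
        Complex.cpow_def_of_ne_zero (by exact_mod_cast hn), ← Complex.natCast_log,
        Real.rpow_def_of_pos hn0, div_eq_mul_inv _ (Complex.exp _), ← Complex.exp_neg]
      have : -((Real.log n : ℂ) * (σ + t * Complex.I)) =
        ((Real.log n * -σ : ℝ) : ℂ) + (-(t * Real.log n) * Complex.I) := by push_cast; ring
      rw [this, Complex.exp_add, ← Complex.ofReal_exp]
      push_cast; ring
    rw [this, Complex.re_ofReal_mul]
  constructor
  · have h := (Complex.hasSum_re hsum.LSeriesHasSum).summable
    simpa only [hterm] using h
  · rw [← DirichletCharacter.LSeries_eq_exp_LSeries χ hs, Complex.norm_exp, LSeries,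
      Complex.re_tsum hsum]
    simp only [hterm]

/-- The value of the Riemann zeta function at the real point `σ > 1`. -/
noncomputable def zetaReal (σ : ℝ) : ℝ := Real.exp (∑' n, logZetaTerm σ n)

theorem zetaReal_pos (σ : ℝ) : 0 < zetaReal σ := Real.exp_pos _

theorem one_le_zetaReal_mul_norm_LSeries {q : ℕ} (χ : DirichletCharacter ℂ q) {σ : ℝ}
    (hσ : 1 < σ) (t : ℝ) :
    1 ≤ zetaReal σ * ‖LSeries (fun n => χ n) (σ + t * Complex.I)‖ := by
  obtain ⟨h1, h2⟩ := norm_LSeries_eq_exp χ hσ t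
  rw [h2, zetaReal, ← Real.exp_add, Real.one_le_exp_iff, ← (summable_logZetaTerm hσ).tsum_add h1]
  refine tsum_nonneg fun n => ?_
  have h3 : -1 ≤ (χ n * twist t n).re := by
    have h4 := Complex.abs_re_le_norm (χ n * twist t n)
    rw [norm_mul, norm_twist, mul_one] at h4
    exact (abs_le.mp (h4.trans (χ.norm_le_one n))).1
  nlinarith [logZetaTerm_nonneg σ n]

theorem three_add_re_nonneg {z w : ℂ} (hz : ‖z‖ ≤ 1) (hw : ‖w‖ ≤ 1) :
    0 ≤ 3 + 2 * z.re + 2 * w.re + 2 * (z * (starRingEnd ℂ) w).re := by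
  have h1 : z.re * z.re + z.im * z.im ≤ 1 := by
    rw [← Complex.normSq_apply, Complex.normSq_eq_norm_sq]; nlinarith [norm_nonneg z]
  have h2 : w.re * w.re + w.im * w.im ≤ 1 := by
    rw [← Complex.normSq_apply, Complex.normSq_eq_norm_sq]; nlinarith [norm_nonneg w]
  simp only [Complex.mul_re, Complex.conj_re, Complex.conj_im]
  nlinarith [sq_nonneg (1 + z.re + w.re), sq_nonneg (z.im + w.im)]

theorem one_le_zetaReal_mul_norm_LSeries_pair {q₁ q₂ q : ℕ} (χ₁ : DirichletCharacter ℂ q₁)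
    (χ₂ : DirichletCharacter ℂ q₂) (χ : DirichletCharacter ℂ q)
    (h : ∀ n : ℕ, χ n = χ₁ n * (starRingEnd ℂ) (χ₂ n)) {σ : ℝ} (hσ : 1 < σ) (t u : ℝ) :
    1 ≤ zetaReal σ ^ 3 * ‖LSeries (fun n => χ₁ n) (σ + t * Complex.I)‖ ^ 2 *
      ‖LSeries (fun n => χ₂ n) (σ + u * Complex.I)‖ ^ 2 *
      ‖LSeries (fun n => χ n) (σ + (t - u : ℝ) * Complex.I)‖ ^ 2 := by
  obtain ⟨h1, e1⟩ := norm_LSeries_eq_exp χ₁ hσ t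
  obtain ⟨h2, e2⟩ := norm_LSeries_eq_exp χ₂ hσ u
  obtain ⟨h3, e3⟩ := norm_LSeries_eq_exp χ hσ (t - u)
  have h0 := summable_logZetaTerm hσ
  rw [e1, e2, e3, zetaReal, ← Real.exp_nat_mul, ← Real.exp_nat_mul, ← Real.exp_nat_mul,
    ← Real.exp_nat_mul, ← Real.exp_add, ← Real.exp_add, ← Real.exp_add, Real.one_le_exp_iff,
    ← tsum_mul_left, ← tsum_mul_left, ← tsum_mul_left, ← tsum_mul_left,
    ← (h0.mul_left _).tsum_add (h1.mul_left _),
    ← ((h0.mul_left _).add (h1.mul_left _)).tsum_add (h2.mul_left _),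
    ← (((h0.mul_left _).add (h1.mul_left _)).add (h2.mul_left _)).tsum_add (h3.mul_left _)]
  refine tsum_nonneg fun n => ?_
  have hz : ‖χ₁ n * twist t n‖ ≤ 1 := by
    rw [norm_mul, norm_twist, mul_one]; exact χ₁.norm_le_one n
  have hw : ‖χ₂ n * twist u n‖ ≤ 1 := by
    rw [norm_mul, norm_twist, mul_one]; exact χ₂.norm_le_one n
  have key := three_add_re_nonneg hz hw
  have e : χ n * twist (t - u) n =
      χ₁ n * twist t n * (starRingEnd ℂ) (χ₂ n * twist u n) := by
    rw [h, twist_sub, map_mul]; ring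
  rw [e]
  push_cast
  nlinarith [mul_nonneg (logZetaTerm_nonneg σ n) key]

theorem zetaReal_eq_tsum {σ : ℝ} (hσ : 1 < σ) : zetaReal σ = ∑' n : ℕ, 1 / (n : ℝ) ^ σ := by
  have hs : 1 < (σ : ℂ).re := by simpa using hσ
  have h1 := norm_LSeries_eq_exp (1 : DirichletCharacter ℂ 1) hσ 0
  have e : (fun n : ℕ => (1 : DirichletCharacter ℂ 1) (n : ZMod 1)) = 1 := by
    ext n; simp [MulChar.one_apply (isUnit_of_subsingleton _)]
  have h2 := h1.2
  rw [e] at h2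
  have h3 : ∀ n : ℕ, (1 : DirichletCharacter ℂ 1) (n : ZMod 1) = 1 := fun n => congrFun e n
  simp only [h3, twist, Complex.ofReal_zero, zero_mul, neg_zero, Complex.exp_zero, mul_one,
    Complex.one_re, add_zero] at h2
  rw [zetaReal, ← h2, LSeries_one_eq_riemannZeta hs, zeta_eq_tsum_one_div_nat_cpow hs]
  have : ∀ n : ℕ, (1 : ℂ) / (n : ℂ) ^ (σ : ℂ) = ((1 / (n : ℝ) ^ σ : ℝ) : ℂ) := by
    intro n
    push_cast [Complex.ofReal_cpow (Nat.cast_nonneg n)]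
    rfl
  simp only [this]
  rw [← Complex.ofReal_tsum, Complex.norm_real, Real.norm_of_nonneg]
  exact tsum_nonneg fun n => by positivity

theorem eventually_zetaReal_le : ∀ᶠ L : ℝ in atTop, zetaReal (1 + 1 / L) ≤ 2 * L := by
  have h := tendsto_sub_mul_tsum_nat_rpow
  have h2 : Tendsto (fun L : ℝ => 1 + 1 / L) atTop (nhdsWithin 1 (Set.Ioi 1)) := by
    refine tendsto_nhdsWithin_iff.mpr ⟨?_, ?_⟩
    · have := (tendsto_const_nhds (x := (1:ℝ))).add (tendsto_const_nhds.div_atTop tendsto_id :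
        Tendsto (fun L : ℝ => 1 / L) atTop (nhds 0))
      simpa using this
    · filter_upwards [eventually_gt_atTop 0] with L hL
      simpa using hL
  filter_upwards [(h.comp h2).eventually (eventually_le_nhds (show (1:ℝ) < 2 by norm_num)),
    eventually_gt_atTop 0] with L h3 hL
  have h4 : 1 < 1 + 1 / L := by have : 0 < 1 / L := by positivity
                                linarith
  rw [zetaReal_eq_tsum h4]
  simp only [Function.comp, add_sub_cancel_left] at h3
  rw [div_mul_eq_mul_div, one_mul, div_le_iff₀ hL] at h3
  exact h3

end PrimeGaps

namespace PrimeGaps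

open Finset

theorem sum_mul_wt_eq_integral {φ : ℝ → ℝ} (hφ : IsBlock φ) {g : ℝ → ℂ} (hgc : Continuous g)
    (hgi : MeasureTheory.Integrable fun t => ‖g t‖)
    (hg : ∀ u : ℝ, (φ u : ℂ) = ∫ t : ℝ, g t * Complex.exp (2 * Real.pi * t * u * Complex.I))
    {N : ℝ} (hN0 : 0 < N) {a : ℕ → ℂ} (ha0 : a 0 = 0)
    (ha : ∀ s : ℂ, 1 < s.re → LSeriesSummable a s) (hL : 0 < Real.log N) :
    ∑ n ∈ range (cutoff N), a n * (wt φ N n : ℂ) =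
      ∫ t : ℝ, g t * Complex.exp (-(2 * Real.pi * t * Real.log N * Complex.I)) *
        LSeries a ((1 + 1 / Real.log N : ℝ) + (-(2 * Real.pi * t) : ℝ) * Complex.I) := by
  set σ : ℝ := 1 + 1 / Real.log N with hσ
  have hσ1 : 1 < σ := by rw [hσ]; have : 0 < 1 / Real.log N := by positivity
                         linarith
  set sg : ℝ → ℂ := fun t => σ + (-(2 * Real.pi * t) : ℝ) * Complex.I with hsg
  have hre : ∀ t, (sg t).re = σ := fun t => by simp [hsg]
  let F : ℕ → ℝ → ℂ := fun n t =>
    g t * Complex.exp (-(2 * Real.pi * t * Real.log N * Complex.I)) * LSeries.term a (sg t) n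
  have hterm : ∀ n t, LSeries.term a (sg t) n =
      a n * Complex.exp (-(1 + 1 / Real.log N - 2 * Real.pi * t * Complex.I) * Real.log n) := by
    intro n t
    rcases eq_or_ne n 0 with rfl | hn
    · simp [ha0]
    · rw [LSeries.term_of_ne_zero hn, Complex.cpow_def_of_ne_zero (by exact_mod_cast hn),
        ← Complex.natCast_log, div_eq_mul_inv, ← Complex.exp_neg]
      congr 2
      simp only [hsg, hσ]; push_cast; ring
  have hnorm : ∀ n t, ‖F n t‖ = ‖LSeries.term a σ n‖ * ‖g t‖ := by
    intro n t
    have h1 : ‖Complex.exp (-(2 * Real.pi * t * Real.log N * Complex.I))‖ = 1 := by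
      rw [← Complex.norm_exp_ofReal_mul_I (-(2 * Real.pi * t * Real.log N))]
      congr 2; push_cast; ring
    simp only [F]
    rw [norm_mul, norm_mul, h1, mul_one, mul_comm, LSeries.norm_term_eq, LSeries.norm_term_eq, hre]
    simp
  have hcont : ∀ n, Continuous (F n) := by
    intro n
    simp only [F, hterm]
    fun_prop
  have hint : ∀ n, MeasureTheory.Integrable (F n) := by
    intro n
    refine MeasureTheory.Integrable.mono' (hgi.const_mul ‖LSeries.term a σ n‖)
      (hcont n).aestronglyMeasurable (Eventually.of_forall fun t => (hnorm n t).le)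
  have hsum : Summable fun n => ∫ t, ‖F n t‖ := by
    simp only [hnorm, MeasureTheory.integral_const_mul]
    exact ((ha σ (by simpa using hσ1)).norm).mul_right _
  have h := MeasureTheory.hasSum_integral_of_summable_integral_norm hint hsum
  have e1 : ∀ n, ∫ t, F n t = a n * (wt φ N n : ℂ) := by
    intro n
    rw [wt_eq_integral hg, ← MeasureTheory.integral_const_mul]
    congr 1; ext t
    simp only [F, hterm]; ring
  have e2 : ∀ t, ∑' n, F n t = g t * Complex.exp (-(2 * Real.pi * t * Real.log N * Complex.I)) *
      LSeries a (sg t) := fun t => by simp only [F]; rw [tsum_mul_left]; rfl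
  simp only [e1, e2] at h
  refine (hasSum_sum_of_ne_finset_zero fun n hn => ?_).unique h
  rw [hφ.wt_eq_zero_of_cutoff_le hN0 (by simpa using hn)]; simp

theorem IsBlock.norm_sum_mul_wt_le_of_LSeries {φ : ℝ → ℝ} (hφ : IsBlock φ) (E J : ℕ) :
    ∃ C : ℝ, 0 < C ∧ ∀ N : ℝ, 0 < N → 0 < Real.log N → ∀ a : ℕ → ℂ, a 0 = 0 →
      (∀ s : ℂ, 1 < s.re → LSeriesSummable a s) → ∀ M₁ M₂ T : ℝ, 0 ≤ M₁ → 0 ≤ M₂ → 0 < T →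
      (∀ t : ℝ, |t| ≤ T → ‖LSeries a ((1 + 1 / Real.log N : ℝ) + (t : ℝ) * Complex.I)‖ ≤ M₁) →
      (∀ t : ℝ, ‖LSeries a ((1 + 1 / Real.log N : ℝ) + (t : ℝ) * Complex.I)‖ ≤
        M₂ * (1 + |t|) ^ E) →
      ‖∑ n ∈ range (cutoff N), a n * (wt φ N n : ℂ)‖ ≤ C * (M₁ + M₂ / T ^ J) := by
  obtain ⟨g, hgc, hgi, hg⟩ := hφ.fourier
  have hgi0 : MeasureTheory.Integrable fun t => ‖g t‖ := by simpa using hgi 0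
  set I₀ := ∫ t, ‖g t‖ with hI₀
  set I₁ := ∫ t, (1 + |t|) ^ (E + J) * ‖g t‖ with hI₁
  have hI₀' : 0 ≤ I₀ := MeasureTheory.integral_nonneg fun t => norm_nonneg _
  have hI₁' : 0 ≤ I₁ := MeasureTheory.integral_nonneg fun t => by positivity
  refine ⟨1 + I₀ + 7 ^ (E + J) * I₁, by positivity, fun N hN0 hL a ha0 ha M₁ M₂ T hM₁ hM₂ hT h1 h2
    => ?_⟩
  rw [sum_mul_wt_eq_integral hφ hgc hgi0 hg hN0 ha0 ha hL]
  have hbound : ∀ t : ℝ, ‖g t * Complex.exp (-(2 * Real.pi * t * Real.log N * Complex.I)) *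
        LSeries a ((1 + 1 / Real.log N : ℝ) + (-(2 * Real.pi * t) : ℝ) * Complex.I)‖ ≤
      M₁ * ‖g t‖ + M₂ / T ^ J * 7 ^ (E + J) * ((1 + |t|) ^ (E + J) * ‖g t‖) := by
    intro t
    have h3 : ‖Complex.exp (-(2 * Real.pi * t * Real.log N * Complex.I))‖ = 1 := by
      rw [← Complex.norm_exp_ofReal_mul_I (-(2 * Real.pi * t * Real.log N))]
      congr 2; push_cast; ring
    rw [norm_mul, norm_mul, h3, mul_one]
    set u := -(2 * Real.pi * t) with hu
    have hub : 1 + |u| ≤ 7 * (1 + |t|) := by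
      rw [hu, abs_neg, abs_mul, abs_of_pos (by positivity : 0 < 2 * Real.pi)]
      nlinarith [Real.pi_lt_d2, abs_nonneg t, Real.pi_pos]
    suffices ‖LSeries a ((1 + 1 / Real.log N : ℝ) + (u : ℝ) * Complex.I)‖ ≤
        M₁ + M₂ / T ^ J * (7 ^ (E + J) * (1 + |t|) ^ (E + J)) by
      calc _ ≤ ‖g t‖ * (M₁ + M₂ / T ^ J * (7 ^ (E + J) * (1 + |t|) ^ (E + J))) := by gcongr
        _ = _ := by ring
    rcases le_or_gt |u| T with hT' | hT'
    · refine (h1 u hT').trans ?_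
      have : 0 ≤ M₂ / T ^ J * (7 ^ (E + J) * (1 + |t|) ^ (E + J)) := by positivity
      linarith
    · refine (h2 u).trans ?_
      have h4 : (1 + |u|) ^ (E + J) ≤ 7 ^ (E + J) * (1 + |t|) ^ (E + J) := by
        rw [← mul_pow]; gcongr
      have h5 : M₂ * (1 + |u|) ^ E ≤ M₂ / T ^ J * (1 + |u|) ^ (E + J) := by
        rw [pow_add, div_mul_eq_mul_div, le_div_iff₀ (by positivity)]
        have : T ^ J ≤ (1 + |u|) ^ J := by gcongr; linarith
        calc _ ≤ M₂ * (1 + |u|) ^ E * (1 + |u|) ^ J := by gcongr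
          _ = _ := by ring
      have h6 : M₂ / T ^ J * (1 + |u|) ^ (E + J) ≤
          M₂ / T ^ J * (7 ^ (E + J) * (1 + |t|) ^ (E + J)) := by gcongr
      linarith
  refine (MeasureTheory.norm_integral_le_of_norm_le ((hgi0.const_mul M₁).add
    ((hgi (E + J)).const_mul (M₂ / T ^ J * 7 ^ (E + J)))) (Eventually.of_forall hbound)).trans ?_
  simp only [Pi.add_apply]
  rw [MeasureTheory.integral_add (hgi0.const_mul M₁) ((hgi (E + J)).const_mul _),
    MeasureTheory.integral_const_mul, MeasureTheory.integral_const_mul]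
  have : 0 ≤ M₂ / T ^ J := by positivity
  have h7 : 0 ≤ 7 ^ (E + J) * I₁ := by positivity
  calc M₁ * I₀ + M₂ / T ^ J * 7 ^ (E + J) * I₁ = M₁ * I₀ + M₂ / T ^ J * (7 ^ (E + J) * I₁) := by ring
    _ ≤ M₁ * (1 + I₀ + 7 ^ (E + J) * I₁) + M₂ / T ^ J * (1 + I₀ + 7 ^ (E + J) * I₁) := by
        gcongr <;> linarith
    _ = _ := by ring

end PrimeGaps

namespace PrimeGaps

open Finset ArithmeticFunction

theorem exists_norm_iteratedDeriv_dirichletCharacter_le (A : ℕ) : ∃ C : ℝ, 0 < C ∧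
    ∀ (q : ℕ) [NeZero q] (ψ : DirichletCharacter ℂ q), ψ ≠ 1 → ∀ σ t : ℝ, 1 < σ → σ ≤ 2 →
      ∀ j ≤ A, ‖iteratedDeriv j (LSeries fun n => ψ n) (σ + t * Complex.I)‖ ≤
        C * (1 + Real.log q) ^ (A + 1) * (1 + |t|) := by
  choose C hC h using norm_iteratedDeriv_LSeries_dirichletCharacter_le
  refine ⟨∑ j ∈ range (A + 1), 2 * C j, sum_pos (fun j _ => by linarith [hC j]) (by simp), ?_⟩
  intro q _ ψ hψ σ t hσ1 hσ2 j hj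
  have hlq : 0 ≤ Real.log q := Real.log_natCast_nonneg q
  have h1 := h j q ψ hψ (σ + t * Complex.I) (by simpa using hσ1)
  have h2 : ‖(σ + t * Complex.I : ℂ)‖ ≤ 2 * (1 + |t|) := by
    refine (norm_add_le _ _).trans ?_
    rw [norm_mul, Complex.norm_I, mul_one, Complex.norm_real, Complex.norm_real,
      Real.norm_of_nonneg (by linarith), Real.norm_eq_abs]
    nlinarith [abs_nonneg t]
  have h3 : 2 * C j ≤ ∑ j ∈ range (A + 1), 2 * C j :=
    single_le_sum (f := fun j => 2 * C j) (fun i _ => by linarith [hC i])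
      (mem_range.mpr (by omega))
  calc _ ≤ C j * (1 + Real.log q) ^ (j + 1) * (2 * (1 + |t|)) := by
        refine h1.trans ?_
        have := hC j
        gcongr
    _ ≤ C j * (1 + Real.log q) ^ (A + 1) * (2 * (1 + |t|)) := by
        have := hC j
        gcongr
        linarith
    _ = 2 * C j * (1 + Real.log q) ^ (A + 1) * (1 + |t|) := by ring
    _ ≤ _ := by gcongr

theorem IsBlock.norm_sum_vonMangoldt_log_pow_le {φ : ℝ → ℝ} (hφ : IsBlock φ) (A : ℕ) :
    ∃ C c : ℝ, 0 < C ∧ 0 < c ∧ ∀ N ℓ : ℝ, 0 < N → 1 ≤ ℓ → Real.log N = ℓ ^ 40 →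
      zetaReal (1 + 1 / Real.log N) ≤ 2 * Real.log N → ∀ (q : ℕ) [NeZero q]
      (ψ : DirichletCharacter ℂ q), ψ ≠ 1 → c * (1 + Real.log q) ^ (A + 2) ≤ ℓ →
      (∀ t : ℝ, |t| ≤ ℓ → 1 / ℓ ^ 32 ≤
        ‖LSeries (fun n => ψ n) ((1 + 1 / Real.log N : ℝ) + t * Complex.I)‖) →
      ‖∑ n ∈ range (cutoff N), (Real.log n : ℂ) ^ A * (ψ n * vonMangoldt n) * (wt φ N n : ℂ)‖ ≤
        C * ℓ ^ (34 * (A + 1)) := by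
  obtain ⟨C₁, hC₁, h₁⟩ := hφ.norm_sum_mul_wt_le_of_LSeries (A + 1) (41 * (A + 1))
  obtain ⟨C₂, hC₂, h₂⟩ := norm_iteratedDeriv_le_of_deriv_eq_mul A
  obtain ⟨C₃, hC₃, h₃⟩ := exists_norm_iteratedDeriv_dirichletCharacter_le (A + 1)
  refine ⟨C₁ * (2 * (C₂ * 2 ^ (A + 1))), C₃, by positivity, hC₃, ?_⟩
  intro N ℓ hN0 hℓ hLℓ hζ q _ ψ hψ hq hlow
  have hLpos : 0 < Real.log N := by rw [hLℓ]; positivity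
  have hL1 : 1 ≤ Real.log N := by rw [hLℓ]; exact one_le_pow₀ hℓ
  set σ : ℝ := 1 + 1 / Real.log N with hσ
  have hσ1 : 1 < σ := by rw [hσ]; have : 0 < 1 / Real.log N := by positivity
                         linarith
  have hσ2 : σ ≤ 2 := by
    rw [hσ]; have : 1 / Real.log N ≤ 1 := by rw [div_le_one hLpos]; exact hL1
    linarith
  set b : ℕ → ℂ := (fun n : ℕ => ψ n) * fun n : ℕ => (vonMangoldt n : ℂ) with hb
  set F : ℂ → ℂ := LSeries fun n => ψ n with hF
  set U : Set ℂ := {s : ℂ | 1 < s.re} with hU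
  have hUo : IsOpen U := isOpen_lt continuous_const Complex.continuous_re
  have habsb : LSeries.abscissaOfAbsConv b ≤ 1 :=
    LSeries.abscissaOfAbsConv_le_of_forall_lt_LSeriesSummable fun y hy =>
      DirichletCharacter.LSeriesSummable_twist_vonMangoldt ψ (by simpa using hy)
  have habsψ : LSeries.abscissaOfAbsConv (fun n : ℕ => ψ n) ≤ 1 :=
    LSeries.abscissaOfAbsConv_le_of_le_const ⟨1, fun n _ => ψ.norm_le_one n⟩
  have hlt : ∀ {f : ℕ → ℂ}, LSeries.abscissaOfAbsConv f ≤ 1 → ∀ s ∈ U,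
      LSeries.abscissaOfAbsConv f < s.re := fun hf s hs =>
    lt_of_le_of_lt hf (by exact_mod_cast hs)
  have hFan : AnalyticOnNhd ℂ F U := (LSeries_analyticOnNhd _).mono (hlt habsψ)
  have hGan : AnalyticOnNhd ℂ (LSeries b) U := (LSeries_analyticOnNhd _).mono (hlt habsb)
  have hd : ∀ z ∈ U, deriv F z = -(LSeries b z * F z) := by
    intro z hz
    rw [hb, DirichletCharacter.LSeries_twist_vonMangoldt_eq ψ hz,
      div_mul_cancel₀ _ (DirichletCharacter.LSeries_ne_zero_of_one_lt_re ψ hz), neg_neg]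
  have hmem : ∀ t : ℝ, (σ + t * Complex.I : ℂ) ∈ U := fun t => by simp [hU, hσ1]
  set a : ℕ → ℂ := LSeries.logMul^[A] b with ha
  have hbound : ∀ t δ : ℝ, 0 < δ → δ ≤ 1 → δ ≤ ‖F (σ + t * Complex.I)‖ →
      ‖LSeries a (σ + t * Complex.I)‖ ≤ C₂ * (ℓ * (1 + |t|) / δ) ^ (A + 1) := by
    intro t δ hδ hδ1 hδF
    have h4 := h₂ F (LSeries b) U _ hUo (hmem t) hFan hGan hd δ (ℓ * (1 + |t|)) hδ hδ1
      (by nlinarith [abs_nonneg t]) hδF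
      (fun j hj => (h₃ q ψ hψ σ t hσ1 hσ2 j hj).trans (by gcongr)) A le_rfl
    rwa [LSeries_iteratedDeriv A (hlt habsb _ (hmem t)), norm_mul, norm_pow, norm_neg, norm_one,
      one_pow, one_mul] at h4
  have hsa : ∀ s : ℂ, 1 < s.re → LSeriesSummable a s := fun s hs =>
    LSeriesSummable_of_abscissaOfAbsConv_lt_re
      (by rw [ha, LSeries.absicssaOfAbsConv_logPowMul]; exact hlt habsb s hs)
  have ha0 : a 0 = 0 := by rw [ha, logMul_iterate_apply]; simp [hb]
  have hmain := h₁ N hN0 hLpos a ha0 hsa (C₂ * (2 * ℓ ^ 34) ^ (A + 1))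
    (C₂ * (2 * ℓ ^ 41) ^ (A + 1)) ℓ (by positivity) (by positivity) (by positivity) ?_ ?_
  · have e : ∀ n : ℕ, (Real.log n : ℂ) ^ A * (ψ n * vonMangoldt n) = a n := fun n => by
      rw [ha, logMul_iterate_apply]; rfl
    simp only [e]
    refine hmain.trans ?_
    have e2 : C₂ * (2 * ℓ ^ 41) ^ (A + 1) / ℓ ^ (41 * (A + 1)) = C₂ * 2 ^ (A + 1) := by
      rw [mul_pow, ← _root_.pow_mul]; field_simp
    have e3 : (2 * ℓ ^ 34) ^ (A + 1) = 2 ^ (A + 1) * ℓ ^ (34 * (A + 1)) := by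
      rw [mul_pow, ← _root_.pow_mul]
    rw [e2, e3]
    have h5 : 1 ≤ ℓ ^ (34 * (A + 1)) := one_le_pow₀ hℓ
    have h6 : C₂ * 2 ^ (A + 1) ≤ C₂ * (2 ^ (A + 1) * ℓ ^ (34 * (A + 1))) := by
      have : 0 ≤ C₂ * 2 ^ (A + 1) := by positivity
      nlinarith
    calc _ ≤ C₁ * (C₂ * (2 ^ (A + 1) * ℓ ^ (34 * (A + 1)))
          + C₂ * (2 ^ (A + 1) * ℓ ^ (34 * (A + 1)))) := by gcongr
      _ = _ := by ring
  · intro t ht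
    refine (hbound t (1 / ℓ ^ 32) (by positivity)
      (div_le_one_of_le₀ (one_le_pow₀ hℓ) (by positivity)) (hlow t ht)).trans ?_
    gcongr
    rw [div_le_iff₀ (by positivity)]
    calc ℓ * (1 + |t|) ≤ ℓ * (ℓ + ℓ) := by gcongr
      _ = 2 * ℓ ^ 34 * (1 / ℓ ^ 32) := by field_simp; ring
  · intro t
    have h7 := one_le_zetaReal_mul_norm_LSeries ψ hσ1 t
    have h8 : 1 / (2 * ℓ ^ 40) ≤ ‖F (σ + t * Complex.I)‖ := by
      rw [div_le_iff₀ (by positivity)]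
      rw [hLℓ] at hζ
      nlinarith [norm_nonneg (F (σ + t * Complex.I)), hF]
    refine (hbound t _ (by positivity) (div_le_one_of_le₀ ?_ (by positivity)) h8).trans ?_
    · have := one_le_pow₀ hℓ (n := 40); linarith
    · rw [mul_assoc C₂, ← mul_pow]
      apply le_of_eq; congr 2; field_simp

end PrimeGaps

namespace PrimeGaps

open Finset ArithmeticFunction

theorem eventually_mul_one_add_log_pow_le (c b : ℝ) (hc : 0 ≤ c) (hb : 0 ≤ b) (m : ℕ) :
    ∀ᶠ ℓ : ℝ in atTop, c * (1 + b * Real.log ℓ) ^ m ≤ ℓ := by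
  have h := (Real.isLittleO_pow_log_id_atTop (n := m)).bound
    (show 0 < 1 / (1 + c * (1 + b) ^ m) by positivity)
  filter_upwards [h, eventually_ge_atTop (Real.exp 1)] with ℓ h1 h2
  have hl1 : 1 ≤ Real.log ℓ := by rwa [Real.le_log_iff_exp_le ((Real.exp_pos 1).trans_le h2)]
  have hl0 : 0 < ℓ := (Real.exp_pos 1).trans_le h2
  rw [Real.norm_of_nonneg (by positivity), id, Real.norm_of_nonneg hl0.le,
    div_mul_eq_mul_div, le_div_iff₀ (by positivity), one_mul] at h1
  calc c * (1 + b * Real.log ℓ) ^ m ≤ c * ((1 + b) * Real.log ℓ) ^ m := by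
        gcongr; nlinarith
    _ = Real.log ℓ ^ m * (c * (1 + b) ^ m) := by rw [mul_pow]; ring
    _ ≤ Real.log ℓ ^ m * (1 + c * (1 + b) ^ m) := by gcongr; linarith
    _ ≤ ℓ := h1

theorem changeLevel_mul_inv_changeLevel_apply {q₁ q₂ q : ℕ} [NeZero q] (h₁ : q₁ ∣ q)
    (h₂ : q₂ ∣ q)
    (h : ∀ n : ℕ, n.Coprime q₁ → n.Coprime q₂ → n.Coprime q)
    (χ₁ : DirichletCharacter ℂ q₁) (χ₂ : DirichletCharacter ℂ q₂) (n : ℕ) :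
    (DirichletCharacter.changeLevel h₁ χ₁ * (DirichletCharacter.changeLevel h₂ χ₂)⁻¹) n =
      χ₁ n * (starRingEnd ℂ) (χ₂ n) := by
  have : NeZero q₂ := ⟨fun h0 => NeZero.ne q (by rw [h0] at h₂; exact zero_dvd_iff.mp h₂)⟩
  rw [MulChar.mul_apply, ← MulChar.star_apply', starRingEnd_apply]
  by_cases hn : n.Coprime q
  · have hu : ((ZMod.unitOfCoprime n hn : (ZMod q)ˣ) : ZMod q) = (n : ZMod q) := rfl
    rw [← hu, DirichletCharacter.changeLevel_eq_cast_of_dvd _ h₁,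
      DirichletCharacter.changeLevel_eq_cast_of_dvd _ h₂, hu, ZMod.cast_natCast h₁,
      ZMod.cast_natCast h₂]
  · rw [MulChar.map_nonunit _ (by rwa [ZMod.isUnit_iff_coprime]), zero_mul]
    by_cases hn1 : n.Coprime q₁
    · have hn2 : ¬ n.Coprime q₂ := fun hn2 => hn (h n hn1 hn2)
      rw [χ₂.map_nonunit (by rwa [ZMod.isUnit_iff_coprime]), star_zero, mul_zero]
    · rw [χ₁.map_nonunit (by rwa [ZMod.isUnit_iff_coprime]), zero_mul]

theorem exists_dirichletCharacter_pair {q₁ q₂ : ℕ} [NeZero q₁] [NeZero q₂]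
    (χ₁ : DirichletCharacter ℂ q₁) (χ₂ : DirichletCharacter ℂ q₂) :
    ∃ χ : DirichletCharacter ℂ (q₁ * q₂),
      (∀ n : ℕ, χ n = χ₁ n * (starRingEnd ℂ) (χ₂ n)) ∧
      (χ = 1 → χ₁.conductor = χ₂.conductor) := by
  have : NeZero (q₁ * q₂) := ⟨mul_ne_zero (NeZero.ne _) (NeZero.ne _)⟩
  refine ⟨DirichletCharacter.changeLevel (dvd_mul_right q₁ q₂) χ₁ *
    (DirichletCharacter.changeLevel (dvd_mul_left q₂ q₁) χ₂)⁻¹,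
    changeLevel_mul_inv_changeLevel_apply _ _ (fun n h1 h2 => h1.mul_right h2) χ₁ χ₂, fun h => ?_⟩
  rw [mul_inv_eq_one] at h
  rw [← DirichletCharacter.conductor_changeLevel χ₁ (dvd_mul_right q₁ q₂), h,
    DirichletCharacter.conductor_changeLevel]

theorem IsBlock.siegel_walfisz {φ : ℝ → ℝ} (hφ : IsBlock φ) (B D : ℕ) :
    ∃ C : ℝ, 0 < C ∧ ∀ᶠ N : ℝ in atTop, ∃ d₁ : ℕ, 2 ≤ d₁ ∧ ∀ (d : ℕ) [NeZero d],
      (d : ℝ) ≤ Real.log N ^ B → d ≠ d₁ → ∀ ψ : DirichletCharacter ℂ d, ψ.IsPrimitive → ψ ≠ 1 →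
      ‖∑ n ∈ range (cutoff N), (vonMangoldt n : ℂ) * (ψ n *
        (((Real.log n / Real.log N) ^ (7 * D + 6) * wt φ N n : ℝ) : ℂ))‖ ≤
        C / Real.log N ^ D := by
  set A := 7 * D + 6 with hA
  obtain ⟨C, c, hC, hc, hmain⟩ := hφ.norm_sum_vonMangoldt_log_pow_le A
  obtain ⟨c₃, hc₃, h₃⟩ := exists_norm_iteratedDeriv_dirichletCharacter_le 0
  refine ⟨C, hC, ?_⟩
  have hroot : Tendsto (fun N : ℝ => Real.log N ^ (1 / 40 : ℝ)) atTop atTop :=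
    (tendsto_rpow_atTop (by norm_num)).comp Real.tendsto_log_atTop
  filter_upwards [hroot.eventually (eventually_mul_one_add_log_pow_le c (40 * B) hc.le
      (by positivity) (A + 2)),
    hroot.eventually (eventually_mul_one_add_log_pow_le (3 * c₃) (80 * B) (by positivity)
      (by positivity) 1), hroot.eventually (eventually_ge_atTop 2),
    Real.tendsto_log_atTop.eventually eventually_zetaReal_le,
    Real.tendsto_log_atTop.eventually (eventually_ge_atTop 1),
    eventually_gt_atTop 0] with N e1 e2 e3 e4 e5 hN0
  set L := Real.log N with hL
  set ℓ := L ^ (1 / 40 : ℝ) with hℓ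
  have hℓL : L = ℓ ^ 40 := by
    rw [hℓ, ← Real.rpow_natCast, ← Real.rpow_mul (by linarith)]; norm_num
  have hlogL : Real.log L = 40 * Real.log ℓ := by rw [hℓL, Real.log_pow]; norm_num
  have hℓ1 : 1 ≤ ℓ := by linarith
  have hlogd : ∀ d : ℕ, [NeZero d] → (d : ℝ) ≤ L ^ B → Real.log d ≤ 40 * B * Real.log ℓ := by
    intro d _ hd
    have hd0 : (0:ℝ) < d := by exact_mod_cast Nat.pos_of_ne_zero (NeZero.ne d)
    have := Real.log_le_log hd0 hd
    rw [Real.log_pow, hlogL] at this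
    linarith
  set σ : ℝ := 1 + 1 / L with hσ
  have hσ1 : 1 < σ := by rw [hσ]; have : 0 < 1 / L := by positivity
                         linarith
  have hσ2 : σ ≤ 2 := by
    rw [hσ]; have : 1 / L ≤ 1 := by rw [div_le_one (by linarith)]; exact e5
    linarith
  have hgood : ∀ (d : ℕ) [NeZero d], (d : ℝ) ≤ L ^ B → ∀ ψ : DirichletCharacter ℂ d, ψ ≠ 1 →
      (∀ t : ℝ, |t| ≤ ℓ → 1 / ℓ ^ 32 ≤ ‖LSeries (fun n => ψ n) (σ + t * Complex.I)‖) →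
      ‖∑ n ∈ range (cutoff N), (vonMangoldt n : ℂ) * (ψ n *
        (((Real.log n / L) ^ A * wt φ N n : ℝ) : ℂ))‖ ≤ C / L ^ D := by
    intro d _ hd ψ hψ hlow
    have hq : c * (1 + Real.log d) ^ (A + 2) ≤ ℓ := by
      refine le_trans ?_ e1
      have := hlogd d hd
      have : 0 ≤ Real.log d := Real.log_natCast_nonneg d
      gcongr
    have h := hmain N ℓ hN0 hℓ1 hℓL e4 d ψ hψ hq hlow
    have e : ∑ n ∈ range (cutoff N), (vonMangoldt n : ℂ) * (ψ n *
        (((Real.log n / L) ^ A * wt φ N n : ℝ) : ℂ)) = (1 / L ^ A : ℂ) *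
        ∑ n ∈ range (cutoff N), (Real.log n : ℂ) ^ A * (ψ n * vonMangoldt n) * (wt φ N n : ℂ) := by
      rw [mul_sum]
      refine sum_congr rfl fun n _ => ?_
      push_cast
      rw [div_pow]; ring
    rw [e, norm_mul, norm_div, norm_one, norm_pow, Complex.norm_real,
      Real.norm_of_nonneg (by linarith)]
    calc 1 / L ^ A * _ ≤ 1 / L ^ A * (C * ℓ ^ (34 * (A + 1))) := by gcongr
      _ = C * (ℓ ^ (34 * (A + 1)) / ℓ ^ (40 * A)) := by rw [hℓL, ← _root_.pow_mul]; ring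
      _ ≤ C * (1 / ℓ ^ (40 * D)) := by
          refine mul_le_mul_of_nonneg_left ?_ hC.le
          rw [div_le_div_iff₀ (by positivity) (by positivity), one_mul, ← pow_add]
          exact pow_le_pow_right₀ hℓ1 (by omega)
      _ = C / L ^ D := by rw [hℓL, ← _root_.pow_mul]; ring
  by_cases hall : ∀ (d : ℕ) [NeZero d], (d : ℝ) ≤ L ^ B → ∀ ψ : DirichletCharacter ℂ d,
      ψ.IsPrimitive → ψ ≠ 1 →
      (∀ t : ℝ, |t| ≤ ℓ → 1 / ℓ ^ 32 ≤ ‖LSeries (fun n => ψ n) (σ + t * Complex.I)‖)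
  · exact ⟨2, le_rfl, fun d _ hd _ ψ hp hψ => hgood d hd ψ hψ (hall d hd ψ hp hψ)⟩
  push Not at hall
  obtain ⟨d₁, _, hd₁, ψ₁, hp₁, hψ₁, t, ht, hlt⟩ := hall
  refine ⟨d₁, ?_, fun d _ hd hne ψ hp hψ => hgood d hd ψ hψ fun u hu => ?_⟩
  · have h0 := NeZero.ne d₁
    have h1 : d₁ ≠ 1 := by rintro rfl; exact hψ₁ (DirichletCharacter.level_one ψ₁)
    omega
  by_contra! hlu
  obtain ⟨χ, hχ, hχ1⟩ := exists_dirichletCharacter_pair ψ₁ ψ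
  have hχne : χ ≠ 1 := by
    intro h
    have := hχ1 h
    rw [(DirichletCharacter.isPrimitive_def ψ₁).mp hp₁,
      (DirichletCharacter.isPrimitive_def ψ).mp hp] at this
    exact hne this.symm
  have : NeZero (d₁ * d) := ⟨mul_ne_zero (NeZero.ne _) (NeZero.ne _)⟩
  have hpair := one_le_zetaReal_mul_norm_LSeries_pair ψ₁ ψ χ hχ hσ1 t u
  have h4 := h₃ (d₁ * d) χ hχne σ (t - u) hσ1 hσ2 0 le_rfl
  rw [iteratedDeriv_zero, zero_add, pow_one] at h4
  have h5 : ‖LSeries (fun n => χ n) (σ + (t - u : ℝ) * Complex.I)‖ ≤ ℓ ^ 2 := by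
    refine h4.trans ?_
    have h6 : Real.log ((d₁ * d : ℕ) : ℝ) ≤ 80 * B * Real.log ℓ := by
      push_cast
      rw [Real.log_mul (by exact_mod_cast NeZero.ne d₁) (by exact_mod_cast NeZero.ne d)]
      linarith [hlogd d hd, hlogd d₁ hd₁]
    have h7 : |t - u| ≤ 2 * ℓ := (abs_sub _ _).trans (by linarith)
    rw [pow_one] at e2
    have h8 : 0 ≤ Real.log ((d₁ * d : ℕ) : ℝ) := Real.log_natCast_nonneg _
    calc c₃ * (1 + Real.log ((d₁ * d : ℕ) : ℝ)) * (1 + |t - u|)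
        ≤ c₃ * (1 + 80 * B * Real.log ℓ) * (3 * ℓ) := by
          refine mul_le_mul (by gcongr) (by linarith) (by positivity) ?_
          have := h8.trans h6
          positivity
      _ = (3 * c₃ * (1 + 80 * B * Real.log ℓ)) * ℓ := by ring
      _ ≤ ℓ * ℓ := by gcongr
      _ = ℓ ^ 2 := by ring
  have h9 : (1:ℝ) ≤ (2 * ℓ ^ 40) ^ 3 * (1 / ℓ ^ 32) ^ 2 * (1 / ℓ ^ 32) ^ 2 * (ℓ ^ 2) ^ 2 := by
    refine hpair.trans ?_
    have hz := zetaReal_pos σ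
    rw [hℓL] at e4
    have e5 : zetaReal σ ≤ 2 * ℓ ^ 40 := e4
    gcongr
  have h10 : (2 * ℓ ^ 40) ^ 3 * (1 / ℓ ^ 32) ^ 2 * (1 / ℓ ^ 32) ^ 2 * (ℓ ^ 2) ^ 2 = 8 / ℓ ^ 4 := by
    field_simp; norm_num
  rw [h10, le_div_iff₀ (by positivity)] at h9
  have : (2:ℝ) ^ 4 ≤ ℓ ^ 4 := by gcongr
  linarith

end PrimeGaps

namespace PrimeGaps

open Finset

variable {ι : Type*} {k : ℕ}

theorem prod_option_ite [Fintype ι] (g : ι → ℝ) (r : ι → Option (Fin k)) :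
    ∏ x, (if r x = none then 1 else g x) = ∏ i, ∏ x with r x = some i, g x := by
  simp_rw [prod_filter]
  rw [Finset.prod_comm]
  refine prod_congr rfl fun x _ => ?_
  cases h : r x with
  | none => simp
  | some j => simp [eq_comm]

/-- The set of indices that a configuration sends to the coordinate `i`. -/
def fiber [Fintype ι] (r : ι → Option (Fin k)) (i : Fin k) : Finset ι := univ.filter fun x => r x = some i

theorem mem_fiber [Fintype ι] {r : ι → Option (Fin k)} {i : Fin k} {x : ι} :
    x ∈ fiber r i ↔ r x = some i := by simp [fiber]

theorem fiber_injective [Fintype ι] :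
    Function.Injective (fiber : (ι → Option (Fin k)) → Fin k → Finset ι) := by
  intro r r' h
  funext x
  refine Option.ext fun i => ?_
  have := congr_arg (x ∈ ·) (congr_fun h i)
  simpa [mem_fiber] using this

/-- The product of the primes used by a configuration. -/
def size [Fintype ι] (p : ι → ℝ) (r : ι → Option (Fin k)) : ℝ := ∏ x, if r x = none then 1 else p x

/-- The sieve coefficients. -/
noncomputable def coeff [Fintype ι] (p : ι → ℝ) (G : Finset ι → ℝ) (R : ℝ) (r : ι → Option (Fin k)) : ℝ :=
  (size p r)⁻¹ * (∏ i, G (fiber r i)) * if size p r ≤ R then 1 else 0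

/-- The Gram matrix of the local sieve functions with respect to all residues. -/
def gram (p : ℝ) : Option (Fin k) → Option (Fin k) → ℝ
  | none, none => 1
  | none, some _ => 0
  | some _, none => 0
  | some i, some j => if i = j then p - 1 else -1

theorem gram_comm (p : ℝ) (a b : Option (Fin k)) : gram p a b = gram p b a := by
  cases a <;> cases b <;> simp [gram, eq_comm]

theorem sum_abs_gram_le {p : ℝ} (hp : 1 ≤ p) (a : Option (Fin k)) :
    ∑ b, |gram p a b| ≤ if a = none then 1 else p + k := by
  cases a with
  | none => simp [gram, Fintype.sum_option]
  | some i =>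
    simp only [Fintype.sum_option, gram, abs_zero, zero_add, reduceCtorEq, if_false]
    calc ∑ j, |if i = j then p - 1 else -1| ≤ ∑ j : Fin k, ((if i = j then p else 0) + 1) := by
          refine sum_le_sum fun j _ => ?_
          split_ifs
          · rw [abs_of_nonneg (by linarith)]; linarith
          · norm_num
      _ = p + k := by simp [sum_add_distrib]

theorem sum_mul_prod_le [Fintype ι] [DecidableEq ι] (c : (ι → Option (Fin k)) → ℝ)
    (B : ι → Option (Fin k) → Option (Fin k) → ℝ) (hB : ∀ x a b, B x a b = B x b a) :
    ∑ r, ∑ r', c r * c r' * ∏ x, B x (r x) (r' x) ≤ ∑ r, c r ^ 2 * ∏ x, ∑ b, |B x (r x) b| := by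
  have h1 : ∀ r r', c r * c r' * ∏ x, B x (r x) (r' x) ≤
      c r ^ 2 / 2 * (∏ x, |B x (r x) (r' x)|) + c r' ^ 2 / 2 * (∏ x, |B x (r' x) (r x)|) := by
    intro r r'
    have e : ∏ x, |B x (r' x) (r x)| = ∏ x, |B x (r x) (r' x)| :=
      prod_congr rfl fun x _ => by rw [hB]
    rw [e, ← abs_prod]
    set P := ∏ x, B x (r x) (r' x)
    have : c r * c r' * P ≤ |c r| * |c r'| * |P| := by
      rw [← abs_mul, ← abs_mul]; exact le_abs_self _
    nlinarith [sq_nonneg (|c r| - |c r'|), abs_nonneg P, sq_abs (c r), sq_abs (c r'),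
      mul_nonneg (abs_nonneg P) (sq_nonneg (|c r| - |c r'|))]
  refine (sum_le_sum fun r _ => sum_le_sum fun r' _ => h1 r r').trans ?_
  simp_rw [sum_add_distrib]
  have e : ∑ r : ι → Option (Fin k), ∑ r' : ι → Option (Fin k), c r' ^ 2 / 2 * (∏ x, |B x (r' x) (r x)|) =
      ∑ r : ι → Option (Fin k), ∑ r' : ι → Option (Fin k),
        c r ^ 2 / 2 * (∏ x, |B x (r x) (r' x)|) := sum_comm
  rw [e, ← sum_add_distrib]
  refine le_of_eq (sum_congr rfl fun r _ => ?_)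
  rw [← mul_sum, ← add_mul, Fintype.prod_sum]
  ring

theorem sum_fiber_le [Fintype ι] [DecidableEq ι] (Ω : (Fin k → Finset ι) → ℝ) (hΩ : ∀ D, 0 ≤ Ω D) :
    ∑ r : ι → Option (Fin k), Ω (fiber r) ≤ ∑ D, Ω D := by
  rw [← sum_image (f := Ω) (g := fiber) (s := univ) (fun _ _ _ _ h => fiber_injective h)]
  exact sum_le_sum_of_subset_of_nonneg (subset_univ _) fun D _ _ => hΩ D

/-- The weight of a set of primes in the diagonal form. -/
noncomputable def weight (k : ℕ) (p : ι → ℝ) (G : Finset ι → ℝ) (D : Finset ι) : ℝ :=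
  G D ^ 2 * ∏ x ∈ D, (p x + k) / p x ^ 2

theorem weight_nonneg {p : ι → ℝ} (hp : ∀ x, 1 ≤ p x) (G : Finset ι → ℝ) (D : Finset ι) :
    0 ≤ weight k p G D :=
  mul_nonneg (sq_nonneg _) (prod_nonneg fun x _ => by have := hp x; positivity)

theorem sum_coeff_mul_gram_le [Fintype ι] [DecidableEq ι] {p : ι → ℝ} (hp : ∀ x, 1 ≤ p x) (G : Finset ι → ℝ) (R : ℝ) :
    ∑ r : ι → Option (Fin k), ∑ r' : ι → Option (Fin k),
      coeff p G R r * coeff p G R r' * ∏ x, gram (p x) (r x) (r' x) ≤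
      (∑ D, weight k p G D) ^ k := by
  refine (sum_mul_prod_le (coeff p G R) (fun x => gram (p x)) fun x => gram_comm _).trans ?_
  have h : ∀ r : ι → Option (Fin k), coeff p G R r ^ 2 * ∏ x, ∑ b, |gram (p x) (r x) b| ≤
      ∏ i, weight k p G (fiber r i) := by
    intro r
    have h0 : (0:ℝ) ≤ ∏ x, ∑ b, |gram (p x) (r x) b| :=
      prod_nonneg fun x _ => sum_nonneg fun b _ => abs_nonneg _
    have h1 : ∏ x, ∑ b, |gram (p x) (r x) b| ≤ ∏ x, if r x = none then 1 else p x + k :=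
      prod_le_prod (fun x _ => sum_nonneg fun b _ => abs_nonneg _)
        fun x _ => sum_abs_gram_le (hp x) _
    have h2 : coeff p G R r ^ 2 ≤ (size p r)⁻¹ ^ 2 * (∏ i, G (fiber r i)) ^ 2 := by
      rw [coeff, mul_pow, mul_pow]
      refine mul_le_of_le_one_right (by positivity) ?_
      split_ifs <;> norm_num
    refine (mul_le_mul h2 h1 h0 (by positivity)).trans (le_of_eq ?_)
    simp_rw [weight, size]
    rw [prod_option_ite, prod_option_ite, prod_mul_distrib, ← prod_pow, ← prod_inv_distrib, mul_assoc,
      ← prod_pow, mul_comm, mul_assoc, ← prod_mul_distrib]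
    congr 1
    refine prod_congr rfl fun i _ => ?_
    rw [← prod_inv_distrib, ← prod_pow, ← prod_mul_distrib]
    refine prod_congr rfl fun x _ => ?_
    rw [inv_pow, div_eq_mul_inv]
  refine (sum_le_sum fun r _ => h r).trans ?_
  refine (sum_fiber_le (fun D => ∏ i, weight k p G (D i))
    fun D => prod_nonneg fun i _ => weight_nonneg hp G _).trans (le_of_eq ?_)
  rw [← Fintype.prod_sum]
  simp

end PrimeGaps

namespace PrimeGaps

open Finset

variable {ι : Type*} {k : ℕ}

/-- The vector of unit means of the local sieve functions. -/
noncomputable def unitMean (p : ℝ) (m : Fin k) (a : Option (Fin k)) : ℝ :=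
  if a = none ∨ a = some m then 1 else -1 / (p - 1)

/-- The Gram matrix of the local sieve functions with respect to the unit residues. -/
noncomputable def gramUnit (p : ℝ) (m : Fin k) (a b : Option (Fin k)) : ℝ :=
  unitMean p m a * unitMean p m b + if (a = none ∨ a = some m) ∨ (b = none ∨ b = some m) then 0
    else (p / (p - 1)) ^ 2 * ((if a = b then p - 1 else 0) - 1)

/-- The coefficients in a representation of the unit Gram matrix as a sum of squares. -/
noncomputable def sosWeight (p : ℝ) (m : Fin k) : Option (Fin k) ⊕ (Fin k × Fin k) → ℝ
  | Sum.inl none => 1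
  | Sum.inl (some i) => if i = m then 0 else (p - k) * (p / (p - 1)) ^ 2
  | Sum.inr (a, b) => if a = m ∨ b = m then 0 else (p / (p - 1)) ^ 2 / 2

/-- The linear forms in a representation of the unit Gram matrix as a sum of squares. -/
noncomputable def sosForm (p : ℝ) (m : Fin k) :
    Option (Fin k) ⊕ (Fin k × Fin k) → Option (Fin k) → ℝ
  | Sum.inl none, b => unitMean p m b
  | Sum.inl (some i), b => if b = some i then 1 else 0
  | Sum.inr (a, a'), b => (if b = some a then 1 else 0) - if b = some a' then 1 else 0

theorem sum_sos (p : ℝ) (m : Fin k) (a b : Option (Fin k)) :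
    ∑ t, sosWeight p m t * (sosForm p m t a * sosForm p m t b) = gramUnit p m a b := by
  rw [Fintype.sum_sum_type, Fintype.sum_option, Fintype.sum_prod_type]
  simp only [sosWeight, sosForm, gramUnit, one_mul]
  rw [add_assoc]
  congr 1
  cases a with
  | none => simp
  | some i =>
  cases b with
  | none => simp
  | some j =>
  simp only [reduceCtorEq, false_or, Option.some.injEq]
  have e1 : ∀ l l' : Fin k, (if l = m ∨ l' = m then (0:ℝ) else (p / (p - 1)) ^ 2 / 2) *
      (((if i = l then 1 else 0) - if i = l' then 1 else 0) *
        ((if j = l then 1 else 0) - if j = l' then 1 else 0)) =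
      (p / (p - 1)) ^ 2 / 2 * ((if l' = m then 0 else 1) * (if l = m then 0 else
          (if i = l then if j = l then 1 else 0 else 0))
        + (if l = m then 0 else 1) * (if l' = m then 0 else
          (if i = l' then if j = l' then 1 else 0 else 0))
        - (if i = l then if l = m then 0 else 1 else 0) * (if j = l' then if l' = m then 0 else 1 else 0)
        - (if i = l' then if l' = m then 0 else 1 else 0) *
          (if j = l then if l = m then 0 else 1 else 0)) := by
    intro l l'
    split_ifs <;> first | (exfalso; tauto) | ring
  have e2 : ∀ l : Fin k, (if l = m then (0:ℝ) else (p - k) * (p / (p - 1)) ^ 2) *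
      ((if i = l then 1 else 0) * if j = l then 1 else 0) =
      if i = l then (if l = m then 0 else if j = l then (p - k) * (p / (p - 1)) ^ 2 else 0) else 0 := by
    intro l
    split_ifs <;> simp
  have hcard : ∑ l : Fin k, (if l = m then (0:ℝ) else 1) = k - 1 := by
    have : ∀ l : Fin k, (if l = m then (0:ℝ) else 1) = 1 - if l = m then 1 else 0 := by
      intro l; split_ifs <;> norm_num
    simp [this]
  have e3 : ∑ l : Fin k, (if l = m then (0:ℝ) else if i = l then if j = l then 1 else 0 else 0) =
      if i = m then 0 else if i = j then 1 else 0 := by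
    have : ∀ l : Fin k, (if l = m then (0:ℝ) else if i = l then if j = l then 1 else 0 else 0) =
        if i = l then (if l = m then 0 else if j = l then 1 else 0) else 0 := by
      intro l; split_ifs <;> rfl
    rw [sum_congr rfl fun l _ => this l, sum_ite_eq]
    simp [eq_comm]
  simp_rw [e1, e2, ← mul_sum, sum_sub_distrib, sum_add_distrib, ← mul_sum, ← sum_mul]
  simp_rw [hcard, ← mul_sum, e3]
  simp only [sum_ite_eq, mem_univ, if_true]
  split_ifs <;> first | (exfalso; grind) | ring

theorem sum_mul_prod_sos {τ : Type*} [Fintype ι] [DecidableEq ι] [Fintype τ] {α : Type*} [Fintype α]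
    (c : (ι → α) → ℝ) (w : ι → τ → ℝ) (M : ι → τ → α → ℝ) :
    ∑ r, ∑ r', c r * c r' * ∏ x, ∑ t, w x t * (M x t (r x) * M x t (r' x)) =
      ∑ t : ι → τ, (∏ x, w x (t x)) * (∑ r, c r * ∏ x, M x (t x) (r x)) ^ 2 := by
  have h : ∀ r r' : ι → α, ∏ x, ∑ t, w x t * (M x t (r x) * M x t (r' x)) =
      ∑ t : ι → τ, ∏ x, w x (t x) * (M x (t x) (r x) * M x (t x) (r' x)) :=
    fun r r' => Fintype.prod_sum _
  rw [sum_congr rfl fun r _ => sum_congr rfl fun r' _ => by rw [h r r', mul_sum],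
    sum_congr rfl fun r _ => sum_comm, sum_comm]
  refine sum_congr rfl fun t _ => ?_
  rw [sq, sum_mul_sum, mul_sum]
  refine sum_congr rfl fun r _ => ?_
  rw [mul_sum]
  refine sum_congr rfl fun r' _ => ?_
  simp_rw [prod_mul_distrib]
  ring

theorem sosWeight_nonneg {p : ℝ} (hp : (k : ℝ) ≤ p) (m : Fin k)
    (t : Option (Fin k) ⊕ (Fin k × Fin k)) : 0 ≤ sosWeight p m t := by
  have : 0 ≤ p - k := by linarith
  match t with
  | Sum.inl none => simp [sosWeight]
  | Sum.inl (some i) => simp only [sosWeight]; split_ifs <;> positivity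
  | Sum.inr (a, b) => simp only [sosWeight]; split_ifs <;> positivity

theorem sum_sq_le_sum_gramUnit [Fintype ι] [DecidableEq ι] {p : ι → ℝ} (hp : ∀ x, (k : ℝ) ≤ p x)
    (m : Fin k) (c : (ι → Option (Fin k)) → ℝ) :
    ∑ s : ι → Option (Fin k), (∏ x, sosWeight (p x) m (Sum.inl (s x))) *
      (∑ r, c r * ∏ x, sosForm (p x) m (Sum.inl (s x)) (r x)) ^ 2 ≤
    ∑ r, ∑ r', c r * c r' * ∏ x, gramUnit (p x) m (r x) (r' x) := by
  simp_rw [← sum_sos]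
  rw [sum_mul_prod_sos c (fun x => sosWeight (p x) m) fun x => sosForm (p x) m]
  let F : (ι → Option (Fin k) ⊕ (Fin k × Fin k)) → ℝ := fun t =>
    (∏ x, sosWeight (p x) m (t x)) * (∑ r, c r * ∏ x, sosForm (p x) m (t x) (r x)) ^ 2
  have hF : ∀ t, 0 ≤ F t := fun t =>
    mul_nonneg (prod_nonneg fun x _ => sosWeight_nonneg (hp x) m _) (sq_nonneg _)
  have hinj : Function.Injective fun (s : ι → Option (Fin k)) (x : ι) =>
      (Sum.inl (s x) : Option (Fin k) ⊕ (Fin k × Fin k)) := by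
    intro s s' h
    funext x
    exact Sum.inl_injective (congr_fun h x)
  calc _ = ∑ t ∈ univ.image fun (s : ι → Option (Fin k)) (x : ι) =>
        (Sum.inl (s x) : Option (Fin k) ⊕ (Fin k × Fin k)), F t := by
        rw [sum_image fun _ _ _ _ h => hinj h]
    _ ≤ ∑ t, F t := sum_le_sum_of_subset_of_nonneg (subset_univ _) fun t _ _ => hF t

end PrimeGaps

namespace PrimeGaps

open Finset

variable {ι : Type*} {k : ℕ}

theorem sum_filter_mem_le [Fintype ι] [DecidableEq ι] {f : Finset ι → ℝ} (hf : ∀ D, 0 ≤ f D)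
    {κ : ℝ} (hκ : 0 ≤ κ) (x : ι) (h : ∀ D, x ∈ D → f D ≤ κ * f (D.erase x)) :
    ∑ D with x ∈ D, f D ≤ κ * ∑ D, f D := by
  calc ∑ D with x ∈ D, f D ≤ ∑ D with x ∈ D, κ * f (D.erase x) :=
        sum_le_sum fun D hD => h D (mem_filter.mp hD).2
    _ = ∑ D ∈ (univ.filter fun D : Finset ι => x ∈ D).image fun D => D.erase x, κ * f D := by
        rw [sum_image]
        intro D hD D' hD' he
        have h1 : x ∈ D := by simpa using hD
        have h2 : x ∈ D' := by simpa using hD'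
        rw [← insert_erase h1, ← insert_erase h2]
        exact congr_arg _ he
    _ ≤ ∑ D, κ * f D :=
        sum_le_sum_of_subset_of_nonneg (subset_univ _) fun D _ _ => mul_nonneg hκ (hf D)
    _ = κ * ∑ D, f D := by rw [mul_sum]

theorem le_sum_filter_disjoint [Fintype ι] [DecidableEq ι] {f : Finset ι → ℝ} (hf : ∀ D, 0 ≤ f D)
    {κ : ι → ℝ} (hκ : ∀ x, 0 ≤ κ x) (h : ∀ x D, x ∈ D → f D ≤ κ x * f (D.erase x))
    (S : Finset ι) : (1 - ∑ x ∈ S, κ x) * ∑ D, f D ≤ ∑ D with Disjoint D S, f D := by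
  have h1 : ∀ D, f D ≤ (if Disjoint D S then f D else 0) + ∑ x ∈ S, if x ∈ D then f D else 0 := by
    intro D
    have h0 : ∀ x ∈ S, 0 ≤ if x ∈ D then f D else 0 := fun x _ => by
      split_ifs
      exacts [hf D, le_rfl]
    by_cases hD : Disjoint D S
    · rw [if_pos hD]; linarith [sum_nonneg h0]
    · rw [if_neg hD, zero_add]
      obtain ⟨x, hx1, hx2⟩ := not_disjoint_iff.mp hD
      calc f D = if x ∈ D then f D else 0 := by rw [if_pos hx1]
        _ ≤ _ := single_le_sum (f := fun x => if x ∈ D then f D else 0) h0 hx2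
  have h2 := sum_le_sum fun D (_ : D ∈ univ) => h1 D
  rw [sum_add_distrib, ← sum_filter, sum_comm] at h2
  have h3 : ∑ x ∈ S, ∑ D, (if x ∈ D then f D else 0) ≤ ∑ x ∈ S, κ x * ∑ D, f D := by
    refine sum_le_sum fun x _ => ?_
    rw [← sum_filter]
    exact sum_filter_mem_le hf (hκ x) x (h x)
  rw [← sum_mul] at h3
  linarith

theorem size_pos [Fintype ι] {p : ι → ℝ} (hp : ∀ x, 0 < p x) (r : ι → Option (Fin k)) :
    0 < size p r :=
  prod_pos fun x _ => by
    split_ifs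
    exacts [one_pos, hp x]

theorem coeff_nonneg [Fintype ι] {p : ι → ℝ} (hp : ∀ x, 0 < p x) {G : Finset ι → ℝ}
    (hG : ∀ D, 0 ≤ G D) (R : ℝ) (r : ι → Option (Fin k)) : 0 ≤ coeff p G R r :=
  mul_nonneg (mul_nonneg (inv_nonneg.mpr (size_pos hp r).le) (prod_nonneg fun i _ => hG _))
    (by split_ifs <;> norm_num)

/-- The indicator that a local component extends `a` using only the coordinate `m`. -/
def extendsBy (m : Fin k) (a b : Option (Fin k)) : ℝ :=
  if a = none then (if b = none ∨ b = some m then 1 else 0) else if b = a then 1 else 0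

theorem extendsBy_nonneg (m : Fin k) (a b : Option (Fin k)) : 0 ≤ extendsBy m a b := by
  unfold extendsBy; split_ifs <;> norm_num

/-- The components of a configuration at new indices with coordinate other than `m`. -/
def extra (m : Fin k) (s r : ι → Option (Fin k)) (x : ι) : Option (Fin k) :=
  if s x = none ∧ r x ≠ some m then r x else none

/-- The remaining components of a configuration. -/
def core (m : Fin k) (s r : ι → Option (Fin k)) (x : ι) : Option (Fin k) :=
  if s x = none ∧ r x ≠ some m then none else r x

theorem abs_sosForm_eq {p : ℝ} (hp : 1 < p) (m : Fin k) (s r : ι → Option (Fin k)) (x : ι) :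
    |sosForm p m (Sum.inl (s x)) (r x)| = extendsBy m (s x) (core m s r x) *
      if extra m s r x = none then 1 else 1 / (p - 1) := by
  have : 0 < 1 / (p - 1) := by have : 0 < p - 1 := by linarith
                               positivity
  have e : |-1 / (p - 1)| = 1 / (p - 1) := by rw [neg_div, abs_neg, abs_of_pos this]
  unfold core extra
  cases hs : s x with
  | some i => by_cases h : r x = some i <;> simp [sosForm, extendsBy, h]
  | none =>
    by_cases h : r x = some m
    · simp [sosForm, extendsBy, h, unitMean]
    · by_cases h' : r x = none
      · simp [sosForm, extendsBy, h', unitMean]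
      · simp only [sosForm, unitMean, h, h', or_self, if_false, e, extendsBy, true_and, ne_eq,
          not_false_eq_true, if_true, true_or, one_mul]

theorem coeff_le_core [Fintype ι] {p : ι → ℝ} (hp : ∀ x, 1 ≤ p x) {G : Finset ι → ℝ}
    (hG : ∀ D, 0 ≤ G D) (hanti : ∀ D D', D ⊆ D' → G D' ≤ G D) (R : ℝ) (m : Fin k)
    (s r : ι → Option (Fin k)) :
    coeff p G R r ≤ coeff p G R (core m s r) * (size p (extra m s r))⁻¹ := by
  have hp0 : ∀ x, 0 < p x := fun x => one_pos.trans_le (hp x)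
  have hsize : size p r = size p (core m s r) * size p (extra m s r) := by
    unfold size
    rw [← prod_mul_distrib]
    refine prod_congr rfl fun x _ => ?_
    unfold core extra
    by_cases h : s x = none ∧ r x ≠ some m
    · simp only [h, ne_eq, not_false_eq_true, and_self, if_true, one_mul]
    · simp only [h, if_false, if_true, mul_one]
  have h1 : 1 ≤ size p (extra m s r) :=
    Finset.prod_induction _ (fun y => 1 ≤ y) (fun a b ha hb => one_le_mul_of_one_le_of_one_le ha hb)
      le_rfl fun x _ => by
        split_ifs
        exacts [le_rfl, hp x]
  have h2 : (∏ i, G (fiber r i)) ≤ ∏ i, G (fiber (core m s r) i) := by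
    refine prod_le_prod (fun i _ => hG _) fun i _ => hanti _ _ ?_
    intro x hx
    rw [mem_fiber] at hx ⊢
    unfold core at hx
    by_cases h : s x = none ∧ r x ≠ some m
    · rw [if_pos h] at hx; cases hx
    · rwa [if_neg h] at hx
  have h3 : (if size p r ≤ R then (1:ℝ) else 0) ≤ if size p (core m s r) ≤ R then 1 else 0 := by
    by_cases h : size p r ≤ R
    · rw [if_pos h, if_pos]
      refine le_trans ?_ h
      rw [hsize]
      exact le_mul_of_one_le_right (size_pos hp0 _).le h1
    · rw [if_neg h]; split_ifs <;> norm_num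
  unfold coeff
  rw [hsize, mul_inv]
  have h4 := size_pos hp0 (core m s r)
  have h5 := size_pos hp0 (extra m s r)
  calc (size p (core m s r))⁻¹ * (size p (extra m s r))⁻¹ * (∏ i, G (fiber r i)) *
        (if size p (core m s r) * size p (extra m s r) ≤ R then 1 else 0)
      ≤ (size p (core m s r))⁻¹ * (size p (extra m s r))⁻¹ * (∏ i, G (fiber (core m s r) i)) *
        (if size p (core m s r) ≤ R then 1 else 0) := by
        rw [← hsize]
        have : 0 ≤ ∏ i, G (fiber (core m s r) i) := prod_nonneg fun i _ => hG _
        refine mul_le_mul (by gcongr) h3 (by split_ifs <;> norm_num) (by positivity)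
    _ = _ := by ring

theorem sum_coeff_mul_abs_sosForm_le [Fintype ι] [DecidableEq ι] {p : ι → ℝ} (hp : ∀ x, 1 < p x)
    {G : Finset ι → ℝ} (hG : ∀ D, 0 ≤ G D) (hanti : ∀ D D', D ⊆ D' → G D' ≤ G D) (R : ℝ)
    (m : Fin k) (s : ι → Option (Fin k)) :
    ∑ r, coeff p G R r * ∏ x, |sosForm (p x) m (Sum.inl (s x)) (r x)| ≤
      (∑ r, coeff p G R r * ∏ x, extendsBy m (s x) (r x)) *
        ∏ x, (1 + k * (1 / (p x * (p x - 1)))) := by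
  have hp0 : ∀ x, 0 < p x := fun x => one_pos.trans (hp x)
  have hp1 : ∀ x, 0 < p x - 1 := fun x => by linarith [hp x]
  let Φ : (ι → Option (Fin k)) × (ι → Option (Fin k)) → ℝ := fun z =>
    (coeff p G R z.1 * ∏ x, extendsBy m (s x) (z.1 x)) *
      ∏ x, if z.2 x = none then 1 else 1 / (p x * (p x - 1))
  have hΦ : ∀ z, 0 ≤ Φ z := by
    intro z
    refine mul_nonneg (mul_nonneg (coeff_nonneg hp0 hG R _)
      (prod_nonneg fun x _ => extendsBy_nonneg _ _ _)) (prod_nonneg fun x _ => ?_)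
    have := hp0 x
    have := hp1 x
    split_ifs <;> positivity
  have hinj : Function.Injective fun r : ι → Option (Fin k) => (core m s r, extra m s r) := by
    intro r r' h
    simp only [Prod.mk.injEq] at h
    funext x
    have h1 := congr_fun h.1 x
    have h2 := congr_fun h.2 x
    simp only [core, extra] at h1 h2
    split_ifs at h1 h2 <;> simp_all
  calc ∑ r, coeff p G R r * ∏ x, |sosForm (p x) m (Sum.inl (s x)) (r x)|
      ≤ ∑ r, Φ (core m s r, extra m s r) := by
        refine sum_le_sum fun r _ => ?_
        simp_rw [fun x => abs_sosForm_eq (hp x) m s r x]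
        rw [prod_mul_distrib]
        have h0 : 0 ≤ (∏ x, extendsBy m (s x) (core m s r x)) *
            ∏ x, if extra m s r x = none then 1 else 1 / (p x - 1) := by
          refine mul_nonneg (prod_nonneg fun x _ => extendsBy_nonneg _ _ _)
            (prod_nonneg fun x _ => ?_)
          have := hp1 x
          split_ifs <;> positivity
        refine (mul_le_mul_of_nonneg_right
          (coeff_le_core (fun x => (hp x).le) hG hanti R m s r) h0).trans (le_of_eq ?_)
        have e : (∏ x, if extra m s r x = none then 1 else 1 / (p x * (p x - 1))) =
            (size p (extra m s r))⁻¹ * ∏ x, if extra m s r x = none then 1 else 1 / (p x - 1) := by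
          unfold size
          rw [← prod_inv_distrib, ← prod_mul_distrib]
          refine prod_congr rfl fun x _ => ?_
          have := (hp0 x).ne'
          have := (hp1 x).ne'
          split_ifs
          · simp
          · field_simp
        simp only [Φ, e]
        ring
    _ = ∑ z ∈ univ.image fun r : ι → Option (Fin k) => (core m s r, extra m s r), Φ z := by
        rw [sum_image fun _ _ _ _ h => hinj h]
    _ ≤ ∑ z, Φ z := sum_le_sum_of_subset_of_nonneg (subset_univ _) fun z _ _ => hΦ z
    _ = _ := by
        rw [Fintype.sum_prod_type, sum_mul]
        refine sum_congr rfl fun r _ => ?_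
        simp only [Φ]
        rw [← mul_sum]
        congr 1
        rw [← Fintype.prod_sum fun (x : ι) (b : Option (Fin k)) =>
          if b = none then 1 else 1 / (p x * (p x - 1))]
        refine prod_congr rfl fun x _ => ?_
        simp [Fintype.sum_option]

end PrimeGaps

namespace PrimeGaps

open Finset

variable {ι : Type*} {k : ℕ}

/-- The configuration obtained from `s` by sending the unused indices in `D` to `m`. -/
def join [DecidableEq ι] (m : Fin k) (s : ι → Option (Fin k)) (D : Finset ι) (x : ι) :
    Option (Fin k) :=
  if s x = none then (if x ∈ D then some m else none) else s x

/-- The set of indices used by a configuration. -/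
def supp [Fintype ι] (s : ι → Option (Fin k)) : Finset ι := univ.filter fun x => s x ≠ none

theorem mem_supp [Fintype ι] {s : ι → Option (Fin k)} {x : ι} : x ∈ supp s ↔ s x ≠ none := by
  simp [supp]

theorem sum_disjoint_le [Fintype ι] [DecidableEq ι] {p : ι → ℝ} (hp : ∀ x, 1 < p x)
    {G : Finset ι → ℝ} (hG : ∀ D, 0 ≤ G D) {R₁ R : ℝ} (hR : R₁ * R₁ ≤ R) (hR₁ : 0 ≤ R₁)
    (hsmall : ∀ D, G D ≠ 0 → ∏ x ∈ D, p x ≤ R₁) (m : Fin k) (s : ι → Option (Fin k))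
    (hs : ∀ x, s x ≠ some m) (hs' : size p s ≤ R₁) :
    (size p s)⁻¹ * (∏ i, if i = m then 1 else G (fiber s i)) *
      ∑ D with Disjoint D (supp s), G D * (∏ x ∈ D, p x)⁻¹ ≤
      ∑ r, coeff p G R r * ∏ x, extendsBy m (s x) (r x) := by
  have hp0 : ∀ x, 0 < p x := fun x => one_pos.trans (hp x)
  have hnn : ∀ r : ι → Option (Fin k), 0 ≤ coeff p G R r * ∏ x, extendsBy m (s x) (r x) :=
    fun r => mul_nonneg (coeff_nonneg hp0 hG R r) (prod_nonneg fun x _ => extendsBy_nonneg _ _ _)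
  have hnone : ∀ D, Disjoint D (supp s) → ∀ x ∈ D, s x = none := by
    intro D hD x hx
    by_contra h
    exact disjoint_left.mp hD hx (mem_supp.mpr h)
  have hfm : ∀ D, Disjoint D (supp s) → fiber (join m s D) m = D := by
    intro D hD
    ext x
    rw [mem_fiber]
    unfold join
    by_cases h : x ∈ D
    · simp [h, hnone D hD x h]
    · by_cases h' : s x = none <;> simp [h, h', hs x]
  have hfi : ∀ D i, i ≠ m → fiber (join m s D) i = fiber s i := by
    intro D i hi
    ext x
    rw [mem_fiber, mem_fiber]
    unfold join
    by_cases h' : s x = none <;> by_cases h : x ∈ D <;> simp [h, h', hi.symm]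
  have hterm : ∀ D, Disjoint D (supp s) →
      (size p s)⁻¹ * (∏ i, if i = m then 1 else G (fiber s i)) * (G D * (∏ x ∈ D, p x)⁻¹) =
      coeff p G R (join m s D) * ∏ x, extendsBy m (s x) (join m s D x) := by
    intro D hD
    have h1 : ∏ x, extendsBy m (s x) (join m s D x) = 1 := by
      refine prod_eq_one fun x _ => ?_
      unfold extendsBy join
      by_cases h' : s x = none <;> by_cases h : x ∈ D <;> simp [h, h']
    have h2 : size p (join m s D) = size p s * ∏ x ∈ D, p x := by
      unfold size
      rw [← prod_filter_mul_prod_filter_not univ (· ∈ D), mul_comm]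
      have e1 : ∏ x ∈ univ.filter (· ∈ D), (if join m s D x = none then 1 else p x) =
          ∏ x ∈ D, p x := by
        rw [filter_mem_eq_inter, univ_inter]
        refine prod_congr rfl fun x hx => ?_
        simp [join, hnone D hD x hx, hx]
      have e2 : ∏ x, (if s x = none then 1 else p x) =
          ∏ x ∈ univ.filter (¬ · ∈ D), (if join m s D x = none then 1 else p x) := by
        rw [prod_filter]
        refine prod_congr rfl fun x _ => ?_
        by_cases h : x ∈ D
        · simp [h, hnone D hD x h]
        · by_cases h' : s x = none <;> simp [join, h, h']
      rw [e1, e2]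
    have h3 : ∏ i, G (fiber (join m s D) i) = (∏ i, if i = m then 1 else G (fiber s i)) * G D := by
      rw [← mul_prod_erase _ _ (mem_univ m), hfm D hD,
        ← mul_prod_erase _ (fun i => if i = m then 1 else G (fiber s i)) (mem_univ m), if_pos rfl,
        one_mul, mul_comm]
      congr 1
      refine prod_congr rfl fun i hi => ?_
      rw [if_neg (ne_of_mem_erase hi), hfi D i (ne_of_mem_erase hi)]
    rw [h1, mul_one, coeff, h2, h3]
    by_cases hGD : G D = 0
    · simp [hGD]
    · rw [if_pos, mul_inv]
      · ring
      · refine le_trans ?_ hR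
        exact mul_le_mul hs' (hsmall D hGD) (prod_nonneg fun x _ => (hp0 x).le) hR₁
  rw [mul_sum]
  calc _ = ∑ D with Disjoint D (supp s), coeff p G R (join m s D) *
          ∏ x, extendsBy m (s x) (join m s D x) :=
        sum_congr rfl fun D hD => hterm D (mem_filter.mp hD).2
    _ = ∑ r ∈ (univ.filter fun D => Disjoint D (supp s)).image (join m s),
          coeff p G R r * ∏ x, extendsBy m (s x) (r x) := by
        rw [sum_image]
        intro D hD D' hD' he
        rw [← hfm D (by simpa using hD), ← hfm D' (by simpa using hD')]
        exact congr_arg (fiber · m) he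
    _ ≤ _ := sum_le_sum_of_subset_of_nonneg (subset_univ _) fun r _ _ => hnn r

theorem prod_one_add_le_of_sum_le {s : Finset ι} {a : ι → ℝ} (ha : ∀ x ∈ s, 0 ≤ a x)
    (h : ∑ x ∈ s, a x ≤ 1 / 4) : ∏ x ∈ s, (1 + a x) ≤ 3 / 2 := by
  have h1 : ∏ x ∈ s, (1 + a x) ≤ Real.exp (∑ x ∈ s, a x) := by
    rw [Real.exp_sum]
    exact prod_le_prod (fun x hx => by linarith [ha x hx])
      fun x _ => by linarith [Real.add_one_le_exp (a x)]
  refine h1.trans ((Real.exp_le_exp.mpr h).trans ?_)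
  have h2 : Real.exp (1 / 4) ^ 4 < (3 / 2 : ℝ) ^ 4 := by
    rw [← Real.exp_nat_mul]
    norm_num
    linarith [Real.exp_one_lt_d9]
  exact (lt_of_pow_lt_pow_left₀ 4 (by norm_num) h2).le

theorem le_sum_coeff_mul_sosForm [Fintype ι] [DecidableEq ι] {p : ι → ℝ} (hp : ∀ x, 2 ≤ p x)
    {G : Finset ι → ℝ} (hG : ∀ D, 0 ≤ G D) (hanti : ∀ D D', D ⊆ D' → G D' ≤ G D) {R₁ R : ℝ}
    (hR : R₁ * R₁ ≤ R) (hR₁ : 0 ≤ R₁) (hsmall : ∀ D, G D ≠ 0 → ∏ x ∈ D, p x ≤ R₁)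
    (hδ : ∑ x, 8 * k / p x ^ 2 ≤ 1) (m : Fin k) (s : ι → Option (Fin k))
    (hs : ∀ x, s x ≠ some m) (hs' : size p s ≤ R₁) (hs'' : ∑ x ∈ supp s, 1 / p x ≤ 1 / 2) :
    (size p s)⁻¹ * (∏ i, if i = m then 1 else G (fiber s i)) *
      (∑ D, G D * (∏ x ∈ D, p x)⁻¹) / 4 ≤
      ∑ r, coeff p G R r * ∏ x, sosForm (p x) m (Sum.inl (s x)) (r x) := by
  have hp1 : ∀ x, 1 < p x := fun x => by linarith [hp x]
  have hp0 : ∀ x, 0 < p x := fun x => by linarith [hp x]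
  set A := ∑ r, coeff p G R r * ∏ x, extendsBy m (s x) (r x) with hA
  have hA0 : 0 ≤ A := sum_nonneg fun r _ =>
    mul_nonneg (coeff_nonneg hp0 hG R r) (prod_nonneg fun x _ => extendsBy_nonneg _ _ _)
  have hAlow := sum_disjoint_le hp1 hG hR hR₁ hsmall m s hs hs'
  rw [← hA] at hAlow
  have hD := le_sum_filter_disjoint (f := fun D => G D * (∏ x ∈ D, p x)⁻¹)
    (fun D => mul_nonneg (hG D) (inv_nonneg.mpr (prod_nonneg fun x _ => (hp0 x).le)))
    (κ := fun x => 1 / p x) (fun x => by have := hp0 x; positivity) (fun x D hx => by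
      rw [← mul_prod_erase _ _ hx, mul_inv, one_div]
      have h1 : 0 ≤ ∏ y ∈ D.erase x, p y := prod_nonneg fun x _ => (hp0 x).le
      have h2 := hp0 x
      calc G D * ((p x)⁻¹ * (∏ y ∈ D.erase x, p y)⁻¹)
          ≤ G (D.erase x) * ((p x)⁻¹ * (∏ y ∈ D.erase x, p y)⁻¹) := by
            gcongr; exact hanti _ _ (erase_subset _ _)
        _ = _ := by ring) (supp s)
  set A₀ := ∑ D, G D * (∏ x ∈ D, p x)⁻¹ with hA₀
  have hA₀0 : 0 ≤ A₀ := sum_nonneg fun D _ =>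
    mul_nonneg (hG D) (inv_nonneg.mpr (prod_nonneg fun x _ => (hp0 x).le))
  have hc : 0 ≤ (size p s)⁻¹ * (∏ i, if i = m then 1 else G (fiber s i)) :=
    mul_nonneg (inv_nonneg.mpr (size_pos hp0 s).le) (prod_nonneg fun i _ => by
      split_ifs
      exacts [zero_le_one, hG _])
  have hA2 : (size p s)⁻¹ * (∏ i, if i = m then 1 else G (fiber s i)) * A₀ / 2 ≤ A := by
    refine le_trans ?_ hAlow
    rw [mul_div_assoc]
    refine mul_le_mul_of_nonneg_left ?_ hc
    refine le_trans ?_ hD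
    nlinarith
  have hup := sum_coeff_mul_abs_sosForm_le hp1 hG hanti R m s
  rw [← hA] at hup
  have h32 : ∏ x, (1 + k * (1 / (p x * (p x - 1)))) ≤ 3 / 2 := by
    have hnn : ∀ x ∈ (univ : Finset ι), 0 ≤ (k:ℝ) * (1 / (p x * (p x - 1))) := fun x _ => by
      have := hp0 x
      have : 0 < p x - 1 := by linarith [hp x]
      positivity
    refine prod_one_add_le_of_sum_le hnn ?_
    have : ∀ x ∈ (univ : Finset ι), (k:ℝ) * (1 / (p x * (p x - 1))) ≤ 8 * k / p x ^ 2 / 4 := by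
      intro x _
      have h0 := hp0 x
      have h1 : p x ^ 2 / 2 ≤ p x * (p x - 1) := by nlinarith [hp x]
      have h2 : 1 / (p x * (p x - 1)) ≤ 1 / (p x ^ 2 / 2) :=
        one_div_le_one_div_of_le (by positivity) h1
      calc (k:ℝ) * (1 / (p x * (p x - 1))) ≤ k * (1 / (p x ^ 2 / 2)) := by gcongr
        _ = _ := by field_simp; ring
    refine (sum_le_sum this).trans ?_
    rw [← sum_div]
    linarith
  have hlow : 2 * A - ∑ r, coeff p G R r * ∏ x, |sosForm (p x) m (Sum.inl (s x)) (r x)| ≤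
      ∑ r, coeff p G R r * ∏ x, sosForm (p x) m (Sum.inl (s x)) (r x) := by
    rw [hA, mul_sum, ← sum_sub_distrib]
    refine sum_le_sum fun r _ => ?_
    have hcr := coeff_nonneg hp0 hG R r
    have hpt : 2 * (∏ x, extendsBy m (s x) (r x)) -
        ∏ x, |sosForm (p x) m (Sum.inl (s x)) (r x)| ≤
        ∏ x, sosForm (p x) m (Sum.inl (s x)) (r x) := by
      by_cases hz : ∃ x, extendsBy m (s x) (r x) = 0
      · obtain ⟨x, hx⟩ := hz
        rw [prod_eq_zero (mem_univ x) hx, ← abs_prod]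
        linarith [neg_abs_le (∏ x, sosForm (p x) m (Sum.inl (s x)) (r x))]
      · push Not at hz
        have h1 : ∀ x, extendsBy m (s x) (r x) = 1 ∧ sosForm (p x) m (Sum.inl (s x)) (r x) = 1 := by
          intro x
          have := hz x
          unfold extendsBy at this ⊢
          cases hsx : s x with
          | none =>
            rw [hsx] at this
            by_cases h' : r x = none ∨ r x = some m
            · simp [h', sosForm, unitMean]
            · simp [h'] at this
          | some i =>
            rw [hsx] at this
            by_cases h' : r x = some i
            · simp [h', sosForm]
            · simp [h'] at this
        simp_rw [fun x => (h1 x).1, fun x => (h1 x).2]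
        norm_num
    nlinarith
  have : A * ∏ x, (1 + k * (1 / (p x * (p x - 1)))) ≤ A * (3 / 2) := by gcongr
  linarith

end PrimeGaps

namespace PrimeGaps

open Finset

variable {ι : Type*} {k : ℕ}

theorem sum_prod_mul_prod_le {α : Type*} [Fintype α] {ω g : Fin k → α → ℝ} {κ : Fin k → ℝ}
    (hω : ∀ i D, 0 ≤ ω i D) (hg : ∀ i D, 0 ≤ g i D)
    (h : ∀ i, ∑ D, ω i D * g i D ≤ κ i * ∑ D, ω i D) :
    ∑ D : Fin k → α, (∏ i, ω i (D i)) * ∏ i, g i (D i) ≤ (∏ i, κ i) * ∏ i, ∑ D, ω i D := by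
  simp_rw [← prod_mul_distrib]
  rw [← Fintype.prod_sum fun (i : Fin k) D => ω i D * g i D]
  exact prod_le_prod (fun i _ => sum_nonneg fun D _ => mul_nonneg (hω i D) (hg i D)) fun i _ => h i

theorem sum_prod_mul_le {α : Type*} [Fintype α] {ω : Fin k → α → ℝ} (hω : ∀ i D, 0 ≤ ω i D)
    {g : α → ℝ} (hg : ∀ D, 0 ≤ g D) {κ : ℝ} (j : Fin k)
    (h : ∑ D, ω j D * g D ≤ κ * ∑ D, ω j D) :
    ∑ D : Fin k → α, (∏ i, ω i (D i)) * g (D j) ≤ κ * ∏ i, ∑ D, ω i D := by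
  have := sum_prod_mul_prod_le (ω := ω) (g := fun i D => if i = j then g D else 1)
    (κ := fun i => if i = j then κ else 1) hω
    (fun i D => by split_ifs; exacts [hg D, zero_le_one]) (fun i => by
      by_cases hi : i = j
      · subst hi; simpa using h
      · simp [hi])
  simpa using this

theorem sum_prod_mul_mul_le {α : Type*} [Fintype α] {ω : Fin k → α → ℝ} (hω : ∀ i D, 0 ≤ ω i D)
    {g : α → ℝ} (hg : ∀ D, 0 ≤ g D) {κ : ℝ} {i j : Fin k} (hij : i ≠ j)
    (h : ∀ i, ∑ D, ω i D * g D ≤ κ * ∑ D, ω i D) :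
    ∑ D : Fin k → α, (∏ i, ω i (D i)) * (g (D i) * g (D j)) ≤ κ ^ 2 * ∏ i, ∑ D, ω i D := by
  have := sum_prod_mul_prod_le (ω := ω) (g := fun l D => if l = i ∨ l = j then g D else 1)
    (κ := fun l => if l = i ∨ l = j then κ else 1) hω
    (fun i D => by split_ifs; exacts [hg D, zero_le_one]) (fun l => by
      by_cases hi : l = i ∨ l = j
      · simpa [hi] using h l
      · simp [hi])
  rw [Fintype.prod_eq_mul i j hij (fun l hl => by simp [hl.1, hl.2])] at this
  simp only [true_or, or_true, if_true] at this
  rw [sq]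
  refine le_trans (le_of_eq (sum_congr rfl fun D _ => ?_)) this
  congr 1
  rw [Fintype.prod_eq_mul i j hij (fun l hl => by simp [hl.1, hl.2])]
  simp

/-- The weights of the coordinates when the coordinate `m` is left empty. -/
noncomputable def coordWeight [DecidableEq ι] (p : ι → ℝ) (G : Finset ι → ℝ) (m i : Fin k)
    (D : Finset ι) : ℝ :=
  if i = m then (if D = ∅ then 1 else 0) else weight k p G D

theorem coordWeight_nonneg [DecidableEq ι] {p : ι → ℝ} (hp : ∀ x, 1 ≤ p x) (G : Finset ι → ℝ)
    (m i : Fin k) (D : Finset ι) : 0 ≤ coordWeight p G m i D := by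
  unfold coordWeight
  split_ifs
  exacts [zero_le_one, le_rfl, weight_nonneg hp G D]

theorem prod_sum_coordWeight [Fintype ι] [DecidableEq ι] (p : ι → ℝ) (G : Finset ι → ℝ)
    (m : Fin k) :
    ∏ i, ∑ D, coordWeight p G m i D = (∑ D, weight k p G D) ^ (k - 1) := by
  have h : ∀ i, ∑ D, coordWeight p G m i D = if i = m then 1 else ∑ D, weight k p G D := by
    intro i
    unfold coordWeight
    split_ifs <;> simp
  simp_rw [h]
  rw [← mul_prod_erase _ _ (mem_univ m), if_pos rfl, one_mul,
    prod_congr rfl fun i hi => if_neg (ne_of_mem_erase hi), prod_const,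
    card_erase_of_mem (mem_univ m), card_univ, Fintype.card_fin]

theorem sum_coordWeight_mul_le [Fintype ι] [DecidableEq ι] {p : ι → ℝ} (hp : ∀ x, 1 ≤ p x)
    (G : Finset ι → ℝ) (m i : Fin k) {κ : ℝ} (hκ : 0 ≤ κ) {g : Finset ι → ℝ} (hg : g ∅ = 0)
    (h : ∑ D, weight k p G D * g D ≤ κ * ∑ D, weight k p G D) :
    ∑ D, coordWeight p G m i D * g D ≤ κ * ∑ D, coordWeight p G m i D := by
  by_cases hi : i = m
  · have e : ∑ D, coordWeight p G m i D * g D = 0 := sum_eq_zero fun D _ => by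
      unfold coordWeight
      rw [if_pos hi]
      split_ifs with h
      · rw [h, hg, mul_zero]
      · rw [zero_mul]
    rw [e]
    exact mul_nonneg hκ (sum_nonneg fun D _ => coordWeight_nonneg hp G m i D)
  · simpa [coordWeight, hi] using h

theorem sum_weight_mem_le [Fintype ι] [DecidableEq ι] {p : ι → ℝ} (hp : ∀ x, 1 ≤ p x)
    {G : Finset ι → ℝ} (hG : ∀ D, 0 ≤ G D) (hanti : ∀ D D', D ⊆ D' → G D' ≤ G D) (x : ι) :
    ∑ D, weight k p G D * (if x ∈ D then 1 else 0) ≤ (p x + k) / p x ^ 2 * ∑ D, weight k p G D := by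
  have := sum_filter_mem_le (fun D => weight_nonneg (k := k) hp G D)
    (show 0 ≤ (p x + k) / p x ^ 2 by have := hp x; positivity) x (fun D hD => by
      unfold weight
      rw [← mul_prod_erase _ _ hD]
      have h1 : G D ^ 2 ≤ G (D.erase x) ^ 2 := by
        have := hG D
        gcongr
        exact hanti _ _ (erase_subset _ _)
      have h2 : 0 ≤ (p x + k) / p x ^ 2 * ∏ y ∈ D.erase x, (p y + k) / p y ^ 2 :=
        mul_nonneg (by have := hp x; positivity)
          (prod_nonneg fun y _ => by have := hp y; positivity)
      nlinarith [mul_le_mul_of_nonneg_right h1 h2])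
  simpa [sum_filter] using this

end PrimeGaps

namespace PrimeGaps

open Finset

variable {ι : Type*} {k : ℕ}

theorem one_sub_sum_le_prod {s : Finset ι} {a : ι → ℝ} (h0 : ∀ x ∈ s, 0 ≤ a x)
    (h1 : ∀ x ∈ s, a x ≤ 1) : 1 - ∑ x ∈ s, a x ≤ ∏ x ∈ s, (1 - a x) := by
  classical
  induction s using Finset.induction_on with
  | empty => simp
  | insert x s hx ih =>
    rw [sum_insert hx, prod_insert hx]
    have i1 := ih (fun y hy => h0 y (mem_insert_of_mem hy)) fun y hy => h1 y (mem_insert_of_mem hy)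
    have i2 := h0 x (mem_insert_self _ _)
    have i3 := h1 x (mem_insert_self _ _)
    have i4 : 0 ≤ ∑ y ∈ s, a y := sum_nonneg fun y hy => h0 y (mem_insert_of_mem hy)
    nlinarith [mul_le_mul_of_nonneg_left i1 (show 0 ≤ 1 - a x by linarith), mul_nonneg i2 i4]

/-- The total penalty of a tuple of sets: overlaps, small primes, and large size. -/
noncomputable def penalty [DecidableEq ι] [Fintype ι] (p : ι → ℝ) (R : ℝ) (D : Fin k → Finset ι) :
    ℝ :=
  (∑ i, ∑ j, ∑ x, if i ≠ j then (if x ∈ D i then 1 else 0) * (if x ∈ D j then 1 else 0) else 0) +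
    4 * k * (∑ i, ∑ x, 1 / p x * if x ∈ D i then 1 else 0) +
    1 / Real.log R * ∑ i, ∑ x ∈ D i, Real.log (p x)

theorem sum_mul_penalty_le [Fintype ι] [DecidableEq ι] {p : ι → ℝ} (hp : ∀ x, 1 ≤ p x)
    (hk : ∀ x, (k : ℝ) ≤ p x)
    {G : Finset ι → ℝ} (hG : ∀ D, 0 ≤ G D) (hanti : ∀ D D', D ⊆ D' → G D' ≤ G D)
    (hδ : ∑ x, 64 * (k:ℝ) ^ 2 / p x ^ 2 ≤ 1) {R : ℝ} (hR : 1 < R) (m : Fin k)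
    (hlog : ∑ D, weight k p G D * ∑ x ∈ D, Real.log (p x) ≤
      Real.log R / (4 * k) * ∑ D, weight k p G D) :
    ∑ D : Fin k → Finset ι, (∏ i, coordWeight p G m i (D i)) * penalty p R D ≤
      1 / 2 * (∑ D, weight k p G D) ^ (k - 1) := by
  have hk0 : (0:ℝ) < k := by exact_mod_cast m.pos
  have hlogR : 0 < Real.log R := Real.log_pos hR
  have hp0 : ∀ x, 0 < p x := fun x => one_pos.trans_le (hp x)
  rw [← prod_sum_coordWeight p G m]
  set T := ∏ i, ∑ D, coordWeight p G m i D with hT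
  have hω := coordWeight_nonneg (k := k) hp G m
  have hT0 : 0 ≤ T := prod_nonneg fun i _ => sum_nonneg fun D _ => hω i D
  let κ : ι → ℝ := fun x => (p x + k) / p x ^ 2
  have hκ0 : ∀ x, 0 ≤ κ x := fun x => by have := hp0 x; positivity
  have hκ2 : ∀ x, κ x ≤ 2 / p x := fun x => by
    have := hp0 x
    have := hk x
    rw [div_le_div_iff₀ (by positivity) (by positivity)]
    nlinarith
  have hmem : ∀ (x : ι) (i : Fin k), ∑ D, coordWeight p G m i D * (if x ∈ D then 1 else 0) ≤
      κ x * ∑ D, coordWeight p G m i D := fun x i =>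
    sum_coordWeight_mul_le hp G m i (hκ0 x) (by simp) (sum_weight_mem_le hp hG hanti x)
  have hind : ∀ (x : ι) (D : Finset ι), (0:ℝ) ≤ if x ∈ D then 1 else 0 := fun x D => by
    split_ifs <;> norm_num
  have hsplit : ∀ D : Fin k → Finset ι, (∏ i, coordWeight p G m i (D i)) * penalty p R D =
      (∑ i, ∑ j, ∑ x, if i ≠ j then (∏ i, coordWeight p G m i (D i)) *
        ((if x ∈ D i then 1 else 0) * (if x ∈ D j then 1 else 0)) else 0) +
      4 * k * (∑ i, ∑ x, 1 / p x * ((∏ i, coordWeight p G m i (D i)) * if x ∈ D i then 1 else 0)) +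
      1 / Real.log R * ∑ i, (∏ i, coordWeight p G m i (D i)) * ∑ x ∈ D i, Real.log (p x) := by
    intro D
    unfold penalty
    rw [mul_add, mul_add]
    refine congr_arg₂ _ (congr_arg₂ _ ?_ ?_) ?_
    · simp_rw [mul_sum, mul_ite, mul_zero]
    · rw [mul_left_comm, mul_sum (a := ∏ i, coordWeight p G m i (D i))]
      congr 1
      refine sum_congr rfl fun i _ => ?_
      rw [mul_sum]
      exact sum_congr rfl fun x _ => by ring
    · rw [mul_left_comm, mul_sum (a := ∏ i, coordWeight p G m i (D i))]
  simp_rw [hsplit]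
  rw [sum_add_distrib, sum_add_distrib, ← mul_sum, ← mul_sum]
  have hsq : ∑ x, 1 / p x ^ 2 ≤ 1 / (64 * (k:ℝ) ^ 2) := by
    rw [le_div_iff₀ (by positivity), sum_mul]
    refine le_trans (le_of_eq (sum_congr rfl fun x _ => ?_)) hδ
    ring
  have b1 : ∑ D : Fin k → Finset ι, (∑ i, ∑ j, ∑ x,
      if i ≠ j then (∏ i, coordWeight p G m i (D i)) *
        ((if x ∈ D i then 1 else 0) * (if x ∈ D j then 1 else 0)) else 0) ≤ 1 / 8 * T := by
    rw [sum_comm]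
    have h1 : ∀ i j : Fin k, ∀ x : ι, ∑ D : Fin k → Finset ι,
        (if i ≠ j then (∏ i, coordWeight p G m i (D i)) *
        ((if x ∈ D i then 1 else 0) * (if x ∈ D j then 1 else 0)) else 0) ≤ 4 / p x ^ 2 * T := by
      intro i j x
      by_cases hij : i = j
      · simp only [hij, ne_eq, not_true_eq_false, if_false, sum_const_zero]
        have := hp0 x
        positivity
      · simp only [ne_eq, hij, not_false_eq_true, if_true]
        refine (sum_prod_mul_mul_le hω (hind x) hij (hmem x)).trans ?_
        have h2 : κ x ^ 2 ≤ (2 / p x) ^ 2 := by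
          have := hκ0 x
          gcongr
          exact hκ2 x
        calc κ x ^ 2 * T ≤ (2 / p x) ^ 2 * T := by gcongr
          _ = _ := by rw [div_pow]; norm_num
    calc _ ≤ ∑ i : Fin k, ∑ j : Fin k, ∑ x : ι, 4 / p x ^ 2 * T := by
          refine sum_le_sum fun i _ => ?_
          rw [sum_comm]
          refine sum_le_sum fun j _ => ?_
          rw [sum_comm]
          exact sum_le_sum fun x _ => h1 i j x
      _ = k ^ 2 * 4 * (∑ x, 1 / p x ^ 2) * T := by
          simp only [sum_const, card_univ, Fintype.card_fin, nsmul_eq_mul]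
          rw [← sum_mul, mul_sum]
          simp_rw [← mul_assoc, mul_one_div]
          rw [show ∑ x, 4 / p x ^ 2 = 4 * ∑ x, 1 / p x ^ 2 by
            rw [mul_sum]; simp_rw [mul_one_div], show ∑ x, (k:ℝ) ^ 2 * 4 / p x ^ 2 =
              (k:ℝ) ^ 2 * 4 * ∑ x, 1 / p x ^ 2 by rw [mul_sum]; simp_rw [mul_one_div]]
          ring
      _ ≤ k ^ 2 * 4 * (1 / (64 * (k:ℝ) ^ 2)) * T := by gcongr
      _ ≤ 1 / 8 * T := by
          refine mul_le_mul_of_nonneg_right ?_ hT0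
          field_simp
          norm_num
  have b2 : ∑ D : Fin k → Finset ι, (∑ i, ∑ x, 1 / p x *
      ((∏ i, coordWeight p G m i (D i)) * if x ∈ D i then 1 else 0)) ≤ 1 / (32 * k) * T := by
    rw [sum_comm]
    calc _ ≤ ∑ i : Fin k, ∑ x : ι, 2 * (1 / p x ^ 2) * T := by
          refine sum_le_sum fun i _ => ?_
          rw [sum_comm]
          refine sum_le_sum fun x _ => ?_
          rw [← mul_sum]
          have := hp0 x
          calc _ ≤ 1 / p x * (κ x * T) := by
                gcongr
                exact sum_prod_mul_le hω (hind x) i (hmem x i)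
            _ ≤ 1 / p x * (2 / p x * T) := by gcongr; exact hκ2 x
            _ = _ := by field_simp
      _ = k * 2 * (∑ x, 1 / p x ^ 2) * T := by
          simp only [sum_const, card_univ, Fintype.card_fin, nsmul_eq_mul]
          rw [← sum_mul, ← mul_sum]
          ring
      _ ≤ k * 2 * (1 / (64 * (k:ℝ) ^ 2)) * T := by gcongr
      _ = 1 / (32 * k) * T := by field_simp; ring
  have b3 : ∑ D : Fin k → Finset ι, (∑ i, (∏ i, coordWeight p G m i (D i)) *
      ∑ x ∈ D i, Real.log (p x)) ≤ Real.log R / 4 * T := by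
    rw [sum_comm]
    calc _ ≤ ∑ i : Fin k, Real.log R / (4 * k) * T :=
          sum_le_sum fun i _ => sum_prod_mul_le hω (g := fun D => ∑ x ∈ D, Real.log (p x))
            (fun D => sum_nonneg fun x _ => Real.log_nonneg (hp x)) i
            (sum_coordWeight_mul_le hp G m i (by positivity) (by simp) hlog)
      _ = _ := by
          simp only [sum_const, card_univ, Fintype.card_fin, nsmul_eq_mul]
          field_simp
  calc _ ≤ 1 / 8 * T + 4 * k * (1 / (32 * k) * T) + 1 / Real.log R * (Real.log R / 4 * T) := by
        gcongr
    _ = 1 / 2 * T := by field_simp; ring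

end PrimeGaps

namespace PrimeGaps

open Finset

variable {ι : Type*} {k : ℕ}

theorem penalty_nonneg [Fintype ι] [DecidableEq ι] {p : ι → ℝ} (hp : ∀ x, 1 ≤ p x) {R : ℝ}
    (hR : 1 < R) (D : Fin k → Finset ι) : 0 ≤ penalty p R D := by
  have h1 := Real.log_pos hR
  have h2 : ∀ x, 0 ≤ 1 / p x := fun x => by have := hp x; positivity
  have h3 : ∀ (x : ι) (E : Finset ι), (0:ℝ) ≤ if x ∈ E then 1 else 0 := fun x E => by
    split_ifs <;> norm_num
  refine add_nonneg (add_nonneg ?_ ?_) ?_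
  · refine sum_nonneg fun i _ => sum_nonneg fun j _ => sum_nonneg fun x _ => ?_
    split_ifs <;> norm_num
  · exact mul_nonneg (by positivity) (sum_nonneg fun i _ => sum_nonneg fun x _ =>
      mul_nonneg (h2 x) (h3 x _))
  · exact mul_nonneg (by positivity) (sum_nonneg fun i _ => sum_nonneg fun x _ =>
      Real.log_nonneg (hp x))

/-- The configurations for which the sums of squares are bounded below. -/
def IsGood [Fintype ι] (p : ι → ℝ) (R : ℝ) (m : Fin k) (s : ι → Option (Fin k)) : Prop :=
  (∀ x, s x ≠ some m) ∧ size p s ≤ R ∧ ∑ x ∈ supp s, 1 / p x ≤ 1 / (4 * k)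

theorem sum_sum_fiber [Fintype ι] (s : ι → Option (Fin k)) (g : ι → ℝ) :
    ∑ i, ∑ x ∈ fiber s i, g x = ∑ x ∈ supp s, g x := by
  simp_rw [fiber, supp, sum_filter]
  rw [Finset.sum_comm]
  refine sum_congr rfl fun x _ => ?_
  cases h : s x with
  | none => simp
  | some j => simp [eq_comm]

theorem log_size [Fintype ι] {p : ι → ℝ} (hp : ∀ x, 1 ≤ p x) (s : ι → Option (Fin k)) :
    Real.log (size p s) = ∑ x ∈ supp s, Real.log (p x) := by
  unfold size supp
  rw [Real.log_prod fun x _ => by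
    have := hp x
    split_ifs <;> linarith, sum_filter]
  refine sum_congr rfl fun x _ => ?_
  by_cases h : s x = none <;> simp [h]

theorem one_le_penalty_or [Fintype ι] [DecidableEq ι] {p : ι → ℝ} (hp : ∀ x, 1 ≤ p x) {R : ℝ}
    (hR : 1 < R) (m : Fin k) (D : Fin k → Finset ι) (hm : D m = ∅) :
    1 ≤ penalty p R D ∨ ∃ s, IsGood p R m s ∧ fiber s = D := by
  classical
  have hk0 : (0:ℝ) < k := by exact_mod_cast m.pos
  have h1 := Real.log_pos hR
  have h2 : ∀ x, 0 ≤ 1 / p x := fun x => by have := hp x; positivity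
  have h3 : ∀ (x : ι) (E : Finset ι), (0:ℝ) ≤ if x ∈ E then 1 else 0 := fun x E => by
    split_ifs <;> norm_num
  have t1 : 0 ≤ ∑ i, ∑ j, ∑ x, (if i ≠ j then (if x ∈ D i then 1 else 0) *
      (if x ∈ D j then 1 else 0) else (0:ℝ)) := by
    refine sum_nonneg fun i _ => sum_nonneg fun j _ => sum_nonneg fun x _ => ?_
    split_ifs <;> norm_num
  have t2 : 0 ≤ 4 * k * (∑ i, ∑ x, 1 / p x * if x ∈ D i then 1 else 0) :=
    mul_nonneg (by positivity) (sum_nonneg fun i _ => sum_nonneg fun x _ =>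
      mul_nonneg (h2 x) (h3 x _))
  have t3 : 0 ≤ 1 / Real.log R * ∑ i, ∑ x ∈ D i, Real.log (p x) :=
    mul_nonneg (by positivity) (sum_nonneg fun i _ => sum_nonneg fun x _ =>
      Real.log_nonneg (hp x))
  by_cases hdis : ∃ i j x, i ≠ j ∧ x ∈ D i ∧ x ∈ D j
  · left
    obtain ⟨i, j, x, hij, hi, hj⟩ := hdis
    have nn : ∀ (i j : Fin k) (x : ι), 0 ≤ (if i ≠ j then (if x ∈ D i then 1 else 0) *
        (if x ∈ D j then 1 else 0) else (0:ℝ)) := fun i j x => by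
      split_ifs <;> norm_num
    have : 1 ≤ ∑ i, ∑ j, ∑ x, (if i ≠ j then (if x ∈ D i then 1 else 0) *
        (if x ∈ D j then 1 else 0) else (0:ℝ)) := by
      calc (1:ℝ) = (if i ≠ j then (if x ∈ D i then 1 else 0) *
            (if x ∈ D j then 1 else 0) else (0:ℝ)) := by simp [hij, hi, hj]
        _ ≤ ∑ x, (if i ≠ j then (if x ∈ D i then 1 else 0) *
            (if x ∈ D j then 1 else 0) else (0:ℝ)) :=
          single_le_sum (fun y _ => nn i j y) (mem_univ x)
        _ ≤ ∑ j, ∑ x, (if i ≠ j then (if x ∈ D i then 1 else 0) *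
            (if x ∈ D j then 1 else 0) else (0:ℝ)) :=
          single_le_sum (f := fun j => ∑ x, (if i ≠ j then (if x ∈ D i then 1 else 0) *
            (if x ∈ D j then 1 else 0) else (0:ℝ)))
            (fun l _ => sum_nonneg fun y _ => nn i l y) (mem_univ j)
        _ ≤ _ := single_le_sum (f := fun i => ∑ j, ∑ x, (if i ≠ j then (if x ∈ D i then 1 else 0) *
            (if x ∈ D j then 1 else 0) else (0:ℝ)))
            (fun q _ => sum_nonneg fun l _ => sum_nonneg fun y _ => nn q l y) (mem_univ i)
    unfold penalty
    linarith
  · push Not at hdis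
    let s : ι → Option (Fin k) := fun x => if h : ∃ i, x ∈ D i then some h.choose else none
    have hs : ∀ x i, s x = some i ↔ x ∈ D i := by
      intro x i
      by_cases h : ∃ i, x ∈ D i
      · simp only [s, h, dif_pos, Option.some.injEq]
        constructor
        · rintro rfl; exact h.choose_spec
        · intro hi
          by_contra hne
          exact hdis _ _ x hne h.choose_spec hi
      · simp only [s, h, dif_neg, not_false_eq_true, reduceCtorEq, false_iff]
        exact fun hi => h ⟨i, hi⟩
    have hf : fiber s = D := by
      funext i; ext x; rw [mem_fiber, hs]
    by_cases hgood : IsGood p R m s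
    · exact Or.inr ⟨s, hgood, hf⟩
    left
    have hsm : ∀ x, s x ≠ some m := fun x hx => by
      have := (hs x m).1 hx
      simp [hm] at this
    have h4 : ¬ (size p s ≤ R ∧ ∑ x ∈ supp s, 1 / p x ≤ 1 / (4 * k)) := fun h => hgood ⟨hsm, h⟩
    rw [not_and_or, not_le, not_le] at h4
    rcases h4 with h4 | h4
    · have : 1 ≤ 1 / Real.log R * ∑ i, ∑ x ∈ D i, Real.log (p x) := by
        rw [← hf, sum_sum_fiber, ← log_size hp, one_div, ← div_eq_inv_mul, one_le_div h1]
        exact Real.log_le_log (by linarith) h4.le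
      unfold penalty
      linarith
    · have : 1 ≤ 4 * k * (∑ i, ∑ x, 1 / p x * if x ∈ D i then 1 else 0) := by
        have h5 : ∑ i, ∑ x, (1 / p x * if x ∈ D i then 1 else 0) = ∑ x ∈ supp s, 1 / p x := by
          rw [← sum_sum_fiber, hf]
          refine sum_congr rfl fun i _ => ?_
          simp_rw [mul_ite, mul_one, mul_zero]
          rw [← sum_filter, filter_mem_eq_inter, univ_inter]
        rw [h5]
        rw [div_lt_iff₀ (by positivity)] at h4
        linarith
      unfold penalty
      linarith

open Classical in
theorem le_sum_isGood [Fintype ι] [DecidableEq ι] {p : ι → ℝ} (hp : ∀ x, 1 ≤ p x)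
    (hk : ∀ x, (k : ℝ) ≤ p x)
    {G : Finset ι → ℝ} (hG : ∀ D, 0 ≤ G D) (hanti : ∀ D D', D ⊆ D' → G D' ≤ G D)
    (hδ : ∑ x, 64 * (k:ℝ) ^ 2 / p x ^ 2 ≤ 1) {R : ℝ} (hR : 1 < R) (m : Fin k)
    (hlog : ∑ D, weight k p G D * ∑ x ∈ D, Real.log (p x) ≤
      Real.log R / (4 * k) * ∑ D, weight k p G D) :
    1 / 2 * (∑ D, weight k p G D) ^ (k - 1) ≤
      ∑ s : ι → Option (Fin k) with IsGood p R m s, ∏ i, coordWeight p G m i (fiber s i) := by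
  have h1 := sum_mul_penalty_le hp hk hG hanti hδ hR m hlog
  have hΩ : ∀ D : Fin k → Finset ι, 0 ≤ ∏ i, coordWeight p G m i (D i) := fun D =>
    prod_nonneg fun i _ => coordWeight_nonneg hp G m i _
  have h2 : ∑ D : Fin k → Finset ι, ∏ i, coordWeight p G m i (D i) =
      (∑ D, weight k p G D) ^ (k - 1) := by
    rw [← prod_sum_coordWeight p G m]
    exact (Fintype.prod_sum fun (i : Fin k) D => coordWeight p G m i D).symm
  have h3 : ∑ D : Fin k → Finset ι, ∏ i, coordWeight p G m i (D i) ≤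
      ∑ s : ι → Option (Fin k) with IsGood p R m s, ∏ i, coordWeight p G m i (fiber s i) +
      ∑ D : Fin k → Finset ι, (∏ i, coordWeight p G m i (D i)) * penalty p R D := by
    rw [← sum_image (f := fun D => ∏ i, coordWeight p G m i (D i)) (g := fiber)
      (fun _ _ _ _ h => fiber_injective h), ← sum_filter_add_sum_filter_not univ
      (fun D => D ∈ image fiber (univ.filter fun s : ι → Option (Fin k) => IsGood p R m s))]
    refine add_le_add ?_ ?_
    · rw [filter_mem_eq_inter, univ_inter]
    · refine (sum_le_sum fun D hD => ?_).trans
        (sum_le_sum_of_subset_of_nonneg (filter_subset _ _) fun D _ _ =>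
          mul_nonneg (hΩ D) (penalty_nonneg hp hR D))
      by_cases hm : D m = ∅
      · rcases one_le_penalty_or hp hR m D hm with h | ⟨s, hs, rfl⟩
        · exact le_mul_of_one_le_right (hΩ D) h
        · exact absurd (mem_image_of_mem _ (mem_filter.2 ⟨mem_univ _, hs⟩)) (mem_filter.1 hD).2
      · rw [prod_eq_zero (mem_univ m) (by simp [coordWeight, hm])]
        simp
  linarith

theorem prod_coordWeight_fiber_le [Fintype ι] [DecidableEq ι] {p : ι → ℝ} (hp : ∀ x, 2 ≤ p x)
    (hk : ∀ x, 2 * (k : ℝ) ≤ p x) {G : Finset ι → ℝ} {R : ℝ} (m : Fin k)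
    {s : ι → Option (Fin k)} (hs : IsGood p R m s) :
    ∏ i, coordWeight p G m i (fiber s i) ≤
      2 * ((∏ x, sosWeight (p x) m (Sum.inl (s x))) *
      ((size p s)⁻¹ * ∏ i, if i = m then 1 else G (fiber s i)) ^ 2) := by
  have hk0 : (0:ℝ) < k := by exact_mod_cast m.pos
  have hp0 : ∀ x, 0 < p x := fun x => two_pos.trans_le (hp x)
  have e1 : ∏ i, coordWeight p G m i (fiber s i) = (∏ i, if i = m then 1 else G (fiber s i)) ^ 2 *
      ∏ x, if s x = none then 1 else (p x + k) / p x ^ 2 := by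
    rw [prod_option_ite, ← prod_pow, ← prod_mul_distrib]
    refine prod_congr rfl fun i _ => ?_
    unfold coordWeight weight
    by_cases hi : i = m
    · subst hi
      have : fiber s i = ∅ := by
        ext x; simp [mem_fiber, hs.1 x]
      have h' : (univ.filter fun x => s x = some i) = ∅ := this
      simp [this, h']
    · simp only [hi, if_false, fiber]
  have e2 : ∏ x, (if s x = none then 1 else (p x + k) / p x ^ 2) ≤
      2 * ((∏ x, sosWeight (p x) m (Sum.inl (s x))) * (size p s)⁻¹ ^ 2) := by
    have h1 : 1 - ∑ x ∈ supp s, 2 * k / p x ≤ ∏ x ∈ supp s, (1 - 2 * k / p x) :=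
      one_sub_sum_le_prod (fun x _ => by have := hp0 x; positivity) fun x _ => by
        rw [div_le_one (hp0 x)]; exact hk x
    have h2 : ∑ x ∈ supp s, 2 * k / p x ≤ 1 / 2 := by
      have := mul_le_mul_of_nonneg_left hs.2.2 (show 0 ≤ 2 * (k:ℝ) by positivity)
      rw [mul_sum] at this
      simp_rw [mul_one_div] at this
      refine this.trans (le_of_eq ?_)
      field_simp
      norm_num
    have h3 : (∏ x ∈ supp s, (1 - 2 * k / p x)) *
        ∏ x, (if s x = none then 1 else (p x + k) / p x ^ 2) ≤
        (∏ x, sosWeight (p x) m (Sum.inl (s x))) * (size p s)⁻¹ ^ 2 := by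
      rw [supp, prod_filter, ← prod_mul_distrib, size, ← prod_inv_distrib, ← prod_pow,
        ← prod_mul_distrib]
      refine prod_le_prod (fun x _ => ?_) fun x _ => ?_
      · have := hp0 x
        have h4 : 2 * k / p x ≤ 1 := by rw [div_le_one (hp0 x)]; exact hk x
        refine mul_nonneg ?_ ?_
        · split_ifs <;> linarith
        · split_ifs <;> positivity
      · have hx := hp0 x
        have hx2 := hp x
        have hxk := hk x
        cases h : s x with
        | none => simp [sosWeight]
        | some i =>
          have him : i ≠ m := fun hi => hs.1 x (hi ▸ h)
          simp only [sosWeight, him, if_false, ne_eq, reduceCtorEq, not_false_eq_true, if_true]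
          have h5 : 1 ≤ p x / (p x - 1) := by
            rw [le_div_iff₀ (by linarith)]; linarith
          have h6 : (1 - 2 * k / p x) * ((p x + k) / p x ^ 2) ≤ (p x - k) * (p x)⁻¹ ^ 2 := by
            rw [inv_pow, ← div_eq_mul_inv, ← mul_div_assoc]
            refine div_le_div_of_nonneg_right ?_ (by positivity)
            have : (1 - 2 * k / p x) * (p x + k) = p x - k - 2 * k ^ 2 / p x := by
              field_simp; ring
            rw [this]
            have : 0 ≤ 2 * (k:ℝ) ^ 2 / p x := by positivity
            linarith
          refine h6.trans ?_
          refine mul_le_mul_of_nonneg_right ?_ (by positivity)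
          exact le_mul_of_one_le_right (by linarith) (one_le_pow₀ h5)
    have h4 : 0 ≤ ∏ x, (if s x = none then 1 else (p x + k) / p x ^ 2) :=
      prod_nonneg fun x _ => by have := hp0 x; split_ifs <;> positivity
    have h5 : (1:ℝ) / 2 ≤ ∏ x ∈ supp s, (1 - 2 * k / p x) := by linarith
    nlinarith [mul_le_mul_of_nonneg_right h5 h4]
  rw [e1, mul_pow]
  calc _ ≤ (∏ i, if i = m then 1 else G (fiber s i)) ^ 2 *
        (2 * ((∏ x, sosWeight (p x) m (Sum.inl (s x))) * (size p s)⁻¹ ^ 2)) := by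
        gcongr
    _ = _ := by ring

/-- The lower bound for the form attached to the unit residues. -/
theorem le_sum_coeff_mul_gramUnit [Fintype ι] [DecidableEq ι] {p : ι → ℝ} (hp : ∀ x, 2 ≤ p x)
    (hk : ∀ x, 2 * (k : ℝ) ≤ p x)
    {G : Finset ι → ℝ} (hG : ∀ D, 0 ≤ G D) (hanti : ∀ D D', D ⊆ D' → G D' ≤ G D)
    (hδ : ∑ x, 64 * (k:ℝ) ^ 2 / p x ^ 2 ≤ 1) {R R₁ : ℝ} (hR₁ : 1 < R₁) (hR : R₁ * R₁ ≤ R)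
    (hsmall : ∀ D, G D ≠ 0 → ∏ x ∈ D, p x ≤ R₁) (m : Fin k)
    (hlog : ∑ D, weight k p G D * ∑ x ∈ D, Real.log (p x) ≤
      Real.log R₁ / (4 * k) * ∑ D, weight k p G D) :
    (∑ D, G D * (∏ x ∈ D, p x)⁻¹) ^ 2 / 64 * (∑ D, weight k p G D) ^ (k - 1) ≤
      ∑ r : ι → Option (Fin k), ∑ r' : ι → Option (Fin k),
        coeff p G R r * coeff p G R r' * ∏ x, gramUnit (p x) m (r x) (r' x) := by
  classical
  have hk0 : (0:ℝ) < k := by exact_mod_cast m.pos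
  have hk1 : (1:ℝ) ≤ k := by exact_mod_cast m.pos
  have hkp : ∀ x, (k:ℝ) ≤ p x := fun x => by have := hk x; linarith
  have hp1 : ∀ x, 1 ≤ p x := fun x => one_le_two.trans (hp x)
  have hp0 : ∀ x, 0 < p x := fun x => one_pos.trans_le (hp1 x)
  refine le_trans ?_ (sum_sq_le_sum_gramUnit hkp m (coeff p G R))
  have hw : ∀ s : ι → Option (Fin k), 0 ≤ ∏ x, sosWeight (p x) m (Sum.inl (s x)) := fun s =>
    prod_nonneg fun x _ => sosWeight_nonneg (hkp x) m _
  have h1 := le_sum_isGood hp1 hkp hG hanti hδ hR₁ m hlog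
  have hδ' : ∑ x, 8 * (k:ℝ) / p x ^ 2 ≤ 1 := by
    refine (sum_le_sum fun x _ => ?_).trans hδ
    have := hp0 x
    gcongr 1
    nlinarith
  set A := ∑ D, G D * (∏ x ∈ D, p x)⁻¹ with hA
  have hA0 : 0 ≤ A := sum_nonneg fun D _ => mul_nonneg (hG D)
    (inv_nonneg.2 (prod_nonneg fun x _ => (hp0 x).le))
  calc A ^ 2 / 64 * (∑ D, weight k p G D) ^ (k - 1)
      = A ^ 2 / 32 * (1 / 2 * (∑ D, weight k p G D) ^ (k - 1)) := by ring
    _ ≤ A ^ 2 / 32 * ∑ s : ι → Option (Fin k) with IsGood p R₁ m s,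
        ∏ i, coordWeight p G m i (fiber s i) := by gcongr
    _ ≤ ∑ s : ι → Option (Fin k) with IsGood p R₁ m s,
        (∏ x, sosWeight (p x) m (Sum.inl (s x))) *
        (∑ r, coeff p G R r * ∏ x, sosForm (p x) m (Sum.inl (s x)) (r x)) ^ 2 := by
        rw [mul_sum]
        refine sum_le_sum fun s hs => ?_
        have hs' := (mem_filter.1 hs).2
        have h2 := le_sum_coeff_mul_sosForm hp hG hanti hR (by linarith) hsmall hδ' m s
          hs'.1 hs'.2.1 (hs'.2.2.trans (by
            rw [div_le_div_iff₀ (by positivity) (by norm_num)]; linarith))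
        have h3 := prod_coordWeight_fiber_le (G := G) hp hk m hs'
        have h4 : 0 ≤ (size p s)⁻¹ * (∏ i, if i = m then 1 else G (fiber s i)) * A / 4 := by
          have : 0 ≤ ∏ i, if i = m then 1 else G (fiber s i) := prod_nonneg fun i _ => by
            split_ifs
            exacts [zero_le_one, hG _]
          have := size_pos hp0 s
          positivity
        have h5 := mul_le_mul_of_nonneg_left (pow_le_pow_left₀ h4 h2 2) (hw s)
        refine le_trans ?_ h5
        exact (mul_le_mul_of_nonneg_left h3 (by positivity)).trans (le_of_eq (by ring))
    _ ≤ _ := sum_le_sum_of_subset_of_nonneg (filter_subset _ _) fun s _ _ =>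
        mul_nonneg (hw s) (sq_nonneg _)

end PrimeGaps

namespace PrimeGaps

open Finset

theorem harmonic_cast_succ (M : ℕ) : (harmonic (M + 1) : ℝ) = harmonic M + ((M:ℝ) + 1)⁻¹ := by
  rw [harmonic_succ]; push_cast; rfl

theorem sum_Ico_coprime_succ (W M : ℕ) (f : ℕ → ℝ) :
    ∑ n ∈ Ico 1 ((M + 1) * W + 1) with W.Coprime n, f n =
      ∑ n ∈ Ico 1 (M * W + 1) with W.Coprime n, f n +
      ∑ n ∈ Ico (M * W + 1) (M * W + 1 + W) with W.Coprime n, f n := by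
  simp_rw [sum_filter]
  rw [sum_Ico_consecutive _ (by omega) (by omega)]
  congr 2
  ring

theorem mul_harmonic_le_sum_coprime {W : ℕ} (hW : 0 < W) (M : ℕ) :
    (W.totient / W : ℝ) * harmonic M ≤
      ∑ n ∈ Ico 1 (M * W + 1) with W.Coprime n, (1 / n : ℝ) := by
  induction M with
  | zero => simp
  | succ M ih =>
    rw [sum_Ico_coprime_succ, harmonic_cast_succ, mul_add]
    refine add_le_add ih ?_
    rw [← Nat.filter_coprime_Ico_eq_totient W (M * W + 1)]
    have hW' : (0:ℝ) < W := by exact_mod_cast hW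
    calc _ = ∑ n ∈ Ico (M * W + 1) (M * W + 1 + W) with W.Coprime n, (1 / ((M + 1) * W) : ℝ) := by
          rw [sum_const, nsmul_eq_mul]; field_simp
      _ ≤ _ := sum_le_sum fun n hn => by
          have hn' := mem_Ico.1 (mem_filter.1 hn).1
          have h1 : (0:ℝ) < n := by exact_mod_cast (by omega : 0 < n)
          have h2 : (n:ℝ) ≤ (M + 1) * W := by exact_mod_cast (by linarith : n ≤ (M + 1) * W)
          gcongr

theorem sum_coprime_le_mul_harmonic {W : ℕ} (hW : 0 < W) (M : ℕ) :
    ∑ n ∈ Ico 1 ((M + 1) * W + 1) with W.Coprime n, (1 / n : ℝ) ≤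
      harmonic W + (W.totient / W : ℝ) * harmonic M := by
  induction M with
  | zero =>
    simp only [zero_add, one_mul, harmonic_zero, Rat.cast_zero, mul_zero, add_zero]
    refine (sum_le_sum_of_subset_of_nonneg (filter_subset _ _) fun n _ _ => by positivity).trans ?_
    rw [sum_Ico_eq_sum_range, harmonic]
    push_cast
    refine le_of_eq (sum_congr (by simp) fun n _ => ?_)
    rw [one_div, add_comm]
  | succ M ih =>
    rw [sum_Ico_coprime_succ, harmonic_cast_succ, mul_add, ← add_assoc]
    refine add_le_add ih ?_
    rw [← Nat.filter_coprime_Ico_eq_totient W ((M + 1) * W + 1)]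
    have hW' : (0:ℝ) < W := by exact_mod_cast hW
    calc _ ≤ ∑ n ∈ Ico ((M + 1) * W + 1) ((M + 1) * W + 1 + W) with W.Coprime n,
          (1 / ((M + 1) * W) : ℝ) := sum_le_sum fun n hn => by
          have hn' := mem_Ico.1 (mem_filter.1 hn).1
          have h2 : ((M:ℝ) + 1) * W ≤ n := by exact_mod_cast (by linarith : (M + 1) * W ≤ n)
          gcongr
      _ = _ := by
          rw [sum_const, nsmul_eq_mul]; field_simp

/-- The sum of the reciprocals of the integers up to `exp t` that are coprime to `W`. -/
noncomputable def coprimeSum (W : ℕ) (t : ℝ) : ℝ :=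
  ∑ n ∈ Ico 1 (⌊Real.exp t⌋₊ + 1) with W.Coprime n, (1 / n : ℝ)

theorem eventually_le_coprimeSum {W : ℕ} (hW : 0 < W) :
    ∀ᶠ t in atTop, (W.totient / W : ℝ) * t / 2 ≤ coprimeSum W t := by
  filter_upwards [eventually_ge_atTop (2 * Real.log W)] with t ht
  have hW' : (0:ℝ) < W := by exact_mod_cast hW
  set M := ⌊Real.exp t⌋₊ / W with hM
  have h1 : M * W ≤ ⌊Real.exp t⌋₊ := Nat.div_mul_le_self _ _
  have h2 : ⌊Real.exp t⌋₊ < (M + 1) * W := by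
    have := Nat.lt_div_mul_add hW (a := ⌊Real.exp t⌋₊)
    rw [← hM] at this
    linarith
  have h3 : Real.exp t ≤ (M + 1) * W := by
    have h4 : (⌊Real.exp t⌋₊ : ℝ) + 1 ≤ (M + 1) * W := by exact_mod_cast h2
    linarith [Nat.lt_floor_add_one (Real.exp t)]
  have h4 : t - Real.log W ≤ Real.log (M + 1) := by
    have := Real.log_le_log (Real.exp_pos t) h3
    rw [Real.log_exp, Real.log_mul (by positivity) hW'.ne'] at this
    linarith
  have h5 : (W.totient / W : ℝ) * (t / 2) ≤ (W.totient / W : ℝ) * harmonic M := by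
    have := log_add_one_le_harmonic M
    push_cast at this
    gcongr
    linarith
  rw [mul_div_assoc]
  refine h5.trans ((mul_harmonic_le_sum_coprime hW M).trans ?_)
  exact sum_le_sum_of_subset_of_nonneg (filter_subset_filter _ (Ico_subset_Ico_right (by omega)))
    fun n _ _ => by positivity

theorem eventually_coprimeSum_le {W : ℕ} (hW : 0 < W) :
    ∀ᶠ t in atTop, coprimeSum W t ≤ 2 * ((W.totient / W : ℝ) * t) := by
  have hW' : (0:ℝ) < W := by exact_mod_cast hW
  have hρ : (0:ℝ) < W.totient / W := by
    have := Nat.totient_pos.2 hW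
    positivity
  filter_upwards [eventually_ge_atTop 0, (tendsto_id.const_mul_atTop hρ).eventually_ge_atTop
    (harmonic W + (W.totient / W : ℝ))] with t ht0 ht
  simp only [id] at ht
  set M := ⌊Real.exp t⌋₊ / W with hM
  have h1 : M * W ≤ ⌊Real.exp t⌋₊ := Nat.div_mul_le_self _ _
  have h2 : ⌊Real.exp t⌋₊ < (M + 1) * W := by
    have := Nat.lt_div_mul_add hW (a := ⌊Real.exp t⌋₊)
    rw [← hM] at this
    linarith
  have h3 : (M:ℝ) ≤ Real.exp t := by
    have : M ≤ ⌊Real.exp t⌋₊ := (Nat.le_mul_of_pos_right M hW).trans h1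
    exact (Nat.cast_le.2 this).trans (Nat.floor_le (Real.exp_pos t).le)
  have h4 : (harmonic M : ℝ) ≤ 1 + t := by
    refine (harmonic_le_one_add_log M).trans ?_
    rcases Nat.eq_zero_or_pos M with h | h
    · simp [h]; linarith
    · have := Real.log_le_log (by exact_mod_cast h) h3
      rw [Real.log_exp] at this
      linarith
  have h5 : coprimeSum W t ≤ harmonic W + (W.totient / W : ℝ) * harmonic M := by
    refine le_trans ?_ (sum_coprime_le_mul_harmonic hW M)
    exact sum_le_sum_of_subset_of_nonneg (filter_subset_filter _ (Ico_subset_Ico_right (by omega)))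
      fun n _ _ => by positivity
  have h6 : (W.totient / W : ℝ) * harmonic M ≤ (W.totient / W : ℝ) * (1 + t) := by gcongr
  linarith

end PrimeGaps

namespace PrimeGaps

open Finset

/-- The sum of the reciprocals of the products at most `exp t` of distinct elements of `P`. -/
noncomputable def primeSum (P : Finset ℕ) (t : ℝ) : ℝ :=
  ∑ D : Finset P, if ∑ x ∈ D, Real.log x ≤ t then (∏ x ∈ D, (x : ℝ))⁻¹ else 0

theorem primeFactors_prod_coe {P : Finset ℕ} (hP : ∀ p ∈ P, p.Prime) (D : Finset P) :
    (∏ x ∈ D, (x : ℕ)).primeFactors = D.map (Function.Embedding.subtype _) := by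
  rw [← Nat.primeFactors_prod (s := D.map (Function.Embedding.subtype _)) (fun p hp => by
    obtain ⟨x, -, rfl⟩ := mem_map.1 hp
    exact hP _ x.2), prod_map]
  rfl

theorem prod_coe_injective {P : Finset ℕ} (hP : ∀ p ∈ P, p.Prime) :
    Function.Injective fun D : Finset P => ∏ x ∈ D, (x : ℕ) := by
  intro D D' h
  have := congr_arg Nat.primeFactors h
  simp only [primeFactors_prod_coe hP] at this
  exact map_injective _ this

theorem sum_log_eq {P : Finset ℕ} (hP : ∀ p ∈ P, p.Prime) (D : Finset P) :
    ∑ x ∈ D, Real.log x = Real.log (∏ x ∈ D, (x : ℕ) : ℕ) := by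
  rw [Nat.cast_prod, Real.log_prod fun x _ => by exact_mod_cast (hP x x.2).ne_zero]

theorem prod_coe_pos {P : Finset ℕ} (hP : ∀ p ∈ P, p.Prime) (D : Finset P) :
    0 < ∏ x ∈ D, (x : ℕ) := prod_pos fun x _ => (hP x x.2).pos

theorem sum_log_le_iff {P : Finset ℕ} (hP : ∀ p ∈ P, p.Prime) (D : Finset P) {t : ℝ} :
    ∑ x ∈ D, Real.log x ≤ t ↔ ∏ x ∈ D, (x : ℕ) ≤ ⌊Real.exp t⌋₊ := by
  have h : (0:ℝ) < (∏ x ∈ D, (x : ℕ) : ℕ) := by exact_mod_cast prod_coe_pos hP D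
  rw [sum_log_eq hP, Real.log_le_iff_le_exp h, Nat.le_floor_iff (Real.exp_pos t).le]

theorem primeSum_le_coprimeSum {P : Finset ℕ} (hP : ∀ p ∈ P, p.Prime) {W : ℕ}
    (hW : ∀ p ∈ P, W.Coprime p) (t : ℝ) : primeSum P t ≤ coprimeSum W t := by
  classical
  unfold primeSum coprimeSum
  rw [← sum_filter]
  calc _ = ∑ D ∈ univ.filter fun D : Finset P => ∑ x ∈ D, Real.log (x : ℕ) ≤ t, (1 / (∏ x ∈ D, (x : ℕ) : ℕ) : ℝ) := by
        refine sum_congr rfl fun D _ => ?_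
        rw [Nat.cast_prod, one_div]
    _ = ∑ n ∈ (univ.filter fun D : Finset P => ∑ x ∈ D, Real.log (x : ℕ) ≤ t).image
          (fun D : Finset P => ∏ x ∈ D, (x : ℕ)), (1 / n : ℝ) :=
        (sum_image (f := fun n : ℕ => (1 / n : ℝ)) fun _ _ _ _ h => prod_coe_injective hP h).symm
    _ ≤ _ := by
        refine sum_le_sum_of_subset_of_nonneg (fun n hn => ?_) fun n _ _ => by positivity
        obtain ⟨D, hD, rfl⟩ := mem_image.1 hn
        have h1 := (sum_log_le_iff hP D).1 (mem_filter.1 hD).2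
        exact mem_filter.2 ⟨mem_Ico.2 ⟨prod_coe_pos hP D, by omega⟩,
          Nat.Coprime.prod_right fun x _ => hW x x.2⟩

theorem sum_coprime_not_dvd_le {P : Finset ℕ} (hP : ∀ p ∈ P, p.Prime) {W p₁ : ℕ} {t : ℝ}
    (hmem : ∀ q : ℕ, q.Prime → q ≤ Real.exp t → W.Coprime q → q ≠ p₁ → q ∈ P) :
    ∑ n ∈ Ico 1 (⌊Real.exp t⌋₊ + 1) with W.Coprime n ∧ ¬ p₁ ∣ n, (1 / n : ℝ) ≤
      2 * primeSum P t := by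
  classical
  set M := ⌊Real.exp t⌋₊ with hM
  let S := (Ico 1 (M + 1)).filter fun n => W.Coprime n ∧ ¬ p₁ ∣ n
  have key : ∀ n ∈ S, ∃ D : Finset P, ∃ b ∈ Ioo 0 (M + 1), b ^ 2 * ∏ x ∈ D, (x : ℕ) = n ∧
      ∑ x ∈ D, Real.log x ≤ t := by
    intro n hn
    obtain ⟨hn1, hn2, hn3⟩ := mem_filter.1 hn
    rw [mem_Ico] at hn1
    obtain ⟨a, b, ha, hb, hab, hsq⟩ := Nat.sq_mul_squarefree_of_pos hn1.1
    have haM : a ≤ M := (Nat.le_of_dvd hn1.1 ⟨b ^ 2, by rw [← hab]; ring⟩).trans (by omega)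
    have hbM : b ≤ M := (Nat.le_of_dvd hn1.1 ⟨b * a, by rw [← hab]; ring⟩).trans (by omega)
    have hdvd : a ∣ n := ⟨b ^ 2, by rw [← hab]; ring⟩
    have hsub : ∀ q ∈ a.primeFactors, q ∈ P := by
      intro q hq
      have hqa := Nat.dvd_of_mem_primeFactors hq
      refine hmem q (Nat.prime_of_mem_primeFactors hq) ?_
        (hn2.coprime_dvd_right (hqa.trans hdvd)) ?_
      · have : q ≤ M := (Nat.le_of_dvd ha hqa).trans haM
        exact (Nat.le_floor_iff (Real.exp_pos t).le).1 this
      · rintro rfl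
        exact hn3 (hqa.trans hdvd)
    have hprod : ∏ x ∈ a.primeFactors.subtype (· ∈ P), (x : ℕ) = a := by
      rw [prod_subtype_of_mem (fun x => x) hsub]
      exact Nat.prod_primeFactors_of_squarefree hsq
    refine ⟨a.primeFactors.subtype (· ∈ P), b, mem_Ioo.2 ⟨hb, by omega⟩, by rw [hprod, hab], ?_⟩
    rw [sum_log_le_iff hP, hprod]
    exact haM
  choose! D b hb hprod hlog using key
  have hinj : Set.InjOn (fun n => (D n, b n)) (S : Set ℕ) := by
    intro n hn n' hn' h
    obtain ⟨h1, h2⟩ := Prod.mk.inj h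
    rw [← hprod n hn, ← hprod n' hn', h1, h2]
  let g : Finset P × ℕ → ℝ := fun z =>
    (if ∑ x ∈ z.1, Real.log x ≤ t then (∏ x ∈ z.1, (x : ℝ))⁻¹ else 0) * ((z.2:ℝ) ^ 2)⁻¹
  calc _ = ∑ n ∈ S, g (D n, b n) := by
        refine sum_congr rfl fun n hn => ?_
        simp only [g]
        rw [if_pos (hlog n hn), ← mul_inv, one_div]
        congr 1
        conv_lhs => rw [← hprod n hn]
        push_cast
        ring
    _ = ∑ z ∈ S.image fun n => (D n, b n), g z := (sum_image hinj).symm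
    _ ≤ ∑ z ∈ univ ×ˢ Ioo 0 (M + 1), g z := by
        refine sum_le_sum_of_subset_of_nonneg (fun z hz => ?_) fun z _ _ => ?_
        · obtain ⟨n, hn, rfl⟩ := mem_image.1 hz
          exact mem_product.2 ⟨mem_univ _, hb n hn⟩
        · simp only [g]
          split_ifs
          · exact mul_nonneg (inv_nonneg.2 (prod_nonneg fun x _ => by positivity)) (by positivity)
          · simp
    _ = primeSum P t * ∑ b ∈ Ioo 0 (M + 1), ((b:ℝ) ^ 2)⁻¹ := by
        rw [sum_product, primeSum, sum_mul]
        exact sum_congr rfl fun D _ => by rw [mul_sum]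
    _ ≤ primeSum P t * 2 := by
        refine mul_le_mul_of_nonneg_left ?_ (sum_nonneg fun D _ => ?_)
        · simpa using sum_Ioo_inv_sq_le (α := ℝ) 0 (M + 1)
        · split_ifs
          · exact inv_nonneg.2 (prod_nonneg fun x _ => by positivity)
          · exact le_rfl
    _ = _ := mul_comm _ _

theorem coprimeSum_le_primeSum {P : Finset ℕ} (hP : ∀ p ∈ P, p.Prime) {W p₁ : ℕ} (hp₁ : 2 ≤ p₁)
    {t : ℝ} (hmem : ∀ q : ℕ, q.Prime → q ≤ Real.exp t → W.Coprime q → q ≠ p₁ → q ∈ P) :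
    coprimeSum W t ≤ 4 * primeSum P t := by
  have h1 := sum_coprime_not_dvd_le hP hmem
  have h2 : ∑ n ∈ Ico 1 (⌊Real.exp t⌋₊ + 1) with W.Coprime n ∧ p₁ ∣ n, (1 / n : ℝ) ≤
      1 / 2 * coprimeSum W t := by
    unfold coprimeSum
    rw [mul_sum]
    calc _ = ∑ n ∈ Ico 1 (⌊Real.exp t⌋₊ + 1) with W.Coprime n ∧ p₁ ∣ n,
          (1 / p₁ * (1 / (n / p₁ : ℕ)) : ℝ) := by
          refine sum_congr rfl fun n hn => ?_
          obtain ⟨m, rfl⟩ := (mem_filter.1 hn).2.2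
          rw [Nat.mul_div_cancel_left _ (by omega)]
          push_cast
          rw [one_div_mul_one_div]
      _ = ∑ m ∈ ((Ico 1 (⌊Real.exp t⌋₊ + 1)).filter fun n => W.Coprime n ∧ p₁ ∣ n).image (· / p₁),
          (1 / p₁ * (1 / m) : ℝ) := by
          refine (sum_image (f := fun m : ℕ => (1 / p₁ * (1 / m) : ℝ)) (g := (· / p₁)) ?_).symm
          intro n hn n' hn' h
          obtain ⟨m, rfl⟩ := (mem_filter.1 hn).2.2
          obtain ⟨m', rfl⟩ := (mem_filter.1 hn').2.2
          simp only [Nat.mul_div_cancel_left _ (show 0 < p₁ by omega)] at h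
          rw [h]
      _ ≤ ∑ n ∈ Ico 1 (⌊Real.exp t⌋₊ + 1) with W.Coprime n, (1 / p₁ * (1 / n) : ℝ) := by
          refine sum_le_sum_of_subset_of_nonneg (fun m hm => ?_) fun n _ _ => by positivity
          obtain ⟨n, hn, rfl⟩ := mem_image.1 hm
          obtain ⟨hn1, hn2, m, rfl⟩ := mem_filter.1 hn
          rw [Nat.mul_div_cancel_left _ (by omega)]
          rw [mem_Ico] at hn1
          refine mem_filter.2 ⟨mem_Ico.2 ⟨?_, ?_⟩, hn2.coprime_dvd_right ⟨p₁, mul_comm _ _⟩⟩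
          · exact Nat.pos_of_ne_zero fun h => by simp [h] at hn1
          · nlinarith [hn1.2]
      _ ≤ _ := by
          refine sum_le_sum fun n _ => ?_
          have : (2:ℝ) ≤ p₁ := by exact_mod_cast hp₁
          gcongr
  have h3 : coprimeSum W t = ∑ n ∈ Ico 1 (⌊Real.exp t⌋₊ + 1) with W.Coprime n ∧ p₁ ∣ n,
      (1 / n : ℝ) + ∑ n ∈ Ico 1 (⌊Real.exp t⌋₊ + 1) with W.Coprime n ∧ ¬ p₁ ∣ n, (1 / n : ℝ) := by
    unfold coprimeSum
    rw [← sum_filter_add_sum_filter_not _ (fun n => p₁ ∣ n), filter_filter, filter_filter]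
  linarith

end PrimeGaps

namespace PrimeGaps

open Finset

/-- A decreasing step function, a discrete analogue of `L / t` for `L ≤ t ≤ 2 ^ J * L`. -/
noncomputable def stepFun (J : ℕ) (L t : ℝ) : ℝ :=
  ∑ j ∈ range J, (1 / 2 : ℝ) ^ j * if t ≤ 2 ^ j * L then 1 else 0

theorem stepFun_nonneg (J : ℕ) (L t : ℝ) : 0 ≤ stepFun J L t :=
  sum_nonneg fun j _ => mul_nonneg (by positivity) (by split_ifs <;> norm_num)

theorem stepFun_anti (J : ℕ) (L : ℝ) {s t : ℝ} (h : s ≤ t) : stepFun J L t ≤ stepFun J L s := by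
  refine sum_le_sum fun j _ => mul_le_mul_of_nonneg_left ?_ (by positivity)
  split_ifs with h1 h2
  exacts [le_rfl, absurd (h.trans h1) h2, zero_le_one, le_rfl]

theorem one_le_stepFun {J : ℕ} (hJ : 0 < J) {L t : ℝ} (h : t ≤ L) : 1 ≤ stepFun J L t := by
  have := single_le_sum (f := fun j => (1 / 2 : ℝ) ^ j * if t ≤ 2 ^ j * L then (1:ℝ) else 0)
    (fun j _ => mul_nonneg (by positivity) (by split_ifs <;> norm_num)) (mem_range.2 hJ)
  simpa [stepFun, h] using this

theorem le_of_stepFun_ne_zero {J : ℕ} {L t : ℝ} (hL : 0 ≤ L) (h : stepFun J L t ≠ 0) :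
    t ≤ 2 ^ J * L := by
  obtain ⟨j, hj, h1⟩ := exists_ne_zero_of_sum_ne_zero h
  have h2 : t ≤ 2 ^ j * L := by
    by_contra h3
    simp [h3] at h1
  refine h2.trans ?_
  have := (mem_range.1 hj).le
  gcongr
  norm_num

theorem sum_half_pow_le (J : ℕ) : ∑ j ∈ range J, (1 / 2 : ℝ) ^ j ≤ 2 :=
  sum_geometric_two_le J

theorem stepFun_sq_le (J : ℕ) (L t : ℝ) :
    stepFun J L t ^ 2 ≤ 4 * ∑ j ∈ range J, (1 / 4 : ℝ) ^ j * if t ≤ 2 ^ j * L then 1 else 0 := by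
  induction J with
  | zero => simp [stepFun]
  | succ J ih =>
    have hs : stepFun (J + 1) L t = stepFun J L t + (1 / 2 : ℝ) ^ J * if t ≤ 2 ^ J * L then 1 else 0 :=
      sum_range_succ _ _
    by_cases h : ∃ j < J, t ≤ 2 ^ j * L
    · classical
      let i := Nat.find h
      have hi : i < J ∧ t ≤ 2 ^ i * L := Nat.find_spec h
      have hmin : ∀ j < i, ¬ t ≤ 2 ^ j * L := fun j hj h' =>
        Nat.find_min h hj ⟨hj.trans hi.1, h'⟩
      have h1 : stepFun (J + 1) L t ≤ 2 * (1 / 2) ^ i := by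
        have : J + 1 = i + (J + 1 - i) := by omega
        rw [stepFun, this, sum_range_add, sum_eq_zero fun j hj => by
          rw [if_neg (hmin j (mem_range.1 hj)), mul_zero], zero_add]
        calc _ ≤ ∑ j ∈ range (J + 1 - i), (1 / 2 : ℝ) ^ i * (1 / 2) ^ j := by
              refine sum_le_sum fun j _ => ?_
              rw [pow_add]
              exact mul_le_of_le_one_right (by positivity) (by split_ifs <;> norm_num)
          _ ≤ _ := by
              rw [← mul_sum, mul_comm]
              exact mul_le_mul_of_nonneg_right (sum_half_pow_le _) (by positivity)
      calc stepFun (J + 1) L t ^ 2 ≤ (2 * (1 / 2) ^ i) ^ 2 :=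
            pow_le_pow_left₀ (stepFun_nonneg _ _ _) h1 2
        _ = 4 * ((1 / 4 : ℝ) ^ i * if t ≤ 2 ^ i * L then 1 else 0) := by
            rw [if_pos hi.2, mul_pow, ← pow_mul, mul_comm i, pow_mul]
            norm_num
        _ ≤ _ := mul_le_mul_of_nonneg_left (single_le_sum
            (f := fun j => (1 / 4 : ℝ) ^ j * if t ≤ 2 ^ j * L then (1:ℝ) else 0)
            (fun j _ => mul_nonneg (by positivity) (by split_ifs <;> norm_num))
            (mem_range.2 (by omega : i < J + 1))) (by norm_num)
    · push Not at h
      have h0 : stepFun J L t = 0 := sum_eq_zero fun j hj => by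
        rw [if_neg (h j (mem_range.1 hj)).not_ge, mul_zero]
      rw [hs, h0, zero_add, sum_range_succ, mul_add, mul_pow, ← pow_mul, mul_comm J, pow_mul]
      have h1 : 0 ≤ ∑ j ∈ range J, (1 / 4 : ℝ) ^ j * if t ≤ 2 ^ j * L then (1:ℝ) else 0 :=
        sum_nonneg fun j _ => mul_nonneg (by positivity) (by split_ifs <;> norm_num)
      have h2 : (0:ℝ) ≤ (1 / 4) ^ J := by positivity
      set S := ∑ j ∈ range J, (1 / 4 : ℝ) ^ j * if t ≤ 2 ^ j * L then (1:ℝ) else 0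
      split_ifs <;> norm_num <;> linarith

theorem sum_mul_prod_one_add_le {ι : Type*} [Fintype ι] [DecidableEq ι] {f : Finset ι → ℝ}
    (hf : ∀ D, 0 ≤ f D) {κ π : ι → ℝ} (hκ : ∀ x, 0 ≤ κ x) (hπ : ∀ x, 0 ≤ π x)
    (h : ∀ D, ∀ x ∈ D, f D ≤ π x * f (D.erase x)) (T : Finset ι) :
    ∑ D, f D * ∏ x ∈ D ∩ T, (1 + κ x) ≤ (∏ x ∈ T, (1 + κ x * π x)) * ∑ D, f D := by
  induction T using Finset.induction_on with
  | empty => simp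
  | insert y T hy ih =>
    have h1 : ∀ D : Finset ι, ∏ x ∈ D ∩ insert y T, (1 + κ x) =
        (∏ x ∈ D ∩ T, (1 + κ x)) * (1 + if y ∈ D then κ y else 0) := by
      intro D
      by_cases hD : y ∈ D
      · rw [if_pos hD, inter_insert_of_mem hD, prod_insert (fun h => hy (mem_inter.1 h).2), mul_comm]
      · rw [if_neg hD, inter_insert_of_notMem hD, add_zero, mul_one]
    have hf' : ∀ D, 0 ≤ f D * ∏ x ∈ D ∩ T, (1 + κ x) := fun D =>
      mul_nonneg (hf D) (prod_nonneg fun x _ => by have := hκ x; positivity)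
    have h2 := sum_filter_mem_le hf' (hπ y) y fun D hD => by
      have : D.erase y ∩ T = D ∩ T := by
        ext z
        simp only [mem_inter, mem_erase]
        constructor
        · exact fun hz => ⟨hz.1.2, hz.2⟩
        · exact fun hz => ⟨⟨fun hzy => hy (hzy ▸ hz.2), hz.1⟩, hz.2⟩
      rw [this, ← mul_assoc]
      exact mul_le_mul_of_nonneg_right (h D y hD)
        (prod_nonneg fun x _ => by have := hκ x; positivity)
    rw [prod_insert hy, mul_assoc]
    have h3 : 0 ≤ 1 + κ y * π y := by have := hκ y; have := hπ y; positivity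
    refine le_trans ?_ (mul_le_mul_of_nonneg_left ih h3)
    calc _ = ∑ D, f D * ∏ x ∈ D ∩ T, (1 + κ x) +
          κ y * ∑ D with y ∈ D, f D * ∏ x ∈ D ∩ T, (1 + κ x) := by
          rw [sum_filter, mul_sum, ← sum_add_distrib]
          refine sum_congr rfl fun D _ => ?_
          rw [h1]
          split_ifs <;> ring
      _ ≤ _ := by nlinarith [mul_le_mul_of_nonneg_left h2 (hκ y)]

theorem sum_prod_le_primeSum {P : Finset ℕ} (hP : ∀ p ∈ P, p.Prime) {k : ℕ}
    (hδ : ∑ x : P, (k:ℝ) / (x:ℝ) ^ 2 ≤ 1 / 4) (t : ℝ) :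
    ∑ D : Finset P, (if ∑ x ∈ D, Real.log x ≤ t then 1 else 0) *
      ∏ x ∈ D, ((x:ℝ) + k) / (x:ℝ) ^ 2 ≤ 3 / 2 * primeSum P t := by
  classical
  have hp1 : ∀ x : P, (1:ℝ) ≤ (x:ℕ) := fun x => by exact_mod_cast (hP x x.2).one_le
  have hp0 : ∀ x : P, (0:ℝ) < (x:ℕ) := fun x => one_pos.trans_le (hp1 x)
  let f : Finset P → ℝ := fun D => if ∑ x ∈ D, Real.log x ≤ t then (∏ x ∈ D, (x : ℝ))⁻¹ else 0
  have hf : ∀ D, 0 ≤ f D := fun D => by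
    simp only [f]
    split_ifs
    exacts [inv_nonneg.2 (prod_nonneg fun x _ => (hp0 x).le), le_rfl]
  have h1 := sum_mul_prod_one_add_le hf (κ := fun x : P => (k:ℝ) / (x:ℝ))
    (π := fun x : P => 1 / (x:ℝ)) (fun x => by positivity) (fun x => by positivity)
    (fun D y hy => by
      simp only [f]
      have h2 := sum_erase_add D (fun x : P => Real.log x) hy
      have h3 := prod_erase_mul D (fun x : P => (x:ℝ)) hy
      have h4 : 0 ≤ Real.log (y:ℕ) := Real.log_nonneg (hp1 y)
      rw [← h2, ← h3]
      by_cases h : ∑ x ∈ D.erase y, Real.log (x:ℕ) + Real.log (y:ℕ) ≤ t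
      · rw [if_pos h, if_pos (by linarith), mul_inv, mul_comm, one_div]
      · rw [if_neg h]
        have : (0:ℝ) ≤ ∏ x ∈ D.erase y, (x:ℝ) := prod_nonneg fun x _ => (hp0 x).le
        split_ifs <;> positivity) univ
  have h2 : ∏ x : P, (1 + (k:ℝ) / (x:ℝ) * (1 / (x:ℝ))) ≤ 3 / 2 := by
    refine prod_one_add_le_of_sum_le (fun x _ => by positivity) (le_trans (le_of_eq ?_) hδ)
    refine sum_congr rfl fun x _ => ?_
    rw [div_mul_div_comm, mul_one, sq]
  refine le_trans (le_of_eq (sum_congr rfl fun D _ => ?_)) (h1.trans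
    (mul_le_mul_of_nonneg_right h2 (sum_nonneg fun D _ => hf D)))
  rw [inter_univ]
  simp only [f]
  split_ifs
  · rw [one_mul, ← prod_inv_distrib, ← prod_mul_distrib]
    refine prod_congr rfl fun x _ => ?_
    have := hp0 x
    field_simp
  · simp

variable {P : Finset ℕ} {k J : ℕ} {L ρ : ℝ}

/-- The sieve weight attached to a set of primes. -/
noncomputable def stepWeight (P : Finset ℕ) (J : ℕ) (L : ℝ) (D : Finset P) : ℝ :=
  stepFun J L (∑ x ∈ D, Real.log x)

theorem le_sum_stepWeight (hL : 0 ≤ L)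
    (hlo : ∀ t, L ≤ t → t ≤ 2 ^ J * L → ρ * t / 8 ≤ primeSum P t) :
    ρ * J * L / 8 ≤ ∑ D, stepWeight P J L D * (∏ x ∈ D, (x : ℝ))⁻¹ := by
  have h1 : ∑ D, stepWeight P J L D * (∏ x ∈ D, (x : ℝ))⁻¹ =
      ∑ j ∈ range J, (1 / 2 : ℝ) ^ j * primeSum P (2 ^ j * L) := by
    simp_rw [stepWeight, stepFun, sum_mul, primeSum, mul_sum]
    rw [Finset.sum_comm]
    refine sum_congr rfl fun j _ => sum_congr rfl fun D _ => ?_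
    split_ifs <;> simp
  rw [h1]
  calc ρ * J * L / 8 = ∑ j ∈ range J, (1 / 2 : ℝ) ^ j * (ρ * (2 ^ j * L) / 8) := by
        have : ∀ j : ℕ, (1 / 2 : ℝ) ^ j * (ρ * (2 ^ j * L) / 8) = ρ * L / 8 := fun j => by
          rw [show (1 / 2 : ℝ) ^ j * (ρ * (2 ^ j * L) / 8) = (1 / 2 : ℝ) ^ j * 2 ^ j * (ρ * L / 8) by
            ring, ← mul_pow]
          norm_num
        simp_rw [this]
        rw [sum_const, card_range, nsmul_eq_mul]
        ring
    _ ≤ _ := sum_le_sum fun j hj => by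
        have h2 : (2:ℝ) ^ j ≤ 2 ^ J := pow_le_pow_right₀ (by norm_num) (mem_range.1 hj).le
        have h3 : (1:ℝ) ≤ 2 ^ j := one_le_pow₀ (by norm_num)
        exact mul_le_mul_of_nonneg_left (hlo _ (le_mul_of_one_le_left hL h3) (by gcongr))
          (by positivity)

theorem le_sum_weight_stepWeight (hP : ∀ p ∈ P, p.Prime) (hJ : 0 < J) (hL : 0 ≤ L)
    (hlo : ∀ t, L ≤ t → t ≤ 2 ^ J * L → ρ * t / 8 ≤ primeSum P t) :
    ρ * L / 8 ≤ ∑ D, weight k (fun x : P => (x:ℝ)) (stepWeight P J L) D := by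
  refine (hlo L le_rfl (le_mul_of_one_le_left hL (one_le_pow₀ (by norm_num)))).trans ?_
  have hp0 : ∀ x : P, (0:ℝ) < (x:ℕ) := fun x => by exact_mod_cast (hP x x.2).pos
  refine sum_le_sum fun D _ => ?_
  split_ifs with h
  · unfold weight
    have h1 : 1 ≤ stepWeight P J L D := one_le_stepFun hJ h
    have h2 : (∏ x ∈ D, (x : ℝ))⁻¹ ≤ ∏ x ∈ D, ((x:ℝ) + k) / (x:ℝ) ^ 2 := by
      rw [← prod_inv_distrib]
      refine prod_le_prod (fun x _ => by positivity) fun x _ => ?_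
      have := hp0 x
      rw [inv_eq_one_div, div_le_div_iff₀ this (by positivity)]
      nlinarith [mul_nonneg (Nat.cast_nonneg (α := ℝ) k) this.le]
    refine h2.trans (le_mul_of_one_le_left (prod_nonneg fun x _ => by positivity) ?_)
    exact one_le_pow₀ h1
  · exact weight_nonneg (fun x => by exact_mod_cast (hP x x.2).one_le) _ _

theorem sum_weight_mul_le (hP : ∀ p ∈ P, p.Prime)
    (hδ : ∑ x : P, (k:ℝ) / (x:ℝ) ^ 2 ≤ 1 / 4) (hL : 0 ≤ L)
    (hup : ∀ t, L ≤ t → t ≤ 2 ^ J * L → primeSum P t ≤ 2 * (ρ * t))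
    {g : Finset P → ℝ} {B : ℕ → ℝ} (hB : ∀ j, 0 ≤ B j)
    (hg : ∀ (j : ℕ) (D : Finset P), ∑ x ∈ D, Real.log (x : ℕ) ≤ 2 ^ j * L → g D ≤ B j) :
    ∑ D, weight k (fun x : P => (x:ℝ)) (stepWeight P J L) D * g D ≤
      12 * ρ * L * ∑ j ∈ range J, (1 / 2 : ℝ) ^ j * B j := by
  have hnn : ∀ D : Finset P, 0 ≤ ∏ x ∈ D, ((x:ℝ) + k) / (x:ℝ) ^ 2 := fun D =>
    prod_nonneg fun x _ => by positivity
  have h0 : ∀ D : Finset P, weight k (fun x : P => (x:ℝ)) (stepWeight P J L) D * g D ≤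
      ∑ j ∈ range J, 4 * (1 / 4 : ℝ) ^ j * B j * ((if ∑ x ∈ D, Real.log x ≤ 2 ^ j * L then 1 else 0) *
      ∏ x ∈ D, ((x:ℝ) + k) / (x:ℝ) ^ 2) := by
    intro D
    by_cases hgD : 0 ≤ g D
    · calc _ ≤ (4 * ∑ j ∈ range J, (1 / 4 : ℝ) ^ j *
            if ∑ x ∈ D, Real.log x ≤ 2 ^ j * L then 1 else 0) *
            (∏ x ∈ D, ((x:ℝ) + k) / (x:ℝ) ^ 2) * g D := by
            refine mul_le_mul_of_nonneg_right ?_ hgD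
            exact mul_le_mul_of_nonneg_right (stepFun_sq_le J L _) (hnn D)
        _ = ∑ j ∈ range J, 4 * (1 / 4 : ℝ) ^ j * g D *
            ((if ∑ x ∈ D, Real.log x ≤ 2 ^ j * L then 1 else 0) *
            ∏ x ∈ D, ((x:ℝ) + k) / (x:ℝ) ^ 2) := by
            rw [mul_sum, sum_mul, sum_mul]
            exact sum_congr rfl fun j _ => by ring
        _ ≤ _ := by
            refine sum_le_sum fun j _ => ?_
            split_ifs with h
            · have := hg j D h
              have := hnn D
              gcongr
            · simp
    · refine (mul_nonpos_of_nonneg_of_nonpos ?_ (not_le.1 hgD).le).trans ?_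
      · exact weight_nonneg (fun x => by exact_mod_cast (hP x x.2).one_le) _ _
      · refine sum_nonneg fun j _ => mul_nonneg (mul_nonneg (by positivity) (hB j))
          (mul_nonneg ?_ (hnn D))
        split_ifs <;> norm_num
  refine (sum_le_sum fun D _ => h0 D).trans ?_
  rw [Finset.sum_comm, mul_sum]
  refine sum_le_sum fun j hj => ?_
  rw [← mul_sum]
  have h2 : (2:ℝ) ^ j ≤ 2 ^ J := pow_le_pow_right₀ (by norm_num) (mem_range.1 hj).le
  have h3 : (1:ℝ) ≤ 2 ^ j := one_le_pow₀ (by norm_num)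
  have h4 := hup (2 ^ j * L) (le_mul_of_one_le_left hL h3) (by gcongr)
  have h5 := hB j
  calc _ ≤ 4 * (1 / 4 : ℝ) ^ j * B j * (3 / 2 * (2 * (ρ * (2 ^ j * L)))) := by
        refine mul_le_mul_of_nonneg_left ?_ (by positivity)
        exact (sum_prod_le_primeSum hP hδ _).trans (by linarith)
    _ = 12 * ρ * L * (((1 / 4 : ℝ) ^ j * 2 ^ j) * B j) := by ring
    _ = _ := by rw [← mul_pow]; norm_num

theorem sum_weight_stepWeight_le (hP : ∀ p ∈ P, p.Prime)
    (hδ : ∑ x : P, (k:ℝ) / (x:ℝ) ^ 2 ≤ 1 / 4) (hL : 0 ≤ L) (hρ : 0 ≤ ρ)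
    (hup : ∀ t, L ≤ t → t ≤ 2 ^ J * L → primeSum P t ≤ 2 * (ρ * t)) :
    ∑ D, weight k (fun x : P => (x:ℝ)) (stepWeight P J L) D ≤ 24 * ρ * L := by
  have := sum_weight_mul_le hP hδ hL hup (g := fun _ => 1) (B := fun _ => 1)
    (fun _ => zero_le_one) fun _ _ _ => le_rfl
  simp only [mul_one] at this
  refine this.trans ?_
  have := mul_le_mul_of_nonneg_left (sum_half_pow_le J) (show 0 ≤ 12 * ρ * L by positivity)
  linarith

theorem sum_weight_mul_log_le (hP : ∀ p ∈ P, p.Prime)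
    (hδ : ∑ x : P, (k:ℝ) / (x:ℝ) ^ 2 ≤ 1 / 4) (hL : 0 ≤ L)
    (hup : ∀ t, L ≤ t → t ≤ 2 ^ J * L → primeSum P t ≤ 2 * (ρ * t)) :
    ∑ D, weight k (fun x : P => (x:ℝ)) (stepWeight P J L) D * ∑ x ∈ D, Real.log (x : ℕ) ≤
      12 * ρ * J * L ^ 2 := by
  refine (sum_weight_mul_le hP hδ hL hup (B := fun j => 2 ^ j * L) (fun _ => by positivity)
    fun _ _ h => h).trans (le_of_eq ?_)
  simp_rw [← mul_assoc, ← mul_pow]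
  norm_num
  ring

end PrimeGaps

namespace PrimeGaps

open Finset

/-- A periodic sequence whose mean over a period is `M`. -/
def HasMean (a : ℕ → ℝ) (q : ℕ) (M : ℝ) : Prop :=
  Function.Periodic a q ∧ ∑ n ∈ range q, a n = q * M

theorem hasMean_one : HasMean (fun _ => 1) 1 1 := ⟨fun _ => rfl, by simp⟩

theorem HasMean.mul {a b : ℕ → ℝ} {q q' : ℕ} {M M' : ℝ} (ha : HasMean a q M) (hb : HasMean b q' M')
    (hqq : q.Coprime q') (hq : 0 < q) (hq' : 0 < q') :
    HasMean (fun n => a n * b n) (q * q') (M * M') := by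
  refine ⟨fun n => ?_, ?_⟩
  · have h1 : a (n + q * q') = a n := by
      rw [mul_comm]; exact_mod_cast ha.1.nat_mul q' n
    have h2 : b (n + q * q') = b n := by
      exact_mod_cast hb.1.nat_mul q n
    show a (n + q * q') * b (n + q * q') = a n * b n
    rw [h1, h2]
  · have hinj : Set.InjOn (fun n => (n % q, n % q')) (range (q * q') : Set ℕ) := by
      intro m hm n hn h
      simp only [coe_range, Set.mem_Iio] at hm hn
      simp only [Prod.mk.injEq] at h
      exact Nat.ModEq.eq_of_lt_of_lt ((Nat.modEq_and_modEq_iff_modEq_mul hqq).1 h) hm hn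
    have himg : (range (q * q')).image (fun n => (n % q, n % q')) = range q ×ˢ range q' := by
      refine eq_of_subset_of_card_le (fun x hx => ?_) ?_
      · obtain ⟨n, -, rfl⟩ := mem_image.1 hx
        simp [Nat.mod_lt _ hq, Nat.mod_lt _ hq']
      · rw [card_image_of_injOn hinj]; simp
    calc ∑ n ∈ range (q * q'), a n * b n
        = ∑ n ∈ range (q * q'), a (n % q) * b (n % q') := by
          refine sum_congr rfl fun n _ => ?_
          rw [ha.1.map_mod_nat, hb.1.map_mod_nat]
      _ = ∑ x ∈ range q ×ˢ range q', a x.1 * b x.2 := by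
          rw [← himg, sum_image (f := fun x => a x.1 * b x.2) hinj]
      _ = (∑ n ∈ range q, a n) * ∑ n ∈ range q', b n := by
          rw [sum_product, sum_mul_sum]
      _ = _ := by rw [ha.2, hb.2]; push_cast; ring

theorem HasMean.prod {ι : Type*} {s : Finset ι} {a : ι → ℕ → ℝ} {q : ι → ℕ} {M : ι → ℝ}
    (ha : ∀ i ∈ s, HasMean (a i) (q i) (M i)) (hq : ∀ i ∈ s, 0 < q i)
    (hco : ∀ i ∈ s, ∀ j ∈ s, i ≠ j → (q i).Coprime (q j)) :
    HasMean (fun n => ∏ i ∈ s, a i n) (∏ i ∈ s, q i) (∏ i ∈ s, M i) := by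
  classical
  induction s using Finset.induction_on with
  | empty => simpa using hasMean_one
  | insert i s hi ih =>
    simp_rw [prod_insert hi]
    refine (ha i (mem_insert_self _ _)).mul (ih (fun j hj => ha j (mem_insert_of_mem hj))
      (fun j hj => hq j (mem_insert_of_mem hj))
      fun j hj l hl => hco j (mem_insert_of_mem hj) l (mem_insert_of_mem hl)) ?_
      (hq i (mem_insert_self _ _)) (prod_pos fun j hj => hq j (mem_insert_of_mem hj))
    exact Nat.Coprime.prod_right fun j hj => hco i (mem_insert_self _ _) j (mem_insert_of_mem hj)
      (by rintro rfl; exact hi hj)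

variable {k : ℕ}

/-- The local sieve function at `p` with shifts `h`. -/
noncomputable def loc (p : ℕ) (h : Fin k → ℤ) : Option (Fin k) → ℕ → ℝ
  | none, _ => 1
  | some i, n => 1 - p * if (p : ℤ) ∣ n + h i then 1 else 0

theorem loc_periodic (p : ℕ) (h : Fin k → ℤ) (a : Option (Fin k)) :
    Function.Periodic (loc p h a) p := by
  intro n
  cases a with
  | none => rfl
  | some i =>
    have : (p : ℤ) ∣ ((n + p : ℕ) : ℤ) + h i ↔ (p : ℤ) ∣ n + h i := by
      rw [show ((n + p : ℕ) : ℤ) + h i = (n + h i) + p by push_cast; ring]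
      exact dvd_add_self_right
    simp only [loc, this]

theorem abs_loc_le {p : ℕ} (hp : 1 ≤ p) (h : Fin k → ℤ) (a : Option (Fin k)) (n : ℕ) :
    |loc p h a n| ≤ if a = none then 1 else (p : ℝ) := by
  have hp' : (1 : ℝ) ≤ p := by exact_mod_cast hp
  cases a with
  | none => simp [loc]
  | some i =>
    simp only [loc, reduceCtorEq, if_false]
    split_ifs
    · rw [abs_le]; constructor <;> linarith
    · simpa using hp'

theorem sum_range_dvd_add {p : ℕ} (hp : 0 < p) (c : ℤ) :
    ∑ n ∈ range p, (if (p : ℤ) ∣ n + c then (1 : ℝ) else 0) = 1 := by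
  have hp' : (0 : ℤ) < p := by exact_mod_cast hp
  rw [sum_eq_single ((-c) % p).toNat]
  · rw [if_pos]
    rw [Int.toNat_of_nonneg (Int.emod_nonneg _ hp'.ne')]
    have := Int.emod_add_mul_ediv (-c) p
    exact ⟨-((-c) / p), by linarith⟩
  · intro n hn hne
    rw [if_neg]
    intro hd
    apply hne
    have h1 : (n : ℤ) % p = (-c) % p := by
      refine Int.ModEq.symm ((Int.modEq_iff_dvd).2 ?_)
      simpa using hd
    rw [Int.emod_eq_of_lt (by positivity) (by exact_mod_cast mem_range.1 hn)] at h1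
    omega
  · intro hn
    exfalso
    apply hn
    rw [mem_range]
    have := Int.emod_lt_of_pos (-c) hp'
    have := Int.emod_nonneg (-c) hp'.ne'
    omega

theorem sum_range_dvd {p : ℕ} (hp : 0 < p) (g : ℕ → ℝ) :
    ∑ n ∈ range p, (if p ∣ n then 0 else 1) * g n = ∑ n ∈ range p, g n - g 0 := by
  obtain ⟨p, rfl⟩ := Nat.exists_eq_succ_of_ne_zero hp.ne'
  rw [sum_range_succ', sum_range_succ']
  simp only [dvd_zero, if_true, zero_mul, add_zero, add_sub_cancel_right]
  refine sum_congr rfl fun n hn => ?_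
  rw [if_neg, one_mul]
  intro hd
  have := Nat.le_of_dvd (by omega) hd
  have := mem_range.1 hn
  omega

theorem dvd_add_ite_mul {p : ℕ} {h : Fin k → ℤ} (hh : ∀ i j, i ≠ j → ¬ (p : ℤ) ∣ h i - h j)
    (i j : Fin k) (n : ℕ) :
    (if (p : ℤ) ∣ n + h i then (1 : ℝ) else 0) * (if (p : ℤ) ∣ n + h j then 1 else 0) =
      if i = j then (if (p : ℤ) ∣ n + h i then 1 else 0) else 0 := by
  by_cases hij : i = j
  · subst hij; simp
  · rw [if_neg hij]
    by_cases h1 : (p : ℤ) ∣ n + h i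
    · by_cases h2 : (p : ℤ) ∣ n + h j
      · refine absurd ?_ (hh i j hij)
        have := dvd_sub h1 h2
        simpa using this
      · simp [h2]
    · simp [h1]

theorem sum_loc_mul_loc {p : ℕ} (hp : 0 < p) {h : Fin k → ℤ}
    (hh : ∀ i j, i ≠ j → ¬ (p : ℤ) ∣ h i - h j) (a b : Option (Fin k)) :
    ∑ n ∈ range p, loc p h a n * loc p h b n = p * gram p a b := by
  cases a with
  | none =>
    cases b with
    | none => simp [loc, gram]
    | some j =>
      simp only [loc, one_mul, sum_sub_distrib, ← mul_sum, sum_range_dvd_add hp, gram]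
      simp
  | some i =>
    cases b with
    | none =>
      simp only [loc, mul_one, sum_sub_distrib, ← mul_sum, sum_range_dvd_add hp, gram]
      simp
    | some j =>
      have key : ∀ n : ℕ, loc p h (some i) n * loc p h (some j) n =
          1 - p * (if (p : ℤ) ∣ n + h i then (1 : ℝ) else 0) - p * (if (p : ℤ) ∣ n + h j then 1 else 0)
            + p ^ 2 * (if i = j then (if (p : ℤ) ∣ n + h i then 1 else 0) else 0) := by
        intro n
        rw [← dvd_add_ite_mul hh]
        simp only [loc]; ring
      simp_rw [key, sum_add_distrib, sum_sub_distrib, ← mul_sum, sum_range_dvd_add hp, gram]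
      by_cases hij : i = j
      · simp only [hij, if_true, sum_range_dvd_add hp]; simp; ring
      · simp [hij]

theorem hasMean_loc_mul_loc {p : ℕ} (hp : 0 < p) {h : Fin k → ℤ}
    (hh : ∀ i j, i ≠ j → ¬ (p : ℤ) ∣ h i - h j) (a b : Option (Fin k)) :
    HasMean (fun n => loc p h a n * loc p h b n) p (gram p a b) :=
  ⟨(loc_periodic p h a).mul (loc_periodic p h b), sum_loc_mul_loc hp hh a b⟩

theorem loc_zero {p : ℕ} {h : Fin k → ℤ} (hh : ∀ i j, i ≠ j → ¬ (p : ℤ) ∣ h i - h j) {m : Fin k}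
    (hm : h m = 0) (a : Option (Fin k)) : loc p h a 0 = if a = some m then 1 - (p : ℝ) else 1 := by
  cases a with
  | none => simp [loc]
  | some i =>
    by_cases hi : i = m
    · subst hi; simp [loc, hm]
    · have := hh i m hi
      rw [hm, sub_zero] at this
      simp [loc, this, hi]

theorem periodic_dvd (p : ℕ) : Function.Periodic (fun n => if p ∣ n then (0 : ℝ) else 1) p := by
  intro n
  simp

theorem hasMean_unit_loc_mul_loc {p : ℕ} (hp : 2 ≤ p) {h : Fin k → ℤ}
    (hh : ∀ i j, i ≠ j → ¬ (p : ℤ) ∣ h i - h j) {m : Fin k} (hm : h m = 0) (a b : Option (Fin k)) :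
    HasMean (fun n => (if p ∣ n then 0 else 1) * (loc p h a n * loc p h b n)) p
      ((p - 1) / p * gramUnit p m a b) := by
  refine ⟨(periodic_dvd p).mul ((loc_periodic p h a).mul (loc_periodic p h b)), ?_⟩
  have hp' : (2 : ℝ) ≤ p := by exact_mod_cast hp
  have h1 : (p : ℝ) - 1 ≠ 0 := by linarith
  have h0 : (p : ℝ) ≠ 0 := by linarith
  rw [sum_range_dvd (by omega) (fun n => loc p h a n * loc p h b n), sum_loc_mul_loc (by omega) hh,
    loc_zero hh hm, loc_zero hh hm, ← mul_assoc, mul_div_cancel₀ _ h0]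
  rcases a with _ | i <;> rcases b with _ | j
  · simp [gram, gramUnit, unitMean]
  · by_cases hj : j = m <;> simp [gram, gramUnit, unitMean, hj] <;> field_simp
  · by_cases hi : i = m <;> simp [gram, gramUnit, unitMean, hi] <;> field_simp
  · by_cases hi : i = m
    · by_cases hj : j = m
      · simp [gram, gramUnit, unitMean, hi, hj]; ring
      · have : m ≠ j := fun e => hj e.symm
        simp [gram, gramUnit, unitMean, hi, hj, this]; field_simp; ring
    · by_cases hj : j = m
      · simp [gram, gramUnit, unitMean, hi, hj]; field_simp; ring
      · by_cases hij : i = j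
        · simp [gram, gramUnit, unitMean, hij, hj]; field_simp; ring
        · simp [gram, gramUnit, unitMean, hij, hi, hj]; field_simp; ring

end PrimeGaps

namespace PrimeGaps

open Finset

variable {ι : Type*} {k : ℕ}

/-- A majorant for the absolute Gram matrix of the local sieve functions on unit residues. -/
noncomputable def absGram (p : ℝ) (a b : Option (Fin k)) : ℝ :=
  if a = none ∧ b = none then 1 else if a = b then 8 * p else 6

theorem absGram_nonneg {p : ℝ} (hp : 0 ≤ p) (a b : Option (Fin k)) : 0 ≤ absGram p a b := by
  unfold absGram; split_ifs <;> positivity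

theorem sum_abs_unit_loc_le {p : ℕ} (hp : 2 ≤ p) {h : Fin k → ℤ}
    (hh : ∀ i j, i ≠ j → ¬ (p : ℤ) ∣ h i - h j) (a b : Option (Fin k)) :
    ∑ n ∈ range p, (if p ∣ n then 0 else 1) * |loc p h a n * loc p h b n| ≤
      (p - 1) * absGram p a b := by
  have hp' : (2 : ℝ) ≤ p := by exact_mod_cast hp
  have hp0 : 0 < p := by omega
  have drop : ∀ n ∈ range p, (if p ∣ n then (0 : ℝ) else 1) * |loc p h a n * loc p h b n| ≤
      |loc p h a n| * |loc p h b n| := by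
    intro n _
    rw [abs_mul]
    split_ifs
    · rw [zero_mul]; positivity
    · rw [one_mul]
  have habs : ∀ i n, |loc p h (some i) n| ≤ 1 + p * if (p : ℤ) ∣ n + h i then (1 : ℝ) else 0 := by
    intro i n
    simp only [loc]
    split_ifs
    · rw [abs_le]; constructor <;> linarith
    · simp
  rcases a with _ | i <;> rcases b with _ | j
  · have := sum_range_dvd hp0 (fun n => |loc p h none n * loc p h none n|)
    rw [this]
    simp [loc, absGram]
  · refine (sum_le_sum fun n hn => (drop n hn).trans (mul_le_mul_of_nonneg_left (habs j n)
      (abs_nonneg _))).trans ?_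
    simp only [loc, abs_one, one_mul, sum_add_distrib, ← mul_sum, sum_range_dvd_add hp0, absGram]
    simp
    linarith
  · refine (sum_le_sum fun n hn => (drop n hn).trans (mul_le_mul_of_nonneg_right (habs i n)
      (abs_nonneg _))).trans ?_
    simp only [loc, abs_one, mul_one, sum_add_distrib, ← mul_sum, sum_range_dvd_add hp0, absGram]
    simp
    linarith
  · refine (sum_le_sum fun n hn => (drop n hn).trans (mul_le_mul (habs i n) (habs j n)
      (abs_nonneg _) (by positivity))).trans ?_
    have key : ∀ n : ℕ, (1 + p * if (p : ℤ) ∣ n + h i then (1 : ℝ) else 0) *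
        (1 + p * if (p : ℤ) ∣ n + h j then (1 : ℝ) else 0) =
          1 + p * (if (p : ℤ) ∣ n + h i then (1 : ℝ) else 0) + p * (if (p : ℤ) ∣ n + h j then 1 else 0)
            + p ^ 2 * (if i = j then (if (p : ℤ) ∣ n + h i then 1 else 0) else 0) := by
      intro n
      rw [← dvd_add_ite_mul hh]; ring
    simp_rw [key, sum_add_distrib, ← mul_sum, sum_range_dvd_add hp0, absGram]
    by_cases hij : i = j
    · simp only [hij, if_true, sum_range_dvd_add hp0]; simp; nlinarith
    · simp [hij]; linarith

theorem sum_sum_prod_eq [Fintype ι] [DecidableEq ι] {α : Type*} [Fintype α] (g : ι → α → α → ℝ) :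
    ∑ r : ι → α, ∑ r' : ι → α, ∏ x, g x (r x) (r' x) = ∏ x, ∑ a, ∑ b, g x a b := by
  rw [Fintype.prod_sum]
  exact sum_congr rfl fun r _ => (Fintype.prod_sum _).symm

theorem coeff_le [Fintype ι] {p : ι → ℝ} (hp : ∀ x, 0 < p x) {G : Finset ι → ℝ} {B : ℝ}
    (hG : ∀ D, 0 ≤ G D) (hB : ∀ D, G D ≤ B) (R : ℝ) (r : ι → Option (Fin k)) :
    coeff p G R r ≤ B ^ k * (size p r)⁻¹ := by
  have h1 : ∏ i, G (fiber r i) ≤ B ^ k := by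
    refine (prod_le_prod (fun i _ => hG _) fun i _ => hB _).trans ?_
    simp
  have h0 : 0 ≤ ∏ i, G (fiber r i) := prod_nonneg fun i _ => hG _
  have hs := size_pos hp r
  rw [coeff, mul_assoc, mul_comm]
  refine mul_le_mul_of_nonneg_right ?_ (by positivity)
  split_ifs
  · simpa using h1
  · simpa using h0.trans h1

/-- The reciprocal of the contribution of one prime to the size of a configuration. -/
noncomputable def invSize (p : ℝ) (a : Option (Fin k)) : ℝ := if a = none then 1 else p⁻¹

theorem inv_size_eq [Fintype ι] (p : ι → ℝ) (r : ι → Option (Fin k)) :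
    (size p r)⁻¹ = ∏ x, invSize (p x) (r x) := by
  rw [size, ← prod_inv_distrib]
  refine prod_congr rfl fun x _ => ?_
  unfold invSize
  split_ifs <;> simp

theorem sum_invSize_mul_absGram_le {p : ℝ} (hp : 1 ≤ p) :
    ∑ a : Option (Fin k), ∑ b : Option (Fin k),
      invSize p a * invSize p b * (if a = none ∧ b = none then 0 else absGram p a b) ≤
      26 * k ^ 2 / p := by
  have hp0 : 0 < p := by linarith
  have hinv : p⁻¹ ≤ 1 := inv_le_one_of_one_le₀ hp
  have h : ∀ i j : Fin k, p⁻¹ * p⁻¹ * (if (some i : Option (Fin k)) = none ∧ (some j : Option (Fin k)) = none then 0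
      else absGram p (some i) (some j)) ≤ 14 * p⁻¹ := by
    intro i j
    simp only [reduceCtorEq, false_and, if_false, absGram, Option.some.injEq]
    split_ifs
    · have : p⁻¹ * p⁻¹ * (8 * p) = 8 * p⁻¹ := by field_simp
      rw [this]
      have : 0 < p⁻¹ := by positivity
      linarith
    · have : 0 < p⁻¹ := by positivity
      nlinarith
  rw [Fintype.sum_option]
  simp_rw [Fintype.sum_option]
  have hk : (k : ℝ) ≤ k ^ 2 := by
    have : k ≤ k ^ 2 := Nat.le_self_pow (by norm_num) k
    exact_mod_cast this
  have hpos : 0 < p⁻¹ := by positivity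
  calc _ ≤ (0 + ∑ _j : Fin k, 6 * p⁻¹) + ∑ _i : Fin k, (6 * p⁻¹ + ∑ _j : Fin k, 14 * p⁻¹) := by
        refine add_le_add (add_le_add (by simp) (sum_le_sum fun j _ => ?_))
          (sum_le_sum fun i _ => add_le_add ?_ (sum_le_sum fun j _ => ?_))
        · simp [invSize, absGram, mul_comm]
        · simp [invSize, absGram, mul_comm]
        · simpa [invSize] using h i j
    _ = p⁻¹ * (12 * k + 14 * k ^ 2) := by simp; ring
    _ ≤ _ := by
        rw [div_eq_mul_inv, mul_comm]
        exact mul_le_mul_of_nonneg_right (by linarith) hpos.le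

theorem sum_coeff_mul_absGram_le [Fintype ι] [DecidableEq ι] {p : ι → ℝ} (hp : ∀ x, 1 ≤ p x)
    {G : Finset ι → ℝ} {B : ℝ} (hG : ∀ D, 0 ≤ G D) (hB : ∀ D, G D ≤ B) (R : ℝ) (D : Finset ι)
    (hk : ∀ x, (26 * k ^ 2 : ℝ) ^ 2 ≤ p x) :
    ∑ r : ι → Option (Fin k), ∑ r' : ι → Option (Fin k), coeff p G R r * coeff p G R r' *
      (if ∀ x ∈ D, ¬ (r x = none ∧ r' x = none) then ∏ x, absGram (p x) (r x) (r' x) else 0) ≤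
      (B ^ k) ^ 2 * ((Real.sqrt (∏ x ∈ D, p x))⁻¹ * (∏ x, (1 + 1 / p x)) ^ (26 * k ^ 2)) := by
  have hp0 : ∀ x, 0 < p x := fun x => by linarith [hp x]
  have hB0 : 0 ≤ B := (hG ∅).trans (hB ∅)
  set g : ι → Option (Fin k) → Option (Fin k) → ℝ := fun x a b =>
    invSize (p x) a * invSize (p x) b *
      (if x ∈ D ∧ (a = none ∧ b = none) then 0 else absGram (p x) a b) with hg
  have hgle : ∀ x, ∑ a, ∑ b, g x a b ≤
      (if x ∈ D then (Real.sqrt (p x))⁻¹ else 1) * (1 + 1 / p x) ^ (26 * k ^ 2) := by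
    intro x
    have h1 := sum_invSize_mul_absGram_le (k := k) (hp x)
    have hber : (1 : ℝ) + 26 * k ^ 2 / p x ≤ (1 + 1 / p x) ^ (26 * k ^ 2) := by
      have := one_add_mul_le_pow (a := 1 / p x) (by
        have : 0 ≤ 1 / p x := by have := hp0 x; positivity
        linarith) (26 * k ^ 2)
      refine le_trans (le_of_eq ?_) this
      push_cast; ring
    by_cases hx : x ∈ D
    · simp only [hg, hx, true_and, if_true]
      refine h1.trans ?_
      have hs : 0 < Real.sqrt (p x) := Real.sqrt_pos.2 (hp0 x)
      have h2 : (26 * k ^ 2 : ℝ) ≤ Real.sqrt (p x) := Real.le_sqrt_of_sq_le (hk x)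
      have h3 : (26 * k ^ 2 : ℝ) / p x ≤ (Real.sqrt (p x))⁻¹ := by
        rw [div_le_iff₀ (hp0 x)]
        nth_rewrite 2 [← Real.mul_self_sqrt (hp0 x).le]
        rw [inv_mul_cancel_left₀ hs.ne']
        exact h2
      have h4 : 0 ≤ (26 * k ^ 2 : ℝ) / p x := by have := hp0 x; positivity
      refine h3.trans (le_mul_of_one_le_right (by positivity) ?_)
      linarith
    · simp only [hg, hx, false_and, if_false, one_mul]
      refine le_trans (le_of_eq ?_) ((add_le_add_right h1 1).trans hber)
      have : ∀ a b : Option (Fin k), invSize (p x) a * invSize (p x) b * absGram (p x) a b =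
          (if a = none then (if b = none then 1 else 0) else 0) + invSize (p x) a * invSize (p x) b *
            (if a = none ∧ b = none then 0 else absGram (p x) a b) := by
        intro a b
        by_cases ha : a = none <;> by_cases hb : b = none <;> simp [ha, hb, invSize, absGram]
      simp_rw [this, sum_add_distrib]
      simp
  have hg0 : ∀ x a b, 0 ≤ g x a b := by
    intro x a b
    have h1 := absGram_nonneg (hp0 x).le a b
    have h2 : ∀ a : Option (Fin k), 0 ≤ invSize (p x) a := fun a => by
      have := hp0 x
      unfold invSize; split_ifs <;> positivity
    have := h2 a
    have := h2 b
    simp only [hg]; split_ifs <;> positivity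
  have hterm : ∀ r r' : ι → Option (Fin k), coeff p G R r * coeff p G R r' *
      (if ∀ x ∈ D, ¬ (r x = none ∧ r' x = none) then ∏ x, absGram (p x) (r x) (r' x) else 0) ≤
      (B ^ k) ^ 2 * ∏ x, g x (r x) (r' x) := by
    intro r r'
    have h0 : 0 ≤ ∏ x, g x (r x) (r' x) := prod_nonneg fun x _ => hg0 _ _ _
    split_ifs with hD
    · have e : ∏ x, g x (r x) (r' x) = (size p r)⁻¹ * (size p r')⁻¹ *
          ∏ x, absGram (p x) (r x) (r' x) := by
        rw [inv_size_eq, inv_size_eq, ← prod_mul_distrib, ← prod_mul_distrib]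
        refine prod_congr rfl fun x _ => ?_
        simp only [hg]
        rw [if_neg]
        exact fun hx => hD x hx.1 hx.2
      have h1 : 0 ≤ ∏ x, absGram (p x) (r x) (r' x) :=
        prod_nonneg fun x _ => absGram_nonneg (hp0 x).le _ _
      have h2 := size_pos hp0 r'
      calc _ ≤ (B ^ k * (size p r)⁻¹) * (B ^ k * (size p r')⁻¹) *
            ∏ x, absGram (p x) (r x) (r' x) := by
            refine mul_le_mul_of_nonneg_right ?_ h1
            have := size_pos hp0 r
            exact mul_le_mul (coeff_le hp0 hG hB R r) (coeff_le hp0 hG hB R r')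
              (coeff_nonneg hp0 hG R r') (by positivity)
        _ = _ := by rw [e]; ring
    · rw [mul_zero]; positivity
  refine (sum_le_sum fun r _ => sum_le_sum fun r' _ => hterm r r').trans ?_
  simp_rw [← mul_sum]
  refine mul_le_mul_of_nonneg_left ?_ (by positivity)
  rw [sum_sum_prod_eq]
  refine (prod_le_prod (fun x _ => sum_nonneg fun a _ => sum_nonneg fun b _ => hg0 _ _ _)
    fun x _ => hgle x).trans (le_of_eq ?_)
  rw [prod_mul_distrib, prod_pow]
  congr 1
  rw [prod_ite, prod_const_one, mul_one, Real.sqrt_eq_rpow,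
    ← Real.finsetProd_rpow _ _ fun x _ => (hp0 x).le, ← prod_inv_distrib]
  simp only [filter_mem_eq_inter, univ_inter, Real.sqrt_eq_rpow]

end PrimeGaps

namespace PrimeGaps

open Finset

theorem eventually_prod_one_add_le :
    ∀ᶠ R : ℝ in atTop, ∀ P : Finset ℕ, (∀ p ∈ P, p.Prime) → (∀ p ∈ P, (p : ℝ) ≤ R) →
      ∏ x : P, (1 + 1 / ((x : ℕ) : ℝ)) ≤ (2 * Real.log R) ^ 3 := by
  filter_upwards [Real.tendsto_log_atTop.eventually eventually_zetaReal_le, eventually_gt_atTop 1]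
    with R hz hR P hP hPR
  have hlog : 0 < Real.log R := Real.log_pos hR
  set σ : ℝ := 1 + 1 / Real.log R with hσ
  have hσ1 : 1 < σ := by rw [hσ]; linarith [show 0 < 1 / Real.log R by positivity]
  have h1 : ∀ x : P, 1 + 1 / ((x : ℕ) : ℝ) ≤ (1 + 1 / ((x : ℕ) : ℝ) ^ σ) ^ 3 := by
    intro x
    have hx0 : (0 : ℝ) < (x : ℕ) := by exact_mod_cast (hP x x.2).pos
    have hx1 : (1 : ℝ) ≤ (x : ℕ) := by exact_mod_cast (hP x x.2).one_le
    have hb := one_add_mul_le_pow (a := 1 / ((x : ℕ) : ℝ) ^ σ) (by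
      have : 0 ≤ 1 / ((x : ℕ) : ℝ) ^ σ := by positivity
      linarith) 3
    refine le_trans ?_ hb
    have e : ((x : ℕ) : ℝ) ^ σ = (x : ℕ) * ((x : ℕ) : ℝ) ^ (1 / Real.log R) := by
      rw [hσ, Real.rpow_add hx0, Real.rpow_one]
    have h3 : ((x : ℕ) : ℝ) ^ (1 / Real.log R) ≤ 3 := by
      rw [Real.rpow_def_of_pos hx0]
      have : Real.log (x : ℕ) * (1 / Real.log R) ≤ 1 := by
        rw [mul_one_div, div_le_one hlog]
        exact Real.log_le_log hx0 (hPR x x.2)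
      exact (Real.exp_le_exp.2 this).trans (by linarith [Real.exp_one_lt_d9])
    rw [e]
    push_cast
    have hpos : (0 : ℝ) < ((x : ℕ) : ℝ) ^ (1 / Real.log R) := by positivity
    rw [add_le_add_iff_left, mul_one_div, div_le_div_iff₀ hx0 (by positivity)]
    nlinarith
  refine (prod_le_prod (fun x _ => by positivity) fun x _ => h1 x).trans ?_
  rw [prod_pow]
  refine pow_le_pow_left₀ (prod_nonneg fun x _ => by positivity) ?_ 3
  refine le_trans ?_ hz
  rw [zetaReal_eq_tsum hσ1, Finset.prod_one_add]
  have e : ∀ D : Finset P, ∏ x ∈ D, 1 / ((x : ℕ) : ℝ) ^ σ =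
      1 / ((∏ x ∈ D, (x : ℕ) : ℕ) : ℝ) ^ σ := by
    intro D
    push_cast
    rw [← Real.finsetProd_rpow _ _ fun x _ => by positivity, prod_div_distrib, prod_const_one]
  rw [sum_congr rfl fun D _ => e D,
    ← sum_image (f := fun n : ℕ => 1 / (n : ℝ) ^ σ) (g := fun D : Finset P => ∏ x ∈ D, (x : ℕ))
      fun _ _ _ _ h => prod_coe_injective hP h]
  exact (Real.summable_one_div_nat_rpow.2 hσ1).sum_le_tsum _ fun n _ => by positivity

theorem IsBlock.abs_sum_mul_wt_sub_le {φ : ℝ → ℝ} (hφ : IsBlock φ) :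
    ∃ C : ℝ, 0 < C ∧ ∀ N : ℝ, 0 < N → 5 ≤ Real.log N → ∀ (a : ℕ → ℝ) (q : ℕ) (M b : ℝ), 0 < q →
      HasMean a q M → (∀ n, |a n| ≤ b) →
      |∑ n ∈ range (cutoff N), a n * wt φ N n - M * ∑ n ∈ range (cutoff N), wt φ N n| ≤
        C * (q * b) / N := by
  obtain ⟨C, hC, h⟩ := hφ.norm_sum_mul_wt_le
  refine ⟨2 * C, by positivity, fun N hN0 hN a q M b hq ha hb => ?_⟩
  have hq' : (0 : ℝ) < q := by exact_mod_cast hq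
  have hM : |M| ≤ b := by
    have : |(q : ℝ) * M| ≤ q * b := by
      rw [← ha.2]
      refine (abs_sum_le_sum_abs _ _).trans ((sum_le_sum fun n _ => hb n).trans ?_)
      simp
    rw [abs_mul, abs_of_pos hq'] at this
    exact le_of_mul_le_mul_left this hq'
  have key := h N hN0 hN (fun n => ((a n - M : ℝ) : ℂ)) (q * (2 * b)) (fun n => by
    refine norm_sum_range_le_of_periodic hq ?_ ?_ ?_ n
    · intro n
      simp only [ha.1 n]
    · rw [← Complex.ofReal_sum, sum_sub_distrib, ha.2]
      simp
    · intro n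
      rw [Complex.norm_real, Real.norm_eq_abs]
      exact (abs_sub _ _).trans (by linarith [hb n])) 1 (cutoff N) one_pos (by
        simpa using lt_cutoff N)
  have e : ∑ l ∈ range (cutoff N), ((a l - M : ℝ) : ℂ) * (wt φ N ((1 : ℕ) * l) : ℂ) =
      ((∑ n ∈ range (cutoff N), a n * wt φ N n - M * ∑ n ∈ range (cutoff N), wt φ N n : ℝ) : ℂ) := by
    rw [mul_sum, ← sum_sub_distrib]
    push_cast
    refine sum_congr rfl fun n _ => ?_
    rw [one_mul]; ring
  rw [e, Complex.norm_real, Real.norm_eq_abs] at key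
  exact key.trans (le_of_eq (by ring))

theorem hasMean_coprime {W : ℕ} (hW : 0 < W) :
    HasMean (fun n => if W.Coprime n then 1 else 0) W (W.totient / W) := by
  refine ⟨fun n => by simp, ?_⟩
  have : (W : ℝ) ≠ 0 := by positivity
  rw [mul_div_cancel₀ _ this, ← sum_filter, sum_const, nsmul_eq_mul, mul_one,
    Nat.totient_eq_card_coprime]

variable {k : ℕ} {P : Finset ℕ}

/-- The sieve function of a configuration. -/
noncomputable def config (h : Fin k → ℤ) (r : P → Option (Fin k)) (n : ℕ) : ℝ :=
  ∏ x : P, loc x h (r x) n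

/-- The size of a configuration of primes. -/
noncomputable abbrev csize (r : P → Option (Fin k)) : ℝ := size (fun x : P => ((x : ℕ) : ℝ)) r

theorem abs_config_le (hP : ∀ p ∈ P, p.Prime) (h : Fin k → ℤ) (r : P → Option (Fin k)) (n : ℕ) :
    |config h r n| ≤ csize r := by
  rw [config, abs_prod, csize, size]
  exact prod_le_prod (fun x _ => abs_nonneg _) fun x _ => abs_loc_le (hP x x.2).one_le h (r x) n

/-- The set of primes used by one of two configurations. -/
def joint (r r' : P → Option (Fin k)) : Finset P := univ.filter fun x => ¬ (r x = none ∧ r' x = none)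

theorem prod_joint_le (hP : ∀ p ∈ P, p.Prime) (r r' : P → Option (Fin k)) :
    ((∏ x ∈ joint r r', (x : ℕ) : ℕ) : ℝ) ≤ csize r * csize r' := by
  push_cast
  rw [joint, prod_filter, csize, csize, size, size, ← prod_mul_distrib]
  refine prod_le_prod (fun x _ => by positivity) fun x _ => ?_
  have hx : (1 : ℝ) ≤ (x : ℕ) := by exact_mod_cast (hP x x.2).one_le
  by_cases h1 : r x = none <;> by_cases h2 : r' x = none <;> simp [h1, h2]
  nlinarith

theorem config_mul_config_eq (h : Fin k → ℤ) (r r' : P → Option (Fin k)) (n : ℕ) :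
    config h r n * config h r' n = ∏ x ∈ joint r r', loc x h (r x) n * loc x h (r' x) n := by
  rw [config, config, ← prod_mul_distrib, joint, prod_filter]
  refine prod_congr rfl fun x _ => ?_
  by_cases hx : r x = none ∧ r' x = none
  · simp [hx.1, hx.2, loc]
  · rw [if_pos hx]

theorem coprime_of_ne (hP : ∀ p ∈ P, p.Prime) (x y : P) (hxy : x ≠ y) :
    (x : ℕ).Coprime (y : ℕ) :=
  (Nat.coprime_primes (hP x x.2) (hP y y.2)).2 fun e => hxy (Subtype.ext e)

theorem hasMean_config (hP : ∀ p ∈ P, p.Prime) {h : Fin k → ℤ}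
    (hh : ∀ p ∈ P, ∀ i j, i ≠ j → ¬ (p : ℤ) ∣ h i - h j) (r r' : P → Option (Fin k)) :
    HasMean (fun n => config h r n * config h r' n) (∏ x ∈ joint r r', (x : ℕ))
      (∏ x : P, gram (x : ℕ) (r x) (r' x)) := by
  have e : ∏ x : P, gram (x : ℕ) (r x) (r' x) = ∏ x ∈ joint r r', gram (x : ℕ) (r x) (r' x) := by
    rw [joint, prod_filter]
    refine prod_congr rfl fun x _ => ?_
    by_cases hx : r x = none ∧ r' x = none
    · simp [hx.1, hx.2, gram]
    · rw [if_pos hx]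
  rw [e]
  simp_rw [config_mul_config_eq]
  exact HasMean.prod (a := fun (x : P) n => loc x h (r x) n * loc x h (r' x) n)
    (fun x _ => hasMean_loc_mul_loc (hP x x.2).pos (hh x x.2) _ _)
    (fun x _ => (hP x x.2).pos) fun x _ y _ hxy => coprime_of_ne hP x y hxy

theorem IsBlock.abs_sum_sq_sub_le {φ : ℝ → ℝ} (hφ : IsBlock φ) :
    ∃ C : ℝ, 0 < C ∧ ∀ N : ℝ, 0 < N → 5 ≤ Real.log N → ∀ (k : ℕ) (P : Finset ℕ) (W : ℕ) (h : Fin k → ℤ)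
      (c : (P → Option (Fin k)) → ℝ), (∀ p ∈ P, p.Prime) → 0 < W → (∀ p ∈ P, W.Coprime p) →
      (∀ p ∈ P, ∀ i j, i ≠ j → ¬ (p : ℤ) ∣ h i - h j) → (∀ r, 0 ≤ c r) →
      |∑ n ∈ range (cutoff N), (if W.Coprime n then 1 else 0) * (∑ r, c r * config h r n) ^ 2 * wt φ N n -
        W.totient / W * (∑ r, ∑ r', c r * c r' * ∏ x : P, gram (x : ℕ) (r x) (r' x)) *
          ∑ n ∈ range (cutoff N), wt φ N n| ≤ C * W * (∑ r, c r * csize r ^ 2) ^ 2 / N := by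
  obtain ⟨C, hC, hmain⟩ := hφ.abs_sum_mul_wt_sub_le
  refine ⟨C, hC, fun N hN0 hN k P W h c hP hW0 hW hh hc => ?_⟩
  set a : (P → Option (Fin k)) → (P → Option (Fin k)) → ℕ → ℝ := fun r r' n =>
    (if W.Coprime n then 1 else 0) * (config h r n * config h r' n) with ha
  have hmean : ∀ r r', HasMean (a r r') (W * ∏ x ∈ joint r r', (x : ℕ))
      (W.totient / W * ∏ x : P, gram (x : ℕ) (r x) (r' x)) := fun r r' =>
    (hasMean_coprime hW0).mul (hasMean_config hP hh r r')
      (Nat.Coprime.prod_right fun x _ => hW x x.2) hW0 (prod_pos fun x _ => (hP x x.2).pos)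
  have hs0 : ∀ r : P → Option (Fin k), 0 < csize r := fun r =>
    size_pos (fun x => by exact_mod_cast (hP x x.2).pos) r
  have hbd : ∀ r r' n, |a r r' n| ≤ csize r * csize r' := by
    intro r r' n
    simp only [ha]
    rw [abs_mul, abs_mul]
    have h1 := abs_config_le hP h r n
    have h2 := abs_config_le hP h r' n
    have h3 : |config h r n| * |config h r' n| ≤ csize r * csize r' :=
      mul_le_mul h1 h2 (abs_nonneg _) (hs0 r).le
    refine (mul_le_of_le_one_left (by positivity) ?_).trans h3
    split_ifs <;> simp
  have e1 : ∑ n ∈ range (cutoff N), (if W.Coprime n then 1 else 0) * (∑ r, c r * config h r n) ^ 2 *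
      wt φ N n = ∑ r, ∑ r', c r * c r' * ∑ n ∈ range (cutoff N), a r r' n * wt φ N n := by
    simp_rw [mul_sum]
    rw [sum_congr rfl fun r _ => Finset.sum_comm, Finset.sum_comm]
    refine sum_congr rfl fun n _ => ?_
    rw [sq, sum_mul_sum, mul_sum, sum_mul]
    refine sum_congr rfl fun r _ => ?_
    rw [mul_sum, sum_mul]
    refine sum_congr rfl fun r' _ => ?_
    simp only [ha]; ring
  have e2 : W.totient / W * (∑ r, ∑ r', c r * c r' * ∏ x : P, gram (x : ℕ) (r x) (r' x)) *
          ∑ n ∈ range (cutoff N), wt φ N n = ∑ r, ∑ r', c r * c r' *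
          ((W.totient / W * ∏ x : P, gram (x : ℕ) (r x) (r' x)) * ∑ n ∈ range (cutoff N), wt φ N n) := by
    generalize ∑ n ∈ range (cutoff N), wt φ N n = X
    rw [mul_sum, sum_mul]
    refine sum_congr rfl fun r _ => ?_
    rw [mul_sum, sum_mul]
    refine sum_congr rfl fun r' _ => ?_
    ring
  rw [e1, e2, ← sum_sub_distrib]
  simp_rw [← sum_sub_distrib, ← mul_sub]
  have e3 : C * W * (∑ r, c r * csize r ^ 2) ^ 2 / N =
      ∑ r : P → Option (Fin k), ∑ r' : P → Option (Fin k), c r * c r' * (C * (W * (csize r * csize r') * (csize r * csize r')) / N) := by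
    rw [sq, sum_mul_sum, mul_sum, sum_div]
    refine sum_congr rfl fun r _ => ?_
    rw [mul_sum, sum_div]
    refine sum_congr rfl fun r' _ => ?_
    ring
  rw [e3]
  refine (abs_sum_le_sum_abs _ _).trans (sum_le_sum fun r _ =>
    (abs_sum_le_sum_abs _ _).trans (sum_le_sum fun r' _ => ?_))
  have hcc : 0 ≤ c r * c r' := mul_nonneg (hc r) (hc r')
  rw [abs_mul, abs_of_nonneg hcc]
  refine mul_le_mul_of_nonneg_left ?_ hcc
  have hq : 0 < W * ∏ x ∈ joint r r', (x : ℕ) :=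
    mul_pos hW0 (prod_pos fun x _ => (hP x x.2).pos)
  refine (hmain N hN0 hN (a r r') _ _ (csize r * csize r') hq (hmean r r') (hbd r r')).trans ?_
  have h4 := prod_joint_le hP r r'
  have h5 : (0 : ℝ) ≤ csize r * csize r' := (mul_pos (hs0 r) (hs0 r')).le
  rw [Nat.cast_mul]
  gcongr

theorem sum_inv_size_le {ι : Type*} [Fintype ι] [DecidableEq ι] {p : ι → ℝ} (hp : ∀ x, 1 ≤ p x) :
    ∑ r : ι → Option (Fin k), (size p r)⁻¹ ≤ (∏ x, (1 + 1 / p x)) ^ k := by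
  simp_rw [inv_size_eq]
  rw [← Fintype.prod_sum, ← prod_pow]
  refine prod_le_prod (fun x _ => sum_nonneg fun a _ => ?_) fun x _ => ?_
  · have := hp x
    unfold invSize; split_ifs <;> positivity
  · rw [Fintype.sum_option]
    have h0 : 0 ≤ 1 / p x := by have := hp x; positivity
    have := one_add_mul_le_pow (a := 1 / p x) (by linarith) k
    refine le_trans (le_of_eq ?_) this
    simp [invSize]

theorem sum_coeff_mul_size_sq_le {ι : Type*} [Fintype ι] [DecidableEq ι] {p : ι → ℝ} (hp : ∀ x, 1 ≤ p x)
    {G : Finset ι → ℝ} {B : ℝ} (hG : ∀ D, 0 ≤ G D) (hB : ∀ D, G D ≤ B) (R : ℝ) :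
    ∑ r : ι → Option (Fin k), coeff p G R r * size p r ^ 2 ≤
      B ^ k * R ^ 2 * (∏ x, (1 + 1 / p x)) ^ k := by
  have hp0 : ∀ x, 0 < p x := fun x => by linarith [hp x]
  have hB0 : 0 ≤ B := (hG ∅).trans (hB ∅)
  calc _ ≤ ∑ r : ι → Option (Fin k), B ^ k * R ^ 2 * (size p r)⁻¹ := by
        refine sum_le_sum fun r _ => ?_
        have hs := size_pos hp0 r
        by_cases hr : size p r ≤ R
        · have h1 := coeff_le hp0 hG hB R r
          calc coeff p G R r * size p r ^ 2 ≤ (B ^ k * (size p r)⁻¹) * R ^ 2 := by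
                refine mul_le_mul h1 (pow_le_pow_left₀ hs.le hr 2) (by positivity) (by positivity)
            _ = _ := by ring
        · have : coeff p G R r = 0 := by simp [coeff, hr]
          rw [this, zero_mul]; positivity
    _ = B ^ k * R ^ 2 * ∑ r : ι → Option (Fin k), (size p r)⁻¹ := by rw [mul_sum]
    _ ≤ _ := mul_le_mul_of_nonneg_left (sum_inv_size_le hp) (by positivity)

end PrimeGaps

namespace PrimeGaps

open Finset

/-- The coefficient of a Dirichlet character in a periodic sequence. -/
noncomputable def charCoeff {q : ℕ} (a : ℕ → ℝ) (χ : DirichletCharacter ℂ q) : ℂ :=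
  (q.totient : ℂ)⁻¹ * ∑ m ∈ range q, (a m : ℂ) * χ⁻¹ (m : ZMod q)

theorem sum_inv_apply_mul_apply {q : ℕ} [NeZero q] (m : ZMod q) {n : ZMod q} (hn : IsUnit n) :
    ∑ χ : DirichletCharacter ℂ q, χ⁻¹ m * χ n = if m = n then (q.totient : ℂ) else 0 := by
  by_cases hm : IsUnit m
  · rw [← DirichletCharacter.sum_char_inv_mul_char_eq ℂ hm]
    refine sum_congr rfl fun χ _ => ?_
    congr 1
    obtain ⟨u, rfl⟩ := hm
    rw [MulChar.inv_apply, Ring.inverse_unit, ZMod.inv_coe_unit]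
  · rw [if_neg (by rintro rfl; exact hm hn)]
    exact sum_eq_zero fun χ _ => by rw [MulChar.map_nonunit _ hm, zero_mul]

theorem sum_charCoeff_mul {q : ℕ} [NeZero q] {a : ℕ → ℝ} (ha : Function.Periodic a q) {n : ℕ}
    (hn : n.Coprime q) : ∑ χ : DirichletCharacter ℂ q, charCoeff a χ * χ (n : ZMod q) = a n := by
  have hu := (ZMod.isUnit_iff_coprime n q).2 hn
  have hφ : (q.totient : ℂ) ≠ 0 := by
    exact_mod_cast (Nat.totient_pos.2 (NeZero.pos q)).ne'
  simp only [charCoeff, mul_assoc, sum_mul]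
  rw [← mul_sum, Finset.sum_comm]
  simp_rw [← mul_sum, sum_inv_apply_mul_apply _ hu]
  rw [sum_eq_single (n % q)]
  · rw [if_pos (by simp), ha.map_mod_nat]
    field_simp
  · intro m hm hne
    rw [if_neg, mul_zero]
    intro h
    apply hne
    have := (ZMod.natCast_eq_natCast_iff m n q).1 h
    rw [← Nat.mod_eq_of_lt (mem_range.1 hm)]
    exact this
  · intro h
    exact absurd (mem_range.2 (Nat.mod_lt _ (NeZero.pos q))) h

theorem charCoeff_sum {q : ℕ} {ι : Type*} (s : Finset ι) (c : ι → ℝ) (a : ι → ℕ → ℝ)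
    (χ : DirichletCharacter ℂ q) :
    charCoeff (fun n => ∑ i ∈ s, c i * a i n) χ = ∑ i ∈ s, c i * charCoeff (a i) χ := by
  simp only [charCoeff]
  push_cast
  simp_rw [sum_mul]
  rw [Finset.sum_comm, mul_sum]
  refine sum_congr rfl fun i _ => ?_
  simp_rw [mul_sum]
  refine sum_congr rfl fun n _ => ?_
  ring

theorem charCoeff_eq_zero {q q' : ℕ} [NeZero q] (hq' : q' ∣ q) {a : ℕ → ℝ}
    (ha : Function.Periodic a q') {χ : DirichletCharacter ℂ q} (hχ : ¬ χ.FactorsThrough q') :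
    charCoeff a χ = 0 := by
  rw [DirichletCharacter.factorsThrough_iff_ker_unitsMap hq', SetLike.not_le_iff_exists] at hχ
  obtain ⟨u, hu, hχu⟩ := hχ
  have : NeZero q' := ⟨fun h => NeZero.ne q (Nat.eq_zero_of_zero_dvd (h ▸ hq'))⟩
  set S := ∑ z : ZMod q, (a z.val : ℂ) * χ⁻¹ z with hS
  have hsum : ∑ m ∈ range q, (a m : ℂ) * χ⁻¹ (m : ZMod q) = S := by
    rw [hS, ← sum_range_eq_sum_zmod q (fun z => (a z.val : ℂ) * χ⁻¹ z)]
    refine sum_congr rfl fun m hm => ?_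
    rw [ZMod.val_natCast, Nat.mod_eq_of_lt (mem_range.1 hm)]
  have hmul : S = χ⁻¹ (u : ZMod q) * S := by
    conv_lhs => rw [hS, ← Equiv.sum_comp (Units.mulLeft u)]
    rw [hS, mul_sum]
    refine sum_congr rfl fun z _ => ?_
    have h1 : a ((u : ZMod q) * z).val = a z.val := by
      have h2 : ((((u : ZMod q) * z).val : ℕ) : ZMod q') = (z.val : ℕ) := by
        rw [ZMod.natCast_val, ZMod.natCast_val, ZMod.cast_mul hq', ← ZMod.unitsMap_val hq' u,
          (MonoidHom.mem_ker).1 hu, Units.val_one, one_mul]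
      have h3 := (ZMod.natCast_eq_natCast_iff _ _ _).1 h2
      rw [← ha.map_mod_nat, h3, ha.map_mod_nat]
    simp only [Units.mulLeft_apply]
    rw [h1, map_mul]
    ring
  have hne : χ⁻¹ (u : ZMod q) ≠ 1 := by
    intro h
    apply hχu
    rw [MonoidHom.mem_ker]
    ext
    rw [MulChar.coe_toUnitHom, Units.val_one]
    have h4 : χ⁻¹ (u : ZMod q) * χ (u : ZMod q) = 1 := by
      rw [← MulChar.mul_apply, inv_mul_cancel, MulChar.one_apply_coe]
    rwa [h, one_mul] at h4
  have hS0 : S = 0 := by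
    have : (1 - χ⁻¹ (u : ZMod q)) * S = 0 := by linear_combination hmul
    exact (mul_eq_zero.1 this).resolve_left (sub_ne_zero.2 hne.symm)
  rw [charCoeff, hsum, hS0, mul_zero]

theorem norm_charCoeff_le {q : ℕ} (a : ℕ → ℝ) (χ : DirichletCharacter ℂ q) :
    ‖charCoeff a χ‖ ≤ (q.totient : ℝ)⁻¹ * ∑ m ∈ range q, (if q.Coprime m then 1 else 0) * |a m| := by
  rw [charCoeff, norm_mul, norm_inv, Complex.norm_natCast]
  refine mul_le_mul_of_nonneg_left ((norm_sum_le _ _).trans (sum_le_sum fun m _ => ?_)) (by positivity)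
  rw [norm_mul, Complex.norm_real, Real.norm_eq_abs]
  split_ifs with h
  · rw [one_mul]
    exact mul_le_of_le_one_right (abs_nonneg _) (DirichletCharacter.norm_le_one _ _)
  · rw [MulChar.map_nonunit _ (fun h' => h ((ZMod.isUnit_iff_coprime m q).1 h').symm)]
    simp

theorem charCoeff_one {q : ℕ} (a : ℕ → ℝ) :
    charCoeff a (1 : DirichletCharacter ℂ q) =
      (((q.totient : ℝ)⁻¹ * ∑ m ∈ range q, (if q.Coprime m then 1 else 0) * a m : ℝ) : ℂ) := by
  rw [charCoeff]
  push_cast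
  congr 1
  refine sum_congr rfl fun m _ => ?_
  split_ifs with h
  · rw [inv_one, MulChar.one_apply ((ZMod.isUnit_iff_coprime m q).2 h.symm)]
    push_cast; ring
  · rw [MulChar.map_nonunit _ (fun h' => h ((ZMod.isUnit_iff_coprime m q).1 h').symm)]
    simp

variable {k : ℕ} {P : Finset ℕ}

theorem ite_coprime_prod (hP : ∀ p ∈ P, p.Prime) (n : ℕ) :
    (if (∏ x : P, (x : ℕ)).Coprime n then (1 : ℝ) else 0) = ∏ x : P, if (x : ℕ) ∣ n then 0 else 1 := by
  by_cases h : ∃ x : P, (x : ℕ) ∣ n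
  · obtain ⟨x, hx⟩ := h
    rw [prod_eq_zero (f := fun x : P => if (x : ℕ) ∣ n then (0 : ℝ) else 1) (mem_univ x) (if_pos hx),
      if_neg]
    intro hc
    have := Nat.Coprime.coprime_dvd_left (dvd_prod_of_mem (fun x : P => (x : ℕ)) (mem_univ x)) hc
    exact ((Nat.Prime.coprime_iff_not_dvd (hP x x.2)).1 this) hx
  · push Not at h
    rw [prod_congr rfl fun x _ => if_neg (h x), prod_const_one, if_pos]
    exact Nat.Coprime.prod_left fun x _ => (Nat.Prime.coprime_iff_not_dvd (hP x x.2)).2 (h x)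

theorem hasMean_unit_config (hP : ∀ p ∈ P, p.Prime) {h : Fin k → ℤ}
    (hh : ∀ p ∈ P, ∀ i j, i ≠ j → ¬ (p : ℤ) ∣ h i - h j) {m : Fin k} (hm : h m = 0)
    (r r' : P → Option (Fin k)) :
    HasMean (fun n => (if (∏ x : P, (x : ℕ)).Coprime n then 1 else 0) *
        (config h r n * config h r' n)) (∏ x : P, (x : ℕ))
      (∏ x : P, ((x : ℕ) - 1 : ℝ) / (x : ℕ) * gramUnit (x : ℕ) m (r x) (r' x)) := by
  have e : ∀ n, (if (∏ x : P, (x : ℕ)).Coprime n then (1 : ℝ) else 0) *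
        (config h r n * config h r' n) = ∏ x : P, (if (x : ℕ) ∣ n then 0 else 1) *
          (loc x h (r x) n * loc x h (r' x) n) := by
    intro n
    rw [ite_coprime_prod hP, config, config, ← prod_mul_distrib, ← prod_mul_distrib]
  simp_rw [e]
  exact HasMean.prod (a := fun (x : P) n => (if (x : ℕ) ∣ n then 0 else 1) *
      (loc x h (r x) n * loc x h (r' x) n))
    (fun x _ => hasMean_unit_loc_mul_loc (hP x x.2).two_le (hh x x.2) hm _ _)
    (fun x _ => (hP x x.2).pos) fun x _ y _ hxy => coprime_of_ne hP x y hxy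

theorem totient_prod (hP : ∀ p ∈ P, p.Prime) :
    ((∏ x : P, (x : ℕ)).totient : ℝ) = ∏ x : P, ((x : ℕ) - 1 : ℝ) := by
  have h : ∀ s : Finset P, ((∏ x ∈ s, (x : ℕ)).totient : ℝ) = ∏ x ∈ s, ((x : ℕ) - 1 : ℝ) := by
    intro s
    induction s using Finset.induction_on with
    | empty => simp
    | insert x s hx ih =>
      rw [prod_insert hx, prod_insert hx, Nat.totient_mul, Nat.totient_prime (hP x x.2), Nat.cast_mul,
        ih, Nat.cast_sub (hP x x.2).one_le, Nat.cast_one]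
      exact Nat.Coprime.prod_right fun y hy => coprime_of_ne hP x y (by rintro rfl; exact hx hy)
  exact h univ

theorem charCoeff_config_one (hP : ∀ p ∈ P, p.Prime) {h : Fin k → ℤ}
    (hh : ∀ p ∈ P, ∀ i j, i ≠ j → ¬ (p : ℤ) ∣ h i - h j) {m : Fin k} (hm : h m = 0)
    (r r' : P → Option (Fin k)) :
    charCoeff (fun n => config h r n * config h r' n) (1 : DirichletCharacter ℂ (∏ x : P, (x : ℕ))) =
      ((∏ x : P, gramUnit (x : ℕ) m (r x) (r' x) : ℝ) : ℂ) := by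
  rw [charCoeff_one, (hasMean_unit_config hP hh hm r r').2, totient_prod hP]
  congr 1
  push_cast
  rw [← prod_mul_distrib, ← prod_inv_distrib, ← prod_mul_distrib]
  refine prod_congr rfl fun x _ => ?_
  have hx : (2 : ℝ) ≤ (x : ℕ) := by exact_mod_cast (hP x x.2).two_le
  have : ((x : ℕ) : ℝ) - 1 ≠ 0 := by linarith
  field_simp

theorem hasMean_of_periodic {a : ℕ → ℝ} {q : ℕ} (hq : 0 < q) (ha : Function.Periodic a q) :
    HasMean a q ((∑ n ∈ range q, a n) / q) := ⟨ha, by field_simp⟩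

theorem norm_charCoeff_config_le (hP : ∀ p ∈ P, p.Prime) {h : Fin k → ℤ}
    (hh : ∀ p ∈ P, ∀ i j, i ≠ j → ¬ (p : ℤ) ∣ h i - h j) (r r' : P → Option (Fin k))
    (χ : DirichletCharacter ℂ (∏ x : P, (x : ℕ))) :
    ‖charCoeff (fun n => config h r n * config h r' n) χ‖ ≤ ∏ x : P, absGram (x : ℕ) (r x) (r' x) := by
  refine (norm_charCoeff_le _ _).trans ?_
  set g : P → ℕ → ℝ := fun x n => (if (x : ℕ) ∣ n then 0 else 1) *
      |loc x h (r x) n * loc x h (r' x) n| with hg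
  have e : ∀ n, (if (∏ x : P, (x : ℕ)).Coprime n then (1 : ℝ) else 0) *
        |config h r n * config h r' n| = ∏ x : P, g x n := by
    intro n
    rw [ite_coprime_prod hP, config, config, ← prod_mul_distrib, abs_prod, ← prod_mul_distrib]
  have hper : ∀ x, Function.Periodic (g x) (x : ℕ) := by
    intro x
    refine (periodic_dvd x).mul fun n => ?_
    simp only [loc_periodic x h _ n]
  have hmean := HasMean.prod (s := univ) (a := g) (q := fun x => (x : ℕ))
    (fun x _ => hasMean_of_periodic (hP x x.2).pos (hper x))
    (fun x _ => (hP x x.2).pos) fun x _ y _ hxy => coprime_of_ne hP x y hxy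
  simp_rw [e]
  rw [hmean.2, totient_prod hP]
  push_cast
  rw [← prod_mul_distrib, ← prod_inv_distrib, ← prod_mul_distrib]
  refine prod_le_prod (fun x _ => ?_) fun (x : P) _ => ?_
  · have hx : (2 : ℝ) ≤ (x : ℕ) := by exact_mod_cast (hP x x.2).two_le
    have : 0 ≤ ∑ n ∈ range (x : ℕ), g x n := sum_nonneg fun n _ => by
      simp only [hg]; split_ifs <;> positivity
    have h1 : (0 : ℝ) ≤ ((x : ℕ) : ℝ) - 1 := by linarith
    positivity
  · have hx : (2 : ℝ) ≤ (x : ℕ) := by exact_mod_cast (hP x x.2).two_le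
    have h1 : (0 : ℝ) < ((x : ℕ) : ℝ) - 1 := by linarith
    have h2 := sum_abs_unit_loc_le (hP x x.2).two_le (hh x x.2) (r x) (r' x)
    rw [mul_div_cancel₀ _ (by linarith : ((x : ℕ) : ℝ) ≠ 0), inv_mul_le_iff₀ h1]
    exact h2

theorem config_mul_config_periodic (h : Fin k → ℤ) (r r' : P → Option (Fin k)) :
    Function.Periodic (fun n => config h r n * config h r' n) (∏ x ∈ joint r r', (x : ℕ)) := by
  intro n
  simp only [config_mul_config_eq]
  refine prod_congr rfl fun x hx => ?_
  obtain ⟨c, hc⟩ := dvd_prod_of_mem (fun x : P => (x : ℕ)) hx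
  have e : n + ∏ x ∈ joint r r', (x : ℕ) = n + c * (x : ℕ) := by rw [hc, mul_comm c]
  have h1 : ∀ a, loc x h a (n + ∏ x ∈ joint r r', (x : ℕ)) = loc x h a n := fun a => by
    rw [e]
    exact_mod_cast (loc_periodic x h a).nat_mul c n
  rw [h1, h1]

theorem charCoeff_config_eq_zero (hP : ∀ p ∈ P, p.Prime) (h : Fin k → ℤ) (r r' : P → Option (Fin k))
    {χ : DirichletCharacter ℂ (∏ x : P, (x : ℕ))}
    (hχ : ¬ χ.conductor ∣ ∏ x ∈ joint r r', (x : ℕ)) :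
    charCoeff (fun n => config h r n * config h r' n) χ = 0 := by
  have : NeZero (∏ x : P, (x : ℕ)) := 
    ⟨(prod_pos fun (x : P) _ => (hP x x.2).pos).ne'⟩
  refine charCoeff_eq_zero (prod_dvd_prod_of_subset _ _ _ (subset_univ _))
    (config_mul_config_periodic h r r') fun hf => hχ ?_
  exact χ.conductor_dvd_of_mem_conductorSet ((DirichletCharacter.mem_conductorSet_iff χ).2 hf)

end PrimeGaps

namespace PrimeGaps

open Finset

variable {k : ℕ} {P : Finset ℕ}

/-- The square of the sieve sum. -/
noncomputable def sieveSq (c : (P → Option (Fin k)) → ℝ) (h : Fin k → ℤ) (n : ℕ) : ℝ :=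
  (∑ r, c r * config h r n) ^ 2

theorem sieveSq_eq (c : (P → Option (Fin k)) → ℝ) (h : Fin k → ℤ) (n : ℕ) :
    sieveSq c h n = ∑ r, c r * ∑ r', c r' * (config h r n * config h r' n) := by
  rw [sieveSq, sq, sum_mul_sum]
  refine sum_congr rfl fun r _ => ?_
  rw [mul_sum]
  refine sum_congr rfl fun r' _ => ?_
  ring

theorem charCoeff_sieveSq (c : (P → Option (Fin k)) → ℝ) (h : Fin k → ℤ) {q : ℕ}
    (χ : DirichletCharacter ℂ q) :
    charCoeff (sieveSq c h) χ =
      ∑ r, ∑ r', ((c r * c r' : ℝ) : ℂ) * charCoeff (fun n => config h r n * config h r' n) χ := by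
  have : sieveSq c h = fun n => ∑ r, c r * ∑ r', c r' * (config h r n * config h r' n) :=
    funext (sieveSq_eq c h)
  rw [this, charCoeff_sum]
  refine sum_congr rfl fun r _ => ?_
  rw [charCoeff_sum univ c (fun r' n => config h r n * config h r' n), mul_sum]
  refine sum_congr rfl fun r' _ => ?_
  push_cast; ring

theorem config_periodic (h : Fin k → ℤ) (r : P → Option (Fin k)) :
    Function.Periodic (config h r) (∏ x : P, (x : ℕ)) := by
  intro n
  rw [config, config]
  refine prod_congr rfl fun x hx => ?_
  obtain ⟨c, hc⟩ := dvd_prod_of_mem (fun x : P => (x : ℕ)) hx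
  have e : n + ∏ x : P, (x : ℕ) = n + c * (x : ℕ) := by rw [hc, mul_comm c]
  rw [e]
  exact_mod_cast (loc_periodic x h (r x)).nat_mul c n

theorem sieveSq_periodic (c : (P → Option (Fin k)) → ℝ) (h : Fin k → ℤ) :
    Function.Periodic (sieveSq c h) (∏ x : P, (x : ℕ)) := by
  intro n
  simp only [sieveSq, config_periodic h _ n]

theorem charCoeff_sieveSq_one (hP : ∀ p ∈ P, p.Prime) {h : Fin k → ℤ}
    (hh : ∀ p ∈ P, ∀ i j, i ≠ j → ¬ (p : ℤ) ∣ h i - h j) {m : Fin k} (hm : h m = 0)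
    (c : (P → Option (Fin k)) → ℝ) :
    charCoeff (sieveSq c h) (1 : DirichletCharacter ℂ (∏ x : P, (x : ℕ))) =
      ((∑ r, ∑ r', c r * c r' * ∏ x : P, gramUnit (x : ℕ) m (r x) (r' x) : ℝ) : ℂ) := by
  rw [charCoeff_sieveSq]
  push_cast
  refine sum_congr rfl fun r _ => sum_congr rfl fun r' _ => ?_
  rw [charCoeff_config_one hP hh hm]
  push_cast; rfl

/-- The sieve coefficients attached to a finite set of primes. -/
noncomputable abbrev ccoeff (k : ℕ) {P : Finset ℕ} (G : Finset P → ℝ) (R : ℝ) :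
    (P → Option (Fin k)) → ℝ := coeff (fun x : P => ((x : ℕ) : ℝ)) G R

theorem charCoeff_sieveSq_eq_zero (hP : ∀ p ∈ P, p.Prime) (h : Fin k → ℤ) (G : Finset P → ℝ)
    {R : ℝ} (hR : 0 ≤ R) {χ : DirichletCharacter ℂ (∏ x : P, (x : ℕ))} (hχ : R ^ 2 < χ.conductor) :
    charCoeff (sieveSq (ccoeff k G R) h) χ = 0 := by
  rw [charCoeff_sieveSq]
  refine sum_eq_zero fun r _ => sum_eq_zero fun r' _ => ?_
  by_cases h1 : csize r ≤ R
  · by_cases h2 : csize r' ≤ R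
    · rw [charCoeff_config_eq_zero hP h r r', mul_zero]
      intro hd
      have h3 := Nat.le_of_dvd (prod_pos fun (x : P) _ => (hP x x.2).pos) hd
      have h4 := prod_joint_le hP r r'
      have h5 : 0 < csize r' := size_pos (fun x => by exact_mod_cast (hP x x.2).pos) r'
      have h6 : csize r * csize r' ≤ R * R := mul_le_mul h1 h2 h5.le hR
      have h7 : (χ.conductor : ℝ) ≤ ((∏ x ∈ joint r r', (x : ℕ) : ℕ) : ℝ) := by exact_mod_cast h3
      nlinarith
    · have : ccoeff k G R r' = 0 := by
        rw [ccoeff, coeff, if_neg h2, mul_zero]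
      simp [this]
  · have : ccoeff k G R r = 0 := by
      rw [ccoeff, coeff, if_neg h1, mul_zero]
    simp [this]

theorem exists_eq_prod_of_dvd (hP : ∀ p ∈ P, p.Prime) {d : ℕ} (hd : d ∣ ∏ x : P, (x : ℕ)) :
    ∃ D : Finset P, d = ∏ x ∈ D, (x : ℕ) := by
  have hsq : Squarefree (∏ x : P, (x : ℕ)) := by
    refine Finset.squarefree_prod_of_pairwise_isCoprime (fun x _ y _ hxy => ?_)
      fun x _ => (hP x x.2).squarefree
    exact Nat.coprime_iff_isRelPrime.1 (coprime_of_ne hP x y hxy)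
  refine ⟨univ.filter fun x => (x : ℕ) ∣ d, ?_⟩
  have hne : ∏ x : P, (x : ℕ) ≠ 0 := (prod_pos fun (x : P) _ => (hP x x.2).pos).ne'
  rw [← Nat.prod_primeFactors_of_squarefree (hsq.squarefree_of_dvd hd)]
  refine (prod_nbij (fun x : P => (x : ℕ)) (fun x hx => ?_) (fun x _ y _ h => Subtype.ext h)
    (fun p hp => ?_) fun x _ => rfl).symm
  · have hx' := (mem_filter.1 hx).2
    rw [Nat.mem_primeFactors]
    refine ⟨hP x x.2, ?_, ne_zero_of_dvd_ne_zero hne hd⟩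
    rwa [Nat.prod_primeFactors_of_squarefree (hsq.squarefree_of_dvd hd)] at hx'
  · have hp' := hp
    rw [mem_coe, Nat.mem_primeFactors] at hp'
    have h1 : p ∈ (∏ x : P, (x : ℕ)).primeFactors := Nat.primeFactors_mono hd hne hp
    rw [primeFactors_prod_coe hP univ] at h1
    obtain ⟨x, -, rfl⟩ := mem_map.1 h1
    refine ⟨x, ?_, rfl⟩
    rw [mem_coe, mem_filter]
    refine ⟨mem_univ _, ?_⟩
    rw [Nat.prod_primeFactors_of_squarefree (hsq.squarefree_of_dvd hd)]
    exact hp'.2.1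

theorem norm_charCoeff_sieveSq_le (hP : ∀ p ∈ P, p.Prime) {h : Fin k → ℤ}
    (hh : ∀ p ∈ P, ∀ i j, i ≠ j → ¬ (p : ℤ) ∣ h i - h j) {G : Finset P → ℝ} {B : ℝ}
    (hG : ∀ D, 0 ≤ G D) (hB : ∀ D, G D ≤ B) (R : ℝ) (hk : ∀ p ∈ P, (26 * k ^ 2) ^ 2 ≤ p)
    (χ : DirichletCharacter ℂ (∏ x : P, (x : ℕ))) :
    ‖charCoeff (sieveSq (ccoeff k G R) h) χ‖ ≤ (B ^ k) ^ 2 * ((Real.sqrt χ.conductor)⁻¹ *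
      (∏ x : P, (1 + 1 / ((x : ℕ) : ℝ))) ^ (26 * k ^ 2)) := by
  obtain ⟨D, hD⟩ := exists_eq_prod_of_dvd hP χ.conductor_dvd_level
  have hp1 : ∀ x : P, (1 : ℝ) ≤ (x : ℕ) := fun x => by exact_mod_cast (hP x x.2).one_le
  have key := sum_coeff_mul_absGram_le (k := k) hp1 hG hB R D
    fun x => by exact_mod_cast hk x x.2
  have e : (χ.conductor : ℝ) = ∏ x ∈ D, ((x : ℕ) : ℝ) := by
    conv_lhs => rw [hD]
    push_cast; rfl
  rw [e]
  refine le_trans ?_ key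
  rw [charCoeff_sieveSq]
  refine (norm_sum_le _ _).trans (sum_le_sum fun r _ => (norm_sum_le _ _).trans
    (sum_le_sum fun r' _ => ?_))
  have hc : ∀ r, 0 ≤ ccoeff k G R r := fun r => coeff_nonneg (fun x => by linarith [hp1 x]) hG R r
  rw [norm_mul, Complex.norm_real, Real.norm_eq_abs, abs_of_nonneg (mul_nonneg (hc r) (hc r'))]
  refine mul_le_mul_of_nonneg_left ?_ (mul_nonneg (hc r) (hc r'))
  split_ifs with hDr
  · exact norm_charCoeff_config_le hP hh r r' χ
  · push Not at hDr
    obtain ⟨x, hxD, hx1, hx2⟩ := hDr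
    rw [charCoeff_config_eq_zero hP h r r', norm_zero]
    intro hd
    have h1 : (x : ℕ) ∣ ∏ y ∈ joint r r', (y : ℕ) := by
      refine dvd_trans ?_ hd
      rw [hD]
      exact dvd_prod_of_mem _ hxD
    obtain ⟨y, hy, hxy⟩ := ((hP x x.2).prime.dvd_finsetProd_iff _).1 h1
    have : x = y := Subtype.ext ((Nat.prime_dvd_prime_iff_eq (hP x x.2) (hP y y.2)).1 hxy)
    subst this
    exact (mem_filter.1 hy).2 ⟨hx1, hx2⟩

open Classical in
theorem abs_sum_mul_sieveSq_sub_le (hP : ∀ p ∈ P, p.Prime) {h : Fin k → ℤ}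
    (hh : ∀ p ∈ P, ∀ i j, i ≠ j → ¬ (p : ℤ) ∣ h i - h j) {m : Fin k} (hm : h m = 0)
    {G : Finset P → ℝ} {B : ℝ} (hG : ∀ D, 0 ≤ G D) (hB : ∀ D, G D ≤ B) {R : ℝ} (hR : 0 ≤ R)
    (hk : ∀ p ∈ P, (26 * k ^ 2) ^ 2 ≤ p) (w : ℕ → ℝ)
    (hw : ∀ n, w n ≠ 0 → n.Coprime (∏ x : P, (x : ℕ))) (M : ℕ) {Q : ℕ} (hQ : R ^ 2 ≤ Q)
    {q : ℕ} (hq : q = ∏ x : P, (x : ℕ)) {F : Finset (DirichletCharacter ℂ q)}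
    (hF : ∀ χ, χ ∈ F ↔ χ ≠ 1 ∧ χ.conductor ≤ Q) :
    |∑ n ∈ range M, w n * sieveSq (ccoeff k G R) h n -
      (∑ r, ∑ r', ccoeff k G R r * ccoeff k G R r' * ∏ x : P, gramUnit (x : ℕ) m (r x) (r' x)) *
        ∑ n ∈ range M, w n| ≤
      (B ^ k) ^ 2 * (∏ x : P, (1 + 1 / ((x : ℕ) : ℝ))) ^ (26 * k ^ 2) *
        ∑ χ ∈ F, (Real.sqrt χ.conductor)⁻¹ * ‖∑ n ∈ range M, (w n : ℂ) * χ.primitiveCharacter n‖ := by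
  subst hq
  have hq : NeZero (∏ x : P, (x : ℕ)) := ⟨(prod_pos fun (x : P) _ => (hP x x.2).pos).ne'⟩
  set E := sieveSq (ccoeff k G R) h with hE
  have hper : Function.Periodic E (∏ x : P, (x : ℕ)) := sieveSq_periodic _ h
  have hwχ : ∀ (χ : DirichletCharacter ℂ (∏ x : P, (x : ℕ))) n, (w n : ℂ) * χ (n : ZMod (∏ x : P, (x : ℕ))) =
      (w n : ℂ) * χ.primitiveCharacter n := by
    intro χ n
    by_cases h0 : w n = 0
    · simp [h0]
    · have h1 := DirichletCharacter.primitiveCharacter_apply_of_isCoprime χ (a := (n : ℤ))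
        (Nat.isCoprime_iff_coprime.2 (hw n h0))
      push_cast at h1
      rw [h1]
  have h1 : ((∑ n ∈ range M, w n * E n : ℝ) : ℂ) =
      ∑ χ : DirichletCharacter ℂ (∏ x : P, (x : ℕ)), charCoeff E χ * ∑ n ∈ range M, (w n : ℂ) * χ.primitiveCharacter n := by
    push_cast
    simp_rw [mul_sum (s := range M), ← hwχ]
    rw [Finset.sum_comm]
    refine sum_congr rfl fun n _ => ?_
    by_cases h0 : w n = 0
    · simp [h0]
    · rw [← sum_charCoeff_mul hper (hw n h0), mul_sum]
      refine sum_congr rfl fun χ _ => ?_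
      ring
  have h2 : charCoeff E (1 : DirichletCharacter ℂ (∏ x : P, (x : ℕ))) * ∑ n ∈ range M, (w n : ℂ) *
      (1 : DirichletCharacter ℂ (∏ x : P, (x : ℕ))).primitiveCharacter n =
      (((∑ r, ∑ r', ccoeff k G R r * ccoeff k G R r' * ∏ x : P, gramUnit (x : ℕ) m (r x) (r' x)) *
        ∑ n ∈ range M, w n : ℝ) : ℂ) := by
    rw [hE, charCoeff_sieveSq_one hP hh hm, Complex.ofReal_mul, Complex.ofReal_sum (range M)]
    congr 1
    refine sum_congr rfl fun n _ => ?_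
    rw [← hwχ]
    by_cases h0 : w n = 0
    · simp [h0]
    · rw [MulChar.one_apply ((ZMod.isUnit_iff_coprime n _).2 (hw n h0)), mul_one]
  rw [← Real.norm_eq_abs, ← Complex.norm_real, Complex.ofReal_sub, h1, ← h2,
    ← add_sum_erase _ _ (mem_univ (1 : DirichletCharacter ℂ (∏ x : P, (x : ℕ)))), add_sub_cancel_left, mul_sum]
  refine (norm_sum_le (univ.erase (1 : DirichletCharacter ℂ (∏ x : P, (x : ℕ)))) _).trans ?_
  have hsub : F ⊆ univ.erase 1 := fun χ hχ => mem_erase.2 ⟨((hF χ).1 hχ).1, mem_univ _⟩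
  rw [← sum_subset hsub]
  · refine sum_le_sum fun χ _ => ?_
    rw [norm_mul, ← mul_assoc]
    refine mul_le_mul_of_nonneg_right ?_ (norm_nonneg _)
    refine (norm_charCoeff_sieveSq_le hP hh hG hB R hk χ).trans (le_of_eq ?_)
    ring
  · intro χ hχ hχ'
    have h3 : Q < χ.conductor := by
      by_contra hle
      exact hχ' ((hF χ).2 ⟨(mem_erase.1 hχ).1, not_lt.1 hle⟩)
    have h4 : R ^ 2 < (χ.conductor : ℝ) := lt_of_le_of_lt hQ (by exact_mod_cast h3)
    rw [hE, charCoeff_sieveSq_eq_zero hP h G hR h4, zero_mul, norm_zero]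

end PrimeGaps

namespace PrimeGaps

open Finset ArithmeticFunction

variable {q : ℕ}

theorem primitiveCharacter_natCast (χ : DirichletCharacter ℂ q) {n : ℕ} (hn : n.Coprime q) :
    χ.primitiveCharacter n = χ n := by
  have h1 := DirichletCharacter.primitiveCharacter_apply_of_isCoprime χ (a := (n : ℤ))
    (Nat.isCoprime_iff_coprime.2 hn)
  push_cast at h1
  exact h1

theorem primitiveCharacter_ne_one {χ : DirichletCharacter ℂ q} (hχ : χ ≠ 1) :
    χ.primitiveCharacter ≠ 1 := by
  intro h
  apply hχ
  rw [← χ.changeLevel_primitiveCharacter, h, map_one]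

variable [NeZero q]

open Classical in
theorem card_conductor_le {Q : ℕ} {F : Finset (DirichletCharacter ℂ q)}
    (hF : ∀ χ ∈ F, χ.conductor ≤ Q) : #F ≤ Q ^ 2 := by
  set T : ℕ → Finset (DirichletCharacter ℂ q) := fun d =>
    if h : d ∣ q then univ.image (DirichletCharacter.changeLevel h) else ∅ with hT
  have hsub : F ⊆ (Icc 1 Q).biUnion T := by
    intro χ hχ
    have hd := χ.conductor_dvd_level
    rw [mem_biUnion]
    refine ⟨χ.conductor, mem_Icc.2 ⟨Nat.pos_of_dvd_of_pos hd (NeZero.pos q), hF χ hχ⟩, ?_⟩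
    simp only [hT]
    rw [dif_pos hd]
    exact mem_image.2 ⟨χ.primitiveCharacter, mem_univ _, χ.changeLevel_primitiveCharacter⟩
  refine (card_le_card hsub).trans (card_biUnion_le.trans ?_)
  have : ∀ d ∈ Icc 1 Q, #(T d) ≤ Q := by
    intro d hd
    simp only [hT]
    split_ifs with h
    · have : NeZero d := ⟨by have := (mem_Icc.1 hd).1; omega⟩
      refine card_image_le.trans ?_
      rw [card_univ, ← Nat.card_eq_fintype_card,
        DirichletCharacter.card_eq_totient_of_hasEnoughRootsOfUnity]
      exact (Nat.totient_le d).trans (mem_Icc.1 hd).2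
    · simp
  refine (sum_le_sum this).trans ?_
  simp [sq]

theorem isFamily_primitiveCharacter {Q : ℕ} {F : Finset (DirichletCharacter ℂ q)}
    (hF : ∀ χ ∈ F, χ ≠ 1 ∧ χ.conductor ≤ Q) :
    IsFamily F (fun χ n => χ.primitiveCharacter n) Q := by
  have hne : ∀ χ : DirichletCharacter ℂ q, NeZero χ.conductor := fun χ =>
    ⟨(Nat.pos_of_dvd_of_pos χ.conductor_dvd_level (NeZero.pos q)).ne'⟩
  refine ⟨fun χ _ m n => by simp, fun χ _ n => DirichletCharacter.norm_le_one _ _,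
    fun χ hχ n => ?_, fun χ hχ ψ hψ hne' n => ?_, card_conductor_le fun χ hχ => (hF χ hχ).2⟩
  · have := hne χ
    exact (norm_sum_dirichletCharacter_le (primitiveCharacter_ne_one (hF χ hχ).1) n).trans
      (by exact_mod_cast (hF χ hχ).2)
  · have h1 := hne χ
    have h2 := hne ψ
    obtain ⟨θ, hθ, -⟩ := exists_dirichletCharacter_pair χ.primitiveCharacter ψ.primitiveCharacter
    have h3 : NeZero (χ.conductor * ψ.conductor) := ⟨mul_ne_zero (NeZero.ne _) (NeZero.ne _)⟩
    have h4 : θ ≠ 1 := by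
      intro h
      apply hne'
      ext u
      obtain ⟨n, hn⟩ := ZMod.natCast_zmod_surjective (u : ZMod q)
      have hcop : n.Coprime q := (ZMod.isUnit_iff_coprime n q).1 (hn ▸ u.isUnit)
      have h5 := hθ n
      have hχ1 : n.Coprime χ.conductor := hcop.coprime_dvd_right χ.conductor_dvd_level
      have hψ1 : n.Coprime ψ.conductor := hcop.coprime_dvd_right ψ.conductor_dvd_level
      rw [h, MulChar.one_apply ((ZMod.isUnit_iff_coprime n _).2 (hχ1.mul_right hψ1)),
        primitiveCharacter_natCast χ hcop, primitiveCharacter_natCast ψ hcop] at h5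
      have h7 : ψ n * (starRingEnd ℂ) (ψ n) = 1 := by
        rw [hn, Complex.mul_conj, Complex.normSq_eq_norm_sq, ψ.unit_norm_eq_one]
        simp
      rw [← hn]
      calc χ n = χ n * (ψ n * (starRingEnd ℂ) (ψ n)) := by rw [h7, mul_one]
        _ = ψ n * (χ n * (starRingEnd ℂ) (ψ n)) := by ring
        _ = ψ n := by rw [← h5, mul_one]
    have h5 := norm_sum_dirichletCharacter_le h4 n
    simp only [hθ] at h5
    refine h5.trans ?_
    rw [sq]
    push_cast
    have := (hF χ hχ).2
    have := (hF ψ hψ).2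
    gcongr

theorem log_div_pow_mul_wt (φ : ℝ → ℝ) {N : ℝ} (hN : Real.log N ≠ 0) (A : ℕ) (y : ℝ) :
    (Real.log y / Real.log N) ^ A * wt φ N y =
      ∑ j ∈ range (A + 1), (A.choose j : ℝ) / Real.log N ^ j * wt (fun u => u ^ j * φ u) N y := by
  have h : Real.log y / Real.log N = (Real.log y - Real.log N) / Real.log N + 1 := by
    field_simp
    ring
  rw [h, add_pow, sum_mul]
  refine sum_congr rfl fun j _ => ?_
  simp only [wt, one_pow, mul_one, div_pow]
  ring

theorem IsBlock.sum_norm_vonMangoldt_log_pow_le {φ : ℝ → ℝ} (hφ : IsBlock φ) (A : ℕ) :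
    ∃ C : ℝ, 0 < C ∧ ∀ (ι : Type) (s : Finset ι) (χ : ι → ℕ → ℂ) (Q : ℕ), IsFamily s χ Q →
      ∀ N : ℝ, 0 < N → 7 ≤ Real.log N → (Q : ℝ) ^ 12 ≤ N →
      ∑ i ∈ s, ‖∑ n ∈ range (cutoff N), (vonMangoldt n : ℂ) * (χ i n *
        (((Real.log n / Real.log N) ^ A * wt φ N n : ℝ) : ℂ))‖ ≤ C * Real.log N ^ 5 := by
  choose C hC hmain using fun j => (hφ.pow_mul j).sum_norm_vonMangoldt_le
  refine ⟨∑ j ∈ range (A + 1), (A.choose j : ℝ) * C j, ?_, ?_⟩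
  · refine sum_pos (fun j hj => mul_pos ?_ (hC j)) ⟨0, by simp⟩
    exact_mod_cast Nat.choose_pos (by simpa [Nat.lt_succ_iff] using hj)
  intro ι s χ Q hfam N hN hlog hQ
  have hL : 1 ≤ Real.log N := by linarith
  have h1 : ∀ i, ‖∑ n ∈ range (cutoff N), (vonMangoldt n : ℂ) * (χ i n *
        (((Real.log n / Real.log N) ^ A * wt φ N n : ℝ) : ℂ))‖ ≤
      ∑ j ∈ range (A + 1), (A.choose j : ℝ) * ‖∑ n ∈ range (cutoff N), (vonMangoldt n : ℂ) *
        (χ i n * wt (fun u => u ^ j * φ u) N n)‖ := by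
    intro i
    have e : ∑ n ∈ range (cutoff N), (vonMangoldt n : ℂ) * (χ i n *
        (((Real.log n / Real.log N) ^ A * wt φ N n : ℝ) : ℂ)) =
        ∑ j ∈ range (A + 1), (((A.choose j : ℝ) / Real.log N ^ j : ℝ) : ℂ) *
          ∑ n ∈ range (cutoff N), (vonMangoldt n : ℂ) *
            (χ i n * wt (fun u => u ^ j * φ u) N n) := by
      simp_rw [mul_sum (s := range (cutoff N))]
      rw [Finset.sum_comm]
      refine sum_congr rfl fun n _ => ?_
      rw [log_div_pow_mul_wt φ (by linarith) A, Complex.ofReal_sum, mul_sum, mul_sum]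
      refine sum_congr rfl fun j _ => ?_
      push_cast
      ring
    rw [e]
    refine (norm_sum_le _ _).trans (sum_le_sum fun j _ => ?_)
    rw [norm_mul, Complex.norm_real, Real.norm_of_nonneg (by positivity)]
    exact mul_le_mul_of_nonneg_right (div_le_self (by positivity) (one_le_pow₀ hL)) (norm_nonneg _)
  refine (sum_le_sum fun i _ => h1 i).trans ?_
  rw [Finset.sum_comm, sum_mul]
  refine sum_le_sum fun j _ => ?_
  rw [← mul_sum, mul_assoc]
  exact mul_le_mul_of_nonneg_left (hmain j ι s χ Q hfam N hN hlog hQ) (by positivity)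

theorem IsBlock.sum_primitiveCharacter_le {φ : ℝ → ℝ} (hφ : IsBlock φ) (D : ℕ) :
    ∃ A : ℕ, ∃ C : ℝ, 0 < C ∧ ∀ᶠ N : ℝ in atTop, ∃ d₁ : ℕ, 2 ≤ d₁ ∧
      ∀ (q : ℕ) [NeZero q], ¬ d₁ ∣ q → ∀ (Q : ℕ), (Q : ℝ) ^ 12 ≤ N →
      ∀ F : Finset (DirichletCharacter ℂ q), (∀ χ ∈ F, χ ≠ 1 ∧ χ.conductor ≤ Q) →
      ∑ χ ∈ F, (Real.sqrt χ.conductor)⁻¹ * ‖∑ n ∈ range (cutoff N), (vonMangoldt n : ℂ) *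
        (χ.primitiveCharacter n * (((Real.log n / Real.log N) ^ A * wt φ N n : ℝ) : ℂ))‖ ≤
        C / Real.log N ^ D := by
  classical
  set B := 2 * (5 + D) with hB
  set D₂ := 2 * B + D with hD₂
  set A := 7 * D₂ + 6 with hA
  obtain ⟨C₁, hC₁, h₁⟩ := hφ.siegel_walfisz B D₂
  obtain ⟨C₂, hC₂, h₂⟩ := hφ.sum_norm_vonMangoldt_log_pow_le A
  refine ⟨A, C₁ + C₂, by positivity, ?_⟩
  filter_upwards [h₁, Real.tendsto_log_atTop.eventually_ge_atTop 7, eventually_gt_atTop 0]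
    with N ⟨d₁, hd₁, h₁⟩ hlog hN
  refine ⟨d₁, hd₁, fun q hq hdq Q hQ F hF => ?_⟩
  set L := Real.log N with hL
  have hL0 : 0 < L := by linarith
  set S : DirichletCharacter ℂ q → ℝ := fun χ => ‖∑ n ∈ range (cutoff N), (vonMangoldt n : ℂ) *
        (χ.primitiveCharacter n * (((Real.log n / L) ^ A * wt φ N n : ℝ) : ℂ))‖ with hS
  have hS0 : ∀ χ, 0 ≤ S χ := fun χ => norm_nonneg _
  have hc1 : ∀ χ : DirichletCharacter ℂ q, 1 ≤ χ.conductor := fun χ =>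
    Nat.pos_of_dvd_of_pos χ.conductor_dvd_level (NeZero.pos q)
  rw [← sum_filter_add_sum_filter_not F (fun χ => (χ.conductor : ℝ) ≤ L ^ B), add_div]
  refine add_le_add ?_ ?_
  · set F' := F.filter fun χ => (χ.conductor : ℝ) ≤ L ^ B
    have hcard : (#F' : ℝ) ≤ L ^ (2 * B) := by
      have h3 := card_conductor_le (Q := ⌊L ^ B⌋₊) (F := F') fun χ hχ =>
        Nat.le_floor (mem_filter.1 hχ).2
      calc (#F' : ℝ) ≤ (⌊L ^ B⌋₊ : ℝ) ^ 2 := by exact_mod_cast h3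
        _ ≤ (L ^ B) ^ 2 := by gcongr; exact Nat.floor_le (by positivity)
        _ = L ^ (2 * B) := by rw [← _root_.pow_mul, mul_comm]
    have h4 : ∀ χ ∈ F', (Real.sqrt χ.conductor)⁻¹ * S χ ≤ C₁ / L ^ D₂ := by
      intro χ hχ
      have hχ' := mem_filter.1 hχ
      have hne : NeZero χ.conductor := ⟨Nat.one_le_iff_ne_zero.1 (hc1 χ)⟩
      refine (mul_le_of_le_one_left (hS0 χ) (inv_le_one_of_one_le₀ ?_)).trans ?_
      · rw [Real.one_le_sqrt]
        exact_mod_cast hc1 χ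
      · refine h₁ χ.conductor hχ'.2 ?_ χ.primitiveCharacter χ.primitiveCharacter_isPrimitive
          (primitiveCharacter_ne_one (hF χ hχ'.1).1)
        rintro rfl
        exact hdq χ.conductor_dvd_level
    refine (sum_le_card_nsmul _ _ _ h4).trans ?_
    rw [nsmul_eq_mul]
    calc (#F' : ℝ) * (C₁ / L ^ D₂) ≤ L ^ (2 * B) * (C₁ / L ^ D₂) := by gcongr
      _ = C₁ / L ^ D := by
        rw [hD₂, pow_add]
        field_simp
  · have h4 : ∀ χ ∈ F.filter fun χ => ¬ (χ.conductor : ℝ) ≤ L ^ B,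
        (Real.sqrt χ.conductor)⁻¹ * S χ ≤ (L ^ (5 + D))⁻¹ * S χ := by
      intro χ hχ
      refine mul_le_mul_of_nonneg_right ?_ (hS0 χ)
      refine inv_anti₀ (by positivity) (Real.le_sqrt_of_sq_le ?_)
      rw [← _root_.pow_mul, mul_comm, ← hB]
      exact (not_le.1 (mem_filter.1 hχ).2).le
    refine (sum_le_sum h4).trans ?_
    rw [← mul_sum]
    have h5 : ∑ χ ∈ F.filter fun χ => ¬ (χ.conductor : ℝ) ≤ L ^ B, S χ ≤ C₂ * L ^ 5 :=
      (sum_le_sum_of_subset_of_nonneg (filter_subset _ _) fun χ _ _ => hS0 χ).trans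
        (h₂ _ F _ Q (isFamily_primitiveCharacter hF) N hN hlog hQ)
    calc (L ^ (5 + D))⁻¹ * ∑ χ ∈ F.filter fun χ => ¬ (χ.conductor : ℝ) ≤ L ^ B, S χ
        ≤ (L ^ (5 + D))⁻¹ * (C₂ * L ^ 5) := by gcongr
      _ = C₂ / L ^ D := by
        rw [pow_add]
        field_simp

end PrimeGaps

namespace PrimeGaps

open Finset ArithmeticFunction

/-- `log n` on the primes, zero elsewhere. -/
noncomputable def logPrime (n : ℕ) : ℝ := if n.Prime then Real.log n else 0

theorem logPrime_nonneg (n : ℕ) : 0 ≤ logPrime n := by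
  rw [logPrime]
  split_ifs
  · exact Real.log_natCast_nonneg n
  · exact le_rfl

theorem logPrime_le (n : ℕ) : logPrime n ≤ vonMangoldt n := by
  rw [logPrime]
  split_ifs with h
  · rw [vonMangoldt_apply_prime h]
  · exact vonMangoldt_nonneg

theorem sum_vonMangoldt_sub_logPrime_le {M : ℕ} (hM : 1 ≤ M) :
    ∑ n ∈ range M, (vonMangoldt n - logPrime n) ≤ 2 * Real.sqrt M * Real.log M := by
  have h1 := Chebyshev.abs_psi_sub_theta_le_sqrt_mul_log (x := M) (by exact_mod_cast hM)
  refine le_trans ?_ ((le_abs_self _).trans h1)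
  rw [Chebyshev.psi_sub_theta_eq_sum_not_prime, sum_filter, Nat.floor_natCast]
  have e : ∀ n, vonMangoldt n - logPrime n = if ¬ n.Prime then vonMangoldt n else 0 := by
    intro n
    rw [logPrime]
    by_cases h : n.Prime
    · rw [if_pos h, if_neg (not_not.2 h), vonMangoldt_apply_prime h, sub_self]
    · rw [if_neg h, if_pos h, sub_zero]
  simp only [e]
  rw [range_eq_Ico, ← sum_erase (Ico 0 M) (a := 0) (by simp)]
  refine sum_le_sum_of_subset_of_nonneg (fun n hn => ?_) fun n _ _ => ?_
  · rw [mem_erase, mem_Ico] at hn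
    rw [mem_Ioc]
    omega
  · rw [← e]
    linarith [logPrime_le n]

theorem cutoff_le {N : ℝ} (hN : 1 ≤ N) : (cutoff N : ℝ) ≤ 56 * N := by
  have h1 : (cutoff N : ℝ) ≤ N * Real.exp 4 + 1 := by
    rw [cutoff]
    push_cast
    have := Nat.floor_le (show 0 ≤ N * Real.exp 4 by positivity)
    linarith
  have h2 : Real.exp 4 ≤ 55 := by
    have := Real.exp_one_lt_d9
    have e : Real.exp 4 = Real.exp 1 ^ 4 := by rw [← Real.exp_nat_mul]; norm_num
    rw [e]
    calc Real.exp 1 ^ 4 ≤ 2.72 ^ 4 := by gcongr; linarith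
      _ ≤ 55 := by norm_num
  nlinarith

theorem cutoff_pos (N : ℝ) : 1 ≤ cutoff N := by simp [cutoff]

theorem IsBlock.abs_log_pow_mul_wt_le {φ : ℝ → ℝ} (hφ : IsBlock φ) (A : ℕ) :
    ∃ C : ℝ, 0 < C ∧ ∀ N : ℝ, 0 < N → 7 ≤ Real.log N → ∀ n ∈ range (cutoff N),
      |(Real.log n / Real.log N) ^ A * wt φ N n| ≤ C / N := by
  obtain ⟨C, hC, h⟩ := hφ.wt_bounds
  refine ⟨2 ^ A * C, by positivity, fun N hN hlog n hn => ?_⟩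
  rw [abs_mul, abs_pow, mul_div_assoc]
  refine mul_le_mul ?_ ((h N hN (by linarith)).1 n (by positivity)) (abs_nonneg _) (by positivity)
  gcongr
  have h0 := Real.log_natCast_nonneg n
  rw [abs_of_nonneg (by positivity), div_le_iff₀ (by linarith)]
  rcases Nat.eq_zero_or_pos n with rfl | hn0
  · simp; linarith
  have h1 : Real.log n ≤ Real.log (cutoff N) :=
    Real.log_le_log (by exact_mod_cast hn0) (by exact_mod_cast (mem_range.1 hn).le)
  have := log_cutoff_le hN hlog
  linarith

theorem IsBlock.sum_logPrime_primitiveCharacter_le {φ : ℝ → ℝ} (hφ : IsBlock φ) (D : ℕ) :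
    ∃ A : ℕ, ∃ C : ℝ, 0 < C ∧ ∀ᶠ N : ℝ in atTop, ∃ d₁ : ℕ, 2 ≤ d₁ ∧
      ∀ (q : ℕ) [NeZero q], ¬ d₁ ∣ q → ∀ (Q : ℕ), (Q : ℝ) ^ 12 ≤ N →
      ∀ F : Finset (DirichletCharacter ℂ q), (∀ χ ∈ F, χ ≠ 1 ∧ χ.conductor ≤ Q) →
      ∑ χ ∈ F, (Real.sqrt χ.conductor)⁻¹ * ‖∑ n ∈ range (cutoff N),
        ((logPrime n * ((Real.log n / Real.log N) ^ A * wt φ N n) : ℝ) : ℂ) *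
          χ.primitiveCharacter n‖ ≤ C / Real.log N ^ D := by
  obtain ⟨A, C₁, hC₁, h₁⟩ := hφ.sum_primitiveCharacter_le D
  obtain ⟨C₂, hC₂, h₂⟩ := hφ.abs_log_pow_mul_wt_le A
  refine ⟨A, C₁ + C₂ * 32, by positivity, ?_⟩
  have hlit : ∀ᶠ N : ℝ in atTop, Real.log N ^ (6 * D + 6) ≤ N := by
    have := (Real.isLittleO_pow_log_id_atTop (n := 6 * D + 6)).bound one_pos
    filter_upwards [this, eventually_ge_atTop 0] with N hN h0
    rw [one_mul, id, Real.norm_of_nonneg h0] at hN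
    exact (le_abs_self _).trans hN
  filter_upwards [h₁, Real.tendsto_log_atTop.eventually_ge_atTop 7, eventually_ge_atTop 1, hlit]
    with N ⟨d₁, hd₁, h₁⟩ hlog hN hlit
  refine ⟨d₁, hd₁, fun q hq hdq Q hQ F hF => ?_⟩
  have hN0 : 0 < N := by linarith
  set L := Real.log N with hL
  have hL0 : 0 < L := by linarith
  set g : ℕ → ℝ := fun n => (Real.log n / L) ^ A * wt φ N n with hg
  have hsmall : ∑ n ∈ range (cutoff N), (vonMangoldt n - logPrime n) * |g n| ≤
      C₂ / N * (32 * Real.sqrt N * L) := by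
    calc ∑ n ∈ range (cutoff N), (vonMangoldt n - logPrime n) * |g n|
        ≤ ∑ n ∈ range (cutoff N), (vonMangoldt n - logPrime n) * (C₂ / N) := by
          refine sum_le_sum fun n hn => mul_le_mul_of_nonneg_left (h₂ N hN0 hlog n hn) ?_
          linarith [logPrime_le n]
      _ = C₂ / N * ∑ n ∈ range (cutoff N), (vonMangoldt n - logPrime n) := by
          rw [← sum_mul, mul_comm]
      _ ≤ C₂ / N * (2 * Real.sqrt (cutoff N) * Real.log (cutoff N)) := by
          gcongr
          exact sum_vonMangoldt_sub_logPrime_le (cutoff_pos N)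
      _ ≤ C₂ / N * (2 * (8 * Real.sqrt N) * (2 * L)) := by
          have h5 : Real.sqrt (cutoff N) ≤ 8 * Real.sqrt N := by
            refine Real.sqrt_le_iff.2 ⟨by positivity, ?_⟩
            rw [mul_pow, Real.sq_sqrt hN0.le]
            linarith [cutoff_le hN]
          have h6 := log_cutoff_le hN0 hlog
          have h7 : (0 : ℝ) ≤ Real.log (cutoff N) := Real.log_natCast_nonneg _
          gcongr
          linarith
      _ = C₂ / N * (32 * Real.sqrt N * L) := by ring
  have hterm : ∀ χ ∈ F, (Real.sqrt χ.conductor)⁻¹ * ‖∑ n ∈ range (cutoff N),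
        ((logPrime n * g n : ℝ) : ℂ) * χ.primitiveCharacter n‖ ≤
      (Real.sqrt χ.conductor)⁻¹ * ‖∑ n ∈ range (cutoff N), (vonMangoldt n : ℂ) *
        (χ.primitiveCharacter n * ((g n : ℝ) : ℂ))‖ + C₂ / N * (32 * Real.sqrt N * L) := by
    intro χ _
    have h3 : ∑ n ∈ range (cutoff N), ((logPrime n * g n : ℝ) : ℂ) * χ.primitiveCharacter n =
        ∑ n ∈ range (cutoff N), (vonMangoldt n : ℂ) *
          (χ.primitiveCharacter n * ((g n : ℝ) : ℂ)) -
        ∑ n ∈ range (cutoff N), (((vonMangoldt n - logPrime n : ℝ)) : ℂ) *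
          (χ.primitiveCharacter n * ((g n : ℝ) : ℂ)) := by
      rw [← sum_sub_distrib]
      refine sum_congr rfl fun n _ => ?_
      push_cast
      ring
    have h4 : ‖∑ n ∈ range (cutoff N), (((vonMangoldt n - logPrime n : ℝ)) : ℂ) *
          (χ.primitiveCharacter n * ((g n : ℝ) : ℂ))‖ ≤ C₂ / N * (32 * Real.sqrt N * L) := by
      refine (norm_sum_le _ _).trans (le_trans (sum_le_sum fun n _ => ?_) hsmall)
      rw [norm_mul, norm_mul, Complex.norm_real, Complex.norm_real,
        Real.norm_of_nonneg (by linarith [logPrime_le n]), Real.norm_eq_abs]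
      refine mul_le_mul_of_nonneg_left ?_ (by linarith [logPrime_le n])
      exact mul_le_of_le_one_left (abs_nonneg _) (DirichletCharacter.norm_le_one _ _)
    have hc : (Real.sqrt χ.conductor)⁻¹ ≤ 1 := by
      refine inv_le_one_of_one_le₀ (Real.one_le_sqrt.2 ?_)
      exact_mod_cast Nat.pos_of_dvd_of_pos χ.conductor_dvd_level (NeZero.pos q)
    have hc0 : 0 ≤ (Real.sqrt χ.conductor)⁻¹ := by positivity
    rw [h3]
    refine (mul_le_mul_of_nonneg_left (norm_sub_le _ _) hc0).trans ?_
    rw [mul_add]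
    refine add_le_add le_rfl ?_
    exact (mul_le_of_le_one_left (norm_nonneg _) hc).trans h4
  refine (sum_le_sum hterm).trans ?_
  rw [sum_add_distrib, add_div, sum_const, nsmul_eq_mul]
  refine add_le_add (h₁ q hdq Q hQ F hF) ?_
  have hcard : (#F : ℝ) ≤ (Q : ℝ) ^ 2 := by
    exact_mod_cast card_conductor_le fun χ hχ => (hF χ hχ).2
  have hkey : (Q : ℝ) ^ 2 * Real.sqrt N * L ^ (D + 1) ≤ N := by
    refine le_of_pow_le_pow_left₀ (n := 6) (by norm_num) hN0.le ?_
    have hs : Real.sqrt N ^ 6 = N ^ 3 := by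
      rw [show (6 : ℕ) = 2 * 3 by norm_num, _root_.pow_mul, Real.sq_sqrt hN0.le]
    calc ((Q : ℝ) ^ 2 * Real.sqrt N * L ^ (D + 1)) ^ 6
        = (Q : ℝ) ^ 12 * Real.sqrt N ^ 6 * L ^ (6 * D + 6) := by ring
      _ ≤ N * N ^ 3 * N := by rw [hs]; gcongr
      _ = N ^ 5 := by ring
      _ ≤ N ^ 6 := pow_le_pow_right₀ hN (by norm_num)
  calc (#F : ℝ) * (C₂ / N * (32 * Real.sqrt N * L))
      ≤ (Q : ℝ) ^ 2 * (C₂ / N * (32 * Real.sqrt N * L)) := by gcongr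
    _ = C₂ * 32 / L ^ D * (((Q : ℝ) ^ 2 * Real.sqrt N * L ^ (D + 1)) / N) := by
        rw [pow_succ]
        generalize Real.sqrt N = t
        field_simp
        ring
    _ ≤ C₂ * 32 / L ^ D * 1 := by
        gcongr
        exact (div_le_one hN0).2 hkey
    _ = C₂ * 32 / L ^ D := mul_one _

end PrimeGaps

namespace PrimeGaps

open Finset

theorem IsBlock.abs_sum_logPrime_mul_sieveSq_sub_le {φ : ℝ → ℝ} (hφ : IsBlock φ) (k : ℕ) {B : ℝ}
    (hB0 : 0 < B) :
    ∃ A : ℕ, ∃ C : ℝ, 0 < C ∧ ∀ᶠ N : ℝ in atTop, ∃ d₁ : ℕ, 2 ≤ d₁ ∧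
      ∀ P : Finset ℕ, (∀ p ∈ P, p.Prime) → (∀ p ∈ P, (p : ℝ) ≤ N ^ (1 / 100 : ℝ)) →
      ¬ d₁ ∣ ∏ x : P, (x : ℕ) → (∀ p ∈ P, (26 * k ^ 2) ^ 2 ≤ p) →
      ∀ h : Fin k → ℤ, (∀ p ∈ P, ∀ i j, i ≠ j → ¬ (p : ℤ) ∣ h i - h j) → ∀ m, h m = 0 →
      ∀ G : Finset P → ℝ, (∀ D, 0 ≤ G D) → (∀ D, G D ≤ B) →
      |∑ n ∈ range (cutoff N), logPrime n * ((Real.log n / Real.log N) ^ A * wt φ N n) *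
          sieveSq (ccoeff k G (N ^ (1 / 100 : ℝ))) h n -
        (∑ r, ∑ r', ccoeff k G (N ^ (1 / 100 : ℝ)) r * ccoeff k G (N ^ (1 / 100 : ℝ)) r' *
          ∏ x : P, gramUnit (x : ℕ) m (r x) (r' x)) *
        ∑ n ∈ range (cutoff N), logPrime n * ((Real.log n / Real.log N) ^ A * wt φ N n)| ≤
        C / Real.log N := by
  set D := 78 * k ^ 2 + 1 with hD
  obtain ⟨A, C, hC, hmain⟩ := hφ.sum_logPrime_primitiveCharacter_le D
  refine ⟨A, (B ^ k) ^ 2 * C, by positivity, ?_⟩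
  have hRtop : Tendsto (fun N : ℝ => N ^ (1 / 100 : ℝ)) atTop atTop :=
    tendsto_rpow_atTop (by norm_num)
  filter_upwards [hmain, Real.tendsto_log_atTop.eventually_ge_atTop 7, eventually_gt_atTop 0,
    hRtop.eventually eventually_prod_one_add_le, hRtop.eventually_ge_atTop (Real.exp 4)]
    with N ⟨d₁, hd₁, hN⟩ hlog hN0 hprod hR
  refine ⟨d₁, hd₁, fun P hP hPR hdq hk h hh m hm G hG hGB => ?_⟩
  set R := N ^ (1 / 100 : ℝ) with hRdef
  have he4 : (16 : ℝ) ≤ Real.exp 4 := by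
    have e : Real.exp 4 = Real.exp 1 ^ 4 := by rw [← Real.exp_nat_mul]; norm_num
    have := Real.add_one_le_exp (1 : ℝ)
    rw [e]
    calc (16 : ℝ) = 2 ^ 4 := by norm_num
      _ ≤ Real.exp 1 ^ 4 := by gcongr; linarith
  have hR16 : 16 ≤ R := he4.trans hR
  have hRN : R ^ 100 = N := by
    rw [hRdef, ← Real.rpow_natCast, ← Real.rpow_mul hN0.le]
    norm_num
  have hlogR : Real.log R = Real.log N / 100 := by
    rw [← hRN, Real.log_pow]
    push_cast
    ring
  have hL0 : 0 < Real.log N := by linarith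
  have hq : NeZero (∏ x : P, (x : ℕ)) := ⟨(prod_pos fun (x : P) _ => (hP x x.2).pos).ne'⟩
  set Q := ⌈R ^ 2⌉₊ with hQdef
  have hQ : (Q : ℝ) ^ 12 ≤ N := by
    have h1 : (Q : ℝ) ≤ R ^ 3 := by
      have := Nat.ceil_lt_add_one (show 0 ≤ R ^ 2 by positivity)
      rw [← hQdef] at this
      nlinarith
    calc (Q : ℝ) ^ 12 ≤ (R ^ 3) ^ 12 := by gcongr
      _ = R ^ 36 := by ring
      _ ≤ R ^ 100 := pow_le_pow_right₀ (by linarith) (by norm_num)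
      _ = N := hRN
  obtain ⟨F, hF⟩ : ∃ F : Finset (DirichletCharacter ℂ (∏ x : P, (x : ℕ))),
      ∀ χ, χ ∈ F ↔ χ ≠ 1 ∧ χ.conductor ≤ Q :=
    ⟨(Set.toFinite {χ | χ ≠ 1 ∧ χ.conductor ≤ Q}).toFinset, fun χ => by
      rw [Set.Finite.mem_toFinset, Set.mem_ofPred_eq]⟩
  have hRlt : R < N * Real.exp (-4) := by
    rw [Real.exp_neg, ← div_eq_mul_inv, lt_div_iff₀ (Real.exp_pos 4), ← hRN]
    calc R * Real.exp 4 ≤ R * R := by gcongr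
      _ < R ^ 100 := by
        rw [← sq]
        exact pow_lt_pow_right₀ (by linarith) (by norm_num)
  have hw : ∀ n : ℕ, logPrime n * ((Real.log n / Real.log N) ^ A * wt φ N n) ≠ 0 →
      n.Coprime (∏ x : P, (x : ℕ)) := by
    intro n hn
    have hnp : n.Prime := by
      by_contra hnp
      exact hn (by rw [logPrime, if_neg hnp, zero_mul])
    refine Nat.Coprime.prod_right fun (x : P) _ => (Nat.coprime_primes hnp (hP x x.2)).2 ?_
    rintro rfl
    apply hn
    rw [hφ.wt_eq_zero_of_lt (by linarith) (by positivity) ((hPR x x.2).trans_lt hRlt)]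
    simp
  refine (abs_sum_mul_sieveSq_sub_le hP hh hm hG hGB (by linarith) hk _ hw (cutoff N)
    (Nat.le_ceil _) rfl hF).trans ?_
  have h1 := hN _ hdq Q hQ F fun χ hχ => (hF χ).1 hχ
  have h2 : (∏ x : P, (1 + 1 / ((x : ℕ) : ℝ))) ^ (26 * k ^ 2) ≤ Real.log N ^ (78 * k ^ 2) := by
    have h3 : ∏ x : P, (1 + 1 / ((x : ℕ) : ℝ)) ≤ Real.log N ^ 3 := by
      refine (hprod P hP hPR).trans ?_
      rw [hlogR]
      gcongr
      linarith
    calc _ ≤ (Real.log N ^ 3) ^ (26 * k ^ 2) := by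
          gcongr
      _ = Real.log N ^ (78 * k ^ 2) := by rw [← _root_.pow_mul]; congr 1; ring
  calc _ ≤ (B ^ k) ^ 2 * Real.log N ^ (78 * k ^ 2) * (C / Real.log N ^ D) := by
        gcongr
    _ = (B ^ k) ^ 2 * C / Real.log N := by
        rw [hD, pow_succ]
        field_simp
        ring

end PrimeGaps

namespace PrimeGaps

open Finset ArithmeticFunction

theorem exists_isBlock {a b : ℝ} (ha : 0 < a) (hab : a < b) (hb : b ≤ 4) :
    ∃ φ : ℝ → ℝ, IsBlock φ ∧ (∀ u, 0 ≤ φ u) ∧ (∀ u, φ u ≤ 1) ∧ (∀ u, |u| ≤ a → φ u = 1) ∧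
      ∀ u, b ≤ |u| → φ u = 0 := by
  let f : ContDiffBump (0 : ℝ) := ⟨a, b, ha, hab⟩
  have hz : ∀ u, b ≤ |u| → f u = 0 := fun u hu => f.zero_of_le_dist (by simpa using hu)
  refine ⟨f, ⟨f.contDiff, fun u hu => hz u (by linarith)⟩, fun u => f.nonneg, fun u => f.le_one,
    fun u hu => f.one_of_mem_closedBall (by simpa using hu), hz⟩

theorem wt_nonneg {φ : ℝ → ℝ} (h0 : ∀ u, 0 ≤ φ u) (N y : ℝ) : 0 ≤ wt φ N y :=
  mul_nonneg (Real.exp_pos _).le (h0 _)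

theorem eventually_log_div_log_pow (A : ℕ) : ∀ᶠ N : ℝ in atTop, ∀ y : ℝ,
    |Real.log y - Real.log N| ≤ 3 →
      1 / 2 ≤ (Real.log y / Real.log N) ^ A ∧ (Real.log y / Real.log N) ^ A ≤ 2 := by
  have hc : ContinuousAt (fun x : ℝ => x ^ A) 1 := (continuous_pow A).continuousAt
  obtain ⟨δ, hδ, h⟩ := Metric.continuousAt_iff.1 hc (1 / 2) (by norm_num)
  filter_upwards [Real.tendsto_log_atTop.eventually_gt_atTop (3 / δ),
    Real.tendsto_log_atTop.eventually_gt_atTop 0] with N hN h0 y hy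
  have h1 : |Real.log y / Real.log N - 1| < δ := by
    have e : Real.log y / Real.log N - 1 = (Real.log y - Real.log N) / Real.log N := by
      field_simp
    rw [e, abs_div, abs_of_pos h0, div_lt_iff₀ h0]
    rw [div_lt_iff₀ hδ] at hN
    linarith
  have h2 := h (x := Real.log y / Real.log N) (by rwa [Real.dist_eq])
  rw [Real.dist_eq, one_pow, abs_lt] at h2
  constructor <;> linarith

theorem IsBlock.exists_sum_wt_le {φ : ℝ → ℝ} (hφ : IsBlock φ) :
    ∃ C : ℝ, 0 < C ∧ ∀ᶠ N : ℝ in atTop, ∑ n ∈ range (cutoff N), wt φ N n ≤ C := by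
  obtain ⟨C, hC, h⟩ := hφ.wt_bounds
  refine ⟨56 * C, by positivity, ?_⟩
  filter_upwards [eventually_ge_atTop 1, Real.tendsto_log_atTop.eventually_ge_atTop 5]
    with N h1 h5
  calc ∑ n ∈ range (cutoff N), wt φ N n ≤ ∑ n ∈ range (cutoff N), C / N :=
        sum_le_sum fun n _ => (le_abs_self _).trans
          ((h N (by linarith) h5).1 n (by positivity))
    _ = (cutoff N : ℝ) * (C / N) := by simp
    _ ≤ (56 * N) * (C / N) := by gcongr; exact cutoff_le h1
    _ = 56 * C := by field_simp

theorem eventually_half_log_two_mul_le_theta :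
    ∀ᶠ x : ℝ in atTop, x / 4 ≤ Chebyshev.theta x := by
  have h1 : (fun x : ℝ => Real.log x) =o[atTop] fun x : ℝ => x ^ (1 / 4 : ℝ) :=
    isLittleO_log_rpow_atTop (by norm_num)
  filter_upwards [h1.bound (show (0 : ℝ) < 1 / 100 by norm_num), eventually_ge_atTop 16]
    with x hx h16
  have h0 : (0 : ℝ) < x := by linarith
  refine le_trans ?_ (Chebyshev.theta_ge' (x := x) (by linarith))
  have hl0 : 0 ≤ Real.log x := Real.log_nonneg (by linarith)
  rw [Real.norm_of_nonneg hl0, Real.norm_of_nonneg (by positivity)] at hx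
  have hs : Real.sqrt x * x ^ (1 / 4 : ℝ) ≤ x := by
    rw [Real.sqrt_eq_rpow, ← Real.rpow_add h0]
    calc x ^ (1 / 2 + 1 / 4 : ℝ) ≤ x ^ (1 : ℝ) :=
          Real.rpow_le_rpow_of_exponent_le (by linarith) (by norm_num)
      _ = x := Real.rpow_one x
  have hs1 : 1 ≤ Real.sqrt x := Real.one_le_sqrt.2 (by linarith)
  have h2 : Real.sqrt x * Real.log x ≤ x / 100 := by
    calc _ ≤ Real.sqrt x * (1 / 100 * x ^ (1 / 4 : ℝ)) := by gcongr
      _ ≤ x / 100 := by linarith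
  have h3 : Real.log (x + 2) ≤ 2 * Real.log x := by
    rw [← Real.log_rpow h0]
    exact Real.log_le_log (by linarith) (by norm_num; nlinarith)
  have h4 : Real.log x ≤ Real.sqrt x * Real.log x := le_mul_of_one_le_left hl0 hs1
  have := Real.log_two_gt_d9
  nlinarith

theorem sum_logPrime_Ioc {a b : ℝ} (hab : a ≤ b) :
    Chebyshev.theta b - Chebyshev.theta a = ∑ n ∈ Ioc ⌊a⌋₊ ⌊b⌋₊, logPrime n := by
  have e : ∀ x : ℝ, Chebyshev.theta x = ∑ n ∈ Ioc 0 ⌊x⌋₊, logPrime n := by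
    intro x
    rw [Chebyshev.theta, sum_filter]
    rfl
  rw [e, e, sub_eq_iff_eq_add, add_comm,
    ← Finset.sum_union (by rw [disjoint_left]; intro x; simp only [mem_Ioc]; omega),
    Ioc_union_Ioc_eq_Ioc (Nat.zero_le _) (Nat.floor_mono hab)]

theorem exists_le_sum_logPrime_mul_wt {φ : ℝ → ℝ} (h0 : ∀ u, 0 ≤ φ u)
    (h1 : ∀ u, |u| ≤ 2 → φ u = 1) (A : ℕ) : ∀ᶠ N : ℝ in atTop, Real.exp (-4) / 2 ≤
      ∑ n ∈ range (cutoff N), logPrime n * ((Real.log n / Real.log N) ^ A * wt φ N n) := by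
  have ht : Tendsto (fun N : ℝ => N * Real.exp 2) atTop atTop :=
    tendsto_id.atTop_mul_const (Real.exp_pos 2)
  filter_upwards [eventually_gt_atTop 1, Real.tendsto_log_atTop.eventually_ge_atTop 2,
    eventually_log_div_log_pow A, ht.eventually eventually_half_log_two_mul_le_theta]
    with N hN hL hA hth
  have hN0 : 0 < N := by linarith
  have hL0 : 0 < Real.log N := by linarith
  have hab : N * Real.exp (-2) ≤ N * Real.exp 2 := by gcongr; norm_num
  have hsub : Ioc ⌊N * Real.exp (-2)⌋₊ ⌊N * Real.exp 2⌋₊ ⊆ range (cutoff N) := by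
    intro n hn
    rw [mem_Ioc] at hn
    rw [mem_range, cutoff]
    have : ⌊N * Real.exp 2⌋₊ ≤ ⌊N * Real.exp 4⌋₊ := Nat.floor_mono (by gcongr; norm_num)
    omega
  have hmain : ∀ n ∈ range (cutoff N),
      0 ≤ logPrime n * ((Real.log n / Real.log N) ^ A * wt φ N n) := fun n _ =>
    mul_nonneg (logPrime_nonneg n) (mul_nonneg
      (pow_nonneg (div_nonneg (Real.log_natCast_nonneg n) hL0.le) A) (wt_nonneg h0 _ _))
  refine le_trans ?_ (sum_le_sum_of_subset_of_nonneg hsub fun n hn _ => hmain n hn)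
  have hlow : ∀ n ∈ Ioc ⌊N * Real.exp (-2)⌋₊ ⌊N * Real.exp 2⌋₊,
      logPrime n * (Real.exp (-4) / (2 * N)) ≤
        logPrime n * ((Real.log n / Real.log N) ^ A * wt φ N n) := by
    intro n hn
    rw [mem_Ioc, Nat.floor_lt (by positivity), Nat.le_floor_iff (by positivity)] at hn
    have hn0 : (0 : ℝ) < n := lt_trans (by positivity) hn.1
    have g1 : Real.log N - 2 ≤ Real.log n := by
      have := Real.log_le_log (by positivity) hn.1.le
      rwa [Real.log_mul (by positivity) (by positivity), Real.log_exp] at this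
    have g2 : Real.log n ≤ Real.log N + 2 := by
      have := Real.log_le_log hn0 hn.2
      rwa [Real.log_mul (by positivity) (by positivity), Real.log_exp] at this
    have g3 : |Real.log n - Real.log N| ≤ 2 := abs_le.2 ⟨by linarith, by linarith⟩
    have g4 : Real.exp (-4) / N ≤ wt φ N n := by
      rw [wt, h1 _ g3, mul_one]
      have e : Real.exp (-4) / N = Real.exp (-4 - Real.log N) := by
        rw [Real.exp_sub, Real.exp_log hN0]
      rw [e, Real.exp_le_exp]
      have : (1 + 1 / Real.log N) * Real.log n ≤ (1 + 1 / Real.log N) * (Real.log N + 2) := by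
        gcongr
      have e2 : (1 + 1 / Real.log N) * (Real.log N + 2) = Real.log N + 3 + 2 / Real.log N := by
        field_simp; ring
      have : 2 / Real.log N ≤ 1 := by rw [div_le_one hL0]; exact hL
      linarith
    refine mul_le_mul_of_nonneg_left ?_ (logPrime_nonneg n)
    calc Real.exp (-4) / (2 * N) = 1 / 2 * (Real.exp (-4) / N) := by ring
      _ ≤ _ := mul_le_mul (hA n (by linarith)).1 g4 (by positivity)
        (by linarith [(hA n (by linarith)).1])
  refine le_trans ?_ (sum_le_sum hlow)
  rw [← sum_mul, ← sum_logPrime_Ioc hab]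
  have hthu := Chebyshev.theta_le_log4_mul_x (x := N * Real.exp (-2)) (by positivity)
  have hl4 : Real.log 4 ≤ 2 := by
    have e : (4 : ℝ) = 2 ^ 2 := by norm_num
    rw [e, Real.log_pow]
    have := Real.log_two_lt_d9
    push_cast
    linarith
  have he2 : 7 ≤ Real.exp 2 := by
    have := Real.exp_one_gt_d9
    have e : Real.exp 2 = Real.exp 1 ^ 2 := by rw [← Real.exp_nat_mul]; norm_num
    rw [e]; nlinarith
  have he3 : Real.exp (-2) ≤ 1 / 7 := by
    rw [Real.exp_neg, inv_eq_one_div]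
    gcongr
  have key : N ≤ Chebyshev.theta (N * Real.exp 2) - Chebyshev.theta (N * Real.exp (-2)) := by
    have a1 : Real.log 4 * (N * Real.exp (-2)) ≤ 2 * (N * (1 / 7)) := by gcongr
    nlinarith
  calc Real.exp (-4) / 2 = N * (Real.exp (-4) / (2 * N)) := by field_simp
    _ ≤ _ := by gcongr

theorem eventually_logPrime_mul_wt_le {φ φ₂ : ℝ → ℝ} (h0 : ∀ u, 0 ≤ φ u) (h1 : ∀ u, φ u ≤ 1)
    (hφ : ∀ u, 3 ≤ |u| → φ u = 0) (h02 : ∀ u, 0 ≤ φ₂ u) (h12 : ∀ u, |u| ≤ 15 / 4 → φ₂ u = 1)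
    (A K : ℕ) : ∀ᶠ N : ℝ in atTop, ∀ n h : ℕ, h ≤ K →
      logPrime (n + h) * ((Real.log (n + h : ℕ) / Real.log N) ^ A * wt φ N (n + h : ℕ)) ≤
        4 * Real.log N * wt φ₂ N n := by
  filter_upwards [eventually_gt_atTop (Real.exp 3 * (2 * (K + 1))),
    Real.tendsto_log_atTop.eventually_ge_atTop 4, eventually_log_div_log_pow A]
    with N hN hL hA n h hK
  have hN0 : 0 < N := lt_of_le_of_lt (by positivity) hN
  have hr : 0 ≤ 4 * Real.log N * wt φ₂ N n := mul_nonneg (by linarith) (wt_nonneg h02 _ _)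
  by_cases hu : 3 ≤ |Real.log (n + h : ℕ) - Real.log N|
  · rw [wt, hφ _ hu]
    simpa using hr
  by_cases hp : (n + h).Prime
  swap
  · rw [logPrime, if_neg hp, zero_mul]; exact hr
  rw [not_le] at hu
  obtain ⟨hu1, hu2⟩ := abs_lt.1 hu
  have hm0 : (0 : ℝ) < (n + h : ℕ) := by exact_mod_cast hp.pos
  have hbig : 2 * ((K : ℝ) + 1) < (n + h : ℕ) := by
    have e : Real.exp (Real.log N - 3) < (n + h : ℕ) := by
      rw [← Real.lt_log_iff_exp_lt hm0]; linarith
    rw [Real.exp_sub, Real.exp_log hN0, div_lt_iff₀ (Real.exp_pos 3)] at e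
    have : Real.exp 3 * (2 * ((K : ℝ) + 1)) < Real.exp 3 * (n + h : ℕ) := by linarith
    exact lt_of_mul_lt_mul_left this (Real.exp_pos 3).le
  have hKr : (h : ℝ) ≤ K := by exact_mod_cast hK
  push_cast at hbig
  have hn2 : ((n + h : ℕ) : ℝ) / 2 ≤ n := by push_cast; linarith
  have hn0 : (0 : ℝ) < n := by push_cast at hm0 hn2; linarith
  have hle : (n : ℝ) ≤ (n + h : ℕ) := by push_cast; linarith [(Nat.cast_nonneg h : (0 : ℝ) ≤ h)]
  have hlog1 : Real.log n ≤ Real.log (n + h : ℕ) := Real.log_le_log hn0 hle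
  have hlog2 : Real.log (n + h : ℕ) - 0.7 ≤ Real.log n := by
    have := Real.log_le_log (by positivity) hn2
    rw [Real.log_div hm0.ne' two_ne_zero] at this
    have := Real.log_two_lt_d9
    linarith
  have hw2 : wt φ N (n + h : ℕ) ≤ wt φ₂ N n := by
    rw [wt, wt, h12 _ (abs_le.2 ⟨by linarith, by linarith⟩), mul_one]
    calc _ ≤ Real.exp (-(1 + 1 / Real.log N) * Real.log (n + h : ℕ)) * 1 := by
          gcongr; exact h1 _
      _ ≤ _ := by
        rw [mul_one, Real.exp_le_exp, neg_mul, neg_mul, neg_le_neg_iff]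
        have : 0 ≤ 1 / Real.log N := by apply div_nonneg <;> linarith
        gcongr
  rw [logPrime, if_pos hp]
  calc _ ≤ (2 * Real.log N) * (2 * wt φ₂ N n) := by
        refine mul_le_mul (by linarith) (mul_le_mul (hA _ hu.le).2 hw2 (wt_nonneg h0 _ _) (by norm_num)) ?_ (by linarith)
        exact mul_nonneg (by linarith [(hA _ hu.le).1]) (wt_nonneg h0 _ _)
    _ = _ := by ring

end PrimeGaps

namespace PrimeGaps

open Finset

theorem lt_of_coprime_factorial {D q : ℕ} (hq : q.Prime) (h : D.factorial.Coprime q) : D < q := by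
  by_contra hle
  have := Nat.dvd_gcd ((hq.dvd_factorial).2 (not_lt.1 hle)) dvd_rfl
  rw [h] at this
  exact hq.one_lt.ne' (Nat.dvd_one.1 this)

theorem exists_sieving_primes (D : ℕ) : ∃ T : ℝ, ∀ R : ℝ, 1 ≤ R → ∀ d : ℕ, 2 ≤ d →
    ∃ P : Finset ℕ, (∀ p ∈ P, p.Prime) ∧ (∀ p ∈ P, (p : ℝ) ≤ R) ∧ (∀ p ∈ P, D < p) ∧
      ¬ d ∣ ∏ x : P, (x : ℕ) ∧
      (∀ t, T ≤ t → t ≤ Real.log R →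
        (D.factorial.totient / D.factorial : ℝ) * t / 8 ≤ primeSum P t) ∧
      ∀ t, T ≤ t → primeSum P t ≤ 2 * ((D.factorial.totient / D.factorial : ℝ) * t) := by
  obtain ⟨T, hT⟩ := eventually_atTop.1
    ((eventually_le_coprimeSum D.factorial_pos).and (eventually_coprimeSum_le D.factorial_pos))
  refine ⟨T, fun R hR d hd => ?_⟩
  let P := (range (⌊R⌋₊ + 1)).filter fun p => p.Prime ∧ D < p ∧ p ≠ d.minFac
  have hmem : ∀ p, p ∈ P ↔ (p : ℝ) ≤ R ∧ p.Prime ∧ D < p ∧ p ≠ d.minFac := by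
    intro p
    rw [mem_filter, mem_range, Nat.lt_succ_iff, Nat.le_floor_iff (by linarith)]
  have hP : ∀ p ∈ P, p.Prime := fun p hp => ((hmem p).1 hp).2.1
  have hdp : d.minFac.Prime := Nat.minFac_prime (by omega)
  refine ⟨P, hP, fun p hp => ((hmem p).1 hp).1, fun p hp => ((hmem p).1 hp).2.2.1, fun hdvd => ?_,
    fun t ht htR => ?_, fun t ht => ?_⟩
  · obtain ⟨x, -, hx⟩ := (hdp.prime.dvd_finsetProd_iff _).1 ((Nat.minFac_dvd d).trans hdvd)
    exact ((hmem x).1 x.2).2.2.2 ((Nat.prime_dvd_prime_iff_eq hdp (hP x x.2)).1 hx).symm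
  · have h1 := coprimeSum_le_primeSum hP (W := D.factorial) hdp.two_le (t := t)
      fun q hq hqt hWq hqd => (hmem q).2 ⟨hqt.trans ?_, hq, lt_of_coprime_factorial hq hWq, hqd⟩
    · have h2 := (hT t ht).1
      linarith
    · rw [← Real.le_log_iff_exp_le (by linarith)]
      exact htR
  · refine (primeSum_le_coprimeSum hP (fun p hp => ?_) t).trans (hT t ht).2
    exact ((hP p hp).coprime_factorial_of_lt ((hmem p).1 hp).2.2.1).symm

theorem sum_div_sq_le {P : Finset ℕ} {D : ℕ} (hD : 0 < D) (hP : ∀ p ∈ P, D < p) {a : ℝ}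
    (ha : 0 ≤ a) : ∑ x : P, a / ((x : ℕ) : ℝ) ^ 2 ≤ a / D := by
  rw [Finset.sum_coe_sort P fun x : ℕ => a / (x : ℝ) ^ 2]
  have hsub : P ⊆ Ioc D (max D (P.sup id)) := fun p hp =>
    mem_Ioc.2 ⟨hP p hp, le_max_of_le_right (le_sup (f := id) hp)⟩
  have h1 := sum_Ioc_inv_sq_le_sub (α := ℝ) hD.ne' (le_max_left D (P.sup id))
  simp only [div_eq_mul_inv, ← mul_sum]
  refine mul_le_mul_of_nonneg_left ?_ ha
  refine (sum_le_sum_of_subset_of_nonneg hsub fun n _ _ => by positivity).trans (h1.trans ?_)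
  simp

theorem not_dvd_mul_sub_mul {D k p : ℕ} (hp : p.Prime) (hD : D < p) (hk : k ≤ D) {i j : Fin k}
    (hij : i ≠ j) :
    ¬ (p : ℤ) ∣ (i : ℕ) * (D.factorial : ℤ) - (j : ℕ) * (D.factorial : ℤ) := by
  rw [← sub_mul]
  intro h
  rcases (Nat.prime_iff_prime_int.1 hp).dvd_or_dvd h with h | h
  · have h1 := Int.eq_zero_of_abs_lt_dvd h (by have := i.2; have := j.2; rw [abs_lt]; omega)
    exact hij (Fin.ext (by omega))
  · exact absurd ((hp.dvd_factorial).1 (Int.natCast_dvd_natCast.1 h)) (by omega)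

end PrimeGaps

namespace PrimeGaps

open Finset

theorem eventually_remainder_le {C : ℝ} (hC : 0 ≤ C) (W k : ℕ) : ∀ᶠ N : ℝ in atTop, ∀ V : ℝ, 0 ≤ V →
    V ≤ 2 ^ k * (N ^ (1 / 100 : ℝ)) ^ 2 * ((2 * Real.log (N ^ (1 / 100 : ℝ))) ^ 3) ^ k →
      C * W * V ^ 2 / N ≤ 1 / Real.log N := by
  have h1 : (fun x : ℝ => Real.log x ^ ((6 * k + 1 : ℕ) : ℝ)) =o[atTop] fun x : ℝ => x ^ (1 / 2 : ℝ) :=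
    isLittleO_log_rpow_rpow_atTop _ (by norm_num)
  have hK : 0 < C * W * 4 ^ k + 1 := by positivity
  filter_upwards [h1.bound (show (0:ℝ) < (C * W * 4 ^ k + 1)⁻¹ by positivity),
    Real.tendsto_log_atTop.eventually_ge_atTop 1, eventually_ge_atTop 1] with N hN hL hN1 V hV hVle
  have hN0 : 0 < N := by linarith
  set L := Real.log N with hLdef
  rw [Real.rpow_natCast, Real.norm_of_nonneg (by positivity), Real.norm_of_nonneg (by positivity),
    inv_mul_eq_div, le_div_iff₀ hK] at hN
  have hlog : 2 * Real.log (N ^ (1 / 100 : ℝ)) ≤ L := by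
    rw [Real.log_rpow hN0]; linarith
  have hlog0 : 0 ≤ 2 * Real.log (N ^ (1 / 100 : ℝ)) := by
    rw [Real.log_rpow hN0]; linarith
  have hV2 : V ≤ 2 ^ k * (N ^ (1 / 100 : ℝ)) ^ 2 * (L ^ 3) ^ k := hVle.trans (by gcongr)
  have e1 : (2 ^ k * (N ^ (1 / 100 : ℝ)) ^ 2 * (L ^ 3) ^ k) ^ 2 =
      4 ^ k * N ^ (1 / 25 : ℝ) * L ^ (6 * k) := by
    have : N ^ (1 / 25 : ℝ) = (N ^ (1 / 100 : ℝ)) ^ 4 := by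
      rw [← Real.rpow_natCast, ← Real.rpow_mul hN0.le]; norm_num
    rw [this, show (4 : ℝ) ^ k = 2 ^ k * 2 ^ k by rw [← mul_pow]; norm_num]
    ring
  rw [div_le_div_iff₀ hN0 (by linarith), one_mul]
  calc C * W * V ^ 2 * L ≤ C * W * (4 ^ k * N ^ (1 / 25 : ℝ) * L ^ (6 * k)) * L := by
        rw [← e1]; gcongr
    _ = N ^ (1 / 25 : ℝ) * (L ^ (6 * k + 1) * (C * W * 4 ^ k)) := by ring
    _ ≤ N ^ (1 / 2 : ℝ) * (L ^ (6 * k + 1) * (C * W * 4 ^ k + 1)) := by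
        gcongr
        · norm_num
        · linarith
    _ ≤ N ^ (1 / 2 : ℝ) * N ^ (1 / 2 : ℝ) := by gcongr
    _ = N := by rw [← Real.rpow_add hN0]; norm_num

theorem sum_le_sum_shift {g S S' : ℕ → ℝ} {s M : ℕ} (hg : ∀ n, 0 ≤ g n) (hS' : ∀ n, 0 ≤ S' n)
    (hz : ∀ n < s, g n = 0) (h : ∀ n, S' (n + s) = S n) :
    ∑ n ∈ range M, g n * S' n ≤ ∑ n ∈ range M, g (n + s) * S n := by
  calc ∑ n ∈ range M, g n * S' n ≤ ∑ n ∈ range (s + M), g n * S' n :=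
        sum_le_sum_of_subset_of_nonneg (range_mono (Nat.le_add_left M s))
          fun n _ _ => mul_nonneg (hg n) (hS' n)
    _ = ∑ n ∈ range M, g (n + s) * S n := by
        rw [sum_range_add, sum_eq_zero fun n hn => by rw [hz n (mem_range.1 hn), zero_mul], zero_add]
        exact sum_congr rfl fun n _ => by rw [add_comm s n, h]

theorem stepFun_le_two (J : ℕ) (L t : ℝ) : stepFun J L t ≤ 2 := by
  refine (sum_le_sum fun j _ => ?_).trans (sum_half_pow_le J)
  exact mul_le_of_le_one_right (by positivity) (by split_ifs <;> norm_num)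

theorem config_shift {k : ℕ} {P : Finset ℕ} {h h' : Fin k → ℤ} {s : ℕ} (hs : ∀ i, h i = s + h' i)
    (r : P → Option (Fin k)) (n : ℕ) : config h' r (n + s) = config h r n := by
  unfold config
  refine prod_congr rfl fun x _ => ?_
  cases r x with
  | none => rfl
  | some i =>
    have e : ((n + s : ℕ) : ℤ) + h' i = n + h i := by rw [hs]; push_cast; ring
    simp only [loc, e]

theorem IsBlock.wt_eq_zero_of_exp_mul_le {φ : ℝ → ℝ} (hφ : IsBlock φ) {N : ℝ} (hN : 5 ≤ Real.log N)
    {M n : ℕ} (hM : Real.exp 4 * M ≤ N) (hn : n < M) : wt φ N n = 0 := by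
  refine hφ.wt_eq_zero_of_lt hN (by positivity) ?_
  have : (n : ℝ) < M := by exact_mod_cast hn
  rw [Real.exp_neg, ← div_eq_mul_inv, lt_div_iff₀ (Real.exp_pos 4)]
  nlinarith [Real.exp_pos 4]

set_option maxHeartbeats 1000000 in
theorem eventually_exists_sieve {φ φ₂ : ℝ → ℝ} (hφ : IsBlock φ) (hφ₂ : IsBlock φ₂)
    (h0 : ∀ u, 0 ≤ φ u) (h1 : ∀ u, |u| ≤ 2 → φ u = 1) (h02 : ∀ u, 0 ≤ φ₂ u) {X : ℝ}
    (hφ₂X : ∀ᶠ N : ℝ in atTop, ∑ n ∈ range (cutoff N), wt φ₂ N n ≤ X)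
    {k J D : ℕ} (hk : 0 < k) (hJ : 0 < J) (hkJ : k = 2 ^ J) (hD : D = (26 * k ^ 2) ^ 2)
    {W : ℕ} (hW : W = D.factorial) {ρ : ℝ} (hρ : ρ = W.totient / W) :
    ∃ A : ℕ, ∃ C : ℝ, 0 < C ∧ ∀ᶠ N : ℝ in atTop, ∃ S : ℕ → ℝ, ∃ a z : ℝ,
      (∀ n, 0 ≤ S n) ∧ ρ * (Real.log N / (76800 * k)) / 8 ≤ a ∧
      ρ * (Real.log N / (76800 * k * J)) / 8 ≤ z ∧ z ≤ 24 * ρ * (Real.log N / (76800 * k * J)) ∧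
      ∑ n ∈ range (cutoff N), (if W.Coprime n then 1 else 0) * S n * wt φ₂ N n ≤
        ρ * z ^ k * X + 1 / Real.log N ∧
      ∀ m < k, a ^ 2 / 64 * z ^ (k - 1) * (Real.exp (-4) / 2) - C / Real.log N ≤
        ∑ n ∈ range (cutoff N), logPrime (n + m * W) *
          ((Real.log (n + m * W : ℕ) / Real.log N) ^ A * wt φ N (n + m * W : ℕ)) * S n := by
  obtain ⟨A, C, hC, hS2⟩ := hφ.abs_sum_logPrime_mul_sieveSq_sub_le k (B := 2) two_pos
  obtain ⟨C₁, hC₁, hS1⟩ := hφ₂.abs_sum_sq_sub_le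
  obtain ⟨T, hT⟩ := exists_sieving_primes D
  have hW0 : 0 < W := hW ▸ D.factorial_pos
  have hW0' : (0 : ℝ) < W := by exact_mod_cast hW0
  have hρ0 : 0 < ρ := by
    have := Nat.totient_pos.2 hW0
    rw [hρ]; positivity
  have hk0 : (0 : ℝ) < k := by exact_mod_cast hk
  have hJ0 : (0 : ℝ) < J := by exact_mod_cast hJ
  have hk1 : 1 ≤ k := hk
  have hkD : 64 * k ^ 2 ≤ D := by rw [hD]; nlinarith [Nat.one_le_pow 2 k hk]
  have hkD1 : 2 * k ≤ D := by nlinarith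
  have hD0 : 0 < D := by nlinarith
  refine ⟨A, C, hC, ?_⟩
  have hRtop : Tendsto (fun N : ℝ => N ^ (1 / 100 : ℝ)) atTop atTop :=
    tendsto_rpow_atTop (by norm_num)
  filter_upwards [hS2, hφ₂X, exists_le_sum_logPrime_mul_wt h0 h1 A,
    eventually_remainder_le hC₁.le W k, hRtop.eventually eventually_prod_one_add_le,
    Real.tendsto_log_atTop.eventually_ge_atTop 7,
    Real.tendsto_log_atTop.eventually_ge_atTop (76800 * k * J * T),
    eventually_gt_atTop (Real.exp 4 * (k * W : ℕ)), eventually_gt_atTop 1]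
    with N ⟨d₁, hd₁, hN⟩ hXN hX' hrem hprod hL hLT hNW hN1
  have hN0 : 0 < N := by linarith
  set L := Real.log N with hLdef
  set R := N ^ (1 / 100 : ℝ) with hRdef
  have hR1 : 1 ≤ R := Real.one_le_rpow hN1.le (by norm_num)
  have hlogR : Real.log R = L / 100 := by rw [hRdef, Real.log_rpow hN0]; ring
  obtain ⟨P, hP, hPR, hPD, hdP, hlo, hup⟩ := hT R hR1 d₁ hd₁
  rw [← hW, ← hρ] at hlo hup
  set L₀ := L / (76800 * k * J) with hL₀def
  have hL₀ : 0 < L₀ := by rw [hL₀def]; apply div_pos <;> first | linarith | positivity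
  have hTL : T ≤ L₀ := by
    rw [hL₀def, le_div_iff₀ (by positivity)]; linarith
  have hkL : 2 ^ J * L₀ ≤ L / 200 := by
    have e : (2 : ℝ) ^ J = k := by rw [hkJ]; push_cast; rfl
    have e2 : (2 : ℝ) ^ J * L₀ = L / (76800 * J) := by
      rw [e, hL₀def]; field_simp
    rw [e2]
    have : (1 : ℝ) ≤ J := by exact_mod_cast hJ
    gcongr
    linarith
  set R₁ := N ^ (1 / 200 : ℝ) with hR₁def
  have hR₁ : 1 < R₁ := Real.one_lt_rpow hN1 (by norm_num)
  have hRR : R₁ * R₁ ≤ R := by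
    rw [hR₁def, ← Real.rpow_add hN0, hRdef]; norm_num
  have hlogR₁ : Real.log R₁ = L / 200 := by rw [hR₁def, Real.log_rpow hN0]; ring
  have hlo' : ∀ t, L₀ ≤ t → t ≤ 2 ^ J * L₀ → ρ * t / 8 ≤ primeSum P t := fun t ht ht' =>
    hlo t (hTL.trans ht) (by rw [hlogR]; linarith)
  have hup' : ∀ t, L₀ ≤ t → t ≤ 2 ^ J * L₀ → primeSum P t ≤ 2 * (ρ * t) := fun t ht _ =>
    hup t (hTL.trans ht)
  have hkDr : 64 * (k : ℝ) ^ 2 ≤ D := by exact_mod_cast hkD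
  have hD0r : (0 : ℝ) < D := by exact_mod_cast hD0
  have hδ₁ : ∑ x : P, (k : ℝ) / ((x : ℕ) : ℝ) ^ 2 ≤ 1 / 4 := by
    refine (sum_div_sq_le hD0 hPD hk0.le).trans ?_
    rw [div_le_iff₀ hD0r]
    have : (1 : ℝ) ≤ k := by exact_mod_cast hk
    nlinarith
  have hδ₂ : ∑ x : P, 64 * (k : ℝ) ^ 2 / ((x : ℕ) : ℝ) ^ 2 ≤ 1 := by
    refine (sum_div_sq_le hD0 hPD (by positivity)).trans ?_
    rwa [div_le_one hD0r]
  set p : P → ℝ := fun x => ((x : ℕ) : ℝ) with hp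
  set G : Finset P → ℝ := stepWeight P J L₀ with hG
  have hG0 : ∀ D, 0 ≤ G D := fun D => stepFun_nonneg _ _ _
  have hG2 : ∀ D, G D ≤ 2 := fun D => stepFun_le_two _ _ _
  have hp2 : ∀ x, 2 ≤ p x := fun x => by
    show (2 : ℝ) ≤ ((x : ℕ) : ℝ)
    exact_mod_cast (hP x x.2).two_le
  have hp1 : ∀ x, 1 ≤ p x := fun x => one_le_two.trans (hp2 x)
  have hpk : ∀ x, 2 * (k : ℝ) ≤ p x := fun x => by
    show 2 * (k : ℝ) ≤ ((x : ℕ) : ℝ)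
    exact_mod_cast hkD1.trans (hPD x x.2).le
  have hanti : ∀ D D', D ⊆ D' → G D' ≤ G D := fun D D' hDD => stepFun_anti _ _
    (sum_le_sum_of_subset_of_nonneg hDD fun x _ _ => Real.log_natCast_nonneg _)
  have hsmall : ∀ D, G D ≠ 0 → ∏ x ∈ D, p x ≤ R₁ := by
    intro D hGD
    have h3 := le_of_stepFun_ne_zero hL₀.le hGD
    have h4 : Real.log (∏ x ∈ D, p x) ≤ Real.log R₁ := by
      rw [Real.log_prod fun x _ => by have := hp1 x; positivity, hlogR₁]
      linarith
    exact (Real.log_le_log_iff (prod_pos fun x _ => by have := hp1 x; positivity) (by linarith)).1 h4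
  set z := ∑ D, weight k p G D with hz
  set a := ∑ D, G D * (∏ x ∈ D, p x)⁻¹ with ha
  have hz1 : ρ * L₀ / 8 ≤ z := le_sum_weight_stepWeight hP hJ hL₀.le hlo'
  have hz2 : z ≤ 24 * ρ * L₀ := sum_weight_stepWeight_le hP hδ₁ hL₀.le hρ0.le hup'
  have ha1 : ρ * J * L₀ / 8 ≤ a := le_sum_stepWeight hL₀.le hlo'
  have hz0 : 0 ≤ z := le_trans (by positivity) hz1
  have hlog : ∑ D, weight k p G D * ∑ x ∈ D, Real.log (p x) ≤ Real.log R₁ / (4 * k) * z := by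
    refine (sum_weight_mul_log_le hP hδ₁ hL₀.le hup').trans ?_
    rw [hlogR₁]
    calc 12 * ρ * J * L₀ ^ 2 = L / 200 / (4 * k) * (ρ * L₀ / 8) := by
          have : L = L₀ * (76800 * k * J) := by rw [hL₀def]; field_simp
          rw [this]; field_simp; ring
      _ ≤ _ := by
          refine mul_le_mul_of_nonneg_left hz1 ?_
          apply div_nonneg <;> linarith
  set h : Fin k → ℤ := fun i => (i : ℕ) * (W : ℤ) with hh
  have hhdvd : ∀ p ∈ P, ∀ i j, i ≠ j → ¬ (p : ℤ) ∣ h i - h j := fun q hq i j hij => by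
    simp only [hh, hW]
    exact not_dvd_mul_sub_mul (hP q hq) (hPD q hq) (by omega) hij
  have hPW : ∀ q ∈ P, W.Coprime q := fun q hq => by
    rw [hW]; exact ((hP q hq).coprime_factorial_of_lt (hPD q hq)).symm
  set c := ccoeff k G R with hc
  have hc0 : ∀ r, 0 ≤ c r := fun r => coeff_nonneg (fun x => by have := hp1 x; linarith) hG0 R r
  refine ⟨sieveSq c h, a, z, fun n => sq_nonneg _, ?_, hz1, hz2, ?_, fun m hm => ?_⟩
  · refine le_trans (le_of_eq ?_) ha1
    rw [hL₀def]; field_simp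
  · have h3 := (abs_le.1 (hS1 N hN0 (by linarith) k P W h c hP hW0 hPW hhdvd hc0)).2
    have h4 : ∑ r, c r * csize r ^ 2 ≤ 2 ^ k * R ^ 2 * ((2 * Real.log R) ^ 3) ^ k := by
      refine (sum_coeff_mul_size_sq_le hp1 hG0 hG2 R).trans ?_
      have := hprod P hP hPR
      gcongr
    have h5 := hrem _ (sum_nonneg fun r _ => mul_nonneg (hc0 r) (sq_nonneg _)) h4
    have h6 : W.totient / W * (∑ r, ∑ r', c r * c r' * ∏ x : P, gram (x : ℕ) (r x) (r' x)) *
        ∑ n ∈ range (cutoff N), wt φ₂ N n ≤ ρ * z ^ k * X := by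
      rw [← hρ]
      have h7 : ∑ r, ∑ r', c r * c r' * ∏ x : P, gram (x : ℕ) (r x) (r' x) ≤ z ^ k :=
        sum_coeff_mul_gram_le hp1 G R
      refine mul_le_mul (by gcongr) hXN (sum_nonneg fun n _ => wt_nonneg h02 _ _) (by positivity)
    simp only [sieveSq]
    linarith
  · let i : Fin k := ⟨m, hm⟩
    set h' : Fin k → ℤ := fun j => h j - h i with hh'
    have h3 := (abs_le.1 (hN P hP hPR hdP (fun q hq => hD ▸ (hPD q hq).le) h'
      (fun q hq j j' hj => by
        rw [hh']; simpa using hhdvd q hq j j' hj) i (sub_self _) G hG0 hG2)).1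
    have h4 := le_sum_coeff_mul_gramUnit hp2 hpk hG0 hanti hδ₂ hR₁ hRR hsmall i hlog
    have h5 : a ^ 2 / 64 * z ^ (k - 1) * (Real.exp (-4) / 2) ≤
        (∑ r, ∑ r', c r * c r' * ∏ x : P, gramUnit (x : ℕ) i (r x) (r' x)) *
        ∑ n ∈ range (cutoff N), logPrime n * ((Real.log n / L) ^ A * wt φ N n) :=
      mul_le_mul h4 hX' (by positivity) (le_trans (by positivity) h4)
    have hshift : ∀ n, sieveSq c h' (n + m * W) = sieveSq c h n := by
      intro n
      unfold sieveSq
      refine congrArg (· ^ 2) (sum_congr rfl fun r _ => ?_)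
      rw [config_shift (h := h) (h' := h') (fun j => ?_)]
      simp only [hh', hh, i]
      push_cast
      ring
    have h6 := sum_le_sum_shift (g := fun n => logPrime n * ((Real.log n / L) ^ A * wt φ N n))
      (S' := sieveSq c h') (S := sieveSq c h) (s := m * W) (M := cutoff N)
      (fun n => mul_nonneg (logPrime_nonneg n) (mul_nonneg
        (pow_nonneg (div_nonneg (Real.log_natCast_nonneg n) (by linarith)) A) (wt_nonneg h0 _ _)))
      (fun n => sq_nonneg _) (fun n hn => ?_) hshift
    · linarith
    · simp [hφ.wt_eq_zero_of_exp_mul_le (by linarith) hNW.le (hn.trans_le (Nat.mul_le_mul_right W hm.le))]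

end PrimeGaps

namespace PrimeGaps

open Finset

theorem sum_logPrime_mul_wt_le {φ φ₂ : ℝ → ℝ} (hφ : IsBlock φ) (h02 : ∀ u, 0 ≤ φ₂ u) {N : ℝ}
    (hN : 5 ≤ Real.log N) {A k W n₀ M : ℕ} (hW : 0 < W) (hM : n₀ + k * W + W + 1 ≤ M)
    (hMN : Real.exp 4 * M ≤ N)
    (hle : ∀ n h : ℕ, h ≤ k * W →
      logPrime (n + h) * ((Real.log (n + h : ℕ) / Real.log N) ^ A * wt φ N (n + h : ℕ)) ≤
        4 * Real.log N * wt φ₂ N n)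
    (hfew : ∀ n, n₀ ≤ n → #{m ∈ range k | (n + m * W).Prime} ≤ 2) (n : ℕ) :
    ∑ m ∈ range k, logPrime (n + m * W) *
        ((Real.log (n + m * W : ℕ) / Real.log N) ^ A * wt φ N (n + m * W : ℕ)) ≤
      8 * Real.log N * ((if W.Coprime n then 1 else 0) * wt φ₂ N n) := by
  have hr : 0 ≤ Real.log N * ((if W.Coprime n then 1 else 0) * wt φ₂ N n) :=
    mul_nonneg (by linarith) (mul_nonneg (by split_ifs <;> norm_num) (wt_nonneg h02 _ _))
  have hz : ∀ n : ℕ, n < M → wt φ N n = 0 := fun n hn => hφ.wt_eq_zero_of_exp_mul_le hN hMN hn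
  by_cases hn : n < n₀
  · rw [sum_eq_zero fun m hm => ?_]
    · linarith
    · have : m * W ≤ k * W := Nat.mul_le_mul_right W (mem_range.1 hm).le
      rw [hz _ (by omega)]
      simp
  calc _ ≤ ∑ m ∈ range k, if (n + m * W).Prime then
        4 * (Real.log N * ((if W.Coprime n then 1 else 0) * wt φ₂ N n)) else 0 := by
        refine sum_le_sum fun m hm => ?_
        split_ifs with hp hc
        · have := hle n (m * W) (Nat.mul_le_mul_right W (mem_range.1 hm).le)
          linarith
        · have hlt : n + m * W < M := by
            have hnc : ¬ (n + m * W).Coprime W := by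
              rwa [Nat.coprime_add_mul_right_left, Nat.coprime_comm]
            rw [hp.coprime_iff_not_dvd, not_not] at hnc
            have := Nat.le_of_dvd hW hnc
            omega
          rw [hz _ hlt]
          simp
        · rw [logPrime, if_neg hp, zero_mul]
    _ = #{m ∈ range k | (n + m * W).Prime} *
        (4 * (Real.log N * ((if W.Coprime n then 1 else 0) * wt φ₂ N n))) := by
        rw [← sum_filter, sum_const, nsmul_eq_mul]
    _ ≤ 2 * (4 * (Real.log N * ((if W.Coprime n then 1 else 0) * wt φ₂ N n))) := by
        have : (#{m ∈ range k | (n + m * W).Prime} : ℝ) ≤ 2 := by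
          exact_mod_cast hfew n (not_lt.1 hn)
        exact mul_le_mul_of_nonneg_right this (by linarith)
    _ = _ := by ring

theorem sieve_comparison {ρ L X c₀ C a z q k J : ℝ} (hρ : 0 < ρ) (hL : 1 ≤ L)
    (hc₀ : 0 < c₀) (hC : 0 < C) (hk : 1 ≤ k) (hJ0 : 0 < J)
    (hJ : 192 * 8192 * 76800 * X / c₀ ≤ J) (ha : ρ * (L / (76800 * k)) / 8 ≤ a)
    (hz : z ≤ 24 * ρ * (L / (76800 * k * J))) (hX : 0 ≤ X) (hq : 1 ≤ q)
    (hLbig : 128 * (C + 8) / c₀ + 1 ≤ ρ * (L / (76800 * k)) / 8) :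
    8 * L * (ρ * (z * q) * X + 1 / L) < k * (a ^ 2 / 64 * q * c₀ - C / L) := by
  set Λ := L / (76800 * k) with hΛ
  have hk0 : 0 < k := by linarith
  have hL0 : 0 < L := by linarith
  have hΛ0 : 0 < Λ := by positivity
  have hkΛ : k * Λ = L / 76800 := by rw [hΛ]; field_simp
  have hz' : z ≤ 24 * ρ * (Λ / J) := by
    rw [hΛ, div_div]; exact hz
  have ha0 : 0 ≤ ρ * Λ / 8 := by positivity
  have h1 : X / J ≤ c₀ / (192 * 8192 * 76800) := by
    rw [div_le_iff₀ hc₀] at hJ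
    rw [div_le_div_iff₀ hJ0 (by norm_num)]
    linarith
  have h2 : 8 * L * (ρ * (z * q) * X) ≤ k * (a ^ 2 / 128 * q * c₀) := by
    calc 8 * L * (ρ * (z * q) * X) ≤ 8 * L * (ρ * (24 * ρ * (Λ / J) * q) * X) := by gcongr
      _ = 192 * L * ρ ^ 2 * Λ * q * (X / J) := by ring
      _ ≤ 192 * L * ρ ^ 2 * Λ * q * (c₀ / (192 * 8192 * 76800)) := by gcongr
      _ = (L / 76800) * Λ * ρ ^ 2 / 8192 * q * c₀ := by ring
      _ = k * ((ρ * Λ / 8) ^ 2 / 128 * q * c₀) := by rw [← hkΛ]; ring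
      _ ≤ k * (a ^ 2 / 128 * q * c₀) := by gcongr
  have h3 : 128 * (C + 8) / c₀ + 1 ≤ a := hLbig.trans ha
  have h4 : 0 < 128 * (C + 8) / c₀ := by positivity
  have h5 : C + 8 < a ^ 2 / 128 * q * c₀ := by
    have h6 : C + 8 = 128 * (C + 8) / c₀ / 128 * 1 * c₀ := by field_simp
    have h7 : 128 * (C + 8) / c₀ < a ^ 2 := by nlinarith
    rw [h6]
    refine mul_lt_mul_of_pos_right (mul_lt_mul_of_pos_of_nonneg' ?_ hq ?_ ?_) hc₀ <;> first | positivity | linarith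
  have h8 : C / L ≤ C := div_le_self hC.le hL
  have h9 : 8 * L * (1 / L) = 8 := by field_simp
  have h10 : k * (C + 8) < k * (a ^ 2 / 128 * q * c₀) := by gcongr
  have h11 : k * (C / L) ≤ k * C := by gcongr
  calc 8 * L * (ρ * (z * q) * X + 1 / L) = 8 * L * (ρ * (z * q) * X) + 8 := by rw [mul_add, h9]
    _ ≤ k * (a ^ 2 / 128 * q * c₀) + 8 := by linarith
    _ < k * (a ^ 2 / 128 * q * c₀) + (k * (a ^ 2 / 128 * q * c₀) - k * C) := by linarith
    _ ≤ k * (a ^ 2 / 64 * q * c₀ - C / L) := by linarith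

theorem exists_three_primes : ∃ k W : ℕ, 0 < W ∧ ∀ n₀ : ℕ, ∃ n, n₀ ≤ n ∧
    2 < #{m ∈ range k | (n + m * W).Prime} := by
  obtain ⟨φ, hφ, h0, hle1, h1, hzero⟩ := exists_isBlock (a := 2) (b := 3) (by norm_num) (by norm_num)
    (by norm_num)
  obtain ⟨φ₂, hφ₂, h02, -, h12, -⟩ := exists_isBlock (a := 15 / 4) (b := 4) (by norm_num)
    (by norm_num) le_rfl
  obtain ⟨X, hX, hXN⟩ := hφ₂.exists_sum_wt_le
  set c₀ : ℝ := Real.exp (-4) / 2 with hc₀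
  have hc₀0 : 0 < c₀ := by positivity
  obtain ⟨J, hJ⟩ := exists_nat_ge (192 * 8192 * 76800 * X / c₀)
  have hJ0 : (0 : ℝ) < J := lt_of_lt_of_le (by positivity) hJ
  set k := 2 ^ J with hk
  have hk0 : 0 < k := by positivity
  have hk1 : (1 : ℝ) ≤ k := by exact_mod_cast hk0
  set W := ((26 * k ^ 2) ^ 2).factorial with hW
  have hW0 : 0 < W := Nat.factorial_pos _
  set ρ : ℝ := W.totient / W with hρ
  have hρ0 : 0 < ρ := by
    have := Nat.totient_pos.2 hW0
    have : (0 : ℝ) < W := by exact_mod_cast hW0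
    rw [hρ]; positivity
  refine ⟨k, W, hW0, ?_⟩
  by_contra! hcon
  obtain ⟨n₀, hfew⟩ := hcon
  obtain ⟨A, C, hC, hev⟩ := eventually_exists_sieve hφ hφ₂ h0 h1 h02 hXN hk0
    (by exact_mod_cast hJ0 : 0 < J) hk rfl hW hρ
  set M := n₀ + k * W + W + 1 with hM
  have ht1 : Tendsto (fun N : ℝ => ρ * (Real.log N / (76800 * k)) / 8) atTop atTop :=
    ((Real.tendsto_log_atTop.atTop_div_const (by positivity)).const_mul_atTop hρ0).atTop_div_const
      (by norm_num)
  have ht2 : Tendsto (fun N : ℝ => ρ * (Real.log N / (76800 * k * J)) / 8) atTop atTop :=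
    ((Real.tendsto_log_atTop.atTop_div_const (by positivity)).const_mul_atTop hρ0).atTop_div_const
      (by norm_num)
  obtain ⟨N, ⟨S, a, z, hS, ha, hz1, hz2, hS1, hS2⟩, hpt, hL, hNM, hbig1, hbig2⟩ :=
    (hev.and ((eventually_logPrime_mul_wt_le h0 hle1 hzero h02 h12 A (k * W)).and
      ((Real.tendsto_log_atTop.eventually_ge_atTop 5).and
      ((eventually_ge_atTop (Real.exp 4 * M)).and ((ht1.eventually_ge_atTop
        (128 * (C + 8) / c₀ + 1)).and (ht2.eventually_ge_atTop 1)))))).exists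
  have hz : 1 ≤ z := hbig2.trans hz1
  have hcmp := sieve_comparison hρ0 (by linarith) hc₀0 hC hk1 hJ0 hJ ha hz2 hX.le
    (one_le_pow₀ hz (n := k - 1)) hbig1
  rw [mul_pow_sub_one hk0.ne'] at hcmp
  have hlow : k * (a ^ 2 / 64 * z ^ (k - 1) * c₀ - C / Real.log N) ≤
      ∑ m ∈ range k, ∑ n ∈ range (cutoff N), logPrime (n + m * W) *
          ((Real.log (n + m * W : ℕ) / Real.log N) ^ A * wt φ N (n + m * W : ℕ)) * S n := by
    have := card_nsmul_le_sum (range k) _ _ fun m hm => hS2 m (mem_range.1 hm)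
    rwa [card_range, nsmul_eq_mul] at this
  have hupp : ∑ m ∈ range k, ∑ n ∈ range (cutoff N), logPrime (n + m * W) *
          ((Real.log (n + m * W : ℕ) / Real.log N) ^ A * wt φ N (n + m * W : ℕ)) * S n ≤
      8 * Real.log N *
        ∑ n ∈ range (cutoff N), (if W.Coprime n then 1 else 0) * S n * wt φ₂ N n := by
    rw [Finset.sum_comm, mul_sum]
    refine sum_le_sum fun n _ => ?_
    rw [← sum_mul]
    have := mul_le_mul_of_nonneg_right
      (sum_logPrime_mul_wt_le (M := M) hφ h02 hL hW0 le_rfl hNM hpt hfew n) (hS n)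
    refine this.trans (le_of_eq (by ring))
  have := mul_le_mul_of_nonneg_left hS1 (show 0 ≤ 8 * Real.log N by linarith)
  linarith

end PrimeGaps

namespace PrimeGaps

open Finset

theorem exists_nth_prime_add_two_le : ∃ K : ℕ, ∀ n₀ : ℕ, ∃ j, n₀ ≤ j ∧
    Nat.nth Nat.Prime (j + 2) ≤ Nat.nth Nat.Prime j + K := by
  obtain ⟨k, W, hW, h⟩ := exists_three_primes
  refine ⟨k * W, fun n₀ => ?_⟩
  obtain ⟨n, hn, hcard⟩ := h (Nat.nth Nat.Prime n₀)
  refine ⟨Nat.count Nat.Prime n, ?_, ?_⟩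
  · rw [← Nat.count_nth_of_infinite Nat.infinite_setOfPred_prime n₀]
    exact Nat.count_monotone _ hn
  have h1 : n ≤ Nat.nth Nat.Prime (Nat.count Nat.Prime n) :=
    Nat.le_nth_count Nat.infinite_setOfPred_prime n
  have h2 : Nat.count Nat.Prime n + 2 < Nat.count Nat.Prime (n + (k * W + 1)) := by
    rw [Nat.count_add, Nat.count_eq_card_filter_range (fun m => (n + m).Prime)]
    refine Nat.add_lt_add_left (hcard.trans_le ?_) _
    refine card_le_card_of_injOn (fun m => m * W) (fun m hm => ?_) fun m _ m' _ e =>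
      Nat.eq_of_mul_eq_mul_right hW e
    simp only [coe_filter, mem_range, Set.mem_ofPred_eq] at hm ⊢
    exact ⟨Nat.lt_succ_of_le (Nat.mul_le_mul_right W hm.1.le), hm.2⟩
  have h3 := Nat.nth_lt_of_lt_count h2
  omega

theorem F2_le_of_pos {ε : ℝ} (hε : 0 < ε) : F2 ≤ ε := by
  obtain ⟨K, hK⟩ := exists_nth_prime_add_two_le
  have hmono : StrictMono (Nat.nth Nat.Prime) := Nat.nth_strictMono Nat.infinite_setOfPred_prime
  have hlog : Tendsto (fun n : ℕ => Real.log (Nat.nth Nat.Prime n)) atTop atTop :=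
    Real.tendsto_log_atTop.comp (tendsto_natCast_atTop_atTop.comp hmono.tendsto_atTop)
  refine Filter.liminf_le_of_frequently_le ?_ ?_
  · obtain ⟨n₀, hn₀⟩ := eventually_atTop.1
      ((hlog.eventually_ge_atTop (K / ε)).and (hlog.eventually_gt_atTop 0))
    refine frequently_atTop.2 fun n => ?_
    obtain ⟨j, hj, hjK⟩ := hK (max n n₀)
    obtain ⟨h1, h0⟩ := hn₀ j (le_of_max_le_right hj)
    refine ⟨j, le_of_max_le_left hj, ?_⟩
    rw [div_le_iff₀ h0]
    rw [div_le_iff₀ hε] at h1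
    have h2 : (Nat.nth Nat.Prime (j + 2) : ℝ) ≤ Nat.nth Nat.Prime j + K := by exact_mod_cast hjK
    have h3 : (Nat.nth Nat.Prime j : ℝ) ≤ Nat.nth Nat.Prime (j + 1) := by
      exact_mod_cast hmono.monotone (Nat.le_succ j)
    have h4 : (Nat.nth Nat.Prime (j + 1) : ℝ) ≤ Nat.nth Nat.Prime (j + 2) := by
      exact_mod_cast hmono.monotone (Nat.le_succ (j + 1))
    exact max_le (by linarith) (by linarith)
  · refine isBoundedUnder_of ⟨0, fun n => ?_⟩
    refine div_nonneg (le_max_of_le_left (sub_nonneg.2 ?_)) (Real.log_natCast_nonneg _)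
    exact_mod_cast hmono.monotone (Nat.le_succ n)

end PrimeGaps

/-- F₂ ≤ 0.17066, and in particular F₂ ≤ c for some c < (√2 − 1)². -/
theorem F2_le : F2 ≤ 0.17066 ∧ ∃ c : ℝ, F2 ≤ c ∧ c < (Real.sqrt 2 - 1) ^ 2 := by
  have h : F2 ≤ 0.17066 := PrimeGaps.F2_le_of_pos (by norm_num)
  refine ⟨h, 0.17066, h, ?_⟩
  have h1 : Real.sqrt 2 < 1.41422 := by
    rw [Real.sqrt_lt' (by norm_num)]; norm_num
  have h2 : Real.sqrt 2 ^ 2 = 2 := Real.sq_sqrt (by norm_num)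
  nlinarith
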